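/- Let p ≥ q ≥ 1 and n = p + q. An element (γ, s, t) with γ = (γ₁ ≥ … ≥ γ_n ≥ 0) ∈ ℝⁿ, s = (s₁ ≥ … ≥ s_p ≥ 0) ∈ ℝ^p, t = (t₁ ≥ … ≥ t_q ≥ 0) ∈ ℝ^q belongs to T(p,q) if and only if: (1) γ_k ≥ s_k for all k ≤ p; (2) γ_j ≥ t_j for all j ≤ q; (3) γ_{2q+ℓ} ≤ s_ℓ for all ℓ ≤ p − q; and (4) |γ|_{A∩[n]} − |γ|_{A^o∩[n]} ≥ |s|_{B∩[p]} − |s|_{B^o∩[p]} + |t|_{C∩[q]} − |t|_{C^o∩[q]} for every triple (A,B,C) where B is a strict subset of [2p], C is a strict subset of [2q], A ⊂ [2n] with #A = #B + #C ≤ n, and (μ(A), μ(B), μ(C)) ∈ LR(#B, #C); here A^o is taken relative to [2n], B^o relative to [2p], and C^o relative to [2q]. -/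

import Mathlib

open Matrix

/-- Eigenvalues of a (Hermitian) complex matrix, listed in decreasing order. -/
noncomputable def eigVec {k : ℕ} (X : Matrix (Fin k) (Fin k) ℂ) (hX : X.IsHermitian) :
    Fin k → ℝ :=
  fun i => hX.eigenvalues (Tuple.sort hX.eigenvalues i.rev)

/-- The `i`-th (0-based) singular value of a rectangular complex matrix:
the square root of the `i`-th largest eigenvalue of `Y * Yᴴ` (and `0` for `i ≥ a`). -/
noncomputable def sval {a b : ℕ} (Y : Matrix (Fin a) (Fin b) ℂ) (i : ℕ) : ℝ :=
  if h : i < a then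
    Real.sqrt (eigVec (Y * Yᴴ) (Matrix.isHermitian_mul_conjTranspose_self Y) ⟨i, h⟩)
  else 0

/-- The Horn cone `Horn(k)`. -/
def Horn (k : ℕ) : Set ((Fin k → ℝ) × (Fin k → ℝ) × (Fin k → ℝ)) :=
  { v | ∃ (X Y : Matrix (Fin k) (Fin k) ℂ) (hX : X.IsHermitian) (hY : Y.IsHermitian),
      v.1 = eigVec X hX ∧ v.2.1 = eigVec Y hY ∧ v.2.2 = eigVec (X + Y) (hX.add hY) }

/-- The Littlewood–Richardson cone `LR(m,n)`. -/
def LRcone (m n : ℕ) : Set ((Fin (m + n) → ℝ) × (Fin m → ℝ) × (Fin n → ℝ)) :=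
  { v | ∃ (M : Matrix (Fin (m + n)) (Fin (m + n)) ℂ) (hM : M.IsHermitian),
      v.1 = eigVec M hM ∧
      v.2.1 = eigVec (M.submatrix (Fin.castAdd n) (Fin.castAdd n))
        (hM.submatrix (Fin.castAdd n)) ∧
      v.2.2 = eigVec (M.submatrix (Fin.natAdd m) (Fin.natAdd m))
        (hM.submatrix (Fin.natAdd m)) }

/-- Top-left `p × p` block. -/
def blockTL (p q : ℕ) (X : Matrix (Fin (p + q)) (Fin (p + q)) ℂ) : Matrix (Fin p) (Fin p) ℂ :=
  X.submatrix (Fin.castAdd q) (Fin.castAdd q)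

/-- Top-right `p × q` block. -/
def blockTR (p q : ℕ) (X : Matrix (Fin (p + q)) (Fin (p + q)) ℂ) : Matrix (Fin p) (Fin q) ℂ :=
  X.submatrix (Fin.castAdd q) (Fin.natAdd p)

/-- Bottom-left `q × p` block. -/
def blockBL (p q : ℕ) (X : Matrix (Fin (p + q)) (Fin (p + q)) ℂ) : Matrix (Fin q) (Fin p) ℂ :=
  X.submatrix (Fin.natAdd p) (Fin.castAdd q)

/-- Bottom-right `q × q` block. -/
def blockBR (p q : ℕ) (X : Matrix (Fin (p + q)) (Fin (p + q)) ℂ) : Matrix (Fin q) (Fin q) ℂ :=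
  X.submatrix (Fin.natAdd p) (Fin.natAdd p)

/-- `λ* = (−λ_k, …, −λ_1)`. -/
def starVec {k : ℕ} (x : Fin k → ℝ) : Fin k → ℝ := fun i => -x i.rev

/-- `ŝ^{p,q} = (s₁, …, s_q, 0, …, 0, −s_q, …, −s₁) ∈ ℝ^{p+q}` (with `p − q` middle zeros). -/
noncomputable def hatPQ (p q : ℕ) (s : Fin q → ℝ) : Fin (p + q) → ℝ :=
  fun i =>
    if h : (i : ℕ) < q then s ⟨i, h⟩
    else if h' : (i : ℕ) < p then 0
    else -s ⟨p + q - 1 - i, by have := i.isLt; omega⟩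

/-- The cone `A(p,q)`: pairs `(e(X), s(X₁₂))` for `X` Hermitian of size `p+q`. -/
def coneA (p q : ℕ) : Set ((Fin (p + q) → ℝ) × (Fin q → ℝ)) :=
  { v | ∃ (X : Matrix (Fin (p + q)) (Fin (p + q)) ℂ) (hX : X.IsHermitian),
      v.1 = eigVec X hX ∧ ∀ i : Fin q, v.2 i = sval (blockTR p q X) (i : ℕ) }

/-- The cone `S(p,q)`: triples `(s(X), s(X₁₂), s(X₂₁))`. -/
def coneS (p q : ℕ) : Set ((Fin (p + q) → ℝ) × (Fin q → ℝ) × (Fin q → ℝ)) :=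
  { v | ∃ X : Matrix (Fin (p + q)) (Fin (p + q)) ℂ,
      (∀ i : Fin (p + q), v.1 i = sval X (i : ℕ)) ∧
      (∀ i : Fin q, v.2.1 i = sval (blockTR p q X) (i : ℕ)) ∧
      (∀ i : Fin q, v.2.2 i = sval (blockBL p q X) (i : ℕ)) }

/-- The cone `T(p,q)`: triples `(s(X), s(X₁₁), s(X₂₂))`. -/
def coneT (p q : ℕ) : Set ((Fin (p + q) → ℝ) × (Fin p → ℝ) × (Fin q → ℝ)) :=
  { v | ∃ X : Matrix (Fin (p + q)) (Fin (p + q)) ℂ,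
      (∀ i : Fin (p + q), v.1 i = sval X (i : ℕ)) ∧
      (∀ i : Fin p, v.2.1 i = sval (blockTL p q X) (i : ℕ)) ∧
      (∀ i : Fin q, v.2.2 i = sval (blockBR p q X) (i : ℕ)) }

/-- `μ(A) = (a_r − r ≥ … ≥ a₂ − 2 ≥ a₁ − 1)` as a decreasing real vector, for
`A = {a₁ < … < a_r}` a subset of `[n]` (0-based indexing internally). -/
noncomputable def muVec {n r : ℕ} (A : Finset (Fin n)) (h : A.card = r) : Fin r → ℝ :=
  fun k => (((A.orderIsoOfFin h k.rev : Fin n) : ℕ) : ℝ) - ((k.rev : ℕ) : ℝ)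

/-- `A^o = {ℓ + 1 − a : a ∈ A}` inside `[ℓ]`. -/
def opp {n : ℕ} (A : Finset (Fin n)) : Finset (Fin n) := A.image Fin.rev

/-- `|s|_{K ∩ [q]}` where `K ⊆ [n]`, `s ∈ ℝ^q` and `[q]` is viewed inside `[n]`. -/
noncomputable def sumRestr {n q : ℕ} (s : Fin q → ℝ) (K : Finset (Fin n)) : ℝ :=
  ∑ i ∈ K, (if h : (i : ℕ) < q then s ⟨i, h⟩ else 0)

/-- The augmented matrix `Ŷ^{p,q} = [[0, Y], [Yᴴ, 0]]` of size `p + q`. -/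
def hatM (p q : ℕ) (Y : Matrix (Fin p) (Fin q) ℂ) : Matrix (Fin (p + q)) (Fin (p + q)) ℂ :=
  Matrix.reindex finSumFinEquiv finSumFinEquiv (Matrix.fromBlocks 0 Y Yᴴ 0)

section AlgebraicGeometry

/-- A dominant polynomial map hits every point off a hypersurface. -/
theorem exists_dense_image_of_algebraicIndependent {σ τ : Type} [Fintype σ] [Fintype τ]
    (Φ : τ → MvPolynomial σ ℂ) (h : AlgebraicIndependent ℂ Φ) :
    ∃ R : MvPolynomial τ ℂ, R ≠ 0 ∧ ∀ y : τ → ℂ, MvPolynomial.eval y R ≠ 0 →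
      ∃ x : σ → ℂ, ∀ j, MvPolynomial.eval x (Φ j) = y j := by
  classical
  set f : MvPolynomial τ ℂ →ₐ[ℂ] MvPolynomial σ ℂ := MvPolynomial.aeval Φ with hf
  have hinj : Function.Injective f := h
  have hfp : f.toRingHom.FinitePresentation := by
    have : f.FinitePresentation :=
      AlgHom.FinitePresentation.of_finiteType.mp
        (AlgHom.FiniteType.of_comp_finiteType (f := Algebra.ofId ℂ _) (by
          have : Algebra.FiniteType ℂ (MvPolynomial σ ℂ) := inferInstance
          rw [show f.comp (Algebra.ofId ℂ _) = Algebra.ofId ℂ _ from Subsingleton.elim _ _]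
          exact RingHom.finiteType_algebraMap.mpr this))
    exact this
  obtain ⟨S, hS⟩ := PrimeSpectrum.exists_constructibleSetData_iff.mpr
    (PrimeSpectrum.isConstructible_range_comap hfp)
  have hbot : (⟨⊥, Ideal.isPrime_bot⟩ : PrimeSpectrum (MvPolynomial τ ℂ)) ∈ S.toSet := by
    rw [hS]
    refine ⟨⟨⊥, Ideal.isPrime_bot⟩, ?_⟩
    ext z
    simp only [PrimeSpectrum.comap_asIdeal, Ideal.mem_comap, Ideal.mem_bot]
    exact map_eq_zero_iff f hinj
  simp only [PrimeSpectrum.ConstructibleSetData.toSet, Set.mem_iUnion] at hbot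
  obtain ⟨C, hC, hb⟩ := hbot
  simp only [PrimeSpectrum.BasicConstructibleSetData.toSet, Set.mem_sdiff,
    PrimeSpectrum.mem_zeroLocus, Set.singleton_subset_iff, SetLike.mem_coe, Ideal.mem_bot] at hb
  refine ⟨C.f, hb.2, fun y hy => ?_⟩
  have hy' : (MvPolynomial.pointToPoint y : PrimeSpectrum (MvPolynomial τ ℂ)) ∈ S.toSet := by
    simp only [PrimeSpectrum.ConstructibleSetData.toSet, Set.mem_iUnion]
    refine ⟨C, hC, ?_, ?_⟩
    · rw [PrimeSpectrum.mem_zeroLocus]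
      intro z hz
      have : z = 0 := by simpa using hb.1 hz
      simp [this]
    · rw [PrimeSpectrum.mem_zeroLocus, Set.singleton_subset_iff]
      intro hmem
      have := (MvPolynomial.mem_vanishingIdeal_singleton_iff y C.f).mp hmem
      exact hy (by simpa [MvPolynomial.aeval_eq_eval] using this)
  rw [hS] at hy'
  obtain ⟨P, hP⟩ := hy'
  obtain ⟨M, hM, hPM⟩ := Ideal.exists_le_maximal P.asIdeal P.2.ne_top
  obtain ⟨x, hx⟩ := MvPolynomial.isMaximal_iff_eq_vanishingIdeal_singleton.mp hM
  refine ⟨x, fun j => ?_⟩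
  have h1 : (MvPolynomial.X j - MvPolynomial.C (y j) : MvPolynomial τ ℂ) ∈
      (MvPolynomial.pointToPoint y : PrimeSpectrum (MvPolynomial τ ℂ)).asIdeal :=
    (MvPolynomial.mem_vanishingIdeal_singleton_iff y _).mpr (by simp)
  rw [← hP] at h1
  have h2 : f (MvPolynomial.X j - MvPolynomial.C (y j)) ∈ M := hPM h1
  rw [hx, MvPolynomial.mem_vanishingIdeal_singleton_iff] at h2
  simpa [hf, sub_eq_zero, MvPolynomial.aeval_eq_eval] using h2

theorem card_le_of_algebraicIndependent {σ τ : Type} [Fintype σ] [Fintype τ]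
    (Φ : τ → MvPolynomial σ ℂ) (h : AlgebraicIndependent ℂ Φ) :
    Fintype.card τ ≤ Fintype.card σ := by
  have h1 := h.cardinalMk_le_trdeg
  rw [MvPolynomial.trdeg_of_isDomain] at h1
  simpa using h1

end AlgebraicGeometry

section Generic

/-- Polynomial functions on a complex vector space. -/
def polyFun (E : Type*) [AddCommGroup E] [Module ℂ E] : Subalgebra ℂ (E → ℂ) :=
  Algebra.adjoin ℂ (Set.range fun (l : E →ₗ[ℂ] ℂ) (x : E) => l x)

variable {E F : Type*} [AddCommGroup E] [Module ℂ E] [AddCommGroup F] [Module ℂ F]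

theorem linear_mem_polyFun (l : E →ₗ[ℂ] ℂ) : (fun x => l x) ∈ polyFun E :=
  Algebra.subset_adjoin ⟨l, rfl⟩

theorem const_mem_polyFun (c : ℂ) : (fun _ : E => c) ∈ polyFun E :=
  (polyFun E).algebraMap_mem c

theorem polyFun_comp {g : E → F} (hg : ∀ l : F →ₗ[ℂ] ℂ, (fun x => l (g x)) ∈ polyFun E)
    {f : F → ℂ} (hf : f ∈ polyFun F) : (fun x => f (g x)) ∈ polyFun E := by
  induction hf using Algebra.adjoin_induction with
  | mem f hf => obtain ⟨l, rfl⟩ := hf; exact hg l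
  | algebraMap c => exact const_mem_polyFun c
  | add a b _ _ ha hb => exact (polyFun E).add_mem ha hb
  | mul a b _ _ ha hb => exact (polyFun E).mul_mem ha hb

theorem polyFun_affine (c : F) (L : E →ₗ[ℂ] F) {f : F → ℂ} (hf : f ∈ polyFun F) :
    (fun x => f (c + L x)) ∈ polyFun E :=
  polyFun_comp (fun l => by
    simp only [map_add]
    exact (polyFun E).add_mem (const_mem_polyFun _) (linear_mem_polyFun (l ∘ₗ L))) hf

theorem exists_polynomial_of_mem_polyFun {f : ℂ → ℂ} (hf : f ∈ polyFun ℂ) :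
    ∃ q : Polynomial ℂ, ∀ z, f z = q.eval z := by
  induction hf using Algebra.adjoin_induction with
  | mem f hf =>
    obtain ⟨l, rfl⟩ := hf
    refine ⟨Polynomial.C (l 1) * Polynomial.X, fun z => ?_⟩
    have := l.map_smul z 1
    rw [smul_eq_mul, mul_one] at this
    change l z = _
    rw [this, smul_eq_mul, Polynomial.eval_mul, Polynomial.eval_C, Polynomial.eval_X, mul_comm]
  | algebraMap c => exact ⟨Polynomial.C c, by simp⟩
  | add a b _ _ ha hb =>
    obtain ⟨p, hp⟩ := ha; obtain ⟨q, hq⟩ := hb; exact ⟨p + q, by simp [hp, hq]⟩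
  | mul a b _ _ ha hb =>
    obtain ⟨p, hp⟩ := ha; obtain ⟨q, hq⟩ := hb; exact ⟨p * q, by simp [hp, hq]⟩

theorem polyFun_finite_zeros {f : ℂ → ℂ} (hf : f ∈ polyFun ℂ) (h0 : f ≠ 0) :
    {z | f z = 0}.Finite := by
  obtain ⟨q, hq⟩ := exists_polynomial_of_mem_polyFun hf
  have hq0 : q ≠ 0 := by rintro rfl; exact h0 (funext fun z => by simp [hq])
  refine (q.roots.toFinset.finite_toSet).subset fun z hz => ?_
  have hz' : f z = 0 := hz
  simp [hq0, Polynomial.IsRoot, ← hq, hz']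

theorem polyFun_mul_ne_zero {f g : E → ℂ} (hf : f ∈ polyFun E) (hg : g ∈ polyFun E)
    (hf0 : f ≠ 0) (hg0 : g ≠ 0) : f * g ≠ 0 := by
  obtain ⟨x, hx⟩ := Function.ne_iff.mp hf0
  obtain ⟨y, hy⟩ := Function.ne_iff.mp hg0
  have key : ∀ {h : E → ℂ}, h ∈ polyFun E → (fun z : ℂ => h (x + z • (y - x))) ∈ polyFun ℂ :=
    fun hh => polyFun_affine x (LinearMap.toSpanSingleton ℂ E (y - x)) hh
  have h1 := polyFun_finite_zeros (key hf) fun h => hx (by simpa using congrFun h 0)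
  have h2 := polyFun_finite_zeros (key hg) fun h => hy (by simpa using congrFun h 1)
  obtain ⟨z, hz⟩ := (h1.union h2).exists_notMem
  simp only [Set.mem_union, Set.mem_ofPred_eq, not_or] at hz
  exact fun h => mul_ne_zero hz.1 hz.2 (congrFun h _)

/-- The filter of sets containing a nonempty Zariski open subset. -/
def zariskiFilter (E : Type*) [AddCommGroup E] [Module ℂ E] : Filter E where
  sets := {s | ∃ f ∈ polyFun E, f ≠ 0 ∧ ∀ x, f x ≠ 0 → x ∈ s}
  univ_sets := ⟨1, (polyFun E).one_mem, one_ne_zero, fun _ _ => trivial⟩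
  sets_of_superset := fun ⟨f, hf, h0, h⟩ hst => ⟨f, hf, h0, fun x hx => hst (h x hx)⟩
  inter_sets := fun ⟨f, hf, hf0, h⟩ ⟨g, hg, hg0, h'⟩ =>
    ⟨f * g, (polyFun E).mul_mem hf hg, polyFun_mul_ne_zero hf hg hf0 hg0,
      fun x hx => ⟨h x (left_ne_zero_of_mul hx), h' x (right_ne_zero_of_mul hx)⟩⟩

theorem eventually_zariski_iff {p : E → Prop} : (∀ᶠ x in zariskiFilter E, p x) ↔
    ∃ f ∈ polyFun E, f ≠ 0 ∧ ∀ x, f x ≠ 0 → p x := Iff.rfl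

instance zariskiFilter_neBot : (zariskiFilter E).NeBot := by
  rw [Filter.neBot_iff]
  intro h
  have : (∅ : Set E) ∈ zariskiFilter E := by rw [h]; trivial
  obtain ⟨f, -, h0, hx⟩ := this
  exact h0 (funext fun x => by_contra fun h => hx x h)

theorem eventually_zariski_of_polyFun {f : E → ℂ} (hf : f ∈ polyFun E) {x : E} (hx : f x ≠ 0) :
    ∀ᶠ x in zariskiFilter E, f x ≠ 0 :=
  ⟨f, hf, fun h => hx (congrFun h x), fun _ h => h⟩

theorem finite_of_eventually_zariski {p : ℂ → Prop} (h : ∀ᶠ z in zariskiFilter ℂ, p z) :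
    {z | ¬ p z}.Finite := by
  obtain ⟨f, hf, h0, hx⟩ := h
  exact (polyFun_finite_zeros hf h0).subset fun z hz => by_contra fun h => hz (hx z h)

/-- Pullback of a generic property along a polynomial map whose image meets the property
generically. -/
theorem eventually_zariski_comp {g : E → F}
    (hg : ∀ l : F →ₗ[ℂ] ℂ, (fun x => l (g x)) ∈ polyFun E) {f : F → ℂ} (hf : f ∈ polyFun F)
    {x : E} (hx : f (g x) ≠ 0) : ∀ᶠ x in zariskiFilter E, f (g x) ≠ 0 :=
  eventually_zariski_of_polyFun (polyFun_comp hg hf) hx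

theorem eventually_zariski_linear {L : E →ₗ[ℂ] F} (hL : Function.Surjective L) {p : F → Prop}
    (hp : ∀ᶠ y in zariskiFilter F, p y) : ∀ᶠ x in zariskiFilter E, p (L x) := by
  obtain ⟨f, hf, h0, h⟩ := hp
  obtain ⟨y, hy⟩ := Function.ne_iff.mp h0
  obtain ⟨x, rfl⟩ := hL y
  exact (eventually_zariski_comp (g := L) (fun l => linear_mem_polyFun (l ∘ₗ L)) hf hy).mono
    fun x hx => h _ hx

theorem polyFun_det {n : Type*} [Fintype n] [DecidableEq n] {A : E → Matrix n n ℂ}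
    (hA : ∀ i j, (fun x => A x i j) ∈ polyFun E) : (fun x => (A x).det) ∈ polyFun E := by
  have : (fun x => (A x).det) =
      ∑ σ : Equiv.Perm n, ((Equiv.Perm.sign σ : ℤ) : ℂ) • ∏ i, fun x => A x (σ i) i := by
    funext x
    simp [Matrix.det_apply, Finset.sum_apply, Finset.prod_apply, Units.smul_def]
  rw [this]
  exact (polyFun E).sum_mem fun σ _ => (polyFun E).smul_mem ((polyFun E).prod_mem fun i _ => hA _ _) _

variable {U W : Type*} [AddCommGroup U] [Module ℂ U] [AddCommGroup W] [Module ℂ W]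
  [FiniteDimensional ℂ U]

/-- Lower semicontinuity of the rank in the Zariski topology. -/
theorem eventually_zariski_finrank_range {D : E → (U →ₗ[ℂ] W)}
    (hD : ∀ u (l : W →ₗ[ℂ] ℂ), (fun x => l (D x u)) ∈ polyFun E) (x₀ : E) :
    ∀ᶠ x in zariskiFilter E,
      Module.finrank ℂ (LinearMap.range (D x₀)) ≤ Module.finrank ℂ (LinearMap.range (D x)) := by
  set ρ := Module.finrank ℂ (LinearMap.range (D x₀)) with hρ
  let e : LinearMap.range (D x₀) ≃ₗ[ℂ] (Fin ρ → ℂ) :=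
    LinearEquiv.ofFinrankEq _ _ (by simp [hρ])
  obtain ⟨G, hG⟩ := (D x₀).rangeRestrict.exists_rightInverse_of_surjective
    (LinearMap.range_rangeRestrict _)
  let L : (Fin ρ → ℂ) →ₗ[ℂ] U := G ∘ₗ e.symm.toLinearMap
  have hL : ∀ v, D x₀ (L v) = (e.symm v : W) := fun v => by
    have := congrArg Subtype.val (LinearMap.congr_fun hG (e.symm v))
    simpa [L] using this
  have hinj : LinearMap.ker (D x₀ ∘ₗ L) = ⊥ := LinearMap.ker_eq_bot'.mpr fun v hv => by
    have : (e.symm v : W) = 0 := by rw [← hL]; exact hv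
    simpa using this
  obtain ⟨R, hR⟩ := (D x₀ ∘ₗ L).exists_leftInverse_of_injective hinj
  have h1 : ∀ᶠ x in zariskiFilter E, (LinearMap.toMatrix' (R ∘ₗ D x ∘ₗ L)).det ≠ 0 := by
    refine eventually_zariski_of_polyFun (x := x₀) (polyFun_det fun i j => ?_) ?_
    · simp only [LinearMap.toMatrix'_apply]
      exact hD _ (LinearMap.proj i ∘ₗ R)
    · rw [hR]; simp
  refine h1.mono fun x hx => ?_
  have hinj' : Function.Injective (R ∘ₗ D x ∘ₗ L) := by
    rw [LinearMap.det_toMatrix'] at hx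
    exact (LinearEquiv.ofIsUnitDet (v := Pi.basisFun ℂ _) (v' := Pi.basisFun ℂ _)
      (f := R ∘ₗ D x ∘ₗ L) (by
        rw [LinearMap.toMatrix_eq_toMatrix', LinearMap.det_toMatrix']; exact hx.isUnit)).injective
  have h2 : Module.finrank ℂ (LinearMap.range (R ∘ₗ D x ∘ₗ L)) = ρ := by
    rw [LinearMap.finrank_range_of_inj hinj']; simp
  rw [← h2, LinearMap.range_comp]
  exact (Submodule.finrank_map_le _ _).trans
    (Submodule.finrank_mono (LinearMap.range_comp_le_range _ _))

end Generic

section Jacobian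

variable {σ τ : Type} [Fintype σ] [Fintype τ]

theorem MvPolynomial.exists_hasStrictFDerivAt_eval (P : MvPolynomial σ ℂ) (x : σ → ℂ) :
    ∃ L : (σ → ℂ) →L[ℂ] ℂ, HasStrictFDerivAt (fun y => MvPolynomial.eval y P) L x := by
  induction P using MvPolynomial.induction_on with
  | C a => exact ⟨0, by simpa using hasStrictFDerivAt_const a x⟩
  | add p q hp hq =>
    obtain ⟨L, hL⟩ := hp; obtain ⟨M, hM⟩ := hq
    exact ⟨L + M, by simp only [map_add]; exact hL.add hM⟩
  | mul_X p n hp =>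
    obtain ⟨L, hL⟩ := hp
    exact ⟨_, by simp only [map_mul, eval_X]; exact hL.mul (hasStrictFDerivAt_apply n x)⟩

omit [Fintype σ] in
theorem MvPolynomial.eval_comp_mem_polyFun {E : Type*} [AddCommGroup E] [Module ℂ E]
    {g : E → σ → ℂ} (hg : ∀ i, (fun x => g x i) ∈ polyFun E) (P : MvPolynomial σ ℂ) :
    (fun x => MvPolynomial.eval (g x) P) ∈ polyFun E := by
  induction P using MvPolynomial.induction_on with
  | C a => simpa using const_mem_polyFun a
  | add p q hp hq => simp only [map_add]; exact (polyFun E).add_mem hp hq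
  | mul_X p n hp => simp only [map_mul, eval_X]; exact (polyFun E).mul_mem hp (hg n)

omit [Fintype σ] [Fintype τ] in
theorem MvPolynomial.eval_aeval_eq (Φ : τ → MvPolynomial σ ℂ) (y : σ → ℂ)
    (P : MvPolynomial τ ℂ) : MvPolynomial.eval y (MvPolynomial.aeval Φ P) =
      MvPolynomial.eval (fun j => MvPolynomial.eval y (Φ j)) P := by
  induction P using MvPolynomial.induction_on with
  | C a => simp
  | add p q hp hq => simp only [map_add, hp, hq]
  | mul_X p n hp => simp only [map_mul, hp, aeval_X, eval_X]

theorem range_mem_nhds_of_jacobian (Φ : τ → MvPolynomial σ ℂ) (x : σ → ℂ)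
    (h : ∀ w : τ → ℂ, ∃ v : σ → ℂ, ∀ j,
      HasDerivAt (fun z : ℂ => MvPolynomial.eval (x + z • v) (Φ j)) (w j) 0) :
    Set.range (fun (y : σ → ℂ) j => MvPolynomial.eval y (Φ j)) ∈
      nhds fun j => MvPolynomial.eval x (Φ j) := by
  choose L hL using fun j => MvPolynomial.exists_hasStrictFDerivAt_eval (Φ j) x
  set F : (σ → ℂ) → (τ → ℂ) := fun y j => MvPolynomial.eval y (Φ j) with hFdef
  have hF : HasStrictFDerivAt F (ContinuousLinearMap.pi L) x := hasStrictFDerivAt_pi.mpr hL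
  have hsurj : (ContinuousLinearMap.pi L).range = ⊤ := by
    refine LinearMap.range_eq_top.mpr fun w => ?_
    obtain ⟨v, hv⟩ := h w
    refine ⟨v, funext fun j => ?_⟩
    have hline : HasDerivAt (fun z : ℂ => x + z • v) v 0 := by
      simpa using ((hasDerivAt_id (0 : ℂ)).smul_const v).const_add x
    have h1 : HasDerivAt (fun z : ℂ => MvPolynomial.eval (x + z • v) (Φ j)) (L j v) 0 :=
      HasFDerivAt.comp_hasDerivAt (x := (0 : ℂ)) (f := fun z : ℂ => x + z • v)
        (l := fun y => MvPolynomial.eval y (Φ j)) (l' := L j)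
        (by simpa using (hL j).hasFDerivAt) hline
    exact h1.unique (hv j)
  have hmap := hF.map_nhds_eq_of_surj hsurj
  rw [show (fun j => MvPolynomial.eval x (Φ j)) = F x from rfl, ← hmap]
  exact Filter.mem_map.mpr (Filter.univ_mem' fun y => ⟨y, rfl⟩)

/-- The Jacobian criterion for algebraic independence. -/
theorem algebraicIndependent_of_jacobian (Φ : τ → MvPolynomial σ ℂ) (x : σ → ℂ)
    (h : ∀ w : τ → ℂ, ∃ v : σ → ℂ, ∀ j,
      HasDerivAt (fun z : ℂ => MvPolynomial.eval (x + z • v) (Φ j)) (w j) 0) :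
    AlgebraicIndependent ℂ Φ := by
  set F : (σ → ℂ) → (τ → ℂ) := fun y j => MvPolynomial.eval y (Φ j) with hFdef
  have hopen : Set.range F ∈ nhds (F x) := range_mem_nhds_of_jacobian Φ x h
  rw [algebraicIndependent_iff]
  intro P hP
  have hzero : ∀ y, MvPolynomial.eval (F y) P = 0 := fun y => by
    have := congrArg (MvPolynomial.eval y) hP
    rwa [MvPolynomial.eval_aeval_eq, map_zero] at this
  refine MvPolynomial.funext fun y => ?_
  have hmem : (fun z : ℂ => MvPolynomial.eval (F x + z • (y - F x)) P) ∈ polyFun ℂ :=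
    MvPolynomial.eval_comp_mem_polyFun (fun i => (polyFun ℂ).add_mem (const_mem_polyFun (F x i))
      ((polyFun ℂ).mul_mem (linear_mem_polyFun LinearMap.id)
        (const_mem_polyFun ((y - F x) i)))) P
  by_contra hy
  have hfin := polyFun_finite_zeros hmem fun h0 => hy (by simpa using congrFun h0 1)
  have hcont : Filter.Tendsto (fun z : ℂ => F x + z • (y - F x)) (nhds 0) (nhds (F x)) := by
    have : Continuous fun z : ℂ => F x + z • (y - F x) := by fun_prop
    simpa using this.tendsto 0
  have hev : ∀ᶠ z in nhds (0 : ℂ), MvPolynomial.eval (F x + z • (y - F x)) P = 0 :=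
    (hcont.eventually hopen).mono fun z hz => by
      obtain ⟨u, hu⟩ := hz
      rw [← hu]; exact hzero u
  exact (infinite_of_mem_nhds (0 : ℂ) hev) hfin

theorem forall_of_eventually_zariski_of_isClosed {E : Type*} [AddCommGroup E] [Module ℂ E]
    [TopologicalSpace E] [ContinuousAdd E] [ContinuousSMul ℂ E] {p : E → Prop}
    (hc : IsClosed {x | p x}) (hp : ∀ᶠ x in zariskiFilter E, p x) (x : E) : p x := by
  obtain ⟨f, hf, h0, h⟩ := hp
  obtain ⟨y, hy⟩ := Function.ne_iff.mp h0
  have hfin := polyFun_finite_zeros (polyFun_affine x (LinearMap.toSpanSingleton ℂ E (y - x)) hf)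
    fun h => hy (by simpa using congrFun h 1)
  have hcont : Continuous fun z : ℂ => x + z • (y - x) := by fun_prop
  have hcl : IsClosed {z : ℂ | p (x + z • (y - x))} := hc.preimage hcont
  have hdense : Dense {z : ℂ | p (x + z • (y - x))} :=
    (hfin.countable.dense_compl ℂ).mono fun z hz => h _ hz
  have : (0 : ℂ) ∈ {z : ℂ | p (x + z • (y - x))} := by
    rw [← hcl.closure_eq]; exact hdense 0
  simpa using this

end Jacobian

section Quiver

variable {V Q : Type}

/-- Representations, in coordinates, of the quiver with arrows `a : src a → tgt a`. -/
abbrev QRep (src tgt : Q → V) (ι : V → Type) := ∀ a : Q, Matrix (ι (tgt a)) (ι (src a)) ℂ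

variable {src tgt : Q → V} {ι κ : V → Type} [∀ v, Fintype (ι v)] [∀ v, Fintype (κ v)]

/-- `S` is a subrepresentation of `x`. -/
def IsSub (x : QRep src tgt ι) (S : ∀ v, Submodule ℂ (ι v → ℂ)) : Prop :=
  ∀ a, ∀ u ∈ S (src a), x a *ᵥ u ∈ S (tgt a)

/-- `x` has a subrepresentation of dimension vector `δ`. -/
def HasSub (x : QRep src tgt ι) (δ : V → ℕ) : Prop :=
  ∃ S : ∀ v, Submodule ℂ (ι v → ℂ), IsSub x S ∧ ∀ v, Module.finrank ℂ (S v) = δ v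

/-- `g` is a morphism of representations from `x` to `y`. -/
def IsHom (x : QRep src tgt ι) (y : QRep src tgt κ)
    (g : ∀ v, (ι v → ℂ) →ₗ[ℂ] (κ v → ℂ)) : Prop :=
  ∀ a u, g (tgt a) (x a *ᵥ u) = y a *ᵥ g (src a) u

theorem IsSub.map {x : QRep src tgt ι} {y : QRep src tgt κ}
    {g : ∀ v, (ι v → ℂ) →ₗ[ℂ] (κ v → ℂ)} (hg : IsHom x y g)
    {S : ∀ v, Submodule ℂ (ι v → ℂ)} (hS : IsSub x S) : IsSub y fun v => (S v).map (g v) := by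
  rintro a _ ⟨u, hu, rfl⟩
  exact ⟨_, hS a u hu, hg a u⟩

theorem IsSub.comap {x : QRep src tgt ι} {y : QRep src tgt κ}
    {g : ∀ v, (ι v → ℂ) →ₗ[ℂ] (κ v → ℂ)} (hg : IsHom x y g)
    {S : ∀ v, Submodule ℂ (κ v → ℂ)} (hS : IsSub y S) : IsSub x fun v => (S v).comap (g v) := by
  intro a u hu
  rw [Submodule.mem_comap, hg a u]
  exact hS a _ hu

theorem HasSub.of_injective {x : QRep src tgt ι} {y : QRep src tgt κ}
    {g : ∀ v, (ι v → ℂ) →ₗ[ℂ] (κ v → ℂ)} (hg : IsHom x y g)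
    (hinj : ∀ v, Function.Injective (g v)) {δ : V → ℕ} (h : HasSub x δ) : HasSub y δ := by
  obtain ⟨S, hS, hd⟩ := h
  exact ⟨_, hS.map hg, fun v => by 
    rw [← hd v]; exact (Submodule.equivMapOfInjective (g v) (hinj v) (S v)).finrank_eq.symm⟩

theorem exists_frame {m : Type} [Fintype m] {d : ℕ} (S : Submodule ℂ (m → ℂ))
    (hS : Module.finrank ℂ S = d) : ∃ U : Matrix m (Fin d) ℂ, Uᴴ * U = 1 ∧
      (∀ w, U *ᵥ w ∈ S) ∧ ∀ u ∈ S, U *ᵥ (Uᴴ *ᵥ u) = u := by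
  classical
  let e : (m → ℂ) ≃ₗ[ℂ] EuclideanSpace ℂ m := (WithLp.linearEquiv 2 ℂ (m → ℂ)).symm
  let S' : Submodule ℂ (EuclideanSpace ℂ m) := S.map e.toLinearMap
  have hS' : Module.finrank ℂ S' = d := by rw [← hS]; exact LinearEquiv.finrank_map_eq e S
  let b : OrthonormalBasis (Fin d) ℂ S' := (stdOrthonormalBasis ℂ S').reindex (finCongr hS')
  let U : Matrix m (Fin d) ℂ := Matrix.of fun i j => (b j : EuclideanSpace ℂ m) i
  have hb : ∀ j, (fun i => (b j : EuclideanSpace ℂ m) i) ∈ S := fun j => by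
    obtain ⟨u, hu, hu'⟩ := (b j).2
    have : (fun i => (b j : EuclideanSpace ℂ m) i) = u := by
      funext i; rw [← hu']; rfl
    rwa [this]
  have hin : ∀ j (u : m → ℂ), (Uᴴ *ᵥ u) j =
      inner ℂ (b j : EuclideanSpace ℂ m) (e u) := fun j u => by
    rw [PiLp.inner_apply]
    simp only [Matrix.mulVec, dotProduct, Matrix.conjTranspose_apply, U, Matrix.of_apply]
    refine Finset.sum_congr rfl fun i _ => ?_
    simp [e, mul_comm]
  refine ⟨U, ?_, fun w => ?_, fun u hu => ?_⟩
  · ext j k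
    have h1 := hin j (fun i => (b k : EuclideanSpace ℂ m) i)
    have h2 : inner ℂ (b j : EuclideanSpace ℂ m) (b k : EuclideanSpace ℂ m)
        = (if j = k then 1 else 0 : ℂ) := by
      have := (orthonormal_iff_ite.mp b.orthonormal) j k
      simpa using this
    rw [Matrix.one_apply, ← h2]
    exact h1
  · have : U *ᵥ w = ∑ j, w j • fun i => (b j : EuclideanSpace ℂ m) i := by
      funext i
      simp [Matrix.mulVec, dotProduct, U, Finset.sum_apply, mul_comm]
    rw [this]
    exact S.sum_mem fun j _ => S.smul_mem _ (hb j)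
  · have h1 := b.sum_repr' (⟨e u, ⟨u, hu, rfl⟩⟩ : S')
    have h2 := congrArg (fun z : S' => (z : EuclideanSpace ℂ m)) h1
    simp only [Submodule.coe_sum, Submodule.coe_smul, Submodule.coe_inner] at h2
    funext i
    have h3 := congrArg (fun z : EuclideanSpace ℂ m => z i) h2
    simp only [WithLp.ofLp_sum, WithLp.ofLp_smul, Finset.sum_apply, Pi.smul_apply,
      smul_eq_mul] at h3
    rw [Matrix.mulVec, dotProduct]
    rw [show u i = (e u) i from rfl, ← h3]
    refine Finset.sum_congr rfl fun j _ => ?_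
    rw [hin, mul_comm]
    rfl

theorem hasSub_iff_frame {x : QRep src tgt ι} {δ : V → ℕ} : HasSub x δ ↔
    ∃ U : ∀ v, Matrix (ι v) (Fin (δ v)) ℂ, (∀ v, (U v)ᴴ * U v = 1) ∧
      ∀ a, x a * U (src a) = U (tgt a) * ((U (tgt a))ᴴ * x a * U (src a)) := by
  classical
  constructor
  · rintro ⟨S, hS, hd⟩
    choose U h1 h2 h3 using fun v => exists_frame (S v) (hd v)
    refine ⟨U, h1, fun a => ?_⟩
    refine Matrix.ext_of_mulVec_single fun j => ?_
    have := h3 (tgt a) _ (hS a _ (h2 (src a) (Pi.single j 1)))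
    simp only [← Matrix.mulVec_mulVec] at this ⊢
    rw [this]
  · rintro ⟨U, h1, h2⟩
    have hinj : ∀ v, Function.Injective (U v).mulVecLin := fun v => by
      refine Function.LeftInverse.injective (g := ((U v)ᴴ).mulVecLin) fun w => ?_
      simp [h1]
    refine ⟨fun v => LinearMap.range (U v).mulVecLin, ?_, fun v => ?_⟩
    · rintro a _ ⟨w, rfl⟩
      refine ⟨((U (tgt a))ᴴ * x a * U (src a)) *ᵥ w, ?_⟩
      simp only [Matrix.mulVecLin_apply, Matrix.mulVec_mulVec]
      rw [← h2]
    · rw [LinearMap.finrank_range_of_inj (hinj v)]; simp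

theorem isCompact_isometries {m : Type} [Fintype m] (d : ℕ) :
    IsCompact {U : Matrix m (Fin d) ℂ | Uᴴ * U = 1} := by
  have hK : IsCompact (Set.pi Set.univ fun _ : m => Set.pi Set.univ fun _ : Fin d =>
      Metric.closedBall (0 : ℂ) 1) :=
    isCompact_univ_pi fun _ => isCompact_univ_pi fun _ => isCompact_closedBall _ _
  refine IsCompact.of_isClosed_subset (X := Matrix m (Fin d) ℂ) hK ?_ ?_
  · exact isClosed_eq (by fun_prop) continuous_const
  · intro U hU i _ j _
    have h1 : (Uᴴ * U) j j = 1 := by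
      have hU' : Uᴴ * U = 1 := hU
      rw [hU', Matrix.one_apply_eq]
    have h2 : ∑ i, ‖U i j‖ ^ 2 = 1 := by
      have := congrArg Complex.re h1
      rw [Matrix.mul_apply, Complex.re_sum] at this
      simp only [Matrix.conjTranspose_apply, Complex.one_re] at this
      rw [← this]
      refine Finset.sum_congr rfl fun i _ => ?_
      rw [Complex.sq_norm, Complex.normSq_apply]
      simp
    have h3 : ‖U i j‖ ^ 2 ≤ 1 := by
      rw [← h2]
      exact Finset.single_le_sum (f := fun i => ‖U i j‖ ^ 2) (fun i _ => by positivity)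
        (Finset.mem_univ i)
    rw [mem_closedBall_zero_iff]
    exact (sq_le_one_iff₀ (norm_nonneg _)).mp h3

theorem isClosed_hasSub (δ : V → ℕ) : IsClosed {x : QRep src tgt ι | HasSub x δ} := by
  let K : Set (∀ v, Matrix (ι v) (Fin (δ v)) ℂ) := Set.pi Set.univ fun v => {U | Uᴴ * U = 1}
  have hK : IsCompact K := isCompact_univ_pi fun v => isCompact_isometries (δ v)
  have : CompactSpace K := isCompact_iff_compactSpace.mp hK
  let Z : Set (QRep src tgt ι × K) := {p | ∀ a, p.1 a * p.2.1 (src a) =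
    p.2.1 (tgt a) * ((p.2.1 (tgt a))ᴴ * p.1 a * p.2.1 (src a))}
  have hZ : IsClosed Z := by
    have : Z = ⋂ a, {p : QRep src tgt ι × K | p.1 a * p.2.1 (src a) =
        p.2.1 (tgt a) * ((p.2.1 (tgt a))ᴴ * p.1 a * p.2.1 (src a))} := by
      ext p; simp [Z]
    rw [this]
    have c1 : ∀ a, Continuous fun p : QRep src tgt ι × K => p.1 a := fun a =>
      (continuous_apply a).comp continuous_fst
    have c2 : ∀ v, Continuous fun p : QRep src tgt ι × K => p.2.1 v := fun v =>
      (continuous_apply v).comp (continuous_subtype_val.comp continuous_snd)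
    exact isClosed_iInter fun a => isClosed_eq ((c1 a).matrix_mul (c2 _))
      ((c2 _).matrix_mul (((c2 _).matrix_conjTranspose.matrix_mul (c1 a)).matrix_mul (c2 _)))
  have := isClosedMap_fst_of_compactSpace Z hZ
  convert this using 1
  ext x
  simp only [Set.mem_image, Set.mem_ofPred_eq, hasSub_iff_frame]
  constructor
  · rintro ⟨U, h1, h2⟩
    exact ⟨⟨x, U, fun v _ => h1 v⟩, h2, rfl⟩
  · rintro ⟨⟨y, U, hU⟩, h2, rfl⟩
    exact ⟨U, fun v => hU v trivial, h2⟩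

end Quiver

section Dichotomy

theorem exists_graph_coordinates {κ : Type} [Fintype κ] {d g : ℕ}
    (hκ : Fintype.card κ = d + g) (S : Submodule ℂ (κ → ℂ)) (hS : Module.finrank ℂ S = d) :
    ∃ (e : κ ≃ Fin d ⊕ Fin g) (ψ : Matrix (Fin g) (Fin d) ℂ), ∀ u : κ → ℂ, u ∈ S ↔
      (fun i => u (e.symm (Sum.inr i))) = ψ *ᵥ fun i => u (e.symm (Sum.inl i)) := by
  classical
  obtain ⟨U, hU1, hU2, hU3⟩ := exists_frame S hS
  have hspan : Submodule.span ℂ (Set.range U.row) = ⊤ := by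
    apply Submodule.eq_top_of_finrank_eq
    rw [← Matrix.rank_eq_finrank_span_row]
    simp only [Module.finrank_fintype_fun_eq_card, Fintype.card_fin]
    refine le_antisymm (by simpa using U.rank_le_card_width) ?_
    have := Matrix.rank_mul_le_right Uᴴ U
    rwa [hU1, Matrix.rank_one, Fintype.card_fin] at this
  obtain ⟨κ', a, ha, hsp, hli⟩ := exists_linearIndependent' ℂ U.row
  have hfin : Finite κ' := Finite.of_injective a ha
  have : Fintype κ' := Fintype.ofFinite κ'
  have b : Module.Basis κ' ℂ (Fin d → ℂ) := Module.Basis.mk hli (by rw [hsp, hspan])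
  have hcard : Fintype.card κ' = d := by
    rw [← Module.finrank_eq_card_basis b]; simp
  let f : Fin d ≃ κ' := (Fintype.equivFinOfCardEq hcard).symm
  have haf : Function.Injective (a ∘ f) := ha.comp f.injective
  let A : Matrix (Fin d) (Fin d) ℂ := U.submatrix (a ∘ f) id
  have hA : IsUnit A := by
    rw [← Matrix.linearIndependent_rows_iff_isUnit]
    exact hli.comp f f.injective
  have hAdet : IsUnit A.det := (Matrix.isUnit_iff_isUnit_det A).mp hA
  have hcompl : Fintype.card {k // ¬ k ∈ Set.range (a ∘ f)} = g := by
    rw [Fintype.card_subtype_compl, hκ]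
    have : Fintype.card {k // k ∈ Set.range (a ∘ f)} = d := by
      rw [← Fintype.card_congr (Equiv.ofInjective _ haf), Fintype.card_fin]
    omega
  let e' : Fin d ⊕ Fin g ≃ κ :=
    (Equiv.sumCongr (Equiv.ofInjective _ haf) (Fintype.equivFinOfCardEq hcompl).symm).trans
      (Equiv.sumCompl _)
  have he' : ∀ i, e' (Sum.inl i) = a (f i) := fun i => rfl
  let C : Matrix (Fin g) (Fin d) ℂ := U.submatrix (fun i => e' (Sum.inr i)) id
  refine ⟨e'.symm, C * A⁻¹, fun u => ?_⟩
  simp only [Equiv.symm_symm]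
  constructor
  · intro hu
    have hw := hU3 u hu
    set w := Uᴴ *ᵥ u
    have h1 : (fun i => u (e' (Sum.inl i))) = A *ᵥ w := by
      funext i; rw [he', ← hw]; rfl
    have h2 : (fun i => u (e' (Sum.inr i))) = C *ᵥ w := by
      funext i; rw [← hw]; rfl
    rw [h1, h2, ← Matrix.mulVec_mulVec, Matrix.mulVec_mulVec (M := A⁻¹),
      Matrix.nonsing_inv_mul A hAdet, Matrix.one_mulVec]
  · intro hu
    have : u = U *ᵥ (A⁻¹ *ᵥ fun i => u (e' (Sum.inl i))) := by
      funext k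
      obtain ⟨i | i, rfl⟩ := e'.surjective k
      · have h : A *ᵥ (A⁻¹ *ᵥ fun i => u (e' (Sum.inl i))) = fun i => u (e' (Sum.inl i)) := by
          rw [Matrix.mulVec_mulVec, Matrix.mul_nonsing_inv A hAdet, Matrix.one_mulVec]
        exact (congrFun h i).symm
      · rw [← Matrix.mulVec_mulVec] at hu
        exact congrFun hu i
    rw [this]
    exact hU2 _

variable {V Q : Type} [Fintype V] [Fintype Q]

/-- The Euler form of a quiver. -/
def euler (src tgt : Q → V) (δ γ : V → ℕ) : ℤ :=
  ∑ v, (δ v : ℤ) * γ v - ∑ a, (δ (src a) : ℤ) * γ (tgt a)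

variable (src tgt : Q → V) (δ γ : V → ℕ)

/-- Parameters of the representations having a graph as a subrepresentation. -/
abbrev ChartIdx : Type :=
  ((Σ a : Q, Fin (δ (tgt a)) × Fin (δ (src a))) ⊕ (Σ a : Q, Fin (γ (tgt a)) × Fin (γ (src a)))) ⊕
    ((Σ a : Q, Fin (δ (tgt a)) × Fin (γ (src a))) ⊕ (Σ v : V, Fin (γ v) × Fin (δ v)))

abbrev ChartSpace (v : V) : Type := Fin (δ v) ⊕ Fin (γ v)

section

variable {src tgt δ γ} {R : Type*} [CommRing R] (y : ChartIdx src tgt δ γ → R)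

def chartSub (a : Q) : Matrix (Fin (δ (tgt a))) (Fin (δ (src a))) R :=
  Matrix.of fun i j => y (Sum.inl (Sum.inl ⟨a, i, j⟩))

def chartQuot (a : Q) : Matrix (Fin (γ (tgt a))) (Fin (γ (src a))) R :=
  Matrix.of fun i j => y (Sum.inl (Sum.inr ⟨a, i, j⟩))

def chartExt (a : Q) : Matrix (Fin (δ (tgt a))) (Fin (γ (src a))) R :=
  Matrix.of fun i j => y (Sum.inr (Sum.inl ⟨a, i, j⟩))

def chartGraph (v : V) : Matrix (Fin (γ v)) (Fin (δ v)) R :=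
  Matrix.of fun i j => y (Sum.inr (Sum.inr ⟨v, i, j⟩))

/-- The representation having the graph of `chartGraph y` as a subrepresentation. -/
def chart (a : Q) :
    Matrix (ChartSpace δ γ (tgt a)) (ChartSpace δ γ (src a)) R :=
  Matrix.fromBlocks (chartSub y a) (chartExt y a)
    (chartGraph y (tgt a) * (chartSub y a + chartExt y a * chartGraph y (src a)) -
      chartQuot y a * chartGraph y (src a)) (chartQuot y a)

omit [Fintype V] [Fintype Q] in
theorem chart_map {R' : Type*} [CommRing R'] (f : R →+* R') (a : Q) :
    (chart y a).map f = chart (fun i => f (y i)) a := by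
  have h1 : (chartSub y a).map f = chartSub (fun i => f (y i)) a := rfl
  have h2 : (chartQuot y a).map f = chartQuot (fun i => f (y i)) a := rfl
  have h3 : (chartExt y a).map f = chartExt (fun i => f (y i)) a := rfl
  have h4 : ∀ v, (chartGraph y v).map f = chartGraph (fun i => f (y i)) v := fun _ => rfl
  simp only [chart, Matrix.fromBlocks_map, Matrix.map_sub f (map_sub f), Matrix.map_mul,
    Matrix.map_add f (map_add f), h1, h2, h3, h4]

end

omit [Fintype V] [Fintype Q] in
theorem hasSub_chart (y : ChartIdx src tgt δ γ → ℂ) :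
    HasSub (src := src) (tgt := tgt) (ι := ChartSpace δ γ) (chart y) δ := by
  let g : ∀ v, (Fin (δ v) → ℂ) →ₗ[ℂ] (ChartSpace δ γ v → ℂ) := fun v =>
    (Matrix.fromRows (1 : Matrix (Fin (δ v)) (Fin (δ v)) ℂ) (chartGraph y v)).mulVecLin
  have hg : ∀ v u, g v u = Sum.elim u (chartGraph y v *ᵥ u) := fun v u => by
    simp [g, Matrix.fromRows_mulVec]
  let x0 : QRep src tgt fun v => Fin (δ v) := fun a =>
    chartSub y a + chartExt y a * chartGraph y (src a)
  have hhom : IsHom (src := src) (tgt := tgt) x0 (chart y) g := by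
    intro a u
    rw [hg, hg, chart, Matrix.fromBlocks_mulVec]
    simp only [Sum.elim_comp_inl, Sum.elim_comp_inr]
    congr 1
    · simp [x0, Matrix.add_mulVec]
    · simp [x0, Matrix.sub_mulVec]
  refine HasSub.of_injective hhom (fun v u w huw => ?_) ⟨fun _ => ⊤, fun _ _ _ => trivial, by simp⟩
  rw [hg, hg] at huw
  funext i
  exact congrFun huw (Sum.inl i)

omit [Fintype V] [Fintype Q] in
theorem mem_range_chart {x : QRep src tgt (ChartSpace δ γ)}
    (ψ : ∀ v, Matrix (Fin (γ v)) (Fin (δ v)) ℂ)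
    (h : ∀ a, (x a).toBlocks₂₁ + (x a).toBlocks₂₂ * ψ (src a) =
      ψ (tgt a) * ((x a).toBlocks₁₁ + (x a).toBlocks₁₂ * ψ (src a))) :
    ∃ y : ChartIdx src tgt δ γ → ℂ, chart y = x := by
  refine ⟨Sum.elim (Sum.elim (fun p => (x p.1).toBlocks₁₁ p.2.1 p.2.2)
    (fun p => (x p.1).toBlocks₂₂ p.2.1 p.2.2)) (Sum.elim
    (fun p => (x p.1).toBlocks₁₂ p.2.1 p.2.2) (fun p => ψ p.1 p.2.1 p.2.2)), ?_⟩
  funext a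
  conv_rhs => rw [← Matrix.fromBlocks_toBlocks (x a)]
  rw [eq_sub_of_add_eq (h a)]
  rfl

end Dichotomy

section Dichotomy

variable {V Q : Type} [Fintype V] [Fintype Q] (src tgt : Q → V) (δ γ : V → ℕ)

/-- The coordinates of the chart as polynomials in its parameters. -/
noncomputable def chartPoly
    (j : Σ a : Q, ChartSpace δ γ (tgt a) × ChartSpace δ γ (src a)) :
    MvPolynomial (ChartIdx src tgt δ γ) ℂ :=
  chart (src := src) (tgt := tgt) MvPolynomial.X j.1 j.2.1 j.2.2

omit [Fintype V] [Fintype Q] in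
theorem eval_chartPoly (y : ChartIdx src tgt δ γ → ℂ)
    (j : Σ a : Q, ChartSpace δ γ (tgt a) × ChartSpace δ γ (src a)) :
    MvPolynomial.eval y (chartPoly src tgt δ γ j) = chart y j.1 j.2.1 j.2.2 := by
  have h := chart_map (src := src) (tgt := tgt) (δ := δ) (γ := γ) MvPolynomial.X
    (MvPolynomial.eval y) j.1
  have key := congrFun (congrFun h j.2.1) j.2.2
  simp only [MvPolynomial.eval_X] at key
  exact key

/-- A matrix entry as a linear form on the space of representations. -/
def repEntry (ι : V → Type) (j : Σ a : Q, ι (tgt a) × ι (src a)) : QRep src tgt ι →ₗ[ℂ] ℂ where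
  toFun x := x j.1 j.2.1 j.2.2
  map_add' _ _ := rfl
  map_smul' _ _ := rfl

omit [Fintype V] [Fintype Q] in
theorem eval_rep_mem_polyFun {ι : V → Type}
    (P : MvPolynomial (Σ a : Q, ι (tgt a) × ι (src a)) ℂ) :
    (fun x : QRep src tgt ι => MvPolynomial.eval (fun j => x j.1 j.2.1 j.2.2) P) ∈
      polyFun (QRep src tgt ι) :=
  MvPolynomial.eval_comp_mem_polyFun (g := fun (x : QRep src tgt ι) j => repEntry src tgt ι j x)
    (fun i => linear_mem_polyFun (repEntry src tgt ι i)) P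

variable {src tgt δ γ}

omit [Fintype V] [Fintype Q] in
theorem rep_eval_ne_zero {ι : V → Type} {P : MvPolynomial (Σ a : Q, ι (tgt a) × ι (src a)) ℂ}
    (hP : P ≠ 0) : (fun x : QRep src tgt ι =>
      MvPolynomial.eval (fun j => x j.1 j.2.1 j.2.2) P) ≠ 0 := by
  intro h
  refine hP (MvPolynomial.funext fun z => ?_)
  have := congrFun h fun a => Matrix.of fun i j => z ⟨a, i, j⟩
  simpa using this

/-- Reindexing of representations along coordinate bijections. -/
def repReindex {ι κ : V → Type} (e : ∀ v, ι v ≃ κ v) :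
    QRep src tgt ι ≃ₗ[ℂ] QRep src tgt κ :=
  LinearEquiv.piCongrRight fun _ => Matrix.reindexLinearEquiv ℂ ℂ (e _) (e _)

section

variable {ι κ : V → Type} [∀ v, Fintype (ι v)] [∀ v, Fintype (κ v)]

omit [Fintype V] [Fintype Q] in
theorem isHom_repReindex (e : ∀ v, ι v ≃ κ v) (x : QRep src tgt ι) :
    IsHom x (repReindex e x) fun v => (LinearEquiv.funCongrLeft ℂ ℂ (e v).symm).toLinearMap := by
  intro a u
  funext i
  simp only [LinearEquiv.coe_coe, LinearEquiv.funCongrLeft_apply, LinearMap.funLeft_apply,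
    Matrix.mulVec, dotProduct, repReindex, LinearEquiv.piCongrRight_apply,
    Matrix.coe_reindexLinearEquiv, Matrix.reindex_apply, Matrix.submatrix_apply]
  exact (Equiv.sum_comp (e (src a)).symm fun j => x a ((e (tgt a)).symm i) j * u j).symm

omit [Fintype V] [Fintype Q] in
theorem hasSub_repReindex (e : ∀ v, ι v ≃ κ v) (x : QRep src tgt ι) {δ : V → ℕ} :
    HasSub (repReindex e x) δ ↔ HasSub x δ := by
  constructor
  · intro h
    have h' : HasSub (repReindex (fun v => (e v).symm) (repReindex e x)) δ :=
      h.of_injective (isHom_repReindex (fun v => (e v).symm) (repReindex e x))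
        fun v => LinearEquiv.injective _
    convert h' using 1
    funext a
    simp [repReindex]
  · exact fun h => h.of_injective (isHom_repReindex e x) fun v => LinearEquiv.injective _

end

omit [Fintype V] [Fintype Q] in
theorem generic_not_hasSub_of_not_algebraicIndependent {κ : V → Type} [∀ v, Fintype (κ v)]
    [Finite V] (hκ : ∀ v, Fintype.card (κ v) = δ v + γ v)
    (h : ¬ AlgebraicIndependent ℂ (chartPoly src tgt δ γ)) :
    ∀ᶠ x in zariskiFilter (QRep src tgt κ), ¬ HasSub x δ := by
  classical
  rw [algebraicIndependent_iff] at h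
  push Not at h
  obtain ⟨P, hP, hP0⟩ := h
  have hgen : ∀ᶠ x in zariskiFilter (QRep src tgt (ChartSpace δ γ)),
      ¬ ∃ y : ChartIdx src tgt δ γ → ℂ, chart y = x := by
    refine ⟨_, eval_rep_mem_polyFun src tgt P, rep_eval_ne_zero hP0, ?_⟩
    rintro x hx ⟨y, rfl⟩
    apply hx
    have := congrArg (MvPolynomial.eval y) hP
    rw [MvPolynomial.eval_aeval_eq, map_zero] at this
    simp only [eval_chartPoly] at this
    exact this
  have hall : ∀ᶠ x in zariskiFilter (QRep src tgt κ), ∀ e : ∀ v, κ v ≃ ChartSpace δ γ v,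
      ¬ ∃ y : ChartIdx src tgt δ γ → ℂ, chart y = repReindex e x :=
    Filter.eventually_all.mpr fun e => eventually_zariski_linear
      (L := (repReindex e).toLinearMap) (repReindex e).surjective hgen
  refine hall.mono fun x hx ⟨S, hS, hd⟩ => ?_
  choose e ψ he using fun v => exists_graph_coordinates (hκ v) (S v) (hd v)
  refine hx e (mem_range_chart src tgt δ γ ψ fun a => Matrix.ext_of_mulVec_single fun j => ?_)
  set w : Fin (δ (src a)) → ℂ := Pi.single j 1
  set u : κ (src a) → ℂ := fun k => Sum.elim w (ψ (src a) *ᵥ w) (e (src a) k) with hu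
  have huS : u ∈ S (src a) := (he _ u).mpr (by simp [hu])
  have h1 := (he _ _).mp (hS a u huS)
  have h2 : ∀ k, (x a *ᵥ u) ((e (tgt a)).symm k) =
      (repReindex e x a *ᵥ Sum.elim w (ψ (src a) *ᵥ w)) k := fun k => by
    have := congrFun (isHom_repReindex e x a u) k
    simp only [LinearEquiv.coe_coe, LinearEquiv.funCongrLeft_apply] at this
    refine Eq.trans (by rfl) (this.trans ?_)
    congr 2
    funext k'
    simp [hu, LinearMap.funLeft_apply]
  simp only [h2] at h1
  rw [← Matrix.fromBlocks_toBlocks (repReindex e x a), Matrix.fromBlocks_mulVec] at h1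
  simp only [Sum.elim_inr, Sum.elim_inl, Sum.elim_comp_inl, Sum.elim_comp_inr] at h1
  rw [Matrix.add_mulVec, ← Matrix.mulVec_mulVec, ← Matrix.mulVec_mulVec, Matrix.add_mulVec,
    ← Matrix.mulVec_mulVec]
  exact h1

theorem hasSub_of_algebraicIndependent {κ : V → Type} [∀ v, Fintype (κ v)]
    (hκ : ∀ v, Fintype.card (κ v) = δ v + γ v)
    (h : AlgebraicIndependent ℂ (chartPoly src tgt δ γ)) (x : QRep src tgt κ) :
    HasSub x δ := by
  classical
  obtain ⟨R, hR, hR'⟩ := exists_dense_image_of_algebraicIndependent _ h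
  have hgen : ∀ᶠ x in zariskiFilter (QRep src tgt (ChartSpace δ γ)), HasSub x δ := by
    refine ⟨_, eval_rep_mem_polyFun src tgt R, rep_eval_ne_zero hR, fun x hx => ?_⟩
    obtain ⟨y, hy⟩ := hR' _ hx
    have : chart y = x := by
      funext a; ext i j
      have := hy ⟨a, i, j⟩
      rwa [eval_chartPoly] at this
    rw [← this]
    exact hasSub_chart src tgt δ γ y
  have e : ∀ v, κ v ≃ ChartSpace δ γ v := fun v => Fintype.equivOfCardEq (by simp [hκ])
  rw [← hasSub_repReindex e]
  exact forall_of_eventually_zariski_of_isClosed (isClosed_hasSub δ) hgen _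

theorem euler_nonneg_of_algebraicIndependent
    (h : AlgebraicIndependent ℂ (chartPoly src tgt δ γ)) : 0 ≤ euler src tgt δ γ := by
  have := card_le_of_algebraicIndependent _ h
  simp only [Fintype.card_sigma, Fintype.card_prod, Fintype.card_sum, Fintype.card_fin] at this
  zify at this
  rw [euler]
  simp only [add_mul, mul_add, Finset.sum_add_distrib] at this ⊢
  have h1 : ∑ v, (γ v : ℤ) * δ v = ∑ v, (δ v : ℤ) * γ v := by simp only [mul_comm]
  have h2 : ∑ a, (γ (tgt a) : ℤ) * δ (src a) = ∑ a, (δ (src a) : ℤ) * γ (tgt a) := by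
    simp only [mul_comm]
  linarith

/-- A dimension vector is either the dimension vector of a subrepresentation of no generic
representation or of a subrepresentation of every representation; in the second case the
corresponding value of the Euler form is nonnegative. -/
theorem hasSub_dichotomy {κ : V → Type} [∀ v, Fintype (κ v)]
    (hκ : ∀ v, Fintype.card (κ v) = δ v + γ v) :
    (∀ᶠ x in zariskiFilter (QRep src tgt κ), ¬ HasSub x δ) ∨
      ((∀ x : QRep src tgt κ, HasSub x δ) ∧ 0 ≤ euler src tgt δ γ) := by
  by_cases h : AlgebraicIndependent ℂ (chartPoly src tgt δ γ)
  · exact Or.inr ⟨hasSub_of_algebraicIndependent hκ h, euler_nonneg_of_algebraicIndependent h⟩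
  · exact Or.inl (generic_not_hasSub_of_not_algebraicIndependent hκ h)

end Dichotomy

section Ext

variable {V Q : Type} {src tgt : Q → V}

/-- The differential of the action of the change-of-basis group; its kernel is the space of
morphisms from `x` to `y` and its cokernel the space of extensions of `x` by `y`. -/
def dmap {ι κ : V → Type} [∀ v, Fintype (ι v)] [∀ v, Fintype (κ v)]
    (x : QRep src tgt ι) (y : QRep src tgt κ) :
    (∀ v, Matrix (κ v) (ι v) ℂ) →ₗ[ℂ] ∀ a : Q, Matrix (κ (tgt a)) (ι (src a)) ℂ where
  toFun φ a := φ (tgt a) * x a - y a * φ (src a)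
  map_add' φ ψ := by
    funext a
    simp only [Pi.add_apply, Matrix.add_mul, Matrix.mul_add]
    abel
  map_smul' c φ := by
    funext a
    simp only [Pi.smul_apply, Matrix.smul_mul, Matrix.mul_smul, RingHom.id_apply, smul_sub]

theorem dmap_apply {ι κ : V → Type} [∀ v, Fintype (ι v)] [∀ v, Fintype (κ v)]
    (x : QRep src tgt ι) (y : QRep src tgt κ) (φ : ∀ v, Matrix (κ v) (ι v) ℂ) (a : Q) :
    dmap x y φ a = φ (tgt a) * x a - y a * φ (src a) := rfl

variable {δ γ : V → ℕ}

theorem hasDerivAt_id_mul_zero {h : ℂ → ℂ} (hc : ContinuousAt h 0) :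
    HasDerivAt (fun z => z * h z) (h 0) 0 := by
  rw [hasDerivAt_iff_tendsto_slope]
  refine (hc.tendsto.mono_left nhdsWithin_le_nhds).congr' ?_
  filter_upwards [self_mem_nhdsWithin] with z hz
  have : z ≠ 0 := hz
  simp [slope_def_field, this]

/-- If extensions vanish then the chart has algebraically independent coordinates. -/
theorem algebraicIndependent_chartPoly [Fintype V] [Fintype Q]
    {x : QRep src tgt fun v => Fin (δ v)} {y : QRep src tgt fun v => Fin (γ v)}
    (h : Function.Surjective (dmap x y)) :
    AlgebraicIndependent ℂ (chartPoly src tgt δ γ) := by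
  let b : ChartIdx src tgt δ γ → ℂ := Sum.elim
    (Sum.elim (fun j => x j.1 j.2.1 j.2.2) (fun j => y j.1 j.2.1 j.2.2)) 0
  refine algebraicIndependent_of_jacobian _ b fun w => ?_
  obtain ⟨φ, hφ⟩ := h fun a => Matrix.of fun i j => w ⟨a, Sum.inr i, Sum.inl j⟩
  let v : ChartIdx src tgt δ γ → ℂ := Sum.elim
    (Sum.elim (fun j => w ⟨j.1, Sum.inl j.2.1, Sum.inl j.2.2⟩)
      (fun j => w ⟨j.1, Sum.inr j.2.1, Sum.inr j.2.2⟩))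
    (Sum.elim (fun j => w ⟨j.1, Sum.inl j.2.1, Sum.inr j.2.2⟩) (fun j => φ j.1 j.2.1 j.2.2))
  refine ⟨v, ?_⟩
  rintro ⟨a, i, j⟩
  simp only [eval_chartPoly]
  have lin : ∀ c d : ℂ, HasDerivAt (fun z : ℂ => c + z * d) d 0 := fun c d => by
    simpa using ((hasDerivAt_id (0 : ℂ)).mul_const d).const_add c
  rcases i with i | i <;> rcases j with j | j
  · exact lin _ _
  · exact lin _ _
  · have hs : ∀ z : ℂ, chartSub (b + z • v) a = x a + z • chartSub v a := fun z => rfl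
    have hq : ∀ z : ℂ, chartQuot (b + z • v) a = y a + z • chartQuot v a := fun z => rfl
    have he : ∀ z : ℂ, chartExt (b + z • v) a = z • chartExt v a := fun z => by
      ext i j; simp [chartExt, b]
    have hg : ∀ (z : ℂ) u, chartGraph (b + z • v) u = z • φ u := fun z u => by
      ext i j; simp [chartGraph, b, v]
    have key : ∀ z : ℂ, chart (b + z • v) a (Sum.inr i) (Sum.inl j) =
        z * ((φ (tgt a) * (x a + z • chartSub v a + z • chartExt v a * z • φ (src a)) -
          (y a + z • chartQuot v a) * φ (src a)) i j) := fun z => by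
      rw [chart, Matrix.fromBlocks_apply₂₁, hs, hq, he, hg, hg]
      simp only [Matrix.sub_apply, Matrix.smul_mul, Matrix.mul_smul, Matrix.smul_apply,
        smul_eq_mul]
      ring
    simp only [key]
    have h0 : w ⟨a, Sum.inr i, Sum.inl j⟩ =
        (φ (tgt a) * (x a + (0 : ℂ) • chartSub v a + (0 : ℂ) • chartExt v a * (0 : ℂ) • φ (src a)) -
          (y a + (0 : ℂ) • chartQuot v a) * φ (src a)) i j := by
      have := congrFun (congrFun (congrFun hφ a) i) j
      simp only [dmap_apply, Matrix.of_apply] at this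
      simp [← this]
    rw [h0]
    refine hasDerivAt_id_mul_zero (h := fun z => (φ (tgt a) * (x a + z • chartSub v a +
      z • chartExt v a * z • φ (src a)) - (y a + z • chartQuot v a) * φ (src a)) i j) ?_
    refine Continuous.continuousAt ?_
    refine Continuous.matrix_elem ?_ i j
    fun_prop
  · exact lin _ _

end Ext

section Schofield

theorem exists_comp_eq_of_ker_le {K E F G : Type*} [Field K] [AddCommGroup E] [Module K E]
    [AddCommGroup F] [Module K F] [AddCommGroup G] [Module K G] (f : E →ₗ[K] F) (g : E →ₗ[K] G)
    (h : LinearMap.ker f ≤ LinearMap.ker g) : ∃ k : F →ₗ[K] G, k ∘ₗ f = g := by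
  obtain ⟨r, hr⟩ := f.rangeRestrict.exists_rightInverse_of_surjective f.range_rangeRestrict
  obtain ⟨k, hk⟩ := LinearMap.exists_extend (g ∘ₗ r)
  refine ⟨k, LinearMap.ext fun u => ?_⟩
  have h1 := LinearMap.congr_fun hk (f.rangeRestrict u)
  have h2 := LinearMap.congr_fun hr (f.rangeRestrict u)
  have h3 : r (f.rangeRestrict u) - u ∈ LinearMap.ker f := by
    rw [LinearMap.mem_ker, map_sub, sub_eq_zero]
    exact congrArg Subtype.val h2
  have h4 := h h3
  rw [LinearMap.mem_ker, map_sub, sub_eq_zero] at h4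
  rw [← h4]
  exact h1

/-- If the rank of a pencil is maximal at `0` then its derivative maps the kernel to the range. -/
theorem mem_range_of_finrank_range_le {U W : Type*} [AddCommGroup U] [Module ℂ U]
    [AddCommGroup W] [Module ℂ W] [FiniteDimensional ℂ U] [FiniteDimensional ℂ W]
    (D D' : U →ₗ[ℂ] W)
    (h : ∀ t : ℂ, Module.finrank ℂ (LinearMap.range (D + t • D')) ≤
      Module.finrank ℂ (LinearMap.range D)) {φ : U} (hφ : D φ = 0) :
    D' φ ∈ LinearMap.range D := by
  by_contra hn
  let F : ℂ → (U × ℂ →ₗ[ℂ] W) := fun t =>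
    LinearMap.coprod (D + t • D') (LinearMap.toSpanSingleton ℂ W (D' φ))
  have hF : ∀ u (l : W →ₗ[ℂ] ℂ), (fun t => l (F t u)) ∈ polyFun ℂ := fun u l => by
    have : (fun t => l (F t u)) = (fun _ => l (D u.1 + u.2 • D' φ)) +
        fun t => (LinearMap.toSpanSingleton ℂ ℂ (l (D' u.1))) t := by
      funext t
      simp [F]
      ring
    rw [this]
    exact (polyFun ℂ).add_mem (const_mem_polyFun _) (linear_mem_polyFun _)
  have h1 := finite_of_eventually_zariski (eventually_zariski_finrank_range hF 0)
  obtain ⟨t, ht⟩ := ((h1.union (Set.finite_singleton 0)).infinite_compl).nonempty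
  simp only [Set.mem_compl_iff, Set.mem_union, Set.mem_ofPred_eq, Set.mem_singleton_iff, not_or,
    not_not] at ht
  have h2 : LinearMap.range (F t) ≤ LinearMap.range (D + t • D') := by
    rintro _ ⟨⟨u, c⟩, rfl⟩
    refine ⟨u + (c / t) • φ, ?_⟩
    simp only [F, map_add, map_smul, LinearMap.coprod_apply, LinearMap.add_apply,
      LinearMap.smul_apply, hφ, zero_add, LinearMap.toSpanSingleton_apply, smul_smul]
    rw [div_mul_cancel₀ _ ht.2]
  have h3 : LinearMap.range D < LinearMap.range (F 0) := by
    refine lt_of_le_of_ne ?_ fun he => hn ?_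
    · rintro _ ⟨u, rfl⟩
      exact ⟨(u, 0), by simp [F]⟩
    · rw [he]
      exact ⟨(0, 1), by simp [F]⟩
  have := Submodule.finrank_lt_finrank_of_lt h3
  have := Submodule.finrank_mono h2
  have := h t
  omega

variable {V Q : Type} [Fintype V] [Fintype Q] {src tgt : Q → V}

omit [Fintype V] [Fintype Q] in
theorem hasSub_trans {ι : V → Type} [∀ v, Fintype (ι v)] {δ δ' : V → ℕ}
    {x : QRep src tgt ι} (h : HasSub x δ)
    (h' : ∀ y : QRep src tgt fun v => Fin (δ v), HasSub y δ') : HasSub x δ' := by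
  obtain ⟨U, hU, hxU⟩ := hasSub_iff_frame.mp h
  refine HasSub.of_injective (g := fun v => (U v).mulVecLin) (fun a u => ?_) (fun v => ?_)
    (h' fun a => (U (tgt a))ᴴ * x a * U (src a))
  · simp only [Matrix.mulVecLin_apply, Matrix.mulVec_mulVec]
    rw [hxU]
  · refine Function.LeftInverse.injective (g := ((U v)ᴴ).mulVecLin) fun w => ?_
    simp [hU]

omit [Fintype V] [Fintype Q] in
theorem dmap_mem_polyFun {ι κ : V → Type} [∀ v, Fintype (ι v)] [∀ v, Fintype (κ v)]
    (φ : ∀ v, Matrix (κ v) (ι v) ℂ)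
    (l : (∀ a : Q, Matrix (κ (tgt a)) (ι (src a)) ℂ) →ₗ[ℂ] ℂ) :
    (fun z : QRep src tgt ι × QRep src tgt κ => l (dmap z.1 z.2 φ)) ∈
      polyFun (QRep src tgt ι × QRep src tgt κ) := by
  let L : QRep src tgt ι × QRep src tgt κ →ₗ[ℂ] ∀ a : Q, Matrix (κ (tgt a)) (ι (src a)) ℂ :=
    { toFun := fun z => dmap z.1 z.2 φ
      map_add' := fun z z' => by
        funext a
        simp only [dmap_apply, Prod.fst_add, Prod.snd_add, Pi.add_apply, Matrix.mul_add,
          Matrix.add_mul]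
        abel
      map_smul' := fun c z => by
        funext a
        simp only [dmap_apply, Prod.smul_fst, Prod.smul_snd, Pi.smul_apply, Matrix.smul_mul,
          Matrix.mul_smul, RingHom.id_apply, smul_sub] }
  exact linear_mem_polyFun (l ∘ₗ L)

omit [Fintype Q] in
theorem eventually_finrank_dmap {ι κ : V → Type} [∀ v, Fintype (ι v)] [∀ v, Fintype (κ v)]
    (x : QRep src tgt ι) (y : QRep src tgt κ) :
    ∀ᶠ z in zariskiFilter (QRep src tgt ι × QRep src tgt κ),
      Module.finrank ℂ (LinearMap.range (dmap x y)) ≤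
        Module.finrank ℂ (LinearMap.range (dmap z.1 z.2)) :=
  eventually_zariski_finrank_range (D := fun z : QRep src tgt ι × QRep src tgt κ => dmap z.1 z.2)
    dmap_mem_polyFun (x, y)

theorem eventually_surjective_dmap {ι κ : V → Type} [∀ v, Fintype (ι v)] [∀ v, Fintype (κ v)]
    {x : QRep src tgt ι} {y : QRep src tgt κ} (h : Function.Surjective (dmap x y))
    {E : Type*} [AddCommGroup E] [Module ℂ E] (g : E → QRep src tgt ι × QRep src tgt κ)
    (hg : ∀ l : QRep src tgt ι × QRep src tgt κ →ₗ[ℂ] ℂ, (fun e => l (g e)) ∈ polyFun E)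
    {e : E} (he : g e = (x, y)) :
    ∀ᶠ e in zariskiFilter E, Function.Surjective (dmap (g e).1 (g e).2) := by
  have := eventually_zariski_finrank_range (D := fun e => dmap (g e).1 (g e).2)
    (fun u l => polyFun_comp hg (dmap_mem_polyFun u l)) e
  filter_upwards [this] with e' h'
  rw [he, LinearMap.range_eq_top.mpr h, finrank_top] at h'
  rw [← LinearMap.range_eq_top]
  exact Submodule.eq_top_of_finrank_eq (le_antisymm (Submodule.finrank_le _) h')

end Schofield

section SchofieldMain

variable {V Q : Type} [Fintype V] [Fintype Q] {src tgt : Q → V}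

theorem surjective_dmap_of_kernel {α δ γ : V → ℕ}
    {x : QRep src tgt fun v => Fin (α v)} {y : QRep src tgt fun v => Fin (γ v)}
    (hmax : ∀ y' : QRep src tgt fun v => Fin (γ v),
      Module.finrank ℂ (LinearMap.range (dmap x y')) ≤
        Module.finrank ℂ (LinearMap.range (dmap x y)))
    {φ : ∀ v, Matrix (Fin (γ v)) (Fin (α v)) ℂ} (hφ : dmap x y φ = 0)
    {U : ∀ v, Matrix (Fin (α v)) (Fin (δ v)) ℂ} (hU : ∀ v, (U v)ᴴ * U v = 1)
    (hker : ∀ v u, φ v *ᵥ u = 0 → ∃ w, U v *ᵥ w = u)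
    {S : QRep src tgt fun v => Fin (δ v)} (hS : ∀ a, x a * U (src a) = U (tgt a) * S a)
    (hsurj : Function.Surjective (dmap S y)) : Function.Surjective (dmap x y) := by
  classical
  intro ξ
  obtain ⟨ψ, hψ⟩ := hsurj fun a => ξ a * U (src a)
  have hξ : ∀ a, (ξ a - dmap x y (fun v => ψ v * (U v)ᴴ) a) * U (src a) = 0 := fun a => by
    have h1 := congrFun hψ a
    rw [dmap_apply] at h1
    rw [dmap_apply, Matrix.sub_mul, ← h1, Matrix.sub_mul, Matrix.mul_assoc (ψ _ * _), hS,
      Matrix.mul_assoc (ψ _), ← Matrix.mul_assoc _ (U _), hU, Matrix.one_mul,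
      Matrix.mul_assoc (y a), Matrix.mul_assoc (ψ _), hU, Matrix.mul_one, sub_self]
  have hfac : ∀ a, ∃ Y : Matrix (Fin (γ (tgt a))) (Fin (γ (src a))) ℂ,
      Y * φ (src a) = ξ a - dmap x y (fun v => ψ v * (U v)ᴴ) a := fun a => by
    obtain ⟨k, hk⟩ := exists_comp_eq_of_ker_le (φ (src a)).mulVecLin
      (ξ a - dmap x y (fun v => ψ v * (U v)ᴴ) a).mulVecLin fun u hu => by
        obtain ⟨w, rfl⟩ := hker _ u hu
        rw [LinearMap.mem_ker, Matrix.mulVecLin_apply, Matrix.mulVec_mulVec, hξ,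
          Matrix.zero_mulVec]
    refine ⟨LinearMap.toMatrix' k, ?_⟩
    have h2 : LinearMap.toMatrix' (k ∘ₗ (φ (src a)).mulVecLin) = LinearMap.toMatrix'
      (ξ a - dmap x y (fun v => ψ v * (U v)ᴴ) a).mulVecLin := by rw [hk]
    rw [LinearMap.toMatrix'_comp] at h2
    simpa [← Matrix.toLin'_apply'] using h2
  choose Y hY using hfac
  let D' : (∀ v, Matrix (Fin (γ v)) (Fin (α v)) ℂ) →ₗ[ℂ]
      ∀ a : Q, Matrix (Fin (γ (tgt a))) (Fin (α (src a))) ℂ :=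
    { toFun := fun χ a => Y a * χ (src a)
      map_add' := fun χ χ' => by funext a; simp only [Pi.add_apply, Matrix.mul_add]
      map_smul' := fun c χ => by
        funext a; simp only [Pi.smul_apply, Matrix.mul_smul, RingHom.id_apply] }
  have hD : ∀ t : ℂ, dmap x y + t • D' = dmap x (y - t • Y) := fun t => by
    refine LinearMap.ext fun χ => funext fun a => ?_
    simp only [LinearMap.add_apply, LinearMap.smul_apply, Pi.add_apply, Pi.smul_apply, dmap_apply,
      D', LinearMap.coe_mk, AddHom.coe_mk, Pi.sub_apply, Matrix.sub_mul, Matrix.smul_mul]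
    abel
  obtain ⟨χ, hχ⟩ := mem_range_of_finrank_range_le (dmap x y) D'
    (fun t => by rw [hD]; exact hmax _) hφ
  refine ⟨χ + fun v => ψ v * (U v)ᴴ, ?_⟩
  rw [map_add, hχ]
  funext a
  rw [Pi.add_apply, show D' φ a = Y a * φ (src a) from rfl, hY, sub_add_cancel]

omit [Fintype V] [Fintype Q] in
theorem isHom_mulVecLin_of_dmap_eq_zero {ι κ : V → Type} [∀ v, Fintype (ι v)]
    [∀ v, Fintype (κ v)] {x : QRep src tgt ι} {y : QRep src tgt κ}
    {φ : ∀ v, Matrix (κ v) (ι v) ℂ} (hφ : dmap x y φ = 0) :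
    IsHom x y fun v => (φ v).mulVecLin := fun a u => by
  have := sub_eq_zero.mp (congrFun hφ a)
  simp only [Matrix.mulVecLin_apply, Matrix.mulVec_mulVec, this]

/-- If all Euler pairings of generic subdimension vectors of `α` with `γ` are nonnegative then
extensions of a generic representation of dimension `α` by a generic one of dimension `γ`
vanish. -/
theorem exists_surjective_dmap (γ : V → ℕ) (n : ℕ) : ∀ α : V → ℕ, ∑ v, α v = n →
    (∀ δ : V → ℕ, (∀ x : QRep src tgt fun v => Fin (α v), HasSub x δ) →
      0 ≤ euler src tgt δ γ) →
    ∃ (x : QRep src tgt fun v => Fin (α v)) (y : QRep src tgt fun v => Fin (γ v)),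
      Function.Surjective (dmap x y) := by
  classical
  induction n using Nat.strong_induction_on with
  | _ n ih =>
  intro α hα h
  let good : (V → ℕ) → Prop := fun δ => ∀ x : QRep src tgt fun v => Fin (α v), HasSub x δ
  have hIH : ∀ δ, good δ → ∑ v, δ v < n →
      ∃ (x : QRep src tgt fun v => Fin (δ v)) (y : QRep src tgt fun v => Fin (γ v)),
        Function.Surjective (dmap x y) := fun δ hδ hlt =>
    ih _ hlt δ rfl fun δ' hδ' => h δ' fun x => hasSub_trans (hδ x) hδ'
  choose X Y hXY using hIH
  obtain ⟨⟨x₀, y₀⟩, hmax⟩ : ∃ z : (QRep src tgt fun v => Fin (α v)) ×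
      (QRep src tgt fun v => Fin (γ v)), ∀ z' : (QRep src tgt fun v => Fin (α v)) ×
      (QRep src tgt fun v => Fin (γ v)), Module.finrank ℂ (LinearMap.range (dmap z'.1 z'.2)) ≤
        Module.finrank ℂ (LinearMap.range (dmap z.1 z.2)) := by
    have hb : BddAbove (Set.range fun z : (QRep src tgt fun v => Fin (α v)) ×
        (QRep src tgt fun v => Fin (γ v)) => Module.finrank ℂ (LinearMap.range (dmap z.1 z.2))) :=
      ⟨_, by rintro _ ⟨z, rfl⟩; exact Submodule.finrank_le _⟩
    obtain ⟨z, hz⟩ := Nat.sSup_mem (Set.range_nonempty _) hb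
    exact ⟨z, fun z' => (le_csSup hb ⟨z', rfl⟩).trans_eq hz.symm⟩
  -- a generic pair
  have g1 : ∀ᶠ z in zariskiFilter ((QRep src tgt fun v => Fin (α v)) ×
      (QRep src tgt fun v => Fin (γ v))), ∀ δ ∈ Fintype.piFinset fun v => Finset.range (α v + 1),
        ¬ good δ → ¬ HasSub z.1 δ := by
    rw [Filter.eventually_all_finset]
    intro δ hδ
    by_cases hg : good δ
    · exact Filter.Eventually.of_forall fun _ h => (h hg).elim
    · have hle : ∀ v, δ v ≤ α v := fun v => by
        have := Fintype.mem_piFinset.mp hδ v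
        rw [Finset.mem_range] at this
        omega
      have := (hasSub_dichotomy (src := src) (tgt := tgt) (δ := δ) (γ := fun v => α v - δ v)
        (κ := fun v => Fin (α v)) (fun v => by simp [hle v])).resolve_right fun h' => hg h'.1
      filter_upwards [eventually_zariski_linear (L := LinearMap.fst ℂ
        (QRep src tgt fun v => Fin (α v)) (QRep src tgt fun v => Fin (γ v)))
        LinearMap.fst_surjective this] with z hz _
      exact hz
  have g2 : ∀ᶠ z in zariskiFilter ((QRep src tgt fun v => Fin (α v)) ×
      (QRep src tgt fun v => Fin (γ v))), ∀ δ ∈ Fintype.piFinset fun v => Finset.range (α v + 1),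
        ∀ (hg : good δ) (hlt : ∑ v, δ v < n), Function.Surjective (dmap (X δ hg hlt) z.2) := by
    rw [Filter.eventually_all_finset]
    intro δ hδ
    by_cases hg : good δ
    · by_cases hlt : ∑ v, δ v < n
      · filter_upwards [eventually_surjective_dmap (hXY δ hg hlt)
          (E := (QRep src tgt fun v => Fin (α v)) × (QRep src tgt fun v => Fin (γ v)))
          (fun z => (X δ hg hlt, z.2)) (fun l => by
            have : (fun e : (QRep src tgt fun v => Fin (α v)) ×
                (QRep src tgt fun v => Fin (γ v)) => l (X δ hg hlt, e.2)) =
                (fun _ => l (X δ hg hlt, 0)) +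
                  fun e => (l ∘ₗ (LinearMap.inr ℂ _ _) ∘ₗ (LinearMap.snd ℂ _ _)) e := by
              funext e
              rw [Pi.add_apply, LinearMap.comp_apply, LinearMap.comp_apply, ← map_add]
              simp
            rw [this]
            exact (polyFun _).add_mem (const_mem_polyFun _) (linear_mem_polyFun _))
          (e := (x₀, Y δ hg hlt)) rfl] with z hz _ _
        exact hz
      · exact Filter.Eventually.of_forall fun _ _ h => (hlt h).elim
    · exact Filter.Eventually.of_forall fun _ h => (hg h).elim
  obtain ⟨⟨x, y⟩, ⟨hx, hy⟩, hxy⟩ := ((g1.and g2).and (eventually_finrank_dmap x₀ y₀)).exists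
  by_cases hinj : Function.Injective (dmap x y)
  · refine ⟨x, y, ?_⟩
    rw [← LinearMap.range_eq_top]
    refine Submodule.eq_top_of_finrank_eq (le_antisymm (Submodule.finrank_le _) ?_)
    rw [LinearMap.finrank_range_of_inj hinj]
    have h0 := h α fun x => ⟨fun _ => ⊤, fun _ _ _ => trivial, fun v => by simp⟩
    rw [euler, sub_nonneg] at h0
    simp only [Module.finrank_pi_fintype, Module.finrank_matrix, Fintype.card_fin,
      Module.finrank_self, mul_one]
    zify
    simp only [mul_comm ((γ _ : ℕ) : ℤ)]
    exact h0
  rw [← LinearMap.ker_eq_bot, Submodule.eq_bot_iff] at hinj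
  push Not at hinj
  obtain ⟨φ, hφ, hφ0⟩ := hinj
  rw [LinearMap.mem_ker] at hφ
  let K : ∀ v, Submodule ℂ (Fin (α v) → ℂ) := fun v => LinearMap.ker (φ v).mulVecLin
  let δ : V → ℕ := fun v => Module.finrank ℂ (K v)
  have hK : IsSub x K := by
    have := IsSub.comap (isHom_mulVecLin_of_dmap_eq_zero hφ) (S := fun _ => ⊥) (fun a u hu => by
      rw [Submodule.mem_bot] at hu ⊢; simp [hu])
    exact this
  have hδle : ∀ v, δ v ≤ α v := fun v => (Submodule.finrank_le _).trans (by simp)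
  have hδmem : δ ∈ Fintype.piFinset fun v => Finset.range (α v + 1) :=
    Fintype.mem_piFinset.mpr fun v => Finset.mem_range.mpr (Nat.lt_succ_of_le (hδle v))
  have hgood : good δ := by
    by_contra hng
    exact hx δ hδmem hng ⟨K, hK, fun _ => rfl⟩
  have hlt : ∑ v, δ v < n := by
    rw [← hα]
    refine Finset.sum_lt_sum (fun v _ => hδle v) ?_
    obtain ⟨v, hv⟩ := Function.ne_iff.mp hφ0
    refine ⟨v, Finset.mem_univ _, lt_of_le_of_ne (hδle v) fun he => hv ?_⟩
    have : K v = ⊤ := Submodule.eq_top_of_finrank_eq (by simpa using he)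
    have h1 : (φ v).mulVecLin = 0 := LinearMap.ker_eq_top.mp this
    exact Matrix.ext_of_mulVec_single fun j => by
      rw [← Matrix.mulVecLin_apply, h1, LinearMap.zero_apply, Pi.zero_apply, Matrix.zero_mulVec]
  choose U hU hUm hUK using fun v => exists_frame (K v) rfl
  have hxU : ∀ a, x a * U (src a) = U (tgt a) * ((U (tgt a))ᴴ * x a * U (src a)) := fun a => by
    refine Matrix.ext_of_mulVec_single fun j => ?_
    have := hUK (tgt a) _ (hK a _ (hUm (src a) (Pi.single j 1)))
    simp only [← Matrix.mulVec_mulVec] at this ⊢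
    rw [this]
  have hφU : ∀ v, φ v * U v = 0 := fun v => Matrix.ext_of_mulVec_single fun j => by
    rw [← Matrix.mulVec_mulVec, Matrix.zero_mulVec]
    exact hUm v (Pi.single j 1)
  -- move the subrepresentation on a line
  let S : QRep src tgt fun v => Fin (δ v) := fun a => (U (tgt a))ᴴ * x a * U (src a)
  let S' : QRep src tgt fun v => Fin (δ v) := X δ hgood hlt - S
  let x' : QRep src tgt fun v => Fin (α v) := fun a => U (tgt a) * S' a * (U (src a))ᴴ
  have e1 : ∀ᶠ t in zariskiFilter ℂ, Function.Surjective (dmap (S + t • S') y) := by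
    refine eventually_surjective_dmap (hy δ hδmem hgood hlt) (fun t : ℂ => (S + t • S', y))
      (fun l => ?_) (e := 1) (by simp [S'])
    have : (fun t : ℂ => l (S + t • S', y)) = (fun _ => l (S, y)) +
        fun t => LinearMap.toSpanSingleton ℂ ℂ (l (S', 0)) t := by
      funext t
      rw [Pi.add_apply, LinearMap.toSpanSingleton_apply, ← map_smul, ← map_add]
      simp
    rw [this]
    exact (polyFun _).add_mem (const_mem_polyFun _) (linear_mem_polyFun _)
  have e2 : ∀ᶠ t in zariskiFilter ℂ, Module.finrank ℂ (LinearMap.range (dmap x y)) ≤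
      Module.finrank ℂ (LinearMap.range (dmap (x + t • x') y)) := by
    have := eventually_zariski_finrank_range (D := fun t : ℂ => dmap (x + t • x') y)
      (fun u l => polyFun_comp (g := fun t : ℂ => (x + t • x', y)) (fun l => ?_)
        (dmap_mem_polyFun u l)) 0
    · rwa [zero_smul ℂ x', add_zero] at this
    · have : (fun t : ℂ => l (x + t • x', y)) = (fun _ => l (x, y)) +
          fun t => LinearMap.toSpanSingleton ℂ ℂ (l (x', 0)) t := by
        funext t
        rw [Pi.add_apply, LinearMap.toSpanSingleton_apply, ← map_smul, ← map_add]
        simp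
      rw [this]
      exact (polyFun _).add_mem (const_mem_polyFun _) (linear_mem_polyFun _)
  obtain ⟨t, ht1, ht2⟩ := (e1.and e2).exists
  refine ⟨x + t • x', y, surjective_dmap_of_kernel (φ := φ) (U := U) (S := S + t • S')
    (fun y' => (hmax (x + t • x', y')).trans (hxy.trans ht2)) ?_ hU (fun v u hu => ?_)
    (fun a => ?_) ht1⟩
  · funext a
    have := congrFun hφ a
    rw [dmap_apply] at this ⊢
    rw [Pi.add_apply, Pi.smul_apply, Matrix.mul_add, Matrix.mul_smul, add_sub_right_comm, this]
    simp only [x', ← Matrix.mul_assoc, hφU, Matrix.zero_mul, smul_zero, add_zero]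
  · exact ⟨_, hUK v u hu⟩
  · simp only [Pi.add_apply, Pi.smul_apply, Matrix.add_mul, Matrix.mul_add, hxU, S, x',
      Matrix.smul_mul, Matrix.mul_smul]
    rw [Matrix.mul_assoc (U (tgt a) * S' a), hU, Matrix.mul_one]

end SchofieldMain

section Moment

variable {V Q : Type} [Fintype V] [Fintype Q] {src tgt : Q → V}

/-- Generic subrepresentations exist as soon as the Euler form is nonnegative on
their own generic subrepresentations. -/
theorem hasSub_of_euler_nonneg {κ : V → Type} [∀ v, Fintype (κ v)] {δ γ : V → ℕ}
    (hκ : ∀ v, Fintype.card (κ v) = δ v + γ v)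
    (h : ∀ δ' : V → ℕ, (∀ x : QRep src tgt fun v => Fin (δ v), HasSub x δ') →
      0 ≤ euler src tgt δ' γ) (x : QRep src tgt κ) : HasSub x δ := by
  obtain ⟨_, _, hs⟩ := exists_surjective_dmap γ _ δ rfl h
  exact hasSub_of_algebraicIndependent hκ (algebraicIndependent_chartPoly hs) x

variable {ι : V → Type} [∀ v, Fintype (ι v)]

/-- The moment map of the unitary group on representations, paired with `Y`. -/
noncomputable def momentPairing (x : QRep src tgt ι) (Y : ∀ v, Matrix (ι v) (ι v) ℂ) : ℝ :=
  ∑ a, ((Y (tgt a) * (x a * (x a)ᴴ)).trace - (Y (src a) * ((x a)ᴴ * x a)).trace).re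

/-- The moment map takes the scalar value `σ v` at each vertex. -/
def IsMoment (x : QRep src tgt ι) (σ : V → ℝ) : Prop :=
  ∀ Y : ∀ v, Matrix (ι v) (ι v) ℂ, (∀ v, (Y v).IsHermitian) →
    momentPairing x Y = ∑ v, σ v * (Y v).trace.re

theorem trace_self_conjTranspose_re_nonneg {m n : Type*} [Fintype m] [Fintype n]
    (N : Matrix m n ℂ) : 0 ≤ (N * Nᴴ).trace.re := by
  open ComplexOrder in
  classical
  exact (Complex.nonneg_iff.mp (Matrix.posSemidef_self_mul_conjTranspose N).trace_nonneg).1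

theorem IsMoment.nonneg {x : QRep src tgt ι} {σ : V → ℝ} (hx : IsMoment x σ) {δ : V → ℕ}
    (h : HasSub x δ) : 0 ≤ ∑ v, σ v * δ v := by
  classical
  obtain ⟨U, hU, hxU⟩ := hasSub_iff_frame.mp h
  have h1 := hx (fun v => U v * (U v)ᴴ) fun v => Matrix.isHermitian_mul_conjTranspose_self _
  have h2 : ∀ v, ((U v * (U v)ᴴ).trace).re = δ v := fun v => by
    rw [Matrix.trace_mul_comm, hU]; simp
  simp only [h2] at h1
  rw [← h1]
  refine Finset.sum_nonneg fun a _ => ?_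
  obtain ⟨N, hN⟩ : ∃ N, N = (U (tgt a))ᴴ * x a := ⟨_, rfl⟩
  obtain ⟨P, hP⟩ : ∃ P, P = U (src a) * (U (src a))ᴴ := ⟨_, rfl⟩
  have hPP : P * P = P := by
    rw [hP, Matrix.mul_assoc, ← Matrix.mul_assoc _ (U _), hU, Matrix.one_mul]
  have hPH : Pᴴ = P := by simp [hP]
  have e1 : (U (tgt a) * (U (tgt a))ᴴ * (x a * (x a)ᴴ)).trace = (N * Nᴴ).trace := by
    rw [Matrix.mul_assoc, Matrix.trace_mul_comm, hN, Matrix.conjTranspose_mul,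
      Matrix.conjTranspose_conjTranspose]
    simp only [Matrix.mul_assoc]
  have e2 : (P * ((x a)ᴴ * x a)).trace = (N * P * Nᴴ).trace := by
    have : P * ((x a)ᴴ * x a) = U (src a) * ((x a * U (src a))ᴴ * x a) := by
      rw [hP, Matrix.conjTranspose_mul]; simp only [Matrix.mul_assoc]
    rw [this, Matrix.trace_mul_comm, Matrix.mul_assoc, hxU, Matrix.conjTranspose_mul,
      Matrix.mul_assoc, ← Matrix.mul_assoc _ (U _), hU, Matrix.one_mul, ← hN,
      Matrix.conjTranspose_mul, Matrix.trace_mul_comm, hP]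
    simp only [Matrix.mul_assoc]
  beta_reduce
  rw [e1, ← hP, e2, ← Matrix.trace_sub]
  have e3 : N * Nᴴ - N * P * Nᴴ = (N * (1 - P)) * (N * (1 - P))ᴴ := by
    rw [Matrix.conjTranspose_mul N (1 - P), Matrix.conjTranspose_sub, hPH, Matrix.conjTranspose_one,
      Matrix.mul_assoc N (1 - P), ← Matrix.mul_assoc (1 - P) (1 - P)]
    simp only [Matrix.mul_sub, Matrix.sub_mul, Matrix.mul_assoc, Matrix.one_mul, Matrix.mul_one]
    rw [← Matrix.mul_assoc P P, hPP]
    abel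
  rw [e3]
  exact trace_self_conjTranspose_re_nonneg _

end Moment

section Minimization

open Filter Topology

variable {E : Type*} [NormedAddCommGroup E] [NormedSpace ℝ E] [FiniteDimensional ℝ E]

/-- A continuous function which is convex on rays from the origin and exceeds its value at the
origin somewhere on each ray attains its minimum. -/
theorem exists_forall_le_of_convexOn_ray {F : E → ℝ} (hF : Continuous F)
    (hconv : ∀ Y, ConvexOn ℝ (Set.Ici (0 : ℝ)) fun t => F (t • Y))
    (hgrow : ∀ Y ≠ 0, ∃ t > (0 : ℝ), F 0 < F (t • Y)) : ∃ X, ∀ Y, F X ≤ F Y := by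
  have hb : ∃ R : ℝ, ∀ X, R ≤ ‖X‖ → F 0 < F X := by
    by_contra hn
    push Not at hn
    choose X hX1 hX2 using fun n : ℕ => hn (n + 1)
    have hpos : ∀ n, 0 < ‖X n‖ := fun n => lt_of_lt_of_le (by positivity) (hX1 n)
    obtain ⟨Y, hY, φ, hφ, hlim⟩ := (isCompact_sphere (0 : E) 1).tendsto_subseq
      (x := fun n => ‖X n‖⁻¹ • X n) fun n => by
        simp [norm_smul, (hpos n).ne']
    have hY0 : Y ≠ 0 := by
      rintro rfl
      simp at hY
    obtain ⟨t, ht, hlt⟩ := hgrow Y hY0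
    have h1 : Tendsto (fun n => F (t • (‖X (φ n)‖⁻¹ • X (φ n)))) atTop (𝓝 (F (t • Y))) :=
      (hF.tendsto _).comp (hlim.const_smul t)
    refine absurd (le_of_tendsto h1 ?_) (not_le.mpr hlt)
    filter_upwards [eventually_ge_atTop ⌈t⌉₊] with n hn
    have htn : t ≤ ‖X (φ n)‖ := by
      refine (Nat.le_ceil t).trans (le_trans ?_ (hX1 (φ n)))
      have : n ≤ φ n := hφ.id_le n
      have : (⌈t⌉₊ : ℝ) ≤ φ n := by exact_mod_cast hn.trans this
      linarith
    have hc := (hconv (‖X (φ n)‖⁻¹ • X (φ n))).le_max_of_mem_Icc (x := 0) (y := ‖X (φ n)‖)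
      (z := t) (Set.mem_Ici.mpr le_rfl) (Set.mem_Ici.mpr (norm_nonneg _)) ⟨ht.le, htn⟩
    rw [zero_smul, smul_smul ‖X (φ n)‖, mul_inv_cancel₀ (hpos _).ne', one_smul] at hc
    exact hc.trans (max_le le_rfl (hX2 _))
  obtain ⟨R, hR⟩ := hb
  obtain ⟨X, -, hX⟩ := (isCompact_closedBall (0 : E) (max R 0)).exists_isMinOn
    ⟨0, by simp⟩ hF.continuousOn
  refine ⟨X, fun Y => ?_⟩
  by_cases hY : Y ∈ Metric.closedBall (0 : E) (max R 0)
  · exact hX hY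
  · have h1 : F 0 < F Y := hR Y (by
      simp only [Metric.mem_closedBall, dist_zero_right, not_le, max_lt_iff] at hY
      exact hY.1.le)
    exact (hX (by simp)).trans h1.le

theorem convexOn_sum_exp {J : Type*} [Fintype J] (c lam : J → ℝ) (hc : ∀ j, 0 ≤ c j) :
    ConvexOn ℝ Set.univ fun t : ℝ => ∑ j, c j * Real.exp (t * lam j) := by
  have h1 : ∀ j, ConvexOn ℝ Set.univ fun t : ℝ => Real.exp (t * lam j) := fun j =>
    convexOn_exp.comp_linearMap (LinearMap.mulRight ℝ (lam j))
  have h2 : ∀ s : Finset J, ConvexOn ℝ Set.univ fun t : ℝ => ∑ j ∈ s, c j * Real.exp (t * lam j) := by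
    classical
    intro s
    induction s using Finset.induction_on with
    | empty => simpa using convexOn_const 0 convex_univ
    | insert j s hj ih =>
      simp only [Finset.sum_insert hj]
      exact ((h1 j).smul (hc j)).add ih
  exact h2 _

/-- A sum of exponentials with a growing term exceeds every affine function. -/
theorem exists_lt_sum_exp {J : Type*} [Fintype J] (c lam : J → ℝ) (hc : ∀ j, 0 ≤ c j) {j₀ : J}
    (h1 : 0 < c j₀) (h2 : 0 < lam j₀) (a b : ℝ) :
    ∃ t > (0 : ℝ), a + b * t < ∑ j, c j * Real.exp (t * lam j) := by
  have h3 : Tendsto (fun t : ℝ => Real.exp t / t ^ 1) atTop atTop :=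
    Real.tendsto_exp_div_pow_atTop 1
  have h4 := (h3.comp (tendsto_id.atTop_mul_const h2)).eventually_gt_atTop
    ((|a| + |b|) / (c j₀ * lam j₀))
  obtain ⟨t, ht, ht1⟩ := (h4.and (eventually_ge_atTop 1)).exists
  refine ⟨t, by linarith, lt_of_lt_of_le ?_ (Finset.single_le_sum
    (f := fun j => c j * Real.exp (t * lam j))
    (fun j _ => mul_nonneg (hc j) (Real.exp_pos _).le) (Finset.mem_univ j₀))⟩
  have ht0 : 0 < t := by linarith
  simp only [Function.comp_apply, id, pow_one] at ht
  rw [lt_div_iff₀ (by positivity), div_mul_eq_mul_div, div_lt_iff₀ (by positivity)] at ht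
  have h5 : |a| ≤ |a| * t := le_mul_of_one_le_right (abs_nonneg a) ht1
  have h6 : (|a| + |b|) * t < c j₀ * Real.exp (t * lam j₀) := by
    by_contra hcon
    push Not at hcon
    have := mul_le_mul_of_nonneg_right hcon h2.le
    nlinarith
  nlinarith [le_abs_self a, le_abs_self b, mul_le_mul_of_nonneg_right (le_abs_self b) ht0.le]

/-- Approximate critical points for a function which behaves like the norm square on the orbit of
a reductive group, parametrized by a Cartan subspace. -/
theorem exists_approx_critical {J : Type*} [Fintype J] {N : E → ℝ} (hN : Continuous N)
    (ell : E →ₗ[ℝ] ℝ) (c lam : E → J → ℝ) (hc : ∀ Y j, 0 ≤ c Y j)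
    (hray : ∀ Y (t : ℝ), N (t • Y) = ∑ j, c Y j * Real.exp (t * lam Y j))
    (hss : ∀ Y, (∀ j, 0 < c Y j → lam Y j ≤ 0) → ell Y ≤ 0)
    (M : E → E → ℝ → ℝ) (m : E → E → ℝ) (hM0 : ∀ X Y, M X Y 0 = N X)
    (hM : ∀ X Y, HasDerivAt (M X Y) (2 * m X Y) 0)
    (hclos : ∀ X Y (t : ℝ), ∃ Z, ‖Z‖ ≤ ‖X‖ + |t| * ‖Y‖ ∧ ell Z = ell X + t * ell Y ∧
      N Z = M X Y t) {ε : ℝ} (hε : 0 < ε) :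
    ∃ X, ∀ Y, |m X Y - ell Y| ≤ ε * ‖Y‖ := by
  let F : E → ℝ := fun X => N X - 2 * ell X + 2 * ε * ‖X‖
  have hell : Continuous ell := ell.continuous_of_finiteDimensional
  obtain ⟨X, hX⟩ := exists_forall_le_of_convexOn_ray (F := F) (by fun_prop) (fun Y => by
    have h1 : ConvexOn ℝ (Set.Ici (0 : ℝ)) fun t : ℝ => N (t • Y) := by
      simp only [hray]
      exact (convexOn_sum_exp _ _ (hc Y)).subset (Set.subset_univ _) (convex_Ici _)
    have h2 : ConvexOn ℝ (Set.Ici (0 : ℝ)) fun t : ℝ => (2 * ε * ‖Y‖ - 2 * ell Y) * t :=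
      ((LinearMap.mulLeft ℝ (2 * ε * ‖Y‖ - 2 * ell Y)).convexOn (convex_Ici _))
    refine (h1.add h2).congr fun t ht => ?_
    have ht : 0 ≤ t := ht
    simp only [Pi.add_apply, F, map_smul, norm_smul, Real.norm_eq_abs, abs_of_nonneg ht,
      smul_eq_mul]
    ring) (fun Y hY => by
    have hY' : 0 < ‖Y‖ := norm_pos_iff.mpr hY
    have hF0 : F 0 = N 0 := by simp [F]
    have hFt : ∀ t : ℝ, 0 < t → F (t • Y) = N (t • Y) + (2 * ε * ‖Y‖ - 2 * ell Y) * t := by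
      intro t ht
      simp only [F, map_smul, norm_smul, Real.norm_eq_abs, abs_of_pos ht, smul_eq_mul]
      ring
    by_cases hb : ∀ j, 0 < c Y j → lam Y j ≤ 0
    · have h1 := hss Y hb
      refine ⟨(N 0 + 1) / (2 * ε * ‖Y‖), ?_, ?_⟩
      · have : 0 ≤ N 0 := by
          rw [← zero_smul ℝ Y, hray]
          exact Finset.sum_nonneg fun j _ => mul_nonneg (hc Y j) (Real.exp_pos _).le
        positivity
      · have h0 : 0 ≤ N 0 := by
          rw [← zero_smul ℝ Y, hray]
          exact Finset.sum_nonneg fun j _ => mul_nonneg (hc Y j) (Real.exp_pos _).le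
        have ht : 0 < (N 0 + 1) / (2 * ε * ‖Y‖) := by positivity
        rw [hFt _ ht, hF0]
        have h2 : 0 ≤ N (((N 0 + 1) / (2 * ε * ‖Y‖)) • Y) := by
          rw [hray]
          exact Finset.sum_nonneg fun j _ => mul_nonneg (hc Y j) (Real.exp_pos _).le
        have h3 : 2 * ε * ‖Y‖ * ((N 0 + 1) / (2 * ε * ‖Y‖)) = N 0 + 1 := by
          field_simp
        have h4 : 0 ≤ -(2 * ell Y) * ((N 0 + 1) / (2 * ε * ‖Y‖)) :=
          mul_nonneg (by linarith) ht.le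
        nlinarith
    · push Not at hb
      obtain ⟨j₀, hj1, hj2⟩ := hb
      obtain ⟨t, ht, hlt⟩ := exists_lt_sum_exp (c Y) (lam Y) (hc Y) hj1 hj2 (N 0)
        (2 * ell Y - 2 * ε * ‖Y‖)
      refine ⟨t, ht, ?_⟩
      rw [hFt t ht, hF0, hray]
      linarith)
  refine ⟨X, fun Y => ?_⟩
  have key : ∀ t : ℝ, 0 ≤ M X Y t - N X - 2 * (t * ell Y) + 2 * ε * (|t| * ‖Y‖) := fun t => by
    obtain ⟨Z, hZ1, hZ2, hZ3⟩ := hclos X Y t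
    have := hX Z
    simp only [F, hZ2, hZ3] at this
    nlinarith
  have hd := hasDerivAt_iff_tendsto_slope_zero.mp (hM X Y)
  have hr : Tendsto (fun t : ℝ => t⁻¹ • (M X Y (0 + t) - M X Y 0)) (𝓝[>] 0) (𝓝 (2 * m X Y)) :=
    hd.mono_left (nhdsWithin_mono _ fun t ht => ne_of_gt ht)
  have hl : Tendsto (fun t : ℝ => t⁻¹ • (M X Y (0 + t) - M X Y 0)) (𝓝[<] 0) (𝓝 (2 * m X Y)) :=
    hd.mono_left (nhdsWithin_mono _ fun t ht => ne_of_lt ht)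
  have h1 : 2 * ell Y - 2 * ε * ‖Y‖ ≤ 2 * m X Y := by
    refine ge_of_tendsto hr ?_
    filter_upwards [self_mem_nhdsWithin] with t ht
    have ht : 0 < t := ht
    have := key t
    rw [abs_of_pos ht] at this
    rw [zero_add, hM0, smul_eq_mul, inv_mul_eq_div, le_div_iff₀ ht]
    linarith
  have h2 : 2 * m X Y ≤ 2 * ell Y + 2 * ε * ‖Y‖ := by
    refine le_of_tendsto hl ?_
    filter_upwards [self_mem_nhdsWithin] with t ht
    have ht : t < 0 := ht
    have := key t
    rw [abs_of_neg ht] at this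
    rw [zero_add, hM0, smul_eq_mul, inv_mul_eq_div, div_le_iff_of_neg ht]
    linarith
  rw [abs_le]
  constructor <;> linarith

end Minimization

section HermitianExp

open NormedSpace
open scoped Matrix.Norms.L2Operator

variable {n : Type} [Fintype n] [DecidableEq n]

theorem exp_conj_diagonal {V : Matrix n n ℂ} (hV : V * Vᴴ = 1) (z : n → ℝ) :
    exp (V * diagonal (fun i => (z i : ℂ)) * Vᴴ) =
      V * diagonal (fun i => (Real.exp (z i) : ℂ)) * Vᴴ := by
  have hinv : V⁻¹ = Vᴴ := Matrix.inv_eq_right_inv hV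
  have hu : IsUnit V := by
    rw [Matrix.isUnit_iff_isUnit_det]
    exact Matrix.isUnit_det_of_right_inverse hV
  rw [← hinv, Matrix.exp_conj _ _ hu, Matrix.exp_diagonal]
  congr 3
  funext i
  rw [Pi.coe_exp, ← Complex.exp_eq_exp_ℂ, Complex.ofReal_exp]

theorem Matrix.IsHermitian.exists_diagonal {A : Matrix n n ℂ} (hA : A.IsHermitian) :
    ∃ (V : Matrix n n ℂ) (z : n → ℝ), V * Vᴴ = 1 ∧ Vᴴ * V = 1 ∧
      A = V * diagonal (fun i => (z i : ℂ)) * Vᴴ := by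
  refine ⟨hA.eigenvectorUnitary, hA.eigenvalues, ?_, ?_, ?_⟩
  · exact Unitary.coe_mul_star_self _
  · exact Unitary.coe_star_mul_self _
  · have := hA.spectral_theorem
    rw [Unitary.conjStarAlgAut_apply] at this
    exact this

theorem exp_smul_diagonal {V : Matrix n n ℂ} (hV : V * Vᴴ = 1) (z : n → ℝ) (t : ℝ) :
    exp (t • (V * diagonal (fun i => (z i : ℂ)) * Vᴴ)) =
      V * diagonal (fun i => (Real.exp (t * z i) : ℂ)) * Vᴴ := by
  rw [← exp_conj_diagonal hV (fun i => t * z i)]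
  congr 1
  rw [← Matrix.smul_mul, ← Matrix.mul_smul]
  congr 2
  ext i j
  by_cases h : i = j
  · subst h; simp
  · simp [h]

theorem norm_conj_diagonal {V : Matrix n n ℂ} (hV : V * Vᴴ = 1) (z : n → ℂ) :
    ‖V * diagonal z * Vᴴ‖ = ‖z‖ := by
  have hV' : Vᴴ * V = 1 := mul_eq_one_comm.mp hV
  let u : unitary (Matrix n n ℂ) := ⟨V, by
    rw [Unitary.mem_iff]; exact ⟨hV', hV⟩⟩
  rw [← Matrix.l2_opNorm_diagonal z, show Vᴴ = ((star u : unitary (Matrix n n ℂ)) : Matrix n n ℂ)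
    from rfl, CStarRing.norm_mul_coe_unitary]
  exact CStarRing.norm_coe_unitary_mul u _

theorem exp_hermitian_injective {A B : Matrix n n ℂ} (hA : A.IsHermitian) (hB : B.IsHermitian)
    (h : exp A = exp B) : A = B := by
  rw [← CFC.log_exp A hA.isSelfAdjoint, h, CFC.log_exp B hB.isSelfAdjoint]

theorem Matrix.IsHermitian.det_normedSpaceExp {A : Matrix n n ℂ} (hA : A.IsHermitian) :
    (NormedSpace.exp A).det = (Real.exp (A.trace.re) : ℂ) := by
  obtain ⟨V, z, h1, h2, h⟩ := hA.exists_diagonal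
  have h3 : A.trace = ((∑ i, z i : ℝ) : ℂ) := by
    rw [h, Matrix.trace_mul_comm, ← Matrix.mul_assoc, h2, Matrix.one_mul, Matrix.trace_diagonal]
    simp
  rw [h3, h, exp_conj_diagonal h1, Matrix.det_mul, Matrix.det_mul_comm, ← Matrix.det_mul,
    Matrix.mul_assoc, h1, Matrix.mul_one, Matrix.det_diagonal, Complex.ofReal_re, Real.exp_sum,
    Complex.ofReal_prod]

/-- Polar decomposition of a product of exponentials. -/
theorem exists_exp_two_smul {X Y : Matrix n n ℂ} (hX : X.IsHermitian) (hY : Y.IsHermitian) :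
    ∃ Z : Matrix n n ℂ, Z.IsHermitian ∧ exp ((2 : ℝ) • Z) = exp X * exp ((2 : ℝ) • Y) * exp X := by
  have hexp : exp X * exp ((2 : ℝ) • Y) * exp X = (exp Y * exp X)ᴴ * (exp Y * exp X) := by
    rw [Matrix.conjTranspose_mul, hX.exp, hY.exp, two_smul,
      Matrix.exp_add_of_commute _ _ (Commute.refl _)]
    simp only [Matrix.mul_assoc]
  open ComplexOrder in
  have hP : (exp X * exp ((2 : ℝ) • Y) * exp X).PosDef := by
    rw [hexp]
    refine Matrix.PosDef.conjTranspose_mul_self _ ?_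
    have : IsUnit (exp Y * exp X) := (Matrix.isUnit_exp Y).mul (Matrix.isUnit_exp X)
    exact Matrix.mulVec_injective_of_isUnit this
  set P := exp X * exp ((2 : ℝ) • Y) * exp X with hPdef
  obtain ⟨V, p, h1, h2, h⟩ := hP.isHermitian.exists_diagonal
  have hp : ∀ i, 0 < p i := fun i => by
    open ComplexOrder in
    have h3 := (hP.conjTranspose_mul_mul_same (B := V) (Matrix.mulVec_injective_of_isUnit
      (by rw [Matrix.isUnit_iff_isUnit_det]; exact Matrix.isUnit_det_of_right_inverse h1))).diag_pos
      (i := i)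
    rw [h, Matrix.mul_assoc, Matrix.mul_assoc, Matrix.mul_assoc, h2, Matrix.mul_one,
      ← Matrix.mul_assoc, h2, Matrix.one_mul, Matrix.diagonal_apply_eq] at h3
    exact_mod_cast h3
  refine ⟨V * diagonal (fun i => ((Real.log (p i) / 2 : ℝ) : ℂ)) * Vᴴ, ?_, ?_⟩
  · rw [Matrix.IsHermitian, Matrix.conjTranspose_mul, Matrix.conjTranspose_mul,
      Matrix.conjTranspose_conjTranspose, Matrix.diagonal_conjTranspose, Matrix.mul_assoc]
    congr 3
    funext i
    simp [Complex.conj_ofReal]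
  · rw [exp_smul_diagonal h1, h]
    congr 3
    funext i
    rw [mul_div_cancel₀ _ (two_ne_zero' ℝ), Real.exp_log (hp i)]

theorem norm_le_of_exp_two_smul {X Y Z : Matrix n n ℂ} (hX : X.IsHermitian) (hY : Y.IsHermitian)
    (hZ : Z.IsHermitian) (h : exp ((2 : ℝ) • Z) = exp X * exp ((2 : ℝ) • Y) * exp X) :
    ‖Z‖ ≤ ‖X‖ + ‖Y‖ := by
  have hn : ∀ {A : Matrix n n ℂ}, A.IsHermitian → ‖exp A‖ ≤ Real.exp ‖A‖ := fun {A} hA => by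
    obtain ⟨V, a, h1, h2, h⟩ := hA.exists_diagonal
    rw [h, exp_conj_diagonal h1, norm_conj_diagonal h1, norm_conj_diagonal h1]
    refine (pi_norm_le_iff_of_nonneg (Real.exp_pos _).le).mpr fun i => ?_
    rw [Complex.norm_real, Real.norm_eq_abs, abs_of_pos (Real.exp_pos _), Real.exp_le_exp]
    refine (le_abs_self _).trans ?_
    have := norm_le_pi_norm (fun i => (a i : ℂ)) i
    simpa using this
  have hprod : ∀ {A B : Matrix n n ℂ}, A.IsHermitian → B.IsHermitian →
      ‖exp A * exp ((2 : ℝ) • B) * exp A‖ ≤ Real.exp (2 * (‖A‖ + ‖B‖)) := fun {A B} hA hB => by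
    have h2B : ((2 : ℝ) • B).IsHermitian := by
      rw [two_smul]; exact hB.add hB
    calc _ ≤ ‖exp A‖ * ‖exp ((2 : ℝ) • B)‖ * ‖exp A‖ :=
          (norm_mul_le _ _).trans (mul_le_mul_of_nonneg_right (norm_mul_le _ _) (norm_nonneg _))
      _ ≤ Real.exp ‖A‖ * Real.exp ‖(2 : ℝ) • B‖ * Real.exp ‖A‖ := by
          gcongr
          · exact hn hA
          · exact hn h2B
          · exact hn hA
      _ = _ := by
          rw [← Real.exp_add, ← Real.exp_add, norm_smul]
          congr 1
          norm_num
          ring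
  have h1 := (congrArg norm h).trans_le (hprod hX hY)
  have h' : exp ((2 : ℝ) • -Z) = exp (-X) * exp ((2 : ℝ) • -Y) * exp (-X) := by
    rw [smul_neg, smul_neg, Matrix.exp_neg, Matrix.exp_neg, Matrix.exp_neg, h,
      Matrix.mul_inv_rev, Matrix.mul_inv_rev, Matrix.mul_assoc]
  have h2 := (congrArg norm h').trans_le (hprod hX.neg hY.neg)
  rw [norm_neg, norm_neg] at h2
  obtain ⟨V, z, k1, k2, k⟩ := hZ.exists_diagonal
  rw [smul_neg, ← neg_smul] at h2
  rw [k, exp_smul_diagonal k1, norm_conj_diagonal k1] at h1 h2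
  rw [k, norm_conj_diagonal k1]
  refine (pi_norm_le_iff_of_nonneg (by positivity)).mpr fun i => ?_
  have e1 := (norm_le_pi_norm (fun i => (Real.exp (2 * z i) : ℂ)) i).trans h1
  have e2 := (norm_le_pi_norm (fun i => (Real.exp (-2 * z i) : ℂ)) i).trans h2
  rw [Complex.norm_real, Real.norm_eq_abs, abs_of_pos (Real.exp_pos _), Real.exp_le_exp] at e1 e2
  rw [Complex.norm_real, Real.norm_eq_abs, abs_le]
  constructor <;> linarith

end HermitianExp

section KempfNess

open NormedSpace
open scoped Matrix.Norms.L2Operator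

theorem trace_mul_conjTranspose_re {m n : Type*} [Fintype m] [Fintype n] (N : Matrix m n ℂ) :
    (N * Nᴴ).trace.re = ∑ i, ∑ j, ‖N i j‖ ^ 2 := by
  simp only [Matrix.trace, Matrix.diag_apply, Matrix.mul_apply, Matrix.conjTranspose_apply,
    Complex.re_sum, RCLike.star_def, Complex.mul_conj, Complex.ofReal_re, Complex.normSq_eq_norm_sq]

variable {V Q : Type} {src tgt : Q → V}
variable {ι : V → Type} [∀ v, Fintype (ι v)] [∀ v, DecidableEq (ι v)]

/-- The action of exponentials on representations. -/
noncomputable def expAct (X : ∀ v, Matrix (ι v) (ι v) ℂ) (x : QRep src tgt ι) : QRep src tgt ι :=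
  fun a => exp (X (tgt a)) * x a * exp (-X (src a))

theorem expAct_mul_conjTranspose_trace {X : ∀ v, Matrix (ι v) (ι v) ℂ}
    (hX : ∀ v, (X v).IsHermitian) (x : QRep src tgt ι) (a : Q) :
    (expAct X x a * (expAct X x a)ᴴ).trace =
      (exp ((2 : ℝ) • X (tgt a)) * (x a * (exp ((2 : ℝ) • -X (src a)) * (x a)ᴴ))).trace := by
  have h2 : ∀ A : Matrix (ι (src a)) (ι (src a)) ℂ, exp ((2 : ℝ) • A) = exp A * exp A := fun A => by
    rw [two_smul, Matrix.exp_add_of_commute _ _ (Commute.refl _)]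
  have h3 : ∀ A : Matrix (ι (tgt a)) (ι (tgt a)) ℂ, exp ((2 : ℝ) • A) = exp A * exp A := fun A => by
    rw [two_smul, Matrix.exp_add_of_commute _ _ (Commute.refl _)]
  simp only [expAct, Matrix.conjTranspose_mul, h2, h3, (hX _).exp.eq, (hX _).neg.exp.eq]
  conv_rhs => rw [Matrix.mul_assoc, Matrix.trace_mul_comm]
  simp only [Matrix.mul_assoc]

variable [Fintype Q]

/-- The sum of the squares of all entries of a representation. -/
noncomputable def repNormSq (x : QRep src tgt ι) : ℝ := ∑ a, (x a * (x a)ᴴ).trace.re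

/-- The entries of a representation in bases adapted to a spectral decomposition. -/
noncomputable def spectralEntry (x : QRep src tgt ι) (W : ∀ v, Matrix (ι v) (ι v) ℂ)
    (j : Σ a, ι (tgt a) × ι (src a)) : ℂ :=
  ((W (tgt j.1))ᴴ * x j.1 * W (src j.1)) j.2.1 j.2.2

theorem repNormSq_expAct_smul {W : ∀ v, Matrix (ι v) (ι v) ℂ} {z : ∀ v, ι v → ℝ}
    (hW : ∀ v, W v * (W v)ᴴ = 1) {Y : ∀ v, Matrix (ι v) (ι v) ℂ}
    (hY : ∀ v, Y v = W v * diagonal (fun i => (z v i : ℂ)) * (W v)ᴴ) (x : QRep src tgt ι) (t : ℝ) :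
    repNormSq (expAct (t • Y) x) = ∑ j, ‖spectralEntry x W j‖ ^ 2 *
      Real.exp (t * (2 * (z _ j.2.1 - z _ j.2.2))) := by
  have hW' : ∀ v, (W v)ᴴ * W v = 1 := fun v => mul_eq_one_comm.mp (hW v)
  rw [repNormSq, Fintype.sum_sigma]
  refine Finset.sum_congr rfl fun a _ => ?_
  rw [Fintype.sum_prod_type]
  have h1 : expAct (t • Y) x a = W (tgt a) * (diagonal (fun i => (Real.exp (t * z (tgt a) i) : ℂ)) *
      ((W (tgt a))ᴴ * x a * W (src a)) * diagonal (fun i => (Real.exp (-t * z (src a) i) : ℂ))) *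
      (W (src a))ᴴ := by
    rw [expAct, Pi.smul_apply, Pi.smul_apply, ← neg_smul, hY, hY, exp_smul_diagonal (hW _),
      exp_smul_diagonal (hW _)]
    simp only [Matrix.mul_assoc]
  obtain ⟨N, hN⟩ : ∃ N, N = diagonal (fun i => (Real.exp (t * z (tgt a) i) : ℂ)) *
      ((W (tgt a))ᴴ * x a * W (src a)) * diagonal (fun i => (Real.exp (-t * z (src a) i) : ℂ)) :=
    ⟨_, rfl⟩
  rw [← hN] at h1
  have h2 : (expAct (t • Y) x a * (expAct (t • Y) x a)ᴴ).trace = (N * Nᴴ).trace := by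
    rw [h1, Matrix.conjTranspose_mul, Matrix.conjTranspose_mul, Matrix.conjTranspose_conjTranspose,
      Matrix.mul_assoc (W (tgt a)), Matrix.mul_assoc (W (tgt a)), Matrix.trace_mul_comm]
    have h3 : N * (W (src a))ᴴ * (W (src a) * (Nᴴ * (W (tgt a))ᴴ)) * W (tgt a) =
        N * (((W (src a))ᴴ * W (src a)) * (Nᴴ * ((W (tgt a))ᴴ * W (tgt a)))) := by
      simp only [Matrix.mul_assoc]
    rw [h3, hW', hW', Matrix.one_mul, Matrix.mul_one]
  rw [h2, trace_mul_conjTranspose_re]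
  refine Finset.sum_congr rfl fun i _ => Finset.sum_congr rfl fun j _ => ?_
  rw [hN, Matrix.mul_diagonal, Matrix.diagonal_mul, spectralEntry, norm_mul, norm_mul,
    Complex.norm_real, Complex.norm_real, Real.norm_eq_abs, Real.norm_eq_abs, Real.abs_exp,
    Real.abs_exp, mul_pow, mul_pow, ← Real.exp_nat_mul, ← Real.exp_nat_mul,
    show t * (2 * (z (tgt a) i - z (src a) j)) =
      (2 : ℕ) * (t * z (tgt a) i) + (2 : ℕ) * (-t * z (src a) j) by push_cast; ring, Real.exp_add]
  ring

theorem trace_conj_diagonal_mul_re {m n : Type*} [Fintype m] [Fintype n] [DecidableEq m]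
    {W : Matrix m m ℂ} {W' : Matrix n n ℂ} [DecidableEq n]
    (hW' : W' * W'ᴴ = 1) (z : m → ℝ) (x : Matrix m n ℂ) :
    ((W * diagonal (fun i => (z i : ℂ)) * Wᴴ) * (x * xᴴ)).trace.re =
      ∑ i, ∑ j, z i * ‖(Wᴴ * x * W') i j‖ ^ 2 := by
  obtain ⟨N, hN⟩ : ∃ N, N = Wᴴ * x * W' := ⟨_, rfl⟩
  have h : ((W * diagonal (fun i => (z i : ℂ)) * Wᴴ) * (x * xᴴ)).trace =
      (diagonal (fun i => (z i : ℂ)) * (N * Nᴴ)).trace := by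
    rw [Matrix.mul_assoc, Matrix.mul_assoc, Matrix.trace_mul_comm, hN]
    have h3 : Wᴴ * x * W' * (Wᴴ * x * W')ᴴ = Wᴴ * x * (W' * W'ᴴ) * (xᴴ * W) := by
      simp only [Matrix.conjTranspose_mul, Matrix.conjTranspose_conjTranspose, Matrix.mul_assoc]
    rw [h3, hW', Matrix.mul_one]
    simp only [Matrix.mul_assoc]
  rw [h, ← hN]
  rw [Matrix.trace, Complex.re_sum]
  refine Finset.sum_congr rfl fun i _ => ?_
  rw [Matrix.diag_apply, Matrix.diagonal_mul, Complex.re_ofReal_mul, Matrix.mul_apply,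
    Complex.re_sum, Finset.mul_sum]
  simp only [Matrix.conjTranspose_apply, RCLike.star_def, Complex.mul_conj, Complex.ofReal_re,
    Complex.normSq_eq_norm_sq]

theorem momentPairing_eq_sum {W : ∀ v, Matrix (ι v) (ι v) ℂ}
    {z : ∀ v, ι v → ℝ}
    (hW : ∀ v, W v * (W v)ᴴ = 1) {Y : ∀ v, Matrix (ι v) (ι v) ℂ}
    (hY : ∀ v, Y v = W v * diagonal (fun i => (z v i : ℂ)) * (W v)ᴴ) (x : QRep src tgt ι) :
    momentPairing x Y = ∑ j, ‖spectralEntry x W j‖ ^ 2 * (z _ j.2.1 - z _ j.2.2) := by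
  rw [momentPairing, Fintype.sum_sigma]
  refine Finset.sum_congr rfl fun a _ => ?_
  have h1 := trace_conj_diagonal_mul_re (W := W (tgt a)) (hW (src a)) (z (tgt a)) (x a)
  have h2 := trace_conj_diagonal_mul_re (W := W (src a)) (hW (tgt a)) (z (src a)) (x a)ᴴ
  rw [Matrix.conjTranspose_conjTranspose, Finset.sum_comm] at h2
  rw [Fintype.sum_prod_type, Complex.sub_re, hY, hY, h1, h2, ← Finset.sum_sub_distrib]
  refine Finset.sum_congr rfl fun i _ => ?_
  rw [← Finset.sum_sub_distrib]
  refine Finset.sum_congr rfl fun j _ => ?_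
  have h3 : ((W (src a))ᴴ * (x a)ᴴ * W (tgt a)) = ((W (tgt a))ᴴ * x a * W (src a))ᴴ := by
    simp only [Matrix.conjTranspose_mul, Matrix.conjTranspose_conjTranspose, Matrix.mul_assoc]
  rw [h3, Matrix.conjTranspose_apply, norm_star, spectralEntry]
  ring

end KempfNess

section KempfNess

open NormedSpace
open scoped Matrix.Norms.L2Operator

variable {V Q : Type} {src tgt : Q → V} [Fintype V] [Fintype Q]
variable {ι : V → Type} [∀ v, Fintype (ι v)] [∀ v, DecidableEq (ι v)]

theorem exp_two_smul_neg {n : Type} [Fintype n] [DecidableEq n] {X Y Z : Matrix n n ℂ}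
    (h : exp ((2 : ℝ) • Z) = exp X * exp ((2 : ℝ) • Y) * exp X) :
    exp ((2 : ℝ) • -Z) = exp (-X) * exp ((2 : ℝ) • -Y) * exp (-X) := by
  rw [smul_neg, smul_neg, Matrix.exp_neg, Matrix.exp_neg, Matrix.exp_neg, h,
    Matrix.mul_inv_rev, Matrix.mul_inv_rev, Matrix.mul_assoc]

omit [Fintype V] in
theorem repNormSq_expAct_eq {X Y Z : ∀ v, Matrix (ι v) (ι v) ℂ} (hX : ∀ v, (X v).IsHermitian)
    (hY : ∀ v, (Y v).IsHermitian) (hZ : ∀ v, (Z v).IsHermitian)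
    (h : ∀ v, exp ((2 : ℝ) • Z v) = exp (X v) * exp ((2 : ℝ) • Y v) * exp (X v))
    (x : QRep src tgt ι) : repNormSq (expAct Z x) = repNormSq (expAct Y (expAct X x)) := by
  refine Finset.sum_congr rfl fun a _ => ?_
  rw [expAct_mul_conjTranspose_trace hZ, expAct_mul_conjTranspose_trace hY, h,
    exp_two_smul_neg (h _), expAct]
  simp only [Matrix.conjTranspose_mul, (hX _).exp.eq, (hX _).neg.exp.eq]
  congr 1
  conv_lhs => rw [Matrix.mul_assoc, Matrix.mul_assoc, Matrix.trace_mul_comm]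
  simp only [Matrix.mul_assoc]

theorem trace_re_of_exp_two_smul {n : Type} [Fintype n] [DecidableEq n] {X Y Z : Matrix n n ℂ}
    (hX : X.IsHermitian) (hY : Y.IsHermitian) (hZ : Z.IsHermitian)
    (h : exp ((2 : ℝ) • Z) = exp X * exp ((2 : ℝ) • Y) * exp X) :
    Z.trace.re = X.trace.re + Y.trace.re := by
  have h2 : ∀ {A : Matrix n n ℂ}, A.IsHermitian → ((2 : ℝ) • A).IsHermitian := fun {A} hA => by
    rw [two_smul]; exact hA.add hA
  have h3 := congrArg Matrix.det h
  rw [Matrix.det_mul, Matrix.det_mul, (h2 hZ).det_normedSpaceExp, (h2 hY).det_normedSpaceExp,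
    hX.det_normedSpaceExp] at h3
  norm_cast at h3
  rw [← Real.exp_add, ← Real.exp_add] at h3
  have h4 := Real.exp_injective h3
  simp only [two_smul, Matrix.trace_add, Complex.add_re] at h4
  linarith

/-- Existence of solutions of the moment map equation for semistable points
(the theorem of Kempf and Ness, relative to a Cartan subspace `𝔰`). -/
theorem exists_mem_forall_momentPairing_eq (𝔰 : Submodule ℝ (∀ v, Matrix (ι v) (ι v) ℂ))
    (hH : ∀ X ∈ 𝔰, ∀ v, (X v).IsHermitian)
    (hC : ∀ X ∈ 𝔰, ∀ Y ∈ 𝔰, ∀ Z : ∀ v, Matrix (ι v) (ι v) ℂ, (∀ v, (Z v).IsHermitian) →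
      (∀ v, exp ((2 : ℝ) • Z v) = exp (X v) * exp ((2 : ℝ) • Y v) * exp (X v)) → Z ∈ 𝔰)
    (ℓ : V → ℝ) (hℓ : (fun v => (ℓ v : ℂ) • (1 : Matrix (ι v) (ι v) ℂ)) ∈ 𝔰)
    (hℓ' : ∀ a, 1 ≤ ℓ (tgt a) - ℓ (src a)) (x : QRep src tgt ι) (σ : V → ℝ)
    (hss : ∀ (W : ∀ v, Matrix (ι v) (ι v) ℂ) (z : ∀ v, ι v → ℝ), (∀ v, W v * (W v)ᴴ = 1) →
      (fun v => W v * diagonal (fun i => (z v i : ℂ)) * (W v)ᴴ) ∈ 𝔰 →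
      (∀ j, spectralEntry x W j ≠ 0 → z _ j.2.1 ≤ z _ j.2.2) → ∑ v, σ v * ∑ i, z v i ≤ 0)
    {C : Set (QRep src tgt ι)} (hCl : IsClosed C) (hCx : ∀ X ∈ 𝔰, expAct X x ∈ C) :
    ∃ x' ∈ C, ∀ Y ∈ 𝔰, momentPairing x' Y = ∑ v, σ v * (Y v).trace.re := by
  have hspec : ∀ Y : 𝔰, ∃ (W : ∀ v, Matrix (ι v) (ι v) ℂ) (z : ∀ v, ι v → ℝ),
      (∀ v, W v * (W v)ᴴ = 1) ∧
        ∀ v, Y.1 v = W v * diagonal (fun i => (z v i : ℂ)) * (W v)ᴴ := fun Y => by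
    choose W z h1 h2 h3 using fun v => (hH _ Y.2 v).exists_diagonal
    exact ⟨W, z, h1, h3⟩
  choose W z hW hY using hspec
  let ell : 𝔰 →ₗ[ℝ] ℝ :=
    { toFun := fun Y => ∑ v, σ v * (Y.1 v).trace.re
      map_add' := fun Y Z => by
        simp [mul_add, Finset.sum_add_distrib]
      map_smul' := fun t Y => by
        simp only [Submodule.coe_smul, Pi.smul_apply, Matrix.trace_smul, Complex.real_smul,
          Complex.re_ofReal_mul, RingHom.id_apply, smul_eq_mul, Finset.mul_sum]
        exact Finset.sum_congr rfl fun v _ => by ring }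
  have hN : Continuous fun X : 𝔰 => repNormSq (expAct X.1 x) := by
    have he : ∀ v, Continuous fun A : Matrix (ι v) (ι v) ℂ => exp A := fun v => by
      let _ : NormedAlgebra ℚ (Matrix (ι v) (ι v) ℂ) := NormedAlgebra.restrictScalars ℚ ℂ _
      exact exp_continuous
    have h1 : ∀ v, Continuous fun X : 𝔰 => exp (X.1 v) := fun v =>
      (he v).comp ((continuous_apply v).comp continuous_subtype_val)
    have h2 : ∀ v, Continuous fun X : 𝔰 => exp (-X.1 v) := fun v =>
      (he v).comp ((continuous_apply v).comp continuous_subtype_val).neg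
    refine continuous_finsetSum _ fun a _ => Complex.continuous_re.comp ?_
    have h3 : Continuous fun X : 𝔰 => expAct X.1 x a :=
      ((h1 (tgt a)).matrix_mul continuous_const).matrix_mul (h2 (src a))
    exact (h3.matrix_mul h3.matrix_conjTranspose).matrix_trace
  have hmp : ∀ (Y : 𝔰) (y : QRep src tgt ι), momentPairing y Y.1 =
      ∑ j, ‖spectralEntry y (W Y) j‖ ^ 2 * (z Y _ j.2.1 - z Y _ j.2.2) := fun Y y =>
    momentPairing_eq_sum (hW Y) (hY Y) y
  have key : ∀ ε : ℝ, 0 < ε → ∃ X : 𝔰, ∀ Y : 𝔰,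
      |momentPairing (expAct X.1 x) Y.1 - ell Y| ≤ ε * ‖Y‖ := fun ε hε => by
    refine exists_approx_critical hN ell (fun Y j => ‖spectralEntry x (W Y) j‖ ^ 2)
      (fun Y j => 2 * (z Y _ j.2.1 - z Y _ j.2.2)) (fun _ _ => by positivity) (fun Y t => ?_)
      (fun Y hYj => ?_) (fun X Y t => repNormSq (expAct (t • Y.1) (expAct X.1 x)))
      (fun X Y => momentPairing (expAct X.1 x) Y.1) (fun X Y => ?_) (fun X Y => ?_)
      (fun X Y t => ?_) hε
    · exact repNormSq_expAct_smul (hW Y) (hY Y) x t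
    · have h1 := hss (W Y) (z Y) (hW Y) (by rw [← funext (hY Y)]; exact Y.2) fun j hj => by
        have := hYj j (by positivity)
        linarith
      refine le_trans (le_of_eq ?_) h1
      refine Finset.sum_congr rfl fun v _ => ?_
      have hW' : (W Y v)ᴴ * W Y v = 1 := mul_eq_one_comm.mp (hW Y v)
      rw [hY Y v, Matrix.trace_mul_comm, ← Matrix.mul_assoc, hW', Matrix.one_mul,
        Matrix.trace_diagonal, Complex.re_sum]
      simp
    · rw [repNormSq_expAct_smul (hW Y) (hY Y)]
      simp only [zero_mul, Real.exp_zero, mul_one]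
      have h0 := repNormSq_expAct_smul (hW Y) (hY Y) (expAct X.1 x) 0
      simp only [zero_mul, Real.exp_zero, mul_one] at h0
      rw [← h0]
      congr 1
      rw [zero_smul]
      funext a
      simp [expAct]
    · refine HasDerivAt.congr_deriv (f' := ∑ j, 2 * (‖spectralEntry (expAct X.1 x) (W Y) j‖ ^ 2 *
        (z Y _ j.2.1 - z Y _ j.2.2))) ?_ (by rw [hmp, Finset.mul_sum])
      refine HasDerivAt.congr_of_eventuallyEq ?_
        (Filter.Eventually.of_forall fun t => repNormSq_expAct_smul (hW Y) (hY Y) (expAct X.1 x) t)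
      refine HasDerivAt.fun_sum fun j _ => ?_
      have h1 := (((hasDerivAt_id (0 : ℝ)).mul_const
        (2 * (z Y _ j.2.1 - z Y _ j.2.2))).exp).const_mul
          (‖spectralEntry (expAct X.1 x) (W Y) j‖ ^ 2)
      exact h1.congr_deriv (by rw [id, zero_mul, Real.exp_zero]; ring)
    · have hYt := (t • Y).2
      choose Z hZ hZe using fun v => exists_exp_two_smul (hH _ X.2 v) (hH _ hYt v)
      refine ⟨⟨Z, hC _ X.2 _ hYt Z hZ hZe⟩, ?_, ?_, ?_⟩
      · refine (pi_norm_le_iff_of_nonneg (by positivity)).mpr fun v => ?_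
        have h1 := norm_le_of_exp_two_smul (hH _ X.2 v) (hH _ hYt v) (hZ v) (hZe v)
        have h2 : ‖X.1 v‖ ≤ ‖X‖ := norm_le_pi_norm X.1 v
        have h3 : ‖(t • Y).1 v‖ ≤ ‖t • Y‖ := norm_le_pi_norm (t • Y).1 v
        rw [norm_smul, Real.norm_eq_abs] at h3
        exact h1.trans (add_le_add h2 h3)
      · rw [← smul_eq_mul, ← map_smul]
        simp only [ell, LinearMap.coe_mk, AddHom.coe_mk, ← Finset.sum_add_distrib, ← mul_add]
        refine Finset.sum_congr rfl fun v _ => ?_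
        rw [trace_re_of_exp_two_smul (hH _ X.2 v) (hH _ hYt v) (hZ v) (hZe v)]
      · exact repNormSq_expAct_eq (hH _ X.2) (hH _ hYt) hZ hZe x
  let Y₀ : 𝔰 := ⟨_, hℓ⟩
  obtain ⟨R, hR⟩ : ∃ R, R = ell Y₀ + ‖Y₀‖ := ⟨_, rfl⟩
  have hbound : ∀ y : QRep src tgt ι, momentPairing y Y₀.1 ≤ R → ∀ a i j, ‖y a i j‖ ^ 2 ≤ R := by
    intro y hy a i j
    have h1 : ∀ b, (y b * (y b)ᴴ).trace.re ≤
        ((Y₀.1 (tgt b) * (y b * (y b)ᴴ)).trace - (Y₀.1 (src b) * ((y b)ᴴ * y b)).trace).re := by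
      intro b
      simp only [Y₀, Matrix.smul_mul, Matrix.one_mul, Matrix.trace_smul]
      rw [Matrix.trace_mul_comm (y b)ᴴ, ← sub_smul, smul_eq_mul, ← Complex.ofReal_sub,
        Complex.re_ofReal_mul]
      exact le_mul_of_one_le_left (trace_self_conjTranspose_re_nonneg _) (hℓ' b)
    have h2 : (y a * (y a)ᴴ).trace.re ≤ R := by
      refine le_trans ?_ ((Finset.sum_le_sum fun b _ => h1 b).trans hy)
      exact Finset.single_le_sum (f := fun b => (y b * (y b)ᴴ).trace.re)
        (fun b _ => trace_self_conjTranspose_re_nonneg _) (Finset.mem_univ a)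
    rw [trace_mul_conjTranspose_re] at h2
    refine le_trans ?_ h2
    refine le_trans ?_ (Finset.single_le_sum (f := fun i => ∑ j, ‖y a i j‖ ^ 2)
      (fun _ _ => by positivity) (Finset.mem_univ i))
    exact Finset.single_le_sum (f := fun j => ‖y a i j‖ ^ 2)
      (fun _ _ => by positivity) (Finset.mem_univ j)
  let K : Set (QRep src tgt ι) := Set.univ.pi fun a => Set.univ.pi fun i => Set.univ.pi fun j =>
    Metric.closedBall (0 : ℂ) (Real.sqrt R)
  have hK : IsCompact K := isCompact_univ_pi fun a => isCompact_univ_pi fun i =>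
    isCompact_univ_pi fun j => isCompact_closedBall _ _
  have hcont : ∀ Y : 𝔰, Continuous fun y : QRep src tgt ι => momentPairing y Y.1 := fun Y => by
    unfold momentPairing
    refine continuous_finsetSum _ fun a _ => Complex.continuous_re.comp ?_
    have h3 : Continuous fun y : QRep src tgt ι => y a := continuous_apply a
    exact (continuous_const.matrix_mul (h3.matrix_mul h3.matrix_conjTranspose)).matrix_trace.sub
      (continuous_const.matrix_mul (h3.matrix_conjTranspose.matrix_mul h3)).matrix_trace
  let T : ℕ → Set (QRep src tgt ι) := fun n =>
    K ∩ C ∩ ⋂ Y : 𝔰, {y | |momentPairing y Y.1 - ell Y| ≤ 1 / ((n : ℝ) + 1) * ‖Y‖}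
  have hTc : ∀ n, IsClosed (T n) := fun n => (hK.isClosed.inter hCl).inter
    (isClosed_iInter fun Y => isClosed_le ((hcont Y).sub continuous_const).abs continuous_const)
  obtain ⟨y, hy⟩ := IsCompact.nonempty_iInter_of_sequence_nonempty_isCompact_isClosed T
    (fun n y hy => ⟨hy.1, Set.mem_iInter.mpr fun Y => le_trans (Set.mem_iInter.mp hy.2 Y) (by
      change 1 / (((n + 1 : ℕ) : ℝ) + 1) * ‖Y‖ ≤ 1 / ((n : ℝ) + 1) * ‖Y‖
      refine mul_le_mul_of_nonneg_right ?_ (norm_nonneg _)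
      refine one_div_le_one_div_of_le (by positivity) ?_
      push_cast
      linarith)⟩)
    (fun n => by
      obtain ⟨X, hX⟩ := key (1 / ((n : ℝ) + 1)) (by positivity)
      refine ⟨expAct X.1 x, ⟨?_, hCx _ X.2⟩, Set.mem_iInter.mpr hX⟩
      have h1 := (abs_le.mp (hX Y₀)).2
      have h2 : 1 / ((n : ℝ) + 1) * ‖Y₀‖ ≤ ‖Y₀‖ := by
        refine mul_le_of_le_one_left (norm_nonneg _) ?_
        rw [div_le_one (by positivity)]
        linarith [Nat.cast_nonneg (α := ℝ) n]
      intro a _ i _ j _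
      rw [mem_closedBall_zero_iff]
      exact Real.le_sqrt_of_sq_le (hbound _ (by rw [hR]; linarith) a i j))
    ((hK.inter_right hCl).inter_right (isClosed_iInter fun Y =>
      isClosed_le ((hcont Y).sub continuous_const).abs continuous_const)) hTc
  refine ⟨y, (Set.mem_iInter.mp hy 0).1.2, fun Y hYs => ?_⟩
  have h1 : ∀ n : ℕ, |momentPairing y Y - ell ⟨Y, hYs⟩| ≤
      1 / ((n : ℝ) + 1) * ‖(⟨Y, hYs⟩ : 𝔰)‖ := fun n =>
    Set.mem_iInter.mp (Set.mem_iInter.mp hy n).2 ⟨Y, hYs⟩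
  have h2 : Filter.Tendsto (fun n : ℕ => 1 / ((n : ℝ) + 1) * ‖(⟨Y, hYs⟩ : 𝔰)‖) Filter.atTop
      (nhds 0) := by
    simpa using (tendsto_one_div_add_atTop_nhds_zero_nat (𝕜 := ℝ)).mul_const ‖(⟨Y, hYs⟩ : 𝔰)‖
  have h3 := ge_of_tendsto' h2 h1
  exact sub_eq_zero.mp (abs_eq_zero.mp (le_antisymm h3 (abs_nonneg _)))

end KempfNess

section King

/-- Summation by parts. -/
theorem sum_mul_sub_nonpos_of_partial_sums {I : Type*} (l w : I → ℝ) (s : Finset I) :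
    ∀ R : ℝ, (∀ i ∈ s, l i ≤ R) → (∀ c < R, 0 ≤ ∑ i ∈ s with l i ≤ c, w i) →
      ∑ i ∈ s, w i * (l i - R) ≤ 0 := by
  classical
  induction s using Finset.induction_on_max_value l with
  | empty => simp
  | insert a s ha hmax ih =>
    intro R hR hc
    have h1 := ih (l a) hmax fun c hca => by
      have := hc c (hca.trans_le (hR a (Finset.mem_insert_self _ _)))
      rwa [Finset.filter_insert, if_neg (not_le.mpr hca)] at this
    have h2 : (∑ i ∈ insert a s, w i) * (l a - R) ≤ 0 := by
      rcases (hR a (Finset.mem_insert_self _ _)).lt_or_eq with h | h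
      · refine mul_nonpos_of_nonneg_of_nonpos ?_ (sub_nonpos.mpr h.le)
        have := hc _ h
        rwa [Finset.filter_true_of_mem fun i hi => (by
          rcases Finset.mem_insert.mp hi with rfl | hi
          · exact le_rfl
          · exact hmax i hi)] at this
      · rw [h, sub_self, mul_zero]
    have h3 : ∑ i ∈ insert a s, w i * (l i - R) =
        ∑ i ∈ s, w i * (l i - l a) + (∑ i ∈ insert a s, w i) * (l a - R) := by
      rw [Finset.sum_mul, Finset.sum_insert ha, Finset.sum_insert ha, add_left_comm,
        ← Finset.sum_add_distrib]
      congr 1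
      exact Finset.sum_congr rfl fun i _ => by ring
    rw [h3]
    exact add_nonpos h1 h2

theorem sum_mul_nonpos_of_partial_sums {I : Type*} [Fintype I] (l w : I → ℝ) (hw : ∑ i, w i = 0)
    (h : ∀ c, 0 ≤ ∑ i with l i ≤ c, w i) : ∑ i, w i * l i ≤ 0 := by
  obtain ⟨R, hR⟩ : ∃ R, ∀ i, l i ≤ R :=
    ⟨∑ i, |l i|, fun i => (le_abs_self _).trans
      (Finset.single_le_sum (f := fun i => |l i|) (fun _ _ => abs_nonneg _) (Finset.mem_univ i))⟩
  have h1 := sum_mul_sub_nonpos_of_partial_sums l w Finset.univ R (fun i _ => hR i) fun c _ => h c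
  simpa [mul_sub, Finset.sum_sub_distrib, ← Finset.sum_mul, hw] using h1

/-- The span of the columns of the unitary matrix `W` whose index satisfies `P`. -/
def specSub {n : Type*} [Fintype n] (W : Matrix n n ℂ) (P : n → Prop) : Submodule ℂ (n → ℂ) where
  carrier := {u | ∀ i, ¬ P i → (Wᴴ *ᵥ u) i = 0}
  add_mem' := fun {u v} hu hv i hi => by
    rw [Matrix.mulVec_add, Pi.add_apply, hu i hi, hv i hi, add_zero]
  zero_mem' := fun i _ => by rw [Matrix.mulVec_zero, Pi.zero_apply]
  smul_mem' := fun c u hu i hi => by rw [Matrix.mulVec_smul, Pi.smul_apply, hu i hi, smul_zero]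

theorem finrank_specSub {n : Type*} [Fintype n] [DecidableEq n] {W : Matrix n n ℂ}
    (hW : W * Wᴴ = 1) (P : n → Prop) [DecidablePred P] :
    Module.finrank ℂ (specSub W P) = (Finset.univ.filter P).card := by
  have hW' : Wᴴ * W = 1 := mul_eq_one_comm.mp hW
  let e : (n → ℂ) ≃ₗ[ℂ] (n → ℂ) := LinearEquiv.ofLinearMap (Matrix.mulVecLin Wᴴ)
    (Matrix.mulVecLin W) (by rw [← Matrix.mulVecLin_mul, hW', Matrix.mulVecLin_one])
    (by rw [← Matrix.mulVecLin_mul, hW, Matrix.mulVecLin_one])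
  have h1 : specSub W P = (⨅ i ∈ {i | ¬ P i},
      LinearMap.ker (LinearMap.proj i : (n → ℂ) →ₗ[ℂ] ℂ)).comap e.toLinearMap := by
    ext u
    simp only [Submodule.mem_comap, Submodule.mem_iInf, LinearMap.mem_ker, LinearMap.proj_apply]
    rfl
  rw [h1, LinearEquiv.finrank_eq (LinearEquiv.ofSubmodule' e _), LinearEquiv.finrank_eq
    (LinearMap.iInfKerProjEquiv ℂ (fun _ => ℂ) (I := {i | P i}) (J := {i | ¬ P i})
      (Set.disjoint_left.mpr fun i hi hi' => hi' hi) (fun i _ => em (P i))),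
    Module.finrank_fintype_fun_eq_card]
  exact Fintype.card_subtype P

variable {V Q : Type} {src tgt : Q → V}
variable {ι : V → Type} [∀ v, Fintype (ι v)] [∀ v, DecidableEq (ι v)]

theorem isSub_specSub {x : QRep src tgt ι} {W : ∀ v, Matrix (ι v) (ι v) ℂ} {z : ∀ v, ι v → ℝ}
    (hW : ∀ v, W v * (W v)ᴴ = 1)
    (hx : ∀ j, spectralEntry x W j ≠ 0 → z _ j.2.1 ≤ z _ j.2.2) {P : ℝ → Prop}
    (hP : ∀ a b, a ≤ b → P b → P a) : IsSub x fun v => specSub (W v) fun i => P (z v i) := by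
  intro a u hu i hi
  have h1 : (W (tgt a))ᴴ *ᵥ (x a *ᵥ u) = ((W (tgt a))ᴴ * x a * W (src a)) *ᵥ ((W (src a))ᴴ *ᵥ u) := by
    rw [Matrix.mulVec_mulVec, Matrix.mulVec_mulVec, Matrix.mul_assoc (_ * _), hW, Matrix.mul_one]
  rw [h1, Matrix.mulVec, dotProduct]
  refine Finset.sum_eq_zero fun j _ => ?_
  by_cases hj : P (z _ j)
  · have : spectralEntry x W ⟨a, i, j⟩ = 0 := by
      by_contra h
      exact hi (hP _ _ (hx _ h) hj)
    rw [show ((W (tgt a))ᴴ * x a * W (src a)) i j = 0 from this, zero_mul]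
  · rw [hu j hj, mul_zero]

variable [Fintype V] [Fintype Q]

/-- A semistable representation degenerates to a solution of the moment map equation. -/
theorem exists_isMoment (ℓ : V → ℝ) (hℓ : ∀ a : Q, 1 ≤ ℓ (tgt a) - ℓ (src a))
    (x : QRep src tgt ι) (σ : V → ℝ) (h0 : ∑ v, σ v * Fintype.card (ι v) = 0)
    (h : ∀ S, IsSub x S → 0 ≤ ∑ v, σ v * Module.finrank ℂ (S v)) :
    ∃ x' : QRep src tgt ι, IsMoment x' σ := by
  let 𝔰 : Submodule ℝ (∀ v, Matrix (ι v) (ι v) ℂ) :=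
    { carrier := {X | ∀ v, (X v).IsHermitian}
      add_mem' := fun hX hY v => (hX v).add (hY v)
      zero_mem' := fun v => Matrix.isHermitian_zero
      smul_mem' := fun c X hX v => by
        change (c • X v)ᴴ = c • X v
        rw [Matrix.conjTranspose_smul, (hX v).eq, star_trivial] }
  obtain ⟨x', -, hx'⟩ := exists_mem_forall_momentPairing_eq 𝔰 (fun X hX => hX)
    (fun X _ Y _ Z hZ _ => hZ) ℓ (fun v => by
      change ((ℓ v : ℂ) • (1 : Matrix (ι v) (ι v) ℂ))ᴴ = _
      rw [Matrix.conjTranspose_smul, Matrix.conjTranspose_one]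
      simp) hℓ x σ (fun W z hW _ hj => by
      have h1 := sum_mul_nonpos_of_partial_sums (I := Σ v, ι v) (fun i => z i.1 i.2)
        (fun i => σ i.1) (by rw [Fintype.sum_sigma]; simpa [mul_comm] using h0) (fun c => by
          have h2 := h _ (isSub_specSub hW hj (P := fun y => y ≤ c) fun a b hab hb => hab.trans hb)
          refine h2.trans_eq ?_
          rw [Finset.sum_filter, Fintype.sum_sigma]
          refine Finset.sum_congr rfl fun v _ => ?_
          rw [finrank_specSub (hW v), ← Finset.sum_filter]
          change _ = ∑ i with z v i ≤ c, σ v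
          rw [Finset.sum_const, nsmul_eq_mul, mul_comm])
      rw [Fintype.sum_sigma] at h1
      simpa [Finset.mul_sum] using h1) isClosed_univ (fun _ _ => Set.mem_univ _)
  exact ⟨x', fun Y hY => hx' Y hY⟩

end King

section HarderNarasimhan

theorem exists_complementary_frames {m : Type} [Fintype m] [DecidableEq m] {d e : ℕ}
    (S : Submodule ℂ (m → ℂ)) (hS : Module.finrank ℂ S = d) (hm : Fintype.card m = d + e) :
    ∃ (U : Matrix m (Fin d) ℂ) (U' : Matrix m (Fin e) ℂ), Uᴴ * U = 1 ∧ U'ᴴ * U' = 1 ∧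
      U'ᴴ * U = 0 ∧ U * Uᴴ + U' * U'ᴴ = 1 ∧ (∀ w, U *ᵥ w ∈ S) := by
  obtain ⟨U, hU, hUS, hSU⟩ := exists_frame S hS
  have hinj : Function.Injective U.mulVecLin := fun v w h => by
    have := congrArg (Uᴴ *ᵥ ·) h
    simpa [Matrix.mulVec_mulVec, hU] using this
  have hsurj : Function.Surjective Uᴴ.mulVecLin := fun v => ⟨U *ᵥ v, by
    simp [Matrix.mulVec_mulVec, hU]⟩
  have hker : Module.finrank ℂ (LinearMap.ker Uᴴ.mulVecLin) = e := by
    have := LinearMap.finrank_range_add_finrank_ker Uᴴ.mulVecLin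
    rw [LinearMap.range_eq_top.mpr hsurj, finrank_top] at this
    simp only [Module.finrank_fintype_fun_eq_card, Fintype.card_fin] at this
    omega
  obtain ⟨U', hU', hU'S, hSU'⟩ := exists_frame _ hker
  have h0 : Uᴴ * U' = 0 := by
    refine Matrix.ext_of_mulVec_single fun i => ?_
    have := hU'S (Pi.single i 1)
    rw [LinearMap.mem_ker, Matrix.mulVecLin_apply, Matrix.mulVec_mulVec] at this
    rw [this, Matrix.zero_mulVec]
  have h0' : U'ᴴ * U = 0 := by
    rw [← Matrix.conjTranspose_conjTranspose U, ← Matrix.conjTranspose_mul, h0,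
      Matrix.conjTranspose_zero]
  refine ⟨U, U', hU, hU', h0', ?_, hUS⟩
  refine Matrix.ext_of_mulVec_single fun i => ?_
  obtain ⟨u, hu⟩ : ∃ u : m → ℂ, u = Pi.single i 1 := ⟨_, rfl⟩
  rw [← hu]
  have h1 := hSU' (u - U *ᵥ (Uᴴ *ᵥ u)) (by
    rw [LinearMap.mem_ker, Matrix.mulVecLin_apply, Matrix.mulVec_sub, Matrix.mulVec_mulVec (M := Uᴴ),
      hU, Matrix.one_mulVec, sub_self])
  rw [Matrix.mulVec_sub U'ᴴ, Matrix.mulVec_mulVec (M := U'ᴴ), h0', Matrix.zero_mulVec, sub_zero] at h1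
  rw [Matrix.add_mulVec, ← Matrix.mulVec_mulVec, ← Matrix.mulVec_mulVec, h1, Matrix.one_mulVec]
  abel

variable {V Q : Type} [Fintype V] [Fintype Q] [DecidableEq V] (src tgt : Q → V)

/-- The weight `⟨·, γ⟩`, for the Euler form of the quiver. -/
noncomputable def eulerWeight (γ : V → ℕ) (v : V) : ℝ :=
  γ v - ∑ a, if src a = v then (γ (tgt a) : ℝ) else 0

theorem sum_eulerWeight_mul (δ γ : V → ℕ) :
    ∑ v, eulerWeight src tgt γ v * δ v = euler src tgt δ γ := by
  simp only [eulerWeight, sub_mul, Finset.sum_sub_distrib, euler, Finset.sum_mul]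
  rw [Finset.sum_comm]
  simp [mul_comm]

variable {src tgt} {κ : V → Type} [∀ v, Fintype (κ v)]

omit [DecidableEq V] [Fintype Q] in
/-- A subrepresentation of minimal weight, and of minimal dimension among those, has no nonzero
morphism to the corresponding quotient. -/
theorem dmap_injective_of_minimal {x : QRep src tgt κ} (σ : V → ℝ) {δ γ : V → ℕ}
    {U : ∀ v, Matrix (κ v) (Fin (δ v)) ℂ} {U' : ∀ v, Matrix (κ v) (Fin (γ v)) ℂ}
    (hU : ∀ v, (U v)ᴴ * U v = 1) (hU' : ∀ v, (U' v)ᴴ * U' v = 1)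
    (hκ : ∀ v, Fintype.card (κ v) = δ v + γ v)
    {xT : QRep src tgt fun v => Fin (δ v)} {y : QRep src tgt fun v => Fin (γ v)}
    (hxT : ∀ a, x a * U (src a) = U (tgt a) * xT a)
    (hy : ∀ a, (U' (tgt a))ᴴ * x a = y a * (U' (src a))ᴴ)
    (hmin : ∀ S, IsSub x S → ∑ v, σ v * δ v ≤ ∑ v, σ v * Module.finrank ℂ (S v))
    (hmin' : ∀ S, IsSub x S → ∑ v, σ v * Module.finrank ℂ (S v) = ∑ v, σ v * δ v →
      ∑ v, δ v ≤ ∑ v, Module.finrank ℂ (S v)) :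
    Function.Injective (dmap xT y) := by
  rw [← LinearMap.ker_eq_bot, Submodule.eq_bot_iff]
  intro φ hφ
  have hφ' := isHom_mulVecLin_of_dmap_eq_zero (LinearMap.mem_ker.mp hφ)
  have hinj : ∀ v, Function.Injective (U v).mulVecLin := fun v u w h => by
    have := congrArg ((U v)ᴴ *ᵥ ·) h
    simpa [Matrix.mulVec_mulVec, hU] using this
  have hsurj : ∀ v, Function.Surjective (U' v)ᴴ.mulVecLin := fun v u => ⟨U' v *ᵥ u, by
    simp [Matrix.mulVec_mulVec, hU']⟩
  have hUx : IsHom xT x fun v => (U v).mulVecLin := fun a u => by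
    simp only [Matrix.mulVecLin_apply, Matrix.mulVec_mulVec, hxT]
  have hUy : IsHom x y fun v => (U' v)ᴴ.mulVecLin := fun a u => by
    simp only [Matrix.mulVecLin_apply, Matrix.mulVec_mulVec, hy]
  obtain ⟨r, hr⟩ : ∃ r : V → ℕ, r = fun v => Module.finrank ℂ (LinearMap.range (φ v).mulVecLin) :=
    ⟨_, rfl⟩
  have hbot : IsSub y fun v => (⊥ : Submodule ℂ (Fin (γ v) → ℂ)) := fun a u hu => by
    rw [Submodule.mem_bot] at hu ⊢
    rw [hu, Matrix.mulVec_zero]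
  have htop : IsSub xT fun v => (⊤ : Submodule ℂ (Fin (δ v) → ℂ)) := fun a u hu => trivial
  have hN := (hbot.comap hφ').map hUx
  have hI := (htop.map hφ').comap hUy
  have hNd : ∀ v, ((Module.finrank ℂ (((⊥ : Submodule ℂ (Fin (γ v) → ℂ)).comap
      (φ v).mulVecLin).map (U v).mulVecLin) : ℕ) : ℝ) = δ v - r v := fun v => by
    rw [← (Submodule.equivMapOfInjective _ (hinj v) _).finrank_eq]
    have := LinearMap.finrank_range_add_finrank_ker (φ v).mulVecLin
    rw [Module.finrank_fintype_fun_eq_card, Fintype.card_fin] at this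
    have h' : (r v : ℝ) + Module.finrank ℂ (LinearMap.ker (φ v).mulVecLin) = δ v := by
      rw [hr]; exact_mod_cast this
    change (Module.finrank ℂ (LinearMap.ker (φ v).mulVecLin) : ℝ) = _
    linarith
  have hId : ∀ v, ((Module.finrank ℂ (((⊤ : Submodule ℂ (Fin (δ v) → ℂ)).map
      (φ v).mulVecLin).comap (U' v)ᴴ.mulVecLin) : ℕ) : ℝ) = δ v + r v := fun v => by
    have h1 := LinearMap.finrank_range_add_finrank_ker
      ((((⊤ : Submodule ℂ (Fin (δ v) → ℂ)).map (φ v).mulVecLin).mkQ) ∘ₗ (U' v)ᴴ.mulVecLin)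
    have hs : Function.Surjective
        ((((⊤ : Submodule ℂ (Fin (δ v) → ℂ)).map (φ v).mulVecLin).mkQ) ∘ₗ
          (U' v)ᴴ.mulVecLin) := by
      rw [LinearMap.coe_comp]
      exact (Submodule.mkQ_surjective _).comp (hsurj v)
    rw [LinearMap.range_eq_top.mpr hs, finrank_top,
      LinearMap.ker_comp, Submodule.ker_mkQ, Module.finrank_fintype_fun_eq_card, hκ] at h1
    have h2 := Submodule.finrank_quotient_add_finrank
      ((⊤ : Submodule ℂ (Fin (δ v) → ℂ)).map (φ v).mulVecLin)
    rw [Module.finrank_fintype_fun_eq_card, Fintype.card_fin] at h2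
    have h3 : r v = Module.finrank ℂ ((⊤ : Submodule ℂ (Fin (δ v) → ℂ)).map (φ v).mulVecLin) := by
      rw [hr, ← LinearMap.range_eq_map]
    rw [← h3] at h2
    norm_cast
    omega
  have e1 := hmin _ hN
  have e2 := hmin _ hI
  simp only [hNd, hId, mul_sub, mul_add, Finset.sum_sub_distrib, Finset.sum_add_distrib] at e1 e2
  have e3 := hmin' _ hN (by
    simp only [hNd, mul_sub, Finset.sum_sub_distrib]; linarith)
  have e4 : (∑ v, δ v : ℝ) ≤ ∑ v, ((δ v : ℝ) - r v) := by
    rw [← Finset.sum_congr rfl fun v _ => hNd v]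
    exact_mod_cast e3
  rw [Finset.sum_sub_distrib] at e4
  have e5 : ∑ v, r v = 0 := by
    have : (∑ v, r v : ℝ) ≤ 0 := by linarith
    exact_mod_cast le_antisymm this (Finset.sum_nonneg fun _ _ => Nat.cast_nonneg _)
  funext v
  have e6 := Finset.sum_eq_zero_iff.mp e5 v (Finset.mem_univ v)
  rw [hr] at e6
  have e7 := LinearMap.range_eq_bot.mp (Submodule.finrank_eq_zero.mp e6)
  refine Matrix.ext_of_mulVec_single fun i => ?_
  have := LinearMap.congr_fun e7 (Pi.single i 1)
  rw [Matrix.mulVecLin_apply] at this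
  rw [this, Pi.zero_apply, Matrix.zero_mulVec, LinearMap.zero_apply]

/-- A minimally destabilizing subrepresentation of a representation with generic
subrepresentations only degenerates to a solution of the moment map equation. -/
theorem exists_isMoment_of_minimal (ℓ : V → ℝ) (hℓ : ∀ a : Q, 1 ≤ ℓ (tgt a) - ℓ (src a))
    {x : QRep src tgt κ} (σ : V → ℝ) {T : ∀ v, Submodule ℂ (κ v → ℂ)} (hT : IsSub x T)
    (hmin : ∀ S, IsSub x S → ∑ v, σ v * Module.finrank ℂ (T v) ≤
      ∑ v, σ v * Module.finrank ℂ (S v))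
    (hmin' : ∀ S, IsSub x S →
      ∑ v, σ v * Module.finrank ℂ (S v) = ∑ v, σ v * Module.finrank ℂ (T v) →
      ∑ v, Module.finrank ℂ (T v) ≤ ∑ v, Module.finrank ℂ (S v))
    {δ γ : V → ℕ} (hδ : ∀ v, Module.finrank ℂ (T v) = δ v)
    (hκ : ∀ v, Fintype.card (κ v) = δ v + γ v) (hgen : 0 ≤ euler src tgt δ γ) :
    ∃ x' : QRep src tgt fun v => Fin (δ v), IsMoment x' (eulerWeight src tgt γ) := by
  classical
  choose U U' hU hU' hU'U hadd hUT using fun v => exists_complementary_frames (T v) (hδ v) (hκ v)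
  simp only [hδ] at hmin hmin'
  obtain ⟨xT, hxTd⟩ : ∃ xT : QRep src tgt fun v => Fin (δ v),
    xT = fun a => (U (tgt a))ᴴ * x a * U (src a) := ⟨_, rfl⟩
  obtain ⟨y, hyd⟩ : ∃ y : QRep src tgt fun v => Fin (γ v),
    y = fun a => (U' (tgt a))ᴴ * x a * U' (src a) := ⟨_, rfl⟩
  have hUT' : ∀ v u, u ∈ T v → (U' v)ᴴ *ᵥ u = 0 := fun v u hu => by
    have h1 : (T v) = LinearMap.range (U v).mulVecLin := by
      symm
      refine Submodule.eq_of_le_of_finrank_eq ?_ ?_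
      · rintro _ ⟨w, rfl⟩
        exact hUT v w
      · rw [LinearMap.finrank_range_of_inj, hδ, Module.finrank_fintype_fun_eq_card, Fintype.card_fin]
        intro u w h
        have := congrArg ((U v)ᴴ *ᵥ ·) h
        simpa [Matrix.mulVec_mulVec, hU] using this
    rw [h1] at hu
    obtain ⟨w, rfl⟩ := hu
    rw [Matrix.mulVecLin_apply, Matrix.mulVec_mulVec, hU'U, Matrix.zero_mulVec]
  have hz : ∀ a, (U' (tgt a))ᴴ * x a * U (src a) = 0 := fun a => by
    refine Matrix.ext_of_mulVec_single fun i => ?_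
    rw [← Matrix.mulVec_mulVec, ← Matrix.mulVec_mulVec, hUT' _ _ (hT a _ (hUT _ _)),
      Matrix.zero_mulVec]
  have hxT : ∀ a, x a * U (src a) = U (tgt a) * xT a := fun a => by
    rw [hxTd]
    calc x a * U (src a) = (U (tgt a) * (U (tgt a))ᴴ + U' (tgt a) * (U' (tgt a))ᴴ) *
          (x a * U (src a)) := by rw [hadd, Matrix.one_mul]
      _ = U (tgt a) * ((U (tgt a))ᴴ * x a * U (src a)) +
          U' (tgt a) * ((U' (tgt a))ᴴ * x a * U (src a)) := by
          simp only [Matrix.add_mul, Matrix.mul_assoc]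
      _ = _ := by rw [hz, Matrix.mul_zero, add_zero]
  have hy : ∀ a, (U' (tgt a))ᴴ * x a = y a * (U' (src a))ᴴ := fun a => by
    rw [hyd]
    calc (U' (tgt a))ᴴ * x a = ((U' (tgt a))ᴴ * x a) *
          (U (src a) * (U (src a))ᴴ + U' (src a) * (U' (src a))ᴴ) := by rw [hadd, Matrix.mul_one]
      _ = ((U' (tgt a))ᴴ * x a * U (src a)) * (U (src a))ᴴ +
          (U' (tgt a))ᴴ * x a * U' (src a) * (U' (src a))ᴴ := by
          simp only [Matrix.mul_add, Matrix.mul_assoc]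
      _ = _ := by rw [hz, Matrix.zero_mul, zero_add]
  have hinj := dmap_injective_of_minimal σ hU hU' hκ hxT hy hmin hmin'
  have hdimd : ∀ {α : V → ℕ}, (Module.finrank ℂ (∀ v, Matrix (Fin (γ v)) (Fin (α v)) ℂ) : ℤ) -
      Module.finrank ℂ (∀ a, Matrix (Fin (γ (tgt a))) (Fin (α (src a))) ℂ) =
      euler src tgt α γ := fun {α} => by
    rw [Module.finrank_pi_fintype, Module.finrank_pi_fintype, euler]
    simp [Module.finrank_matrix, mul_comm]
  have hle := LinearMap.finrank_le_finrank_of_injective hinj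
  have heq : Module.finrank ℂ (∀ v, Matrix (Fin (γ v)) (Fin (δ v)) ℂ) =
      Module.finrank ℂ (∀ a, Matrix (Fin (γ (tgt a))) (Fin (δ (src a))) ℂ) := by
    have := hdimd (α := δ)
    omega
  have hsurj : Function.Surjective (dmap xT y) :=
    (LinearMap.injective_iff_surjective_of_finrank_eq_finrank heq).mp hinj
  refine exists_isMoment ℓ hℓ xT _ ?_ fun S hS => ?_
  · have h1 := sum_eulerWeight_mul src tgt δ γ
    have h2 : euler src tgt δ γ = 0 := by rw [← hdimd]; omega
    rw [h2] at h1
    simpa using h1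
  · have h1 := sum_eulerWeight_mul src tgt (fun v => Module.finrank ℂ (S v)) γ
    rw [h1]
    norm_cast
    choose P hP hPS hSP using fun v => exists_frame (S v) rfl
    obtain ⟨xS, hxS⟩ : ∃ xS : QRep src tgt fun v => Fin (Module.finrank ℂ (S v)),
      xS = fun a => (P (tgt a))ᴴ * xT a * P (src a) := ⟨_, rfl⟩
    have hxP : ∀ a, P (tgt a) * xS a = xT a * P (src a) := fun a => by
      refine Matrix.ext_of_mulVec_single fun i => ?_
      rw [hxS]
      have := hSP _ _ (hS a _ (hPS (src a) (Pi.single i 1)))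
      simpa only [Matrix.mulVec_mulVec, Matrix.mul_assoc] using this
    have hs : Function.Surjective (dmap xS y) := fun ψ => by
      obtain ⟨φ, hφ⟩ := hsurj fun a => ψ a * (P (src a))ᴴ
      refine ⟨fun v => φ v * P v, ?_⟩
      funext a
      have h2 := congrArg (· * P (src a)) (congrFun hφ a)
      simp only [dmap_apply, Matrix.sub_mul, Matrix.mul_assoc, hP, Matrix.mul_one] at h2
      rw [dmap_apply, Matrix.mul_assoc, hxP, h2]
    have := LinearMap.finrank_le_finrank_of_surjective hs
    rw [← hdimd]
    omega

end HarderNarasimhan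

section Star

variable {K : Type} (L : K → ℕ)

/-- The vertices of a star quiver: a center, and one arm with `L k + 1` vertices for each `k`. -/
abbrev StarV : Type := Option (Σ k, Fin (L k + 1))

/-- The arrows of a star quiver, all oriented towards the center. -/
abbrev StarQ : Type := (Σ k, Fin (L k)) ⊕ K

/-- The source of an arrow of a star quiver. -/
@[reducible] def starSrc : StarQ L → StarV L
  | .inl a => some ⟨a.1, a.2.castSucc⟩
  | .inr k => some ⟨k, Fin.last _⟩

/-- The target of an arrow of a star quiver. -/
@[reducible] def starTgt : StarQ L → StarV L
  | .inl a => some ⟨a.1, a.2.succ⟩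
  | .inr _ => none

variable {L} {ι : StarV L → Type} [∀ v, Fintype (ι v)]

/-- The matrix of an arrow on an arm of a star quiver. -/
def armMap (x : QRep (starSrc L) (starTgt L) ι) (k : K) (i : Fin (L k)) :
    Matrix (ι (some ⟨k, i.succ⟩)) (ι (some ⟨k, i.castSucc⟩)) ℂ := x (.inl ⟨k, i⟩)

/-- The matrix of the arrow from the end of an arm of a star quiver to its center. -/
def armLast (x : QRep (starSrc L) (starTgt L) ι) (k : K) :
    Matrix (ι none) (ι (some ⟨k, Fin.last _⟩)) ℂ := x (.inr k)

/-- The matrix `xᴴ * x`, for the arrow `x` starting at a vertex of an arm. -/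
def starOut (x : QRep (starSrc L) (starTgt L) ι) (k : K) (i : Fin (L k + 1)) :
    Matrix (ι (some ⟨k, i⟩)) (ι (some ⟨k, i⟩)) ℂ :=
  Fin.lastCases (motive := fun i => Matrix (ι (some ⟨k, i⟩)) (ι (some ⟨k, i⟩)) ℂ)
    ((armLast x k)ᴴ * armLast x k) (fun j => (armMap x k j)ᴴ * armMap x k j) i

theorem starOut_last (x : QRep (starSrc L) (starTgt L) ι) (k : K) :
    starOut x k (Fin.last _) = (armLast x k)ᴴ * armLast x k := by
  rw [starOut, Fin.lastCases_last]

theorem starOut_castSucc (x : QRep (starSrc L) (starTgt L) ι) (k : K) (i : Fin (L k)) :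
    starOut x k i.castSucc = (armMap x k i)ᴴ * armMap x k i := by
  rw [starOut, Fin.lastCases_castSucc]

theorem isHermitian_starOut (x : QRep (starSrc L) (starTgt L) ι) (k : K) (i : Fin (L k + 1)) :
    (starOut x k i).IsHermitian := by
  induction i using Fin.lastCases with
  | last => rw [starOut_last]; exact isHermitian_conjTranspose_mul_self _
  | cast j => rw [starOut_castSucc]; exact isHermitian_conjTranspose_mul_self _

variable [Fintype K]

/-- The moment map of the representations of a star quiver. -/
def starMoment (x : QRep (starSrc L) (starTgt L) ι) : ∀ v, Matrix (ι v) (ι v) ℂ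
  | none => ∑ k, armLast x k * (armLast x k)ᴴ
  | some ⟨k, i⟩ => Fin.cases (motive := fun i => Matrix (ι (some ⟨k, i⟩)) (ι (some ⟨k, i⟩)) ℂ)
      (-starOut x k 0)
      (fun j => armMap x k j * (armMap x k j)ᴴ - starOut x k j.succ) i

theorem starMoment_none (x : QRep (starSrc L) (starTgt L) ι) :
    starMoment x none = ∑ k, armLast x k * (armLast x k)ᴴ := rfl

theorem starMoment_succ (x : QRep (starSrc L) (starTgt L) ι) (k : K) (i : Fin (L k)) :
    starMoment x (some ⟨k, i.succ⟩) =
      armMap x k i * (armMap x k i)ᴴ - starOut x k i.succ := rfl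

theorem isHermitian_starMoment (x : QRep (starSrc L) (starTgt L) ι) (v : StarV L) :
    (starMoment x v).IsHermitian := by
  rcases v with - | ⟨k, i⟩
  · rw [starMoment_none]
    exact (isSelfAdjoint_sum _ fun k _ => (isHermitian_mul_conjTranspose_self _).isSelfAdjoint)
  · induction i using Fin.cases with
    | zero => exact (isHermitian_starOut x k 0).neg
    | succ j => exact (isHermitian_mul_conjTranspose_self _).sub (isHermitian_starOut x k _)

theorem momentPairing_star (x : QRep (starSrc L) (starTgt L) ι) (Y : ∀ v, Matrix (ι v) (ι v) ℂ) :
    momentPairing x Y = ∑ v, ((Y v * starMoment x v).trace).re := by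
  have h0 : momentPairing x Y =
      (∑ k, ∑ i : Fin (L k), (((Y (some ⟨k, i.succ⟩) * (armMap x k i * (armMap x k i)ᴴ)).trace).re -
        ((Y (some ⟨k, i.castSucc⟩) * ((armMap x k i)ᴴ * armMap x k i)).trace).re)) +
      ∑ k, (((Y none * (armLast x k * (armLast x k)ᴴ)).trace).re -
        ((Y (some ⟨k, Fin.last _⟩) * ((armLast x k)ᴴ * armLast x k)).trace).re) := by
    rw [momentPairing, Fintype.sum_sum_type, Fintype.sum_sigma]
    rfl
  rw [h0, Fintype.sum_option, starMoment_none, Fintype.sum_sigma, Matrix.mul_sum, Matrix.trace_sum,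
    Complex.re_sum, Finset.sum_sub_distrib]
  have h : ∀ k, ∑ i : Fin (L k + 1), ((Y (some ⟨k, i⟩) * starMoment x (some ⟨k, i⟩)).trace).re =
      (∑ i : Fin (L k), (((Y (some ⟨k, i.succ⟩) * (armMap x k i * (armMap x k i)ᴴ)).trace).re -
        ((Y (some ⟨k, i.castSucc⟩) * ((armMap x k i)ᴴ * armMap x k i)).trace).re)) -
      ((Y (some ⟨k, Fin.last _⟩) * ((armLast x k)ᴴ * armLast x k)).trace).re := fun k => by
    have h1 : ∑ i : Fin (L k + 1), ((Y (some ⟨k, i⟩) * starOut x k i).trace).re =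
        (∑ i : Fin (L k), ((Y (some ⟨k, i.castSucc⟩) *
          ((armMap x k i)ᴴ * armMap x k i)).trace).re) +
        ((Y (some ⟨k, Fin.last _⟩) * ((armLast x k)ᴴ * armLast x k)).trace).re := by
      rw [Fin.sum_univ_castSucc, starOut_last]
      simp only [starOut_castSucc]
    rw [Fin.sum_univ_succ] at h1 ⊢
    have h2 : starMoment x (some ⟨k, 0⟩) = -starOut x k 0 := rfl
    simp only [h2, starMoment_succ, Matrix.mul_neg, Matrix.trace_neg, Complex.neg_re,
      Matrix.mul_sub, Matrix.trace_sub, Complex.sub_re, Finset.sum_sub_distrib] at h1 ⊢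
    linarith
  simp only [h, Finset.sum_sub_distrib]
  ring

/-- A Hermitian matrix is determined by its trace pairing. -/
theorem eq_smul_one_of_trace {m : Type} [Fintype m] [DecidableEq m] {M : Matrix m m ℂ}
    (hM : M.IsHermitian) (s : ℝ)
    (h : ∀ Y : Matrix m m ℂ, Y.IsHermitian → ((Y * M).trace).re = s * (Y.trace).re) :
    M = (s : ℂ) • 1 := by
  have h1 : (M - (s : ℂ) • 1).IsHermitian := hM.sub (by
    rw [IsHermitian, conjTranspose_smul, conjTranspose_one]; simp)
  have h2 := h _ h1
  have h3 : (((M - (s : ℂ) • 1) * (M - (s : ℂ) • 1)ᴴ).trace).re = 0 := by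
    rw [h1.eq, Matrix.mul_sub, Matrix.trace_sub, Complex.sub_re, h2, Matrix.mul_smul,
      Matrix.mul_one, Matrix.trace_smul]
    simp
  rw [trace_mul_conjTranspose_re] at h3
  rw [← sub_eq_zero]
  ext i j
  have h4 := (Finset.sum_eq_zero_iff_of_nonneg fun i _ =>
    Finset.sum_nonneg fun j _ => sq_nonneg _).mp h3 i (Finset.mem_univ i)
  have h5 := (Finset.sum_eq_zero_iff_of_nonneg fun j _ => sq_nonneg _).mp h4 j (Finset.mem_univ j)
  simpa using h5

variable [DecidableEq K] [∀ v, DecidableEq (ι v)]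

theorem isMoment_star_iff (x : QRep (starSrc L) (starTgt L) ι) (σ : StarV L → ℝ) :
    IsMoment x σ ↔ ∀ v, starMoment x v = (σ v : ℂ) • 1 := by
  constructor
  · intro h v
    refine eq_smul_one_of_trace (isHermitian_starMoment x v) _ fun Y hY => ?_
    have := h (Pi.single v Y) fun w => by
      rcases eq_or_ne w v with rfl | hw
      · rwa [Pi.single_eq_same]
      · rw [Pi.single_eq_of_ne hw]; exact isHermitian_zero
    rw [momentPairing_star, Finset.sum_eq_single v, Finset.sum_eq_single v, Pi.single_eq_same]
      at this
    · exact this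
    · intro w _ hw; rw [Pi.single_eq_of_ne hw]; simp
    · simp
    · intro w _ hw; rw [Pi.single_eq_of_ne hw]; simp
    · simp
  · intro h Y hY
    rw [momentPairing_star]
    refine Finset.sum_congr rfl fun v _ => ?_
    rw [h, Matrix.mul_smul, Matrix.mul_one, Matrix.trace_smul]
    simp

end Star

section Spectra

variable {m n J J' : Type} [Fintype m] [DecidableEq m] [Fintype n] [DecidableEq n]
  [Fintype J] [DecidableEq J] [Fintype J'] [DecidableEq J']

open Polynomial in
/-- The eigenvalues of the matrix `M`, with multiplicities, are the members of the family `e`. -/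
def HasSpec (M : Matrix m m ℂ) (e : J → ℝ) : Prop :=
  M.charpoly = ∏ j, (X - C (e j : ℂ))

omit [DecidableEq J] [DecidableEq J'] in
theorem HasSpec.comp_equiv {M : Matrix m m ℂ} {e : J → ℝ} (h : HasSpec M e) (σ : J' ≃ J) :
    HasSpec M (e ∘ σ) := by
  rw [HasSpec, h]
  exact (Equiv.prod_comp σ _).symm

omit [DecidableEq J] [DecidableEq J'] in
theorem exists_equiv_of_map_eq {e : J → ℝ} {z : J' → ℝ}
    (h : Finset.univ.val.map e = Finset.univ.val.map z) : ∃ σ : J ≃ J', e = z ∘ σ := by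
  classical
  have hc : ∀ r, Nonempty ({j // e j = r} ≃ {j // z j = r}) := fun r => by
    refine Fintype.card_eq.mp ?_
    have := congrArg (Multiset.count r) h
    rw [Multiset.count_map, Multiset.count_map] at this
    rw [Fintype.card_subtype, Fintype.card_subtype]
    simpa [Finset.card_def, Finset.filter_val, eq_comm] using this
  refine ⟨(Equiv.sigmaFiberEquiv e).symm.trans
    ((Equiv.sigmaCongrRight fun r => (hc r).some).trans (Equiv.sigmaFiberEquiv z)), ?_⟩
  funext j
  exact ((hc (e j)).some ⟨j, rfl⟩).2.symm

open Polynomial in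
omit [DecidableEq J] [DecidableEq J'] in
theorem exists_equiv_of_prod_eq {e : J → ℝ} {z : J' → ℝ}
    (h : ∏ j, (X - C (e j : ℂ)) = ∏ j, (X - C (z j : ℂ))) : ∃ σ : J ≃ J', e = z ∘ σ := by
  refine exists_equiv_of_map_eq ?_
  have h1 := congrArg Polynomial.roots h
  have h2 : ∀ {I : Type} [Fintype I] (f : I → ℝ), (∏ j, (X - C (f j : ℂ))).roots =
      (Finset.univ.val.map f).map (fun r : ℝ => (r : ℂ)) := fun f => by
    rw [Multiset.map_map]
    exact Polynomial.roots_multiset_prod_X_sub_C (Finset.univ.val.map fun j => (f j : ℂ)) ▸ by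
      rw [Multiset.map_map]; rfl
  rw [h2, h2] at h1
  exact Multiset.map_injective Complex.ofReal_injective h1

omit [DecidableEq J] [DecidableEq J'] in
theorem HasSpec.exists_equiv {M : Matrix m m ℂ} {e : J → ℝ} {z : J' → ℝ} (h : HasSpec M e)
    (h' : HasSpec M z) : ∃ σ : J ≃ J', e = z ∘ σ :=
  exists_equiv_of_prod_eq (h.symm.trans h')

theorem hasSpec_conj {V : Matrix m J ℂ} (hV : Vᴴ * V = 1) (hV' : V * Vᴴ = 1) (e : J → ℝ) :
    HasSpec (V * diagonal (fun j => (e j : ℂ)) * Vᴴ) e := by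
  have hc : Fintype.card m = Fintype.card J := by
    have h1 := congrArg Matrix.trace hV
    rw [Matrix.trace_mul_comm, hV', Matrix.trace_one, Matrix.trace_one] at h1
    exact_mod_cast h1
  have := Matrix.charpoly_mul_comm' (V * diagonal (fun j => (e j : ℂ))) Vᴴ
  rw [hc] at this
  rw [HasSpec, (Polynomial.isRegular_X_pow _).left.eq_iff.mp this, ← Matrix.mul_assoc, hV,
    Matrix.one_mul, Matrix.charpoly_diagonal]

omit [DecidableEq J'] in
theorem HasSpec.exists_conj {M : Matrix m m ℂ} {e : J → ℝ} (hM : M.IsHermitian)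
    (h : HasSpec M e) : ∃ V : Matrix m J ℂ, Vᴴ * V = 1 ∧ V * Vᴴ = 1 ∧
      M = V * diagonal (fun j => (e j : ℂ)) * Vᴴ := by
  obtain ⟨W, z, hW, hW', hM⟩ := hM.exists_diagonal
  obtain ⟨σ, rfl⟩ := h.exists_equiv (hM ▸ hasSpec_conj hW' hW z)
  refine ⟨W.submatrix id σ, ?_, ?_, ?_⟩
  · rw [conjTranspose_submatrix, ← Matrix.submatrix_mul _ _ _ _ _ Function.bijective_id, hW',
      Matrix.submatrix_one_equiv]
  · rw [conjTranspose_submatrix, ← Matrix.submatrix_mul _ _ _ _ _ σ.bijective, hW,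
      Matrix.submatrix_id_id]
  · have : diagonal (fun j => ((z ∘ σ) j : ℂ)) = (diagonal fun j => (z j : ℂ)).submatrix σ σ := by
      rw [Matrix.submatrix_diagonal_equiv]; rfl
    rw [this, conjTranspose_submatrix, ← Matrix.submatrix_mul _ _ _ _ _ σ.bijective,
      ← Matrix.submatrix_mul _ _ _ _ _ σ.bijective, Matrix.submatrix_id_id, hM]

theorem HasSpec.const_sub {M : Matrix m m ℂ} {e : J → ℝ} (hM : M.IsHermitian)
    (h : HasSpec M e) (c : ℝ) : HasSpec ((c : ℂ) • 1 - M) fun j => c - e j := by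
  obtain ⟨V, hV, hV', hM⟩ := h.exists_conj hM
  have : (c : ℂ) • 1 - M = V * diagonal (fun j => ((c - e j : ℝ) : ℂ)) * Vᴴ := by
    have : diagonal (fun j => ((c - e j : ℝ) : ℂ)) =
        (c : ℂ) • 1 - diagonal (fun j => (e j : ℂ)) := by
      rw [← Matrix.diagonal_one, ← Matrix.diagonal_smul, Matrix.diagonal_sub]
      congr 1
      funext j
      simp
    rw [this, Matrix.mul_sub, Matrix.sub_mul, ← hM, Matrix.mul_smul, Matrix.smul_mul,
      Matrix.mul_one, hV']
  rw [this]
  exact hasSpec_conj hV hV' _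

/-- A positive semidefinite Hermitian matrix has a Hermitian square root. -/
theorem HasSpec.exists_sqrt {M : Matrix m m ℂ} {e : J → ℝ} (hM : M.IsHermitian)
    (h : HasSpec M e) (he : ∀ j, 0 ≤ e j) :
    ∃ Z : Matrix m m ℂ, Zᴴ * Z = M ∧ Z * Zᴴ = M := by
  obtain ⟨V, hV, hV', hM⟩ := h.exists_conj hM
  have h1 : ((V * diagonal (fun j => ((Real.sqrt (e j) : ℝ) : ℂ)) * Vᴴ)ᴴ) =
      V * diagonal (fun j => ((Real.sqrt (e j) : ℝ) : ℂ)) * Vᴴ := by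
    rw [conjTranspose_mul, conjTranspose_mul, conjTranspose_conjTranspose, diagonal_conjTranspose,
      ← Matrix.mul_assoc]
    congr 3
    funext j
    simp
  have h2 : V * diagonal (fun j => ((Real.sqrt (e j) : ℝ) : ℂ)) * Vᴴ *
      (V * diagonal (fun j => ((Real.sqrt (e j) : ℝ) : ℂ)) * Vᴴ) = M := by
    calc _ = V * diagonal (fun j => ((Real.sqrt (e j) : ℝ) : ℂ)) * (Vᴴ *
          V) * diagonal (fun j => ((Real.sqrt (e j) : ℝ) : ℂ)) * Vᴴ := by
          simp only [Matrix.mul_assoc]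
      _ = _ := by
        rw [hV, Matrix.mul_one, Matrix.mul_assoc V, Matrix.diagonal_mul_diagonal, hM]
        congr 3
        funext j
        exact_mod_cast Real.mul_self_sqrt (he j)
  exact ⟨_, by rw [h1, h2], by rw [h1, h2]⟩

omit [DecidableEq J] in
theorem HasSpec.mul_comm {A : Matrix m n ℂ} {B : Matrix n m ℂ} {e : J → ℝ}
    (h : HasSpec (A * B) e) (hc : Fintype.card m = Fintype.card n) : HasSpec (B * A) e := by
  have := Matrix.charpoly_mul_comm' A B
  rw [hc] at this
  rw [HasSpec, ← (Polynomial.isRegular_X_pow _).left.eq_iff.mp this, h]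

omit [DecidableEq J] in
theorem HasSpec.submatrix {M : Matrix m m ℂ} {e : J → ℝ} (h : HasSpec M e) (σ : n ≃ m) :
    HasSpec (M.submatrix σ σ) e := by
  rw [HasSpec, ← h]
  exact Matrix.charpoly_reindex σ.symm M

theorem antitone_eigVec {k : ℕ} (M : Matrix (Fin k) (Fin k) ℂ) (hM : M.IsHermitian) :
    Antitone (eigVec M hM) := fun _ _ h =>
  Tuple.monotone_sort hM.eigenvalues (Fin.rev_le_rev.mpr h)

theorem hasSpec_eigVec {k : ℕ} (M : Matrix (Fin k) (Fin k) ℂ) (hM : M.IsHermitian) :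
    HasSpec M (eigVec M hM) := by
  have : HasSpec M hM.eigenvalues := hM.charpoly_eq
  exact this.comp_equiv (Fin.revPerm.trans (Tuple.sort hM.eigenvalues))

theorem eigVec_eq_of_hasSpec {k : ℕ} {M : Matrix (Fin k) (Fin k) ℂ} (hM : M.IsHermitian)
    {e : Fin k → ℝ} (he : Antitone e) (h : HasSpec M e) : eigVec M hM = e := by
  obtain ⟨σ, hσ⟩ := (hasSpec_eigVec M hM).exists_equiv h
  have := Tuple.unique_antitone (f := e) (σ := σ) (τ := Equiv.refl _)
    (hσ ▸ antitone_eigVec M hM) he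
  rw [hσ, this]
  rfl

end Spectra

section Arms

variable {K : Type} {L : K → ℕ}

/-- Index sets for the representations of a star quiver with center `c`, whose dimension at the
vertex `i` of the arm `k` is the number of elements of `B k` below `i`. -/
def starIdx (c : Type) (B : ∀ k, Finset (Fin (L k))) : StarV L → Type
  | none => c
  | some ⟨k, i⟩ => {b : Fin (L k) // b ∈ B k ∧ b.val < i.val}

instance (c : Type) [Fintype c] (B : ∀ k, Finset (Fin (L k))) : ∀ v, Fintype (starIdx c B v)
  | none => inferInstanceAs (Fintype c)
  | some ⟨k, i⟩ => inferInstanceAs (Fintype {b : Fin (L k) // b ∈ B k ∧ b.val < i.val})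

instance (c : Type) [DecidableEq c] (B : ∀ k, Finset (Fin (L k))) :
    ∀ v, DecidableEq (starIdx c B v)
  | none => inferInstanceAs (DecidableEq c)
  | some ⟨k, i⟩ => inferInstanceAs (DecidableEq {b : Fin (L k) // b ∈ B k ∧ b.val < i.val})

/-- The dimension vector of the representations indexed by `starIdx`. -/
def starDim (B : ∀ k, Finset (Fin (L k))) (r : ℕ) : StarV L → ℕ
  | none => r
  | some ⟨k, i⟩ => ((B k).filter fun b => b.val < i.val).card

theorem card_starIdx (c : Type) [Fintype c] (B : ∀ k, Finset (Fin (L k))) (v : StarV L) :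
    Fintype.card (starIdx c B v) = starDim B (Fintype.card c) v := by
  rcases v with - | ⟨k, i⟩
  · rfl
  · refine (Fintype.card_subtype _).trans (congrArg Finset.card ?_)
    ext b
    simp

/-- A weight for the star quiver; on the arm `k` it is given by the differences of `e k`. -/
def starWeight (e : K → ℕ → ℝ) (w : ℝ) : StarV L → ℝ
  | none => w
  | some ⟨k, i⟩ => e k i - e k (i - 1)

theorem sum_fin_ite_sub (e : ℕ → ℝ) {l b : ℕ} (hb : b < l) :
    ∑ i : Fin (l + 1), (if b < i.val then e i - e (i - 1) else 0) = e l - e b := by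
  rw [Fin.sum_univ_succ, if_neg (by simp), zero_add]
  simp only [Fin.val_succ, Nat.add_sub_cancel]
  rw [Fin.sum_univ_eq_sum_range (fun i => if b < i + 1 then e (i + 1) - e i else 0) l]
  induction l, hb using Nat.le_induction with
  | base =>
    rw [Finset.sum_range_succ, if_pos (by simp), Finset.sum_eq_zero, zero_add]
    intro i hi
    rw [if_neg]
    have := Finset.mem_range.mp hi
    omega
  | succ l hl ih => rw [Finset.sum_range_succ, ih, if_pos (by omega)]; ring

theorem sum_starWeight_mul_starDim [Fintype K] (e : K → ℕ → ℝ) (he : ∀ k, e k (L k) = 0) (w : ℝ)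
    (B : ∀ k, Finset (Fin (L k))) (r : ℕ) :
    ∑ v, starWeight e w v * starDim B r v = w * r - ∑ k, ∑ b ∈ B k, e k b := by
  rw [Fintype.sum_option, Fintype.sum_sigma, sub_eq_add_neg, ← Finset.sum_neg_distrib]
  congr 1
  refine Finset.sum_congr rfl fun k _ => ?_
  simp only [starWeight, starDim, Finset.card_filter, Nat.cast_sum, Finset.mul_sum]
  rw [Finset.sum_comm, ← Finset.sum_neg_distrib]
  refine Finset.sum_congr rfl fun b _ => ?_
  have := sum_fin_ite_sub (e k) b.2
  rw [he, zero_sub] at this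
  rw [← this]
  refine Finset.sum_congr rfl fun i _ => ?_
  simp

variable [Fintype K]

open Polynomial in
/-- The eigenvalues along an arm of a solution of the moment map equation. -/
theorem charpoly_starOut {ι : StarV L → Type} [∀ v, Fintype (ι v)] [∀ v, DecidableEq (ι v)]
    (x : QRep (starSrc L) (starTgt L) ι) {k : K} {B : Finset (Fin (L k))}
    (hd : ∀ i, Fintype.card (ι (some ⟨k, i⟩)) = (B.filter fun b => b.val < i.val).card)
    {e : ℕ → ℝ} (h : ∀ i : Fin (L k), starMoment x (some ⟨k, i.succ⟩) =
      ((e (i + 1) - e i : ℝ) : ℂ) • 1) (i : Fin (L k + 1)) :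
    (starOut x k i).charpoly =
      ∏ b ∈ B.filter (fun b => b.val < i.val), (X - C ((e b - e i : ℝ) : ℂ)) := by
  induction i using Fin.induction with
  | zero =>
    have : IsEmpty (ι (some ⟨k, 0⟩)) := Fintype.card_eq_zero_iff.mp (by rw [hd]; simp)
    simp [Matrix.charpoly]
  | succ i ih =>
    have h1 : starOut x k i.succ = armMap x k i * (armMap x k i)ᴴ -
        Matrix.scalar _ ((e (i + 1) - e i : ℝ) : ℂ) := by
      have h2 := h i
      rw [starMoment_succ] at h2
      rw [Matrix.scalar_apply, ← Matrix.smul_one_eq_diagonal, ← h2, sub_sub_cancel]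
    have hsub : B.filter (fun b => b.val < i.castSucc.val) ⊆
        B.filter (fun b => b.val < i.succ.val) := by
      intro b
      simp only [Finset.mem_filter, Fin.val_castSucc, Fin.val_succ]
      exact fun hb => ⟨hb.1, by omega⟩
    rw [h1, Matrix.charpoly_sub_scalar, Matrix.charpoly_mul_comm_of_le _ _ (by
      rw [hd, hd]; exact Finset.card_le_card hsub), ← starOut_castSucc, ih, hd, hd,
      ← Finset.card_sdiff_of_subset hsub]
    have h3 : (X : ℂ[X]) ^ (B.filter (fun b => b.val < i.succ.val) \
        B.filter (fun b => b.val < i.castSucc.val)).card =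
        ∏ b ∈ B.filter (fun b => b.val < i.succ.val) \
        B.filter (fun b => b.val < i.castSucc.val),
          (X - C ((e b - e i.castSucc.val : ℝ) : ℂ)) := by
      rw [Finset.prod_congr rfl (g := fun _ => X), Finset.prod_const]
      intro b hb
      have : b.val = i.castSucc.val := by
        simp only [Finset.mem_sdiff, Finset.mem_filter, Fin.val_castSucc, Fin.val_succ] at hb ⊢
        by_contra hne
        exact hb.2 ⟨hb.1.1, by omega⟩
      rw [this]
      simp
    rw [h3, Finset.prod_sdiff hsub, Polynomial.prod_comp]
    refine Finset.prod_congr rfl fun b _ => ?_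
    simp only [Polynomial.sub_comp, Polynomial.X_comp, Polynomial.C_comp, Fin.val_castSucc,
      Fin.val_succ]
    rw [add_sub_assoc, ← C_sub, sub_eq_add_neg X, ← C_neg]
    congr 2
    push_cast
    ring

theorem hasSpec_armLast {ι : StarV L → Type} [∀ v, Fintype (ι v)] [∀ v, DecidableEq (ι v)]
    (x : QRep (starSrc L) (starTgt L) ι) {k : K} {B : Finset (Fin (L k))}
    (hd : ∀ i, Fintype.card (ι (some ⟨k, i⟩)) = (B.filter fun b => b.val < i.val).card)
    {e : ℕ → ℝ} (h : ∀ i : Fin (L k), starMoment x (some ⟨k, i.succ⟩) =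
      ((e (i + 1) - e i : ℝ) : ℂ) • 1) (he : e (L k) = 0) :
    HasSpec ((armLast x k)ᴴ * armLast x k) fun b : B => e b := by
  have := charpoly_starOut x hd h (Fin.last _)
  rw [starOut_last] at this
  rw [HasSpec, this, Finset.prod_coe_sort B fun b =>
    Polynomial.X - Polynomial.C ((e b : ℝ) : ℂ)]
  simp [he]

/-- A representation of a star quiver with diagonal arms. -/
noncomputable def starRep {c : Type} {B : ∀ k, Finset (Fin (L k))} (e : K → ℕ → ℝ)
    (h : ∀ k, Matrix c (starIdx c B (some ⟨k, Fin.last _⟩)) ℂ) :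
    QRep (starSrc L) (starTgt L) (starIdx c B)
  | .inl ⟨k, i⟩ => fun b' b => if b'.1 = b.1 then ((Real.sqrt (e k b.1 - e k i) : ℝ) : ℂ) else 0
  | .inr k => h k

theorem starMoment_starRep {c : Type} [Fintype c] [DecidableEq c] {B : ∀ k, Finset (Fin (L k))}
    {e : K → ℕ → ℝ} (he : ∀ k, Antitone (e k)) (he0 : ∀ k, e k (L k) = 0)
    {h : ∀ k, Matrix c (starIdx c B (some ⟨k, Fin.last _⟩)) ℂ}
    (hh : ∀ k, (h k)ᴴ * h k = diagonal fun b => (e k b.1 : ℂ)) (k : K) (i : Fin (L k)) :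
    starMoment (starRep e h) (some ⟨k, i.succ⟩) = ((e k (i + 1) - e k i : ℝ) : ℂ) • 1 := by
  have h1 : ∀ i : Fin (L k + 1), starOut (starRep e h) k i =
      diagonal fun b => ((e k b.1 - e k i : ℝ) : ℂ) := fun i => by
    induction i using Fin.lastCases with
    | last =>
      rw [starOut_last]
      refine (hh k).trans ?_
      simp [he0]
    | cast i =>
      rw [starOut_castSucc]
      ext b b'
      obtain ⟨b₀, hb₀⟩ : ∃ b₀ : starIdx c B (some ⟨k, i.succ⟩), b₀.1 = b.1 :=
        ⟨⟨b.1, b.2.1, b.2.2.trans (by simp)⟩, rfl⟩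
      rw [Matrix.mul_apply, Finset.sum_eq_single b₀]
      · rw [conjTranspose_apply, Matrix.diagonal_apply]
        change star (if b₀.1 = b.1 then _ else (0 : ℂ)) * (if b₀.1 = b'.1 then _ else (0 : ℂ)) = _
        rw [if_pos hb₀, hb₀]
        by_cases hb : b = b'
        · subst hb
          rw [if_pos rfl, if_pos rfl, Complex.star_def, Complex.conj_ofReal]
          exact_mod_cast Real.mul_self_sqrt (sub_nonneg.mpr (he k b.2.2.le))
        · rw [if_neg hb, if_neg fun h => hb (Subtype.ext h), mul_zero]
      · intro b'' _ hb
        rw [conjTranspose_apply]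
        change star (if b''.1 = b.1 then _ else (0 : ℂ)) * _ = _
        rw [if_neg fun h => hb (Subtype.ext (h.trans hb₀.symm)), star_zero, zero_mul]
      · simp
  rw [starMoment_succ, h1]
  ext b b'
  have h2 : (armMap (starRep e h) k i * (armMap (starRep e h) k i)ᴴ) b b' =
      if b = b' then ((e k b.1 - e k i : ℝ) : ℂ) else 0 := by
    rw [Matrix.mul_apply]
    by_cases hb : b.1.val < i.val
    · obtain ⟨b₀, hb₀⟩ : ∃ b₀ : starIdx c B (some ⟨k, i.castSucc⟩), b₀.1 = b.1 :=
        ⟨⟨b.1, b.2.1, hb⟩, rfl⟩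
      rw [Finset.sum_eq_single b₀]
      · rw [conjTranspose_apply]
        change (if b.1 = b₀.1 then _ else (0 : ℂ)) * star (if b'.1 = b₀.1 then _ else (0 : ℂ)) = _
        rw [if_pos hb₀.symm, hb₀]
        by_cases hb' : b = b'
        · subst hb'
          rw [if_pos rfl, if_pos rfl, Complex.star_def, Complex.conj_ofReal]
          exact_mod_cast Real.mul_self_sqrt (sub_nonneg.mpr (he k hb.le))
        · rw [if_neg hb', if_neg fun h => hb' (Subtype.ext h.symm), star_zero, mul_zero]
      · intro b'' _ hb
        change (if b.1 = b''.1 then _ else (0 : ℂ)) * _ = _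
        rw [if_neg fun h => hb (Subtype.ext (h.symm.trans hb₀.symm)), zero_mul]
      · simp
    · have h3 : b.1.val = i.val := by
        have := b.2.2
        simp only [Fin.val_succ] at this
        omega
      rw [Finset.sum_eq_zero, h3, sub_self, Complex.ofReal_zero, ite_self]
      intro b'' _
      change (if b.1 = b''.1 then _ else (0 : ℂ)) * _ = _
      rw [if_neg, zero_mul]
      intro h
      have := b''.2.2
      rw [← h, h3] at this
      simp at this
  rw [Matrix.sub_apply, h2, Matrix.diagonal_apply, Matrix.smul_apply, Matrix.one_apply]
  by_cases hb : b = b'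
  · simp only [if_pos hb, Fin.val_succ, smul_eq_mul, mul_one]
    push_cast
    ring
  · simp [if_neg hb]

end Arms

section Triple

/-- The lengths of three arms, indexed by `Option Bool`. -/
@[reducible] def triLen (a b c : ℕ) : Option Bool → ℕ
  | none => a
  | some false => b
  | some true => c

/-- A family indexed by `Option Bool`. -/
@[reducible] def triFun {α : Type} (a b c : α) : Option Bool → α
  | none => a
  | some false => b
  | some true => c

/-- A family of finite sets indexed by `Option Bool`. -/
@[reducible] def triSet {a b c : ℕ} (A : Finset (Fin a)) (B : Finset (Fin b)) (C : Finset (Fin c)) :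
    ∀ k, Finset (Fin (triLen a b c k))
  | none => A
  | some false => B
  | some true => C

variable {a b c : ℕ} {A : Finset (Fin a)} {B : Finset (Fin b)} {C : Finset (Fin c)}

/-- The index set at the end of an arm. -/
def starIdxLast {K : Type} {L : K → ℕ} (z : Type) (B : ∀ k, Finset (Fin (L k))) (k : K) :
    starIdx z B (some ⟨k, Fin.last _⟩) ≃ B k where
  toFun b := ⟨b.1, b.2.1⟩
  invFun b := ⟨b.1, b.2, b.1.2⟩
  left_inv _ := rfl
  right_inv _ := rfl

/-- A Hermitian matrix with given eigenvalues, whose diagonal blocks have given eigenvalues, yields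
a solution of the moment map equation for a star with three arms. -/
theorem exists_isMoment_of_isHermitian {m n : Type} [Fintype m] [Fintype n] [DecidableEq m]
    [DecidableEq n] {M : Matrix (m ⊕ n) (m ⊕ n) ℂ} (hM : M.IsHermitian) {e : Option Bool → ℕ → ℝ}
    {w : ℝ} (he : ∀ k, Antitone (e k)) (he0 : ∀ k, e k (triLen a b c k) = 0)
    (hw : ∀ j : A, e none j ≤ w) (hA : HasSpec M fun j : A => e none j)
    (hB : HasSpec M.toBlocks₁₁ fun j : B => w - e (some false) j)
    (hC : HasSpec M.toBlocks₂₂ fun j : C => w - e (some true) j) :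
    ∃ x : QRep (starSrc (triLen a b c)) (starTgt (triLen a b c)) (starIdx (m ⊕ n) (triSet A B C)),
      IsMoment x (starWeight e w) := by
  have hM1 : M.toBlocks₁₁.IsHermitian := by
    ext i j; exact congrFun (congrFun hM (.inl i)) (.inl j)
  have hM2 : M.toBlocks₂₂.IsHermitian := by
    ext i j; exact congrFun (congrFun hM (.inr i)) (.inr j)
  have hc1 : ∀ {l : Type} [Fintype l] [DecidableEq l] {N : Matrix l l ℂ}, N.IsHermitian →
      ((w : ℂ) • 1 - N).IsHermitian := fun hN => by
    refine IsHermitian.sub ?_ hN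
    rw [IsHermitian, conjTranspose_smul, conjTranspose_one]
    simp
  have hnn : ∀ k (j : Fin (triLen a b c k)), 0 ≤ e k j := fun k j => he0 k ▸ he k j.2.le
  obtain ⟨Z, hZ, hZ'⟩ := (hA.const_sub hM w).exists_sqrt (hc1 hM) fun j =>
    sub_nonneg.mpr (hw j)
  obtain ⟨VF, hVF, hVF', hMF⟩ := (hA.comp_equiv (starIdxLast (m ⊕ n) (triSet A B C) none)).exists_conj
    hM
  obtain ⟨VB, hVB, hVB', hMB⟩ := ((hB.const_sub hM1 w).comp_equiv
    (starIdxLast (m ⊕ n) (triSet A B C) (some false))).exists_conj (hc1 hM1)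
  obtain ⟨VC, hVC, hVC', hMC⟩ := ((hC.const_sub hM2 w).comp_equiv
    (starIdxLast (m ⊕ n) (triSet A B C) (some true))).exists_conj (hc1 hM2)
  obtain ⟨Z1, hZ1⟩ : ∃ Z1 : Matrix (m ⊕ n) m ℂ, Z1 = Z.toCols₁ := ⟨_, rfl⟩
  obtain ⟨Z2, hZ2⟩ : ∃ Z2 : Matrix (m ⊕ n) n ℂ, Z2 = Z.toCols₂ := ⟨_, rfl⟩
  have hZc : Z = fromCols Z1 Z2 := by rw [hZ1, hZ2, fromCols_toCols]
  rw [hZc, conjTranspose_fromCols_eq_fromRows_conjTranspose] at hZ hZ'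
  rw [fromRows_mul_fromCols] at hZ
  rw [fromCols_mul_fromRows] at hZ'
  have hZ11 : Z1ᴴ * Z1 = (w : ℂ) • 1 - M.toBlocks₁₁ := by
    rw [← toBlocks_fromBlocks₁₁ (Z1ᴴ * Z1) (Z1ᴴ * Z2) (Z2ᴴ * Z1) (Z2ᴴ * Z2), hZ]
    ext i j
    simp [toBlocks₁₁, Matrix.one_apply]
  have hZ22 : Z2ᴴ * Z2 = (w : ℂ) • 1 - M.toBlocks₂₂ := by
    rw [← toBlocks_fromBlocks₂₂ (Z1ᴴ * Z1) (Z1ᴴ * Z2) (Z2ᴴ * Z1) (Z2ᴴ * Z2), hZ]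
    ext i j
    simp [toBlocks₂₂, Matrix.one_apply]
  obtain ⟨hf, hhf⟩ : ∃ hf : Matrix (m ⊕ n) (starIdx (m ⊕ n) (triSet A B C)
      (some ⟨none, Fin.last _⟩)) ℂ, hf = VF * (diagonal (fun j => ((Real.sqrt (e none j.1) : ℝ) : ℂ)) :
        Matrix (starIdx (m ⊕ n) (triSet A B C) (some ⟨none, Fin.last _⟩))
          (starIdx (m ⊕ n) (triSet A B C) (some ⟨none, Fin.last _⟩)) ℂ) := ⟨_, rfl⟩
  have hsq : (diagonal (fun j => ((Real.sqrt (e none j.1) : ℝ) : ℂ)) :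
        Matrix (starIdx (m ⊕ n) (triSet A B C) (some ⟨none, Fin.last _⟩))
          (starIdx (m ⊕ n) (triSet A B C) (some ⟨none, Fin.last _⟩)) ℂ) *
      (diagonal (fun j => ((Real.sqrt (e none j.1) : ℝ) : ℂ)))ᴴ =
      diagonal fun j => (e none j.1 : ℂ) := by
    rw [diagonal_conjTranspose, diagonal_mul_diagonal]
    congr 1
    funext j
    rw [Pi.star_apply, Complex.star_def, Complex.conj_ofReal]
    exact_mod_cast Real.mul_self_sqrt (hnn none j.1)
  have hsq' : (diagonal (fun j => ((Real.sqrt (e none j.1) : ℝ) : ℂ)) :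
        Matrix (starIdx (m ⊕ n) (triSet A B C) (some ⟨none, Fin.last _⟩))
          (starIdx (m ⊕ n) (triSet A B C) (some ⟨none, Fin.last _⟩)) ℂ)ᴴ *
      (diagonal (fun j => ((Real.sqrt (e none j.1) : ℝ) : ℂ))) =
      diagonal fun j => (e none j.1 : ℂ) := by
    rw [← hsq, diagonal_conjTranspose, diagonal_mul_diagonal, diagonal_mul_diagonal]
    congr 1
    funext j
    exact mul_comm _ _
  obtain ⟨h, hhd⟩ : ∃ h : ∀ k, Matrix (m ⊕ n) (starIdx (m ⊕ n) (triSet A B C)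
      (some ⟨k, Fin.last _⟩)) ℂ, h = fun k => match k with
        | none => hf
        | some false => Z1 * VB
        | some true => Z2 * VC := ⟨_, rfl⟩
  have hh : ∀ k, (h k)ᴴ * h k = diagonal fun j => (e k j.1 : ℂ) := fun k => by
    rw [hhd]
    match k with
    | none =>
      simp only
      rw [hhf, conjTranspose_mul, Matrix.mul_assoc, ← Matrix.mul_assoc VFᴴ, hVF, Matrix.one_mul,
        hsq']
    | some false =>
      simp only
      rw [conjTranspose_mul, Matrix.mul_assoc, ← Matrix.mul_assoc Z1ᴴ, hZ11, hMB, ← Matrix.mul_assoc,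
        ← Matrix.mul_assoc, ← Matrix.mul_assoc, hVB, Matrix.one_mul, Matrix.mul_assoc, hVB,
        Matrix.mul_one]
      congr 1
      funext j
      rw [Function.comp_apply, sub_sub_cancel]
      rfl
    | some true =>
      simp only
      rw [conjTranspose_mul, Matrix.mul_assoc, ← Matrix.mul_assoc Z2ᴴ, hZ22, hMC, ← Matrix.mul_assoc,
        ← Matrix.mul_assoc, ← Matrix.mul_assoc, hVC, Matrix.one_mul, Matrix.mul_assoc, hVC,
        Matrix.mul_one]
      congr 1
      funext j
      rw [Function.comp_apply, sub_sub_cancel]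
      rfl
  refine ⟨starRep e h, (isMoment_star_iff _ _).mpr fun v => ?_⟩
  rcases v with - | ⟨k, i⟩
  · rw [starMoment_none, Fintype.sum_option, Fintype.sum_bool]
    change h none * (h none)ᴴ + (h (some true) * (h (some true))ᴴ +
      h (some false) * (h (some false))ᴴ) = (w : ℂ) • 1
    have h1 : h none * (h none)ᴴ = M := by
      have : h none = hf := by rw [hhd]
      rw [this, hhf, conjTranspose_mul, Matrix.mul_assoc, ← Matrix.mul_assoc (diagonal _), hsq,
        ← Matrix.mul_assoc]
      exact hMF.symm
    have h2 : h (some false) * (h (some false))ᴴ = Z1 * Z1ᴴ := by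
      have : h (some false) = Z1 * VB := by rw [hhd]
      rw [this, conjTranspose_mul, Matrix.mul_assoc, ← Matrix.mul_assoc VB, hVB', Matrix.one_mul]
    have h3 : h (some true) * (h (some true))ᴴ = Z2 * Z2ᴴ := by
      have : h (some true) = Z2 * VC := by rw [hhd]
      rw [this, conjTranspose_mul, Matrix.mul_assoc, ← Matrix.mul_assoc VC, hVC', Matrix.one_mul]
    rw [h1, h2, h3, add_comm (Z2 * Z2ᴴ), hZ', add_sub_cancel]
    rfl
  · induction i using Fin.cases with
    | zero =>
      ext j
      exact absurd j.2.2 (Nat.not_lt_zero _)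
    | succ i => exact starMoment_starRep he he0 hh k i

/-- A solution of the moment map equation for a star with three arms yields a Hermitian matrix with
given eigenvalues, whose diagonal blocks have given eigenvalues. -/
theorem exists_isHermitian_of_starMoment {ι : StarV (triLen a b c) → Type} [∀ v, Fintype (ι v)]
    [∀ v, DecidableEq (ι v)] {x : QRep (starSrc (triLen a b c)) (starTgt (triLen a b c)) ι}
    (hd : ∀ k i, Fintype.card (ι (some ⟨k, i⟩)) =
      ((triSet A B C k).filter fun j => j.val < i.val).card)
    (hc : Fintype.card (ι none) = A.card) (hABC : A.card = B.card + C.card)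
    {e : Option Bool → ℕ → ℝ} {w : ℝ} (he0 : ∀ k, e k (triLen a b c k) = 0)
    (hx : ∀ k (i : Fin (triLen a b c k)), starMoment x (some ⟨k, i.succ⟩) =
      ((e k (i + 1) - e k i : ℝ) : ℂ) • 1) (hx0 : starMoment x none = (w : ℂ) • 1) :
    ∃ (m n : Type) (_ : Fintype m) (_ : Fintype n) (_ : DecidableEq m) (_ : DecidableEq n)
      (M : Matrix (m ⊕ n) (m ⊕ n) ℂ), Fintype.card m = B.card ∧ Fintype.card n = C.card ∧
      M.IsHermitian ∧ HasSpec M (fun j : A => e none j) ∧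
      HasSpec M.toBlocks₁₁ (fun j : B => w - e (some false) j) ∧
      HasSpec M.toBlocks₂₂ fun j : C => w - e (some true) j := by
  have hl : ∀ k, Fintype.card (ι (some ⟨k, Fin.last _⟩)) = (triSet A B C k).card := fun k => by
    rw [hd, Finset.filter_true_of_mem]
    exact fun j _ => j.2
  have hs := fun k => hasSpec_armLast x (hd k) (hx k) (he0 k)
  obtain ⟨f, hf⟩ : ∃ f, f = armLast x none := ⟨_, rfl⟩
  obtain ⟨z₁, hz₁⟩ : ∃ z, z = armLast x (some false) := ⟨_, rfl⟩
  obtain ⟨z₂, hz₂⟩ : ∃ z, z = armLast x (some true) := ⟨_, rfl⟩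
  rw [starMoment_none, Fintype.sum_option, Fintype.sum_bool, ← hf, ← hz₁, ← hz₂] at hx0
  have hF := hs none
  have h1 := hs (some false)
  have h2 := hs (some true)
  rw [← hf] at hF
  rw [← hz₁] at h1
  rw [← hz₂] at h2
  have hcw : ∀ {l : Type} [Fintype l] [DecidableEq l], ((w : ℂ) • (1 : Matrix l l ℂ)).IsHermitian :=
    fun {l} _ _ => by
    rw [IsHermitian, conjTranspose_smul, conjTranspose_one]
    simp
  obtain ⟨Z, hZ⟩ : ∃ Z, Z = fromCols z₁ z₂ := ⟨_, rfl⟩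
  have hZZ : Z * Zᴴ = (w : ℂ) • 1 - f * fᴴ := by
    rw [hZ, conjTranspose_fromCols_eq_fromRows_conjTranspose, fromCols_mul_fromRows, ← hx0]
    abel
  have hZZ' : Zᴴ * Z = fromBlocks (z₁ᴴ * z₁) (z₁ᴴ * z₂) (z₂ᴴ * z₁) (z₂ᴴ * z₂) := by
    rw [hZ, conjTranspose_fromCols_eq_fromRows_conjTranspose, fromRows_mul_fromCols]
  have hM := (isHermitian_conjTranspose_mul_self Z)
  refine ⟨_, _, inferInstance, inferInstance, inferInstance, inferInstance,
    (w : ℂ) • 1 - Zᴴ * Z, hl (some false), hl (some true), hcw.sub hM, ?_, ?_, ?_⟩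
  · have h3 := (hF.mul_comm ((hl none).trans hc.symm)).const_sub
      (isHermitian_mul_conjTranspose_self f) w
    rw [← hZZ] at h3
    have h4 := (h3.mul_comm (by
      rw [Fintype.card_sum, hl, hl, hc]
      exact hABC)).const_sub hM w
    simpa only [sub_sub_cancel] using h4
  · have h3 := h1.const_sub (isHermitian_conjTranspose_mul_self z₁) w
    have : ((w : ℂ) • 1 - Zᴴ * Z).toBlocks₁₁ = (w : ℂ) • 1 - z₁ᴴ * z₁ := by
      rw [hZZ']
      ext i j
      simp [toBlocks₁₁, Matrix.one_apply]
    rw [this]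
    exact h3
  · have h3 := h2.const_sub (isHermitian_conjTranspose_mul_self z₂) w
    have : ((w : ℂ) • 1 - Zᴴ * Z).toBlocks₂₂ = (w : ℂ) • 1 - z₂ᴴ * z₂ := by
      rw [hZZ']
      ext i j
      simp [toBlocks₂₂, Matrix.one_apply]
    rw [this]
    exact h3

end Triple

section Partitions

/-- The part `b - #{a ∈ B | a < b}` of the partition attached to a set `B`. -/
def muE {l : ℕ} (B : Finset (Fin l)) (b : Fin l) : ℝ := b - (B.filter (· < b)).card

theorem card_filter_lt_orderIsoOfFin {l r : ℕ} {B : Finset (Fin l)} (h : B.card = r) (j : Fin r) :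
    (B.filter (· < (B.orderIsoOfFin h j).1)).card = j := by
  have : B.filter (· < (B.orderIsoOfFin h j).1) =
      (Finset.univ.filter (· < j)).map
        ((B.orderIsoOfFin h).toEmbedding.trans (Function.Embedding.subtype _)) := by
    ext x
    simp only [Finset.mem_filter, Finset.mem_map, Finset.mem_univ, true_and,
      Function.Embedding.trans_apply, Function.Embedding.subtype_apply]
    constructor
    · rintro ⟨hx, hlt⟩
      refine ⟨(B.orderIsoOfFin h).symm ⟨x, hx⟩, ?_, by simp⟩
      rw [OrderIso.symm_apply_lt]
      exact hlt
    · rintro ⟨i, hi, rfl⟩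
      exact ⟨(B.orderIsoOfFin h i).2, (B.orderIsoOfFin h).lt_iff_lt.mpr hi⟩
  rw [this, Finset.card_map, Finset.filter_gt_eq_Iio, Fin.card_Iio]

theorem muVec_eq_muE {l r : ℕ} (B : Finset (Fin l)) (h : B.card = r) (j : Fin r) :
    muVec B h j = muE B (B.orderIsoOfFin h j.rev).1 := by
  rw [muVec, muE, card_filter_lt_orderIsoOfFin]

theorem antitone_muVec {l r : ℕ} (B : Finset (Fin l)) (h : B.card = r) : Antitone (muVec B h) := by
  have key : Monotone fun j : Fin r => (((B.orderIsoOfFin h j).1.val : ℤ) - j.val) := by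
    cases r with
    | zero => exact fun i => i.elim0
    | succ r =>
      refine Fin.monotone_iff_le_succ.mpr fun i => ?_
      have : (B.orderIsoOfFin h i.castSucc).1.val < (B.orderIsoOfFin h i.succ).1.val :=
        (B.orderIsoOfFin h).lt_iff_lt.mpr i.castSucc_lt_succ
      simp only [Fin.val_castSucc, Fin.val_succ]
      push_cast
      omega
  intro i j hij
  have := key (Fin.rev_le_rev.mpr hij)
  simp only [muVec]
  exact_mod_cast this

/-- A Hermitian matrix has the spectrum `muE B` if and only if its eigenvalues are `muVec B`. -/
theorem hasSpec_muE_iff {l r : ℕ} (B : Finset (Fin l)) (h : B.card = r)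
    {M : Matrix (Fin r) (Fin r) ℂ} (hM : M.IsHermitian) :
    HasSpec M (fun j : B => muE B j) ↔ muVec B h = eigVec M hM := by
  obtain ⟨σ, hσ⟩ : ∃ σ : Fin r ≃ B, σ = Fin.revPerm.trans (B.orderIsoOfFin h).toEquiv := ⟨_, rfl⟩
  have h1 : (fun j : B => muE B j) ∘ σ = muVec B h := by
    funext j
    rw [muVec_eq_muE, hσ]
    rfl
  have h2 : muVec B h ∘ σ.symm = fun j : B => muE B j := by
    rw [← h1, Function.comp_assoc, Equiv.self_comp_symm, Function.comp_id]
  constructor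
  · intro hs
    refine (eigVec_eq_of_hasSpec hM (antitone_muVec B h) ?_).symm
    rw [← h1]
    exact hs.comp_equiv σ
  · intro hs
    rw [← h2, hs]
    exact (hasSpec_eigVec M hM).comp_equiv σ.symm

/-- The weights on the arm of a star quiver coming from its Euler form. -/
def gapFun {l : ℕ} (B : Finset (Fin l)) (g : ℝ) (i : ℕ) : ℝ :=
  if i < l then g - (Bᶜ.filter fun j => j.val ≤ i).card else 0

theorem gapFun_length {l : ℕ} (B : Finset (Fin l)) (g : ℝ) : gapFun B g l = 0 :=
  if_neg (lt_irrefl l)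

theorem antitone_gapFun {l : ℕ} {B : Finset (Fin l)} {g : ℝ} (h : (l : ℝ) ≤ g + B.card) :
    Antitone (gapFun B g) := by
  intro i j hij
  simp only [gapFun]
  by_cases hj : j < l
  · rw [if_pos hj, if_pos (by omega)]
    gcongr
  · rw [if_neg hj]
    split_ifs with hi
    · have h1 : (Bᶜ.filter fun j => j.val ≤ i).card ≤ Bᶜ.card :=
        Finset.card_le_card (Finset.filter_subset _ _)
      rw [Finset.card_compl, Fintype.card_fin] at h1
      have h2 := Finset.card_le_univ B
      rw [Fintype.card_fin] at h2
      have h3 : ((Bᶜ.filter fun j => j.val ≤ i).card : ℝ) + B.card ≤ l := by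
        exact_mod_cast (by omega : (Bᶜ.filter fun j => j.val ≤ i).card + B.card ≤ l)
      linarith
    · exact le_rfl

theorem gapFun_le {l : ℕ} (B : Finset (Fin l)) (g : ℝ) (i : Fin l) : gapFun B g i ≤ g := by
  rw [gapFun, if_pos i.2]
  exact sub_le_self _ (Nat.cast_nonneg _)

theorem gapFun_eq {l : ℕ} {B : Finset (Fin l)} (g : ℝ) {b : Fin l} (hb : b ∈ B) :
    gapFun B g b = g - muE B b := by
  have h1 : (Bᶜ.filter fun j => j.val ≤ b.val) ∪ B.filter (· < b) = Finset.univ.filter (· < b) := by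
    ext j
    simp only [Finset.mem_union, Finset.mem_filter, Finset.mem_compl, Finset.mem_univ, true_and]
    constructor
    · rintro (⟨h, h'⟩ | ⟨-, h⟩)
      · exact lt_of_le_of_ne h' fun h'' => h (h'' ▸ hb)
      · exact h
    · intro h
      by_cases hj : j ∈ B
      · exact Or.inr ⟨hj, h⟩
      · exact Or.inl ⟨hj, h.le⟩
  have h2 : Disjoint (Bᶜ.filter fun j => j.val ≤ b.val) (B.filter (· < b)) := by
    rw [Finset.disjoint_left]
    intro j hj hj'
    exact Finset.mem_compl.mp (Finset.mem_filter.mp hj).1 (Finset.mem_filter.mp hj').1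
  have h3 := congrArg Finset.card h1
  rw [Finset.card_union_of_disjoint h2, Finset.filter_gt_eq_Iio, Fin.card_Iio] at h3
  have h4 : ((Bᶜ.filter fun j => j.val ≤ b.val).card : ℝ) + (B.filter (· < b)).card = b.val := by
    exact_mod_cast h3
  rw [gapFun, if_pos b.2, muE, ← h4]
  ring

theorem mem_opp {l : ℕ} {A : Finset (Fin l)} {i : Fin l} : i ∈ opp A ↔ i.rev ∈ A := by
  rw [opp, Finset.mem_image]
  exact ⟨fun ⟨a, ha, h⟩ => by rwa [← h, Fin.rev_rev], fun h => ⟨_, h, Fin.rev_rev i⟩⟩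

theorem card_opp {l : ℕ} (A : Finset (Fin l)) : (opp A).card = A.card :=
  Finset.card_image_of_injective _ Fin.rev_injective

/-- The reversal of a set. -/
def oppEquiv {l : ℕ} (A : Finset (Fin l)) : A ≃ opp A :=
  Fin.revPerm.subtypeEquiv fun a => by rw [mem_opp, Fin.revPerm_apply, Fin.rev_rev]

theorem muE_opp {l : ℕ} (A : Finset (Fin l)) {a : Fin l} (ha : a ∈ A) :
    (l : ℝ) - A.card - muE (opp A) a.rev = muE A a := by
  have h1 : (opp A).filter (· < a.rev) = (A.filter (a < ·)).image Fin.rev := by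
    ext j
    simp only [Finset.mem_filter, mem_opp, Finset.mem_image]
    constructor
    · rintro ⟨h, h'⟩
      exact ⟨j.rev, ⟨h, by rwa [Fin.lt_rev_iff] at h' ⟩, Fin.rev_rev j⟩
    · rintro ⟨i, ⟨h, h'⟩, rfl⟩
      exact ⟨by rwa [Fin.rev_rev], Fin.rev_lt_rev.mpr h'⟩
  have h2 : A.card = (A.filter (· < a)).card + 1 + (A.filter (a < ·)).card := by
    have h3 : A = insert a ((A.filter (· < a)) ∪ A.filter (a < ·)) := by
      ext j
      simp only [Finset.mem_insert, Finset.mem_union, Finset.mem_filter]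
      rcases lt_trichotomy j a with h | h | h
      · simp [h, h.ne, h.not_gt]
      · simp [h, ha]
      · simp [h, h.ne', h.not_gt]
    conv_lhs => rw [h3]
    rw [Finset.card_insert_of_notMem (by simp), Finset.card_union_of_disjoint]
    · ring
    · rw [Finset.disjoint_left]
      intro j hj hj'
      exact (Finset.mem_filter.mp hj).2.not_gt (Finset.mem_filter.mp hj').2
  have h4 : (a.rev.val : ℝ) = l - (a.val + 1) := by
    rw [Fin.val_rev, Nat.cast_sub a.2]
    push_cast
    ring
  rw [muE, muE, h1, Finset.card_image_of_injective _ Fin.rev_injective, h2, h4]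
  push_cast
  ring

theorem eulerWeight_starDim {K : Type} [Fintype K] [DecidableEq K] {L : K → ℕ}
    (B : ∀ k, Finset (Fin (L k))) (g : ℕ) (v : StarV L) (hv : ∀ k, v ≠ some ⟨k, 0⟩) :
    eulerWeight (starSrc L) (starTgt L) (starDim (fun k => (B k)ᶜ) g) v =
      starWeight (fun k => gapFun (B k) g) g v := by
  rcases v with - | ⟨k, i⟩
  · rw [eulerWeight, Finset.sum_eq_zero]
    · rw [sub_zero]
      rfl
    · rintro (a | k) -
      · exact if_neg (by simp)
      · exact if_neg (by simp)
  · induction i using Fin.cases with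
    | zero => exact absurd rfl (hv k)
    | succ i =>
      have hi1 : gapFun (B k) g i = g - ((B k)ᶜ.filter fun j => j.val < i.val + 1).card := by
        rw [gapFun, if_pos i.2]
        simp only [Nat.lt_succ_iff]
      by_cases hi : i.val + 1 < L k
      · have hi' : i.succ = Fin.castSucc ⟨i.val + 1, hi⟩ := rfl
        rw [eulerWeight, Finset.sum_eq_single (.inl ⟨k, ⟨i.val + 1, hi⟩⟩), if_pos (by rw [hi'])]
        · simp only [starDim, starWeight, Fin.val_succ, Nat.add_sub_cancel, hi1]
          rw [gapFun, if_pos hi]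
          simp only [Nat.lt_succ_iff]
          ring
        · rintro (⟨k', j⟩ | k') - hne
          · refine if_neg fun h => hne ?_
            obtain ⟨rfl, h⟩ := Sigma.mk.inj (Option.some.inj h)
            congr 2
            have := congrArg Fin.val (eq_of_heq h)
            exact Fin.ext this
          · refine if_neg fun h => ?_
            obtain ⟨rfl, h⟩ := Sigma.mk.inj (Option.some.inj h)
            have := congrArg Fin.val (eq_of_heq h)
            simp at this
            omega
        · simp
      · have hl : i.val + 1 = L k := by have := i.2; omega
        have hi' : i.succ = Fin.last _ := Fin.ext hl
        rw [eulerWeight, Finset.sum_eq_single (.inr k), if_pos (by rw [hi'])]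
        · simp only [starDim, starWeight, Fin.val_succ, Nat.add_sub_cancel, hi1]
          rw [gapFun, if_neg hi]
          ring
        · rintro (⟨k', j⟩ | k') - hne
          · refine if_neg fun h => ?_
            obtain ⟨rfl, h⟩ := Sigma.mk.inj (Option.some.inj h)
            have := congrArg Fin.val (eq_of_heq h)
            have hj : j.val < L k' := j.2
            have h' : j.val = i.val + 1 := this
            have hl' : i.val + 1 = L k' := hl
            omega
          · refine if_neg fun h => hne ?_
            obtain ⟨rfl, h⟩ := Sigma.mk.inj (Option.some.inj h)
            rfl
        · simp

variable {a b c : ℕ} {A : Finset (Fin a)} {B : Finset (Fin b)} {C : Finset (Fin c)}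

theorem exists_isMoment_of_mem_LRcone (ha : a = b + c) (hA : A.card = B.card + C.card)
    (h : (muVec A hA, muVec B rfl, muVec C rfl) ∈ LRcone B.card C.card) :
    ∃ x : QRep (starSrc (triLen a b c)) (starTgt (triLen a b c))
        (starIdx (Fin B.card ⊕ Fin C.card) (triSet (opp A) B C)),
      IsMoment x (eulerWeight (starSrc (triLen a b c)) (starTgt (triLen a b c))
        (starDim (fun k => (triSet (opp A) B C k)ᶜ) (a - A.card))) := by
  obtain ⟨M, hM, h1, h2, h3⟩ := h
  have hle := Finset.card_le_univ A
  have hB := Finset.card_le_univ B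
  have hC := Finset.card_le_univ C
  rw [Fintype.card_fin] at hle hB hC
  have hg : ((a - A.card : ℕ) : ℝ) = a - A.card := Nat.cast_sub hle
  have ha' : (a : ℝ) = b + c := by exact_mod_cast ha
  have hA' : (A.card : ℝ) = B.card + C.card := by exact_mod_cast hA
  have hB' : (B.card : ℝ) ≤ b := by exact_mod_cast hB
  have hC' : (C.card : ℝ) ≤ c := by exact_mod_cast hC
  obtain ⟨e, he⟩ : ∃ e : Option Bool → ℕ → ℝ,
    e = fun k => gapFun (triSet (opp A) B C k) (a - A.card : ℕ) := ⟨_, rfl⟩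
  obtain ⟨N, hN⟩ : ∃ N : Matrix (Fin B.card ⊕ Fin C.card) (Fin B.card ⊕ Fin C.card) ℂ,
    N = M.submatrix finSumFinEquiv finSumFinEquiv := ⟨_, rfl⟩
  have hNH : N.IsHermitian := hN ▸ hM.submatrix _
  obtain ⟨x, hx⟩ := exists_isMoment_of_isHermitian (A := opp A) (B := B) (C := C) hNH (e := e)
    (w := (a - A.card : ℕ)) (fun k => by
      rw [he]
      apply antitone_gapFun
      match k with
      | none =>
        change (a : ℝ) ≤ _ + ((opp A).card : ℝ)
        rw [card_opp, hg]; linarith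
      | some false => change (b : ℝ) ≤ _ + (B.card : ℝ); linarith
      | some true => change (c : ℝ) ≤ _ + (C.card : ℝ); linarith)
    (fun k => by rw [he]; exact gapFun_length _ _) (fun j => by rw [he]; exact gapFun_le _ _ _)
    (by
      have h4 := (((hasSpec_muE_iff A hA hM).mpr h1).submatrix finSumFinEquiv).comp_equiv
        (oppEquiv A).symm
      rw [← hN] at h4
      convert h4 using 1
      funext j
      obtain ⟨j, rfl⟩ := (oppEquiv A).surjective j
      rw [Function.comp_apply, Equiv.symm_apply_apply, he]
      change gapFun (opp A) _ (j.1.rev : Fin a) = _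
      rw [gapFun_eq _ (mem_opp.mpr (by rw [Fin.rev_rev]; exact j.2)), hg]
      exact muE_opp A j.2)
    (by
      have h4 := (hasSpec_muE_iff B rfl (hM.submatrix (Fin.castAdd _))).mpr h2
      have h5 : N.toBlocks₁₁ = M.submatrix (Fin.castAdd _) (Fin.castAdd _) := by
        rw [hN]; rfl
      rw [h5]
      convert h4 using 1
      funext j
      rw [he]
      change _ - gapFun B _ _ = _
      rw [gapFun_eq _ j.2, sub_sub_cancel])
    (by
      have h4 := (hasSpec_muE_iff C rfl (hM.submatrix (Fin.natAdd _))).mpr h3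
      have h5 : N.toBlocks₂₂ = M.submatrix (Fin.natAdd _) (Fin.natAdd _) := by
        rw [hN]; rfl
      rw [h5]
      convert h4 using 1
      funext j
      rw [he]
      change _ - gapFun C _ _ = _
      rw [gapFun_eq _ j.2, sub_sub_cancel])
  refine ⟨x, (isMoment_star_iff _ _).mpr fun v => ?_⟩
  by_cases hv : ∀ k, v ≠ some ⟨k, 0⟩
  · rw [eulerWeight_starDim _ _ _ hv, (isMoment_star_iff _ _).mp hx v, he]
  · push Not at hv
    obtain ⟨k, rfl⟩ := hv
    ext j
    exact absurd j.2.2 (Nat.not_lt_zero _)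

theorem mem_LRcone_of_isMoment (hA : A.card = B.card + C.card)
    {ι : StarV (triLen a b c) → Type} [∀ v, Fintype (ι v)] [∀ v, DecidableEq (ι v)]
    (hι : ∀ v, Fintype.card (ι v) = starDim (triSet (opp A) B C) A.card v)
    {x : QRep (starSrc (triLen a b c)) (starTgt (triLen a b c)) ι}
    (hx : IsMoment x (eulerWeight (starSrc (triLen a b c)) (starTgt (triLen a b c))
        (starDim (fun k => (triSet (opp A) B C k)ᶜ) (a - A.card)))) :
    (muVec A hA, muVec B rfl, muVec C rfl) ∈ LRcone B.card C.card := by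
  have hle := Finset.card_le_univ A
  rw [Fintype.card_fin] at hle
  have hg : ((a - A.card : ℕ) : ℝ) = a - A.card := Nat.cast_sub hle
  rw [isMoment_star_iff] at hx
  obtain ⟨e, he⟩ : ∃ e : Option Bool → ℕ → ℝ,
    e = fun k => gapFun (triSet (opp A) B C k) (a - A.card : ℕ) := ⟨_, rfl⟩
  obtain ⟨m, n, _, _, _, _, M, hm, hn, hM, h1, h2, h3⟩ := exists_isHermitian_of_starMoment
    (A := opp A) (B := B) (C := C) (x := x) (fun k i => hι _) ((hι none).trans (card_opp A).symm)
    ((card_opp A).trans hA) (e := e) (w := (a - A.card : ℕ))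
    (fun k => by rw [he]; exact gapFun_length _ _)
    (fun k i => by
      rw [hx, eulerWeight_starDim _ _ _ (by simp), he]
      rfl)
    (by
      rw [hx, eulerWeight_starDim _ _ _ (by simp)]
      rfl)
  obtain ⟨σ⟩ : Nonempty (Fin B.card ≃ m) :=
    Fintype.card_eq.mp (by rw [Fintype.card_fin, hm])
  obtain ⟨τ⟩ : Nonempty (Fin C.card ≃ n) :=
    Fintype.card_eq.mp (by rw [Fintype.card_fin, hn])
  obtain ⟨θ, hθ⟩ : ∃ θ : Fin (B.card + C.card) ≃ m ⊕ n,
    θ = finSumFinEquiv.symm.trans (σ.sumCongr τ) := ⟨_, rfl⟩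
  refine ⟨M.submatrix θ θ, hM.submatrix _, ?_, ?_, ?_⟩
  · refine (hasSpec_muE_iff A hA _).mp ?_
    convert (h1.submatrix θ).comp_equiv (oppEquiv A) using 1
    funext j
    rw [Function.comp_apply, he]
    change _ = gapFun (opp A) _ (j.1.rev : Fin a)
    rw [gapFun_eq _ (mem_opp.mpr (by rw [Fin.rev_rev]; exact j.2)), hg]
    exact (muE_opp A j.2).symm
  · refine (hasSpec_muE_iff B rfl _).mp ?_
    have h5 : (M.submatrix θ θ).submatrix (Fin.castAdd _) (Fin.castAdd _) =
        M.toBlocks₁₁.submatrix σ σ := by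
      ext i j
      simp [hθ, toBlocks₁₁]
    simp only [h5]
    convert h2.submatrix σ using 1
    funext j
    rw [he]
    change _ = _ - gapFun B _ _
    rw [gapFun_eq _ j.2, sub_sub_cancel]
  · refine (hasSpec_muE_iff C rfl _).mp ?_
    have h5 : (M.submatrix θ θ).submatrix (Fin.natAdd _) (Fin.natAdd _) =
        M.toBlocks₂₂.submatrix τ τ := by
      ext i j
      simp [hθ, toBlocks₂₂]
    simp only [h5]
    convert h3.submatrix τ using 1
    funext j
    rw [he]
    change _ = _ - gapFun C _ _
    rw [gapFun_eq _ j.2, sub_sub_cancel]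

end Partitions

section Augmented

/-- The vector `(g₁, …, gₙ, -gₙ, …, -g₁)`. -/
noncomputable def hatVec {n : ℕ} (g : Fin n → ℝ) (i : ℕ) : ℝ :=
  if h : i < n then g ⟨i, h⟩ else if h' : i < n + n then -g ⟨n + n - 1 - i, by omega⟩ else 0

variable {n : ℕ} {g : Fin n → ℝ}

theorem hatVec_castAdd (g : Fin n → ℝ) (i : Fin n) : hatVec g i = g i := dif_pos i.2

theorem hatVec_natAdd_rev (g : Fin n → ℝ) (i : Fin n) :
    hatVec g (Fin.natAdd n i.rev).val = -g i := by
  have := i.2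
  rw [hatVec, dif_neg (by simp), dif_pos (Fin.natAdd n i.rev).2]
  congr 2
  ext
  simp only [Fin.val_natAdd, Fin.val_rev]
  omega

theorem hatVec_rev (g : Fin n → ℝ) (i : Fin (n + n)) : hatVec g i.rev = -hatVec g i := by
  refine Fin.addCases (fun j => ?_) (fun j => ?_) i
  · have : (Fin.castAdd n j).rev = Fin.natAdd n j.rev := by
      ext; simp only [Fin.val_rev, Fin.val_castAdd, Fin.val_natAdd]; omega
    rw [this, hatVec_natAdd_rev, Fin.val_castAdd, hatVec_castAdd]
  · obtain ⟨j, rfl⟩ := Fin.rev_surjective j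
    have : (Fin.natAdd n j.rev).rev = Fin.castAdd n j := by
      ext; simp only [Fin.val_rev, Fin.val_castAdd, Fin.val_natAdd]; omega
    rw [this, hatVec_natAdd_rev, Fin.val_castAdd, hatVec_castAdd, neg_neg]

theorem sum_hatVec (g : Fin n → ℝ) (A : Finset (Fin (n + n))) :
    ∑ i ∈ A, hatVec g i = sumRestr g A - sumRestr g (opp A) := by
  rw [sumRestr, sumRestr, opp, Finset.sum_image fun _ _ _ _ h => Fin.rev_injective h,
    ← Finset.sum_sub_distrib]
  refine Finset.sum_congr rfl fun i _ => ?_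
  have hi := i.2
  have hr : (i.rev : ℕ) = n + n - 1 - i := by rw [Fin.val_rev]; omega
  by_cases h : i.val < n
  · rw [hatVec, dif_pos h, dif_pos h, dif_neg (by omega), sub_zero]
  · rw [hatVec, dif_neg h, dif_neg h, dif_pos hi, dif_pos (by omega), zero_sub]
    congr 3
    exact hr.symm

theorem sum_opp_hatVec (g : Fin n → ℝ) (A : Finset (Fin (n + n))) :
    ∑ i ∈ opp A, hatVec g i = -∑ i ∈ A, hatVec g i := by
  rw [opp, Finset.sum_image fun _ _ _ _ h => Fin.rev_injective h, ← Finset.sum_neg_distrib]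
  exact Finset.sum_congr rfl fun i _ => hatVec_rev g i

/-- The vector `hatVec g`, shifted by `K` on its support. -/
noncomputable def extVec (K : ℝ) (g : Fin n → ℝ) (i : ℕ) : ℝ :=
  if i < n + n then K + hatVec g i else 0

theorem extVec_length (K : ℝ) (g : Fin n → ℝ) : extVec K g (n + n) = 0 := if_neg (lt_irrefl _)

theorem extVec_fin (K : ℝ) (g : Fin n → ℝ) (i : Fin (n + n)) :
    extVec K g i = K + hatVec g i := if_pos i.2

theorem hatVec_le {K : ℝ} (h0 : ∀ i, 0 ≤ g i) (hK : ∀ i, g i ≤ K) (i : Fin (n + n)) :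
    hatVec g i ≤ K := by
  rw [hatVec]
  split_ifs with h h'
  · exact hK _
  · linarith [h0 ⟨n + n - 1 - i, by omega⟩, hK ⟨n + n - 1 - i, by omega⟩]
  · omega

theorem antitone_extVec {K : ℝ} (hg : Antitone g) (h0 : ∀ i, 0 ≤ g i) (hK : ∀ i, g i ≤ K) :
    Antitone (extVec K g) := by
  intro i j hij
  rw [extVec, extVec]
  by_cases hj : j < n + n
  · have hi : i < n + n := by omega
    rw [if_pos hj, if_pos hi]
    refine add_le_add_right ?_ K
    rw [hatVec, hatVec]
    by_cases hj' : j < n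
    · rw [dif_pos hj', dif_pos (by omega)]
      exact hg hij
    · rw [dif_neg hj', dif_pos hj]
      split_ifs with hi'
      · linarith [h0 ⟨i, hi'⟩, h0 ⟨n + n - 1 - j, by omega⟩]
      · refine neg_le_neg (hg ?_)
        rw [Fin.mk_le_mk]
        omega
  · rw [if_neg hj]
    split_ifs with hi
    · have := hatVec_le h0 hK (Fin.rev ⟨i, hi⟩)
      rw [hatVec_rev] at this
      simp only at this
      linarith
    · exact le_rfl

open Polynomial in
/-- The eigenvalues of `[[0, Y], [Yᴴ, 0]]` are the singular values of `Y` and their opposites. -/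
theorem hasSpec_fromBlocks {Y : Matrix (Fin n) (Fin n) ℂ}
    (h : HasSpec (Y * Yᴴ) fun i => g i ^ 2) :
    HasSpec (fromBlocks 0 Y Yᴴ 0) fun i : Fin (n + n) => hatVec g i := by
  rw [HasSpec]
  refine Polynomial.eq_of_infinite_eval_eq _ _ (Set.infinite_of_finite_compl (s := {c | _}) ?_)
  refine (Set.finite_singleton (0 : ℂ)).subset fun c hc => ?_
  by_contra hc0
  rw [Set.mem_singleton_iff] at hc0
  refine hc ?_
  rw [Set.mem_ofPred_eq, eval_charpoly, eval_prod, Fin.prod_univ_add]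
  have h1 : (∏ i : Fin n, eval c (X - C (hatVec g (Fin.castAdd n i).val : ℂ))) *
      ∏ i : Fin n, eval c (X - C (hatVec g (Fin.natAdd n i).val : ℂ)) =
        ∏ i, (c ^ 2 - (g i : ℂ) ^ 2) := by
    rw [← Equiv.prod_comp Fin.revPerm fun i => eval c (X - C (hatVec g (Fin.natAdd n i).val : ℂ)),
      ← Finset.prod_mul_distrib]
    refine Finset.prod_congr rfl fun i _ => ?_
    rw [Fin.revPerm_apply, hatVec_natAdd_rev, Fin.val_castAdd, hatVec_castAdd]
    simp only [eval_sub, eval_X, eval_C, Complex.ofReal_neg]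
    ring
  have h2 : (scalar (Fin n ⊕ Fin n)) c - fromBlocks 0 Y Yᴴ 0 =
      fromBlocks ((scalar (Fin n)) c) (-Y) (-Yᴴ) ((scalar (Fin n)) c) := by
    ext (i | i) (j | j) <;> simp [Matrix.diagonal_apply]
  have h3 : IsUnit ((scalar (Fin n)) c : Matrix (Fin n) (Fin n) ℂ).det := by
    rw [scalar_apply, det_diagonal, Finset.prod_const]
    exact (pow_ne_zero _ hc0).isUnit
  let _ := invertibleOfIsUnitDet _ h3
  have h4 : ⅟((scalar (Fin n)) c : Matrix (Fin n) (Fin n) ℂ) = c⁻¹ • 1 := by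
    rw [invOf_eq_nonsing_inv]
    refine inv_eq_left_inv ?_
    ext i j
    by_cases hij : i = j <;> simp [hij, hc0, Matrix.one_apply]
  rw [h1, h2, det_fromBlocks₂₂, h4, ← det_mul]
  have h5 := congrArg (eval (c ^ 2)) h
  rw [eval_charpoly, eval_prod] at h5
  simp only [eval_sub, eval_X, eval_C, Complex.ofReal_pow] at h5
  rw [← h5]
  congr 1
  rw [scalar_apply, scalar_apply, ← smul_one_eq_diagonal, ← smul_one_eq_diagonal]
  simp only [Matrix.mul_smul, Matrix.smul_mul, Matrix.mul_one, Matrix.one_mul, neg_mul_neg,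
    smul_sub, smul_smul, mul_inv_cancel₀ hc0, one_smul, sq]

theorem forall_eq_sval_iff {Y : Matrix (Fin n) (Fin n) ℂ} (hg : Antitone g) (h0 : ∀ i, 0 ≤ g i) :
    (∀ i : Fin n, g i = sval Y i) ↔ HasSpec (Y * Yᴴ) fun i => g i ^ 2 := by
  have hY := isHermitian_mul_conjTranspose_self Y
  have h1 : ∀ i : Fin n, sval Y i = Real.sqrt (eigVec (Y * Yᴴ) hY i) := fun i => dif_pos i.2
  constructor
  · intro h
    convert hasSpec_eigVec (Y * Yᴴ) hY using 1
    funext i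
    rw [h, h1, Real.sq_sqrt]
    open ComplexOrder in
    exact (Matrix.posSemidef_self_mul_conjTranspose Y).eigenvalues_nonneg _
  · intro h i
    rw [h1, eigVec_eq_of_hasSpec hY (fun i j hij => pow_le_pow_left₀ (h0 _) (hg hij) 2) h,
      Real.sqrt_sq (h0 i)]

/-- The weight on a star quiver with three arms attached to three vectors. -/
noncomputable def triWeight {n p q : ℕ} (K : ℝ) (g : Fin n → ℝ) (s : Fin p → ℝ) (t : Fin q → ℝ) :
    StarV (triLen (n + n) (p + p) (q + q)) → ℝ :=
  starWeight (triFun (extVec K g) (extVec K s) (extVec K t)) (2 * K)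

theorem sum_triWeight_mul {n p q : ℕ} (K : ℝ) (g : Fin n → ℝ) (s : Fin p → ℝ) (t : Fin q → ℝ)
    {A : Finset (Fin (n + n))} {B : Finset (Fin (p + p))} {C : Finset (Fin (q + q))}
    (hA : A.card = B.card + C.card) :
    ∑ v, triWeight K g s t v * starDim (triSet (opp A) B C) A.card v =
      ∑ i ∈ A, hatVec g i - ∑ i ∈ B, hatVec s i - ∑ i ∈ C, hatVec t i := by
  rw [triWeight, sum_starWeight_mul_starDim, Fintype.sum_option, Fintype.sum_bool]
  · simp only [triFun, triSet, extVec_fin, Finset.sum_add_distrib, sum_opp_hatVec,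
      Finset.sum_const, nsmul_eq_mul, card_opp, hA]
    push_cast
    ring
  · rintro (- | - | -)
    · exact extVec_length K g
    · exact extVec_length K s
    · exact extVec_length K t

end Augmented

section Necessity

theorem starDim_add_compl {K : Type} {L : K → ℕ} (B : ∀ k, Finset (Fin (L k))) (r g : ℕ)
    (v : StarV L) :
    starDim B r v + starDim (fun k => (B k)ᶜ) g v = starDim (fun _ => Finset.univ) (r + g) v := by
  rcases v with - | ⟨k, i⟩
  · rfl
  · simp only [starDim]
    rw [← Finset.card_union_of_disjoint, ← Finset.filter_union, Finset.union_compl]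
    rw [Finset.disjoint_left]
    intro j hj hj'
    exact Finset.mem_compl.mp (Finset.mem_filter.mp hj').1 (Finset.mem_filter.mp hj).1

theorem hasSub_of_mem_LRcone {a b c : ℕ} {A : Finset (Fin a)} {B : Finset (Fin b)}
    {C : Finset (Fin c)} (ha : a = b + c) (hA : A.card = B.card + C.card)
    (h : (muVec A hA, muVec B rfl, muVec C rfl) ∈ LRcone B.card C.card)
    {κ : StarV (triLen a b c) → Type} [∀ v, Fintype (κ v)]
    (hκ : ∀ v, Fintype.card (κ v) = starDim (fun _ => Finset.univ) a v)
    (x : QRep (starSrc (triLen a b c)) (starTgt (triLen a b c)) κ) :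
    HasSub x (starDim (triSet (opp A) B C) A.card) := by
  obtain ⟨y, hy⟩ := exists_isMoment_of_mem_LRcone ha hA h
  have hle := Finset.card_le_univ A
  rw [Fintype.card_fin] at hle
  refine hasSub_of_euler_nonneg (γ := starDim (fun k => (triSet (opp A) B C k)ᶜ) (a - A.card))
    (fun v => by rw [starDim_add_compl, Nat.add_sub_cancel' hle, hκ]) (fun δ' hδ' => ?_) x
  have h1 := fun v => card_starIdx (Fin B.card ⊕ Fin C.card) (triSet (opp A) B C) v
  rw [Fintype.card_sum, Fintype.card_fin, Fintype.card_fin, ← hA] at h1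
  have h2 := (hasSub_repReindex (fun v => Fintype.equivFinOfCardEq (h1 v)) y).mp (hδ' _)
  have h3 := hy.nonneg h2
  rw [sum_eulerWeight_mul] at h3
  exact_mod_cast h3

theorem sum_hatVec_le {p q : ℕ} {g : Fin (p + q) → ℝ} {s : Fin p → ℝ} {t : Fin q → ℝ}
    (hg : Antitone g) (hg0 : ∀ i, 0 ≤ g i) (hs : Antitone s) (hs0 : ∀ i, 0 ≤ s i)
    (ht : Antitone t) (ht0 : ∀ i, 0 ≤ t i) (h : (g, s, t) ∈ coneT p q)
    {A : Finset (Fin (p + q + (p + q)))} {B : Finset (Fin (p + p))} {C : Finset (Fin (q + q))}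
    (hA : A.card = B.card + C.card)
    (hLR : (muVec A hA, muVec B rfl, muVec C rfl) ∈ LRcone B.card C.card) :
    0 ≤ ∑ i ∈ A, hatVec g i - ∑ i ∈ B, hatVec s i - ∑ i ∈ C, hatVec t i := by
  obtain ⟨X, h1, h2, h3⟩ := h
  replace h1 := hasSpec_fromBlocks ((forall_eq_sval_iff hg hg0).mp h1)
  replace h2 := hasSpec_fromBlocks ((forall_eq_sval_iff hs hs0).mp h2)
  replace h3 := hasSpec_fromBlocks ((forall_eq_sval_iff ht ht0).mp h3)
  obtain ⟨K, hKg, hKs, hKt⟩ : ∃ K : ℝ, (∀ i, g i ≤ K) ∧ (∀ i, s i ≤ K) ∧ ∀ i, t i ≤ K := by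
    refine ⟨∑ i, g i + ∑ i, s i + ∑ i, t i, fun i => ?_, fun i => ?_, fun i => ?_⟩
    · linarith [Finset.single_le_sum (fun i _ => hg0 i) (Finset.mem_univ i),
        Finset.sum_nonneg fun i (_ : i ∈ Finset.univ) => hs0 i,
        Finset.sum_nonneg fun i (_ : i ∈ Finset.univ) => ht0 i]
    · linarith [Finset.single_le_sum (fun i _ => hs0 i) (Finset.mem_univ i),
        Finset.sum_nonneg fun i (_ : i ∈ Finset.univ) => hg0 i,
        Finset.sum_nonneg fun i (_ : i ∈ Finset.univ) => ht0 i]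
    · linarith [Finset.single_le_sum (fun i _ => ht0 i) (Finset.mem_univ i),
        Finset.sum_nonneg fun i (_ : i ∈ Finset.univ) => hs0 i,
        Finset.sum_nonneg fun i (_ : i ∈ Finset.univ) => hg0 i]
  obtain ⟨θ, hθ⟩ : ∃ θ : (Fin p ⊕ Fin p) ⊕ (Fin q ⊕ Fin q) ≃ Fin (p + q) ⊕ Fin (p + q),
    θ = (Equiv.sumSumSumComm _ _ _ _).trans (finSumFinEquiv.sumCongr finSumFinEquiv) := ⟨_, rfl⟩
  obtain ⟨H, hH⟩ : ∃ H : Matrix ((Fin p ⊕ Fin p) ⊕ (Fin q ⊕ Fin q))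
    ((Fin p ⊕ Fin p) ⊕ (Fin q ⊕ Fin q)) ℂ, H = (fromBlocks 0 X Xᴴ 0).submatrix θ θ := ⟨_, rfl⟩
  have hHH : H.IsHermitian := by
    rw [hH]
    refine IsHermitian.submatrix ?_ _
    rw [IsHermitian, fromBlocks_conjTranspose, conjTranspose_zero,
      conjTranspose_conjTranspose]
  have hb1 : H.toBlocks₁₁ = fromBlocks 0 (blockTL p q X) (blockTL p q X)ᴴ 0 := by
    rw [hH, hθ]
    ext (i | i) (j | j) <;> simp [toBlocks₁₁, blockTL]
  have hb2 : H.toBlocks₂₂ = fromBlocks 0 (blockBR p q X) (blockBR p q X)ᴴ 0 := by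
    rw [hH, hθ]
    ext (i | i) (j | j) <;> simp [toBlocks₂₂, blockBR]
  have hb1H : H.toBlocks₁₁.IsHermitian := by
    ext i j; exact congrFun (congrFun hHH (.inl i)) (.inl j)
  have hb2H : H.toBlocks₂₂.IsHermitian := by
    ext i j; exact congrFun (congrFun hHH (.inr i)) (.inr j)
  have hK1 : (((K : ℝ) : ℂ) • 1 - H).IsHermitian := by
    refine IsHermitian.sub ?_ hHH
    rw [IsHermitian, conjTranspose_smul, conjTranspose_one]
    simp
  have hu : HasSpec (((K : ℝ) : ℂ) • 1 - H)
      fun j : (Finset.univ : Finset (Fin (p + q + (p + q)))) => extVec K g j.1 := by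
    have h4 := ((h1.submatrix θ).comp_equiv Fin.revPerm)
    rw [← hH] at h4
    convert (h4.const_sub hHH K).comp_equiv (Equiv.subtypeUnivEquiv Finset.mem_univ) using 1
    funext j
    simp only [Function.comp_apply, Fin.revPerm_apply, hatVec_rev, extVec_fin,
      Equiv.subtypeUnivEquiv_apply, sub_neg_eq_add]
  obtain ⟨x, hx⟩ := exists_isMoment_of_isHermitian (A := Finset.univ) (B := Finset.univ)
    (C := Finset.univ) (c := q + q) (b := p + p) (a := p + q + (p + q)) hK1
    (e := triFun (extVec K g) (extVec K s) (extVec K t)) (w := 2 * K)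
    (by
      rintro (- | - | -)
      · exact antitone_extVec hg hg0 hKg
      · exact antitone_extVec hs hs0 hKs
      · exact antitone_extVec ht ht0 hKt)
    (by
      rintro (- | - | -)
      · exact extVec_length K g
      · exact extVec_length K s
      · exact extVec_length K t)
    (fun j => by
      change extVec K g _ ≤ _
      rw [extVec_fin]
      linarith [hatVec_le hg0 hKg j.1])
    hu
    (by
      have h5 : (((K : ℝ) : ℂ) • 1 - H).toBlocks₁₁ = ((K : ℝ) : ℂ) • 1 - H.toBlocks₁₁ := by
        ext i j
        simp [toBlocks₁₁, Matrix.one_apply]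
      rw [h5]
      rw [← hb1] at h2
      convert (h2.const_sub hb1H K).comp_equiv (Equiv.subtypeUnivEquiv Finset.mem_univ) using 1
      funext j
      simp only [Function.comp_apply, extVec_fin, Equiv.subtypeUnivEquiv_apply]
      ring)
    (by
      have h5 : (((K : ℝ) : ℂ) • 1 - H).toBlocks₂₂ = ((K : ℝ) : ℂ) • 1 - H.toBlocks₂₂ := by
        ext i j
        simp [toBlocks₂₂, Matrix.one_apply]
      rw [h5]
      rw [← hb2] at h3
      convert (h3.const_sub hb2H K).comp_equiv (Equiv.subtypeUnivEquiv Finset.mem_univ) using 1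
      funext j
      simp only [Function.comp_apply, extVec_fin, Equiv.subtypeUnivEquiv_apply]
      ring)
  have h6 := hx.nonneg (hasSub_of_mem_LRcone (by ring) hA hLR (fun v => by
    rw [card_starIdx]
    rcases v with - | ⟨k, i⟩
    · simp only [starDim, Fintype.card_sum, Fintype.card_fin]
      ring
    · rcases k with - | - | - <;> rfl) x)
  rw [← sum_triWeight_mul K g s t hA]
  exact h6

end Necessity

section Perp

variable {c : Type} [Fintype c] [DecidableEq c] (η : Matrix c c ℂ)

/-- The orthogonal of a subspace for a Hermitian form. -/
def perp (S : Submodule ℂ (c → ℂ)) : Submodule ℂ (c → ℂ) where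
  carrier := {v | ∀ u ∈ S, star u ⬝ᵥ (η *ᵥ v) = 0}
  add_mem' hv hw u hu := by rw [mulVec_add, dotProduct_add, hv u hu, hw u hu, add_zero]
  zero_mem' u _ := by rw [mulVec_zero, dotProduct_zero]
  smul_mem' a v hv u hu := by rw [mulVec_smul, dotProduct_smul, hv u hu, smul_zero]

variable {η}

omit [DecidableEq c] in
theorem perp_anti {S T : Submodule ℂ (c → ℂ)} (h : S ≤ T) : perp η T ≤ perp η S :=
  fun _ hv u hu => hv u (h hu)

omit [DecidableEq c] in
theorem perp_sup (S T : Submodule ℂ (c → ℂ)) : perp η (S ⊔ T) = perp η S ⊓ perp η T := by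
  refine le_antisymm (le_inf (perp_anti le_sup_left) (perp_anti le_sup_right)) ?_
  intro v hv u hu
  obtain ⟨a, ha, b, hb, rfl⟩ := Submodule.mem_sup.mp hu
  rw [star_add, add_dotProduct, hv.1 a ha, hv.2 b hb, add_zero]

omit [DecidableEq c] in
theorem le_perp_perp (hη : η.IsHermitian) (S : Submodule ℂ (c → ℂ)) :
    S ≤ perp η (perp η S) := fun u hu v hv => by
  have h := congrArg star (hv u hu)
  rw [star_zero, ← star_dotProduct_star, star_star, star_mulVec, hη.eq] at h
  rwa [dotProduct_mulVec]

theorem finrank_perp_add (hη' : η * η = 1) (S : Submodule ℂ (c → ℂ)) :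
    Module.finrank ℂ (perp η S) + Module.finrank ℂ S = Fintype.card c := by
  obtain ⟨U, hU, hUS, hSU⟩ := exists_frame S rfl
  have h1 : perp η S = LinearMap.ker (Uᴴ * η).mulVecLin := by
    ext v
    rw [LinearMap.mem_ker, mulVecLin_apply, ← mulVec_mulVec]
    constructor
    · intro hv
      funext i
      have h2 := hv _ (hUS (Pi.single i 1))
      rw [star_mulVec, ← dotProduct_mulVec, Pi.star_single, star_one, single_dotProduct,
        one_mul] at h2
      exact h2
    · intro hv u hu
      rw [← hSU u hu, star_mulVec, ← dotProduct_mulVec, hv, dotProduct_zero]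
  have h2 : LinearMap.range (Uᴴ * η).mulVecLin = ⊤ := by
    rw [LinearMap.range_eq_top]
    intro w
    refine ⟨η *ᵥ U *ᵥ w, ?_⟩
    rw [mulVecLin_apply, mulVec_mulVec, Matrix.mul_assoc, hη', Matrix.mul_one, mulVec_mulVec, hU,
      one_mulVec]
  have h3 := LinearMap.finrank_range_add_finrank_ker (Uᴴ * η).mulVecLin
  rw [h2, finrank_top, Module.finrank_fin_fun, Module.finrank_fintype_fun_eq_card, ← h1] at h3
  omega

theorem perp_perp (hη : η.IsHermitian) (hη' : η * η = 1) (S : Submodule ℂ (c → ℂ)) :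
    perp η (perp η S) = S := by
  refine (Submodule.eq_of_le_of_finrank_eq (le_perp_perp hη S) ?_).symm
  have h1 := finrank_perp_add hη' S
  have h2 := finrank_perp_add hη' (perp η S)
  omega

theorem perp_inf (hη : η.IsHermitian) (hη' : η * η = 1) (S T : Submodule ℂ (c → ℂ)) :
    perp η (S ⊓ T) = perp η S ⊔ perp η T := by
  rw [← perp_perp hη hη' (perp η S ⊔ perp η T), perp_sup, perp_perp hη hη', perp_perp hη hη']

theorem finrank_inf_perp (hη : η.IsHermitian) (hη' : η * η = 1) (F S : Submodule ℂ (c → ℂ)) :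
    Module.finrank ℂ ↥(perp η F ⊓ S) + Module.finrank ℂ F =
      Module.finrank ℂ S + Module.finrank ℂ ↥(F ⊓ perp η S) := by
  have h1 := finrank_perp_add hη' (F ⊔ perp η S)
  rw [perp_sup, perp_perp hη hη'] at h1
  have h2 := Submodule.finrank_sup_add_finrank_inf_eq F (perp η S)
  have h3 := finrank_perp_add hη' S
  omega

/-- The subspaces spanned by the first vectors of a family. -/
def flag {l : ℕ} (f : Fin l → c → ℂ) (i : ℕ) : Submodule ℂ (c → ℂ) :=
  Submodule.span ℂ (f '' {b | b.val < i})

variable (η) in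
/-- The Gram matrix of the family is antidiagonal and invertible. -/
def SelfDual {l : ℕ} (f : Fin l → c → ℂ) : Prop :=
  ∀ a b, star (f a) ⬝ᵥ (η *ᵥ f b) = 0 ↔ b ≠ a.rev

omit [DecidableEq c] in
theorem SelfDual.apply_sum {l : ℕ} {f : Fin l → c → ℂ} (hf : SelfDual η f) (z : Fin l → ℂ)
    (a : Fin l) : star (f a) ⬝ᵥ (η *ᵥ ∑ b, z b • f b) =
      z a.rev * (star (f a) ⬝ᵥ (η *ᵥ f a.rev)) := by
  rw [mulVec_sum, dotProduct_sum, Finset.sum_eq_single a.rev]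
  · rw [mulVec_smul, dotProduct_smul, smul_eq_mul]
  · intro b _ hb
    rw [mulVec_smul, dotProduct_smul, (hf a b).mpr hb, smul_zero]
  · simp

omit [DecidableEq c] in
theorem SelfDual.linearIndependent {l : ℕ} {f : Fin l → c → ℂ} (hf : SelfDual η f) :
    LinearIndependent ℂ f := by
  rw [Fintype.linearIndependent_iff]
  intro z hz a
  have h1 := hf.apply_sum z a.rev
  rw [hz, mulVec_zero, dotProduct_zero, Fin.rev_rev] at h1
  refine (mul_eq_zero.mp h1.symm).resolve_right fun h => ?_
  exact (hf a.rev a).mp h (Fin.rev_rev a).symm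

omit [Fintype c] [DecidableEq c] in
theorem flag_mono {l : ℕ} (f : Fin l → c → ℂ) {i j : ℕ} (h : i ≤ j) : flag f i ≤ flag f j :=
  Submodule.span_mono (Set.image_mono fun _ hb => lt_of_lt_of_le hb h)

omit [Fintype c] [DecidableEq c] in
theorem mem_flag_length {l : ℕ} (f : Fin l → c → ℂ) {v : c → ℂ} :
    v ∈ flag f l ↔ ∃ z : Fin l → ℂ, ∑ b, z b • f b = v := by
  rw [flag, ← Submodule.mem_span_range_iff_exists_fun ℂ]
  have : f '' {b | b.val < l} = Set.range f := by
    rw [← Set.image_univ]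
    congr 1
    ext b
    simp
  rw [this]

omit [Fintype c] [DecidableEq c] in
theorem finrank_flag {l : ℕ} {f : Fin l → c → ℂ} (hf : LinearIndependent ℂ f) {i : ℕ}
    (hi : i ≤ l) : Module.finrank ℂ (flag f i) = i := by
  have h1 : LinearIndependent ℂ fun b : {b : Fin l // b.val < i} => f b.1 :=
    hf.comp _ Subtype.val_injective
  have h2 := finrank_span_eq_card h1
  have h3 : Set.range (fun b : {b : Fin l // b.val < i} => f b.1) = f '' {b | b.val < i} := by
    ext v
    simp
  rw [h3, Fintype.card_subtype, Fin.card_filter_val_lt, min_eq_right hi] at h2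
  exact h2

omit [DecidableEq c] in
theorem SelfDual.flag_sub {l : ℕ} {f : Fin l → c → ℂ} (hf : SelfDual η f) {i : ℕ} (hi : i ≤ l) :
    flag f (l - i) = flag f l ⊓ perp η (flag f i) := by
  apply le_antisymm
  · refine le_inf (flag_mono f (Nat.sub_le _ _)) (Submodule.span_le.mpr ?_)
    rintro - ⟨b, hb, rfl⟩ u hu
    refine Submodule.span_induction (p := fun u _ => star u ⬝ᵥ (η *ᵥ f b) = 0) ?_ ?_ ?_ ?_ hu
    · rintro - ⟨a, ha, rfl⟩
      refine (hf a b).mpr fun h => ?_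
      have h1 : b.val < l - i := hb
      have h2 : a.val < i := ha
      rw [h, Fin.val_rev] at h1
      omega
    · rw [star_zero, zero_dotProduct]
    · intro x y _ _ hx hy
      rw [star_add, add_dotProduct, hx, hy, add_zero]
    · intro r x _ hx
      rw [star_smul, smul_dotProduct, hx, smul_zero]
  · rintro v ⟨hv, hv'⟩
    obtain ⟨z, rfl⟩ := (mem_flag_length f).mp hv
    refine Submodule.sum_mem _ fun b _ => ?_
    by_cases hb : b.val < l - i
    · exact Submodule.smul_mem _ _ (Submodule.subset_span ⟨b, hb, rfl⟩)
    · have h1 : b.rev.val < i := by rw [Fin.val_rev]; have := b.2; omega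
      have h2 := hv' (f b.rev) (Submodule.subset_span ⟨_, h1, rfl⟩)
      rw [hf.apply_sum, Fin.rev_rev] at h2
      have h3 : z b = 0 := (mul_eq_zero.mp h2).resolve_right fun h =>
        (hf b.rev b).mp h (Fin.rev_rev b).symm
      rw [h3, zero_smul]
      exact zero_mem _

/-- The subspace is the sum of its intersections with `W` and the orthogonal of `W`. -/
def Splits (η : Matrix c c ℂ) (W S : Submodule ℂ (c → ℂ)) : Prop := S ≤ (S ⊓ W) ⊔ (S ⊓ perp η W)

theorem SelfDual.finrank_flag_sub_inf {l : ℕ} {f : Fin l → c → ℂ} (hf : SelfDual η f)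
    (hη : η.IsHermitian) (hη' : η * η = 1) {S : Submodule ℂ (c → ℂ)} (hS : Splits η (flag f l) S)
    {i : ℕ} (hi : i ≤ l) :
    Module.finrank ℂ ↥(flag f (l - i) ⊓ S) + i =
      Module.finrank ℂ ↥(flag f l ⊓ S) + Module.finrank ℂ ↥(flag f i ⊓ perp η S) := by
  obtain ⟨W, hW⟩ : ∃ W, W = flag f l := ⟨_, rfl⟩
  obtain ⟨F, hF⟩ : ∃ F, F = flag f i := ⟨_, rfl⟩
  have hFW : F ≤ W := hF ▸ hW ▸ flag_mono f hi
  have h0 : W ⊓ perp η W = ⊥ := by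
    rw [hW, ← hf.flag_sub le_rfl, Nat.sub_self, flag]
    simp
  have key : ∀ T : Submodule ℂ (c → ℂ), Splits η W T → Module.finrank ℂ T =
      Module.finrank ℂ ↥(W ⊓ T) + Module.finrank ℂ ↥(T ⊓ perp η W) := fun T hT => by
    have h1 := Submodule.finrank_sup_add_finrank_inf_eq (T ⊓ W) (T ⊓ perp η W)
    have h2 : (T ⊓ W) ⊓ (T ⊓ perp η W) = ⊥ := by
      rw [eq_bot_iff, ← h0]
      exact inf_le_inf inf_le_right inf_le_right
    have h3 : (T ⊓ W) ⊔ (T ⊓ perp η W) = T := le_antisymm (sup_le inf_le_left inf_le_left) hT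
    rw [h2, h3, finrank_bot, add_zero, inf_comm T W] at h1
    exact h1
  rw [hf.flag_sub hi, ← hW, ← hF]
  rw [← hW] at hS
  have h1 := key S hS
  have h2 : Splits η W (perp η F ⊓ S) := by
    rintro v ⟨hv, hv'⟩
    obtain ⟨a, ha, b, hb, rfl⟩ := Submodule.mem_sup.mp (hS hv')
    have hb' : b ∈ perp η F := perp_anti hFW hb.2
    refine Submodule.add_mem_sup ⟨⟨?_, ha.1⟩, ha.2⟩ ⟨⟨hb', hb.1⟩, hb.2⟩
    have := Submodule.sub_mem _ hv hb'
    rwa [add_sub_cancel_right] at this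
  have h3 := key _ h2
  have h4 := finrank_inf_perp hη hη' F S
  have h5 : perp η F ⊓ S ⊓ perp η W = S ⊓ perp η W := by
    rw [inf_comm (perp η F), inf_assoc, inf_eq_right.mpr (perp_anti hFW)]
  have h6 : Module.finrank ℂ F = i := hF ▸ finrank_flag hf.linearIndependent hi
  rw [h5, ← inf_assoc] at h3
  omega

theorem finrank_inf_le_finrank_inf_inf_perp (hη : η.IsHermitian) (hη' : η * η = 1)
    (F S : Submodule ℂ (c → ℂ)) :
    Module.finrank ℂ ↥(F ⊓ S) + Module.finrank ℂ ↥(F ⊓ perp η S) ≤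
      Module.finrank ℂ ↥(F ⊓ (S ⊓ perp η S)) +
        Module.finrank ℂ ↥(F ⊓ perp η (S ⊓ perp η S)) := by
  rw [perp_inf hη hη', perp_perp hη hη', ← Submodule.finrank_sup_add_finrank_inf_eq (F ⊓ S),
    add_comm, ← inf_inf_distrib_left, sup_comm (perp η S) S]
  refine Nat.add_le_add_left (Submodule.finrank_mono ?_) _
  exact sup_le (inf_le_inf_left F le_sup_left) (inf_le_inf_left F le_sup_right)

end Perp

section InclRep

variable {K : Type} {L : K → ℕ} {c : Type}

/-- The index set for the standard representations of a star quiver. -/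
abbrev stdIdx (c : Type) (L : K → ℕ) : StarV L → Type := starIdx c fun _ => Finset.univ

/-- The matrix whose columns are the vectors attached to a vertex of a star quiver. -/
def starCol [DecidableEq c] (f : ∀ k, Fin (L k) → c → ℂ) :
    ∀ v : StarV L, Matrix c (stdIdx c L v) ℂ
  | none => (1 : Matrix c c ℂ)
  | some ⟨k, _⟩ => fun j b => f k b.1 j

/-- The representation of a star quiver by the flags generated by families of vectors. -/
def inclRep (f : ∀ k, Fin (L k) → c → ℂ) : QRep (starSrc L) (starTgt L) (stdIdx c L)
  | .inl _ => fun b' b => if b'.1 = b.1 then 1 else 0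
  | .inr k => fun j b => f k b.1 j

variable [Fintype c] [DecidableEq c]

omit [Fintype c] [DecidableEq c] in
theorem sum_mul_ite_eq {l : ℕ} {P : Fin l → Prop} [Fintype {b // P b}] (f : Fin l → ℂ) {b : Fin l}
    (hb : P b) : ∑ b' : {b // P b}, f b'.1 * (if b'.1 = b then 1 else 0) = f b := by
  rw [Finset.sum_eq_single (⟨b, hb⟩ : {b // P b})]
  · simp
  · intro b' _ hb'
    rw [if_neg fun h => hb' (Subtype.ext h), mul_zero]
  · simp

theorem starCol_mul_inclRep (f : ∀ k, Fin (L k) → c → ℂ) (a : StarQ L) :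
    starCol f (starTgt L a) * inclRep f a = starCol f (starSrc L a) := by
  rcases a with ⟨k, i⟩ | k
  · ext j b
    have h0 : b.1.val < i.val := b.2.2
    have h1 : b.1 ∈ Finset.univ ∧ b.1.val < i.succ.val :=
      ⟨Finset.mem_univ _, by rw [Fin.val_succ]; omega⟩
    exact sum_mul_ite_eq (P := fun b => b ∈ Finset.univ ∧ b.val < i.succ.val)
      (fun b => f k b j) h1
  · exact Matrix.one_mul _

theorem starCol_mulVec_none (f : ∀ k, Fin (L k) → c → ℂ) (u : c → ℂ) :
    (starCol f none).mulVecLin u = u := one_mulVec u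

theorem starCol_mulVec_some (f : ∀ k, Fin (L k) → c → ℂ) (k : K) (i : Fin (L k + 1))
    (z : stdIdx c L (some ⟨k, i⟩) → ℂ) :
    starCol f (some ⟨k, i⟩) *ᵥ z = ∑ b, z b • f k b.1 := by
  ext j
  simp only [mulVec, dotProduct, Finset.sum_apply, Pi.smul_apply, smul_eq_mul, starCol]
  exact Finset.sum_congr rfl fun b _ => mul_comm _ _

theorem range_starCol_some (f : ∀ k, Fin (L k) → c → ℂ) (k : K) (i : Fin (L k + 1)) :
    LinearMap.range (starCol f (some ⟨k, i⟩)).mulVecLin = flag (f k) i := by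
  have h1 : f k '' {b | b.val < i.val} =
      Set.range fun b : stdIdx c L (some ⟨k, i⟩) => f k b.1 := by
    ext v
    constructor
    · rintro ⟨b, hb, rfl⟩
      exact ⟨⟨b, Finset.mem_univ _, hb⟩, rfl⟩
    · rintro ⟨b, rfl⟩
      exact ⟨b.1, b.2.2, rfl⟩
  ext v
  rw [flag, h1, Submodule.mem_span_range_iff_exists_fun]
  constructor
  · rintro ⟨z, rfl⟩
    exact ⟨z, (starCol_mulVec_some f k i z).symm⟩
  · rintro ⟨z, rfl⟩
    exact ⟨z, starCol_mulVec_some f k i z⟩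

theorem starCol_injective {f : ∀ k, Fin (L k) → c → ℂ} (hf : ∀ k, LinearIndependent ℂ (f k))
    (v : StarV L) : Function.Injective (starCol f v).mulVecLin := by
  rcases v with - | ⟨k, i⟩
  · intro z z' h
    exact (starCol_mulVec_none f z).symm.trans (h.trans (starCol_mulVec_none f z'))
  · rw [injective_iff_map_eq_zero]
    intro z hz
    have h1 : LinearIndependent ℂ fun b : stdIdx c L (some ⟨k, i⟩) => f k b.1 :=
      (hf k).comp _ Subtype.val_injective
    rw [Fintype.linearIndependent_iff] at h1
    funext b
    exact h1 z ((starCol_mulVec_some f k i z).symm.trans hz) b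

/-- The largest subrepresentation with a given subspace at the center. -/
def fullSub (f : ∀ k, Fin (L k) → c → ℂ) (S : Submodule ℂ (c → ℂ)) (v : StarV L) :
    Submodule ℂ (stdIdx c L v → ℂ) := S.comap (starCol f v).mulVecLin

theorem isSub_fullSub (f : ∀ k, Fin (L k) → c → ℂ) (S : Submodule ℂ (c → ℂ)) :
    IsSub (inclRep f) (fullSub f S) := by
  intro a u hu
  rw [fullSub, Submodule.mem_comap, mulVecLin_apply, mulVec_mulVec, starCol_mul_inclRep]
  exact hu

theorem fullSub_none (f : ∀ k, Fin (L k) → c → ℂ) (S : Submodule ℂ (c → ℂ)) :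
    fullSub f S none = S :=
  Submodule.ext fun u => by
    have h1 := starCol_mulVec_none f u
    change (starCol f none).mulVecLin u ∈ S ↔ u ∈ S
    exact iff_of_eq (congrArg (· ∈ S) h1)

theorem finrank_fullSub_some {f : ∀ k, Fin (L k) → c → ℂ} (hf : ∀ k, LinearIndependent ℂ (f k))
    (S : Submodule ℂ (c → ℂ)) (k : K) (i : Fin (L k + 1)) :
    Module.finrank ℂ (fullSub f S (some ⟨k, i⟩)) = Module.finrank ℂ ↥(flag (f k) i ⊓ S) := by
  have h1 := (Submodule.equivMapOfInjective _ (starCol_injective hf (some ⟨k, i⟩))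
    (fullSub f S (some ⟨k, i⟩))).finrank_eq
  rw [h1, fullSub, Submodule.map_comap_eq, range_starCol_some]

theorem IsSub.le_fullSub {f : ∀ k, Fin (L k) → c → ℂ} {S : ∀ v, Submodule ℂ (stdIdx c L v → ℂ)}
    (hS : IsSub (inclRep f) S) (v : StarV L) : S v ≤ fullSub f (S none) v := by
  rcases v with - | ⟨k, i⟩
  · exact (fullSub_none f (S none)).ge
  · induction i using Fin.reverseInduction with
    | last =>
      intro u hu
      exact hS (.inr k) u hu
    | cast i ih =>
      intro u hu
      have h1 := ih (hS (.inl ⟨k, i⟩) u hu)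
      have h2 := congrArg (· *ᵥ u) (starCol_mul_inclRep f (.inl ⟨k, i⟩))
      simp only [← mulVec_mulVec] at h2
      change starCol f (some ⟨k, i.castSucc⟩) *ᵥ u ∈ S none
      exact h2 ▸ h1

omit [Fintype c] [DecidableEq c] in
theorem finrank_flag_succ_inf_le [Finite c] {l : ℕ} {f : Fin l → c → ℂ} (hf : LinearIndependent ℂ f)
    (S : Submodule ℂ (c → ℂ)) {i : ℕ} (hi : i < l) :
    Module.finrank ℂ ↥(flag f (i + 1) ⊓ S) ≤ Module.finrank ℂ ↥(flag f i ⊓ S) + 1 := by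
  have h1 := Submodule.finrank_sup_add_finrank_inf_eq (flag f (i + 1) ⊓ S) (flag f i)
  have h2 : flag f (i + 1) ⊓ S ⊓ flag f i = flag f i ⊓ S := by
    rw [inf_comm, ← inf_assoc, inf_eq_left.mpr (flag_mono f (Nat.le_succ i))]
  have h3 : Module.finrank ℂ ↥(flag f (i + 1) ⊓ S ⊔ flag f i) ≤ Module.finrank ℂ (flag f (i + 1)) :=
    Submodule.finrank_mono (sup_le inf_le_left (flag_mono f (Nat.le_succ i)))
  rw [finrank_flag hf hi] at h3
  rw [h2, finrank_flag hf hi.le] at h1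
  omega

/-- The positions of the jumps of the dimension of the intersections with a flag. -/
noncomputable def jumps {l : ℕ} (f : Fin l → c → ℂ) (S : Submodule ℂ (c → ℂ)) : Finset (Fin l) :=
  Finset.univ.filter fun b =>
    Module.finrank ℂ ↥(flag f b ⊓ S) < Module.finrank ℂ ↥(flag f (b + 1) ⊓ S)

omit [DecidableEq c] in
theorem card_filter_jumps {l : ℕ} {f : Fin l → c → ℂ} (hf : LinearIndependent ℂ f)
    (S : Submodule ℂ (c → ℂ)) {i : ℕ} (hi : i ≤ l) :
    ((jumps f S).filter fun b => b.val < i).card = Module.finrank ℂ ↥(flag f i ⊓ S) := by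
  induction i with
  | zero =>
    have h1 : flag f 0 = ⊥ := by simp [flag]
    rw [h1, bot_inf_eq, finrank_bot]
    simp
  | succ i ih =>
    have h1 := finrank_flag_succ_inf_le hf S hi
    have h2 : Module.finrank ℂ ↥(flag f i ⊓ S) ≤ Module.finrank ℂ ↥(flag f (i + 1) ⊓ S) :=
      Submodule.finrank_mono (inf_le_inf_right S (flag_mono f (Nat.le_succ i)))
    have h3 := ih (by omega)
    by_cases h : (⟨i, hi⟩ : Fin l) ∈ jumps f S
    · have h4 : (jumps f S).filter (fun b => b.val < i + 1) =
          insert ⟨i, hi⟩ ((jumps f S).filter fun b => b.val < i) := by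
        ext b
        simp only [Finset.mem_filter, Finset.mem_insert]
        constructor
        · rintro ⟨hb, hb'⟩
          by_cases hbi : b.val = i
          · exact Or.inl (Fin.ext hbi)
          · exact Or.inr ⟨hb, by omega⟩
        · rintro (rfl | ⟨hb, hb'⟩)
          · exact ⟨h, Nat.lt_succ_self i⟩
          · exact ⟨hb, by omega⟩
      rw [h4, Finset.card_insert_of_notMem (by simp), h3]
      have h5 := (Finset.mem_filter.mp h).2
      simp only at h5
      omega
    · have h4 : (jumps f S).filter (fun b => b.val < i + 1) =
          (jumps f S).filter fun b => b.val < i := by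
        ext b
        simp only [Finset.mem_filter]
        refine and_congr_right fun hb => ⟨fun hb' => ?_, fun hb' => by omega⟩
        by_contra hbi
        have : b = ⟨i, hi⟩ := Fin.ext (by simp only; omega)
        exact h (this ▸ hb)
      rw [h4, h3]
      have h5 : ¬ (Module.finrank ℂ ↥(flag f i ⊓ S) < Module.finrank ℂ ↥(flag f (i + 1) ⊓ S)) :=
        fun h5 => h (Finset.mem_filter.mpr ⟨Finset.mem_univ _, h5⟩)
      omega

theorem finrank_fullSub {f : ∀ k, Fin (L k) → c → ℂ} (hf : ∀ k, LinearIndependent ℂ (f k))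
    (S : Submodule ℂ (c → ℂ)) (v : StarV L) :
    Module.finrank ℂ (fullSub f S v) =
      starDim (fun k => jumps (f k) S) (Module.finrank ℂ S) v := by
  rcases v with - | ⟨k, i⟩
  · rw [fullSub_none]
    rfl
  · rw [finrank_fullSub_some hf]
    exact (card_filter_jumps (hf k) S (Nat.lt_succ_iff.mp i.2)).symm

end InclRep

section Defect

variable {m : ℕ}

/-- The successive differences of the vector `hatVec g`. -/
noncomputable def gap (g : Fin m → ℝ) (i : ℕ) : ℝ := hatVec g (i - 1) - hatVec g i

theorem gap_sub (g : Fin m → ℝ) {i : ℕ} (hi : 0 < i) (hi' : i < m + m) :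
    gap g (m + m - i) = gap g i := by
  have h1 := hatVec_rev g ⟨i, hi'⟩
  have h2 := hatVec_rev g ⟨i - 1, by omega⟩
  rw [Fin.val_rev] at h1 h2
  simp only at h1 h2
  rw [gap, gap, show m + m - i - 1 = m + m - (i + 1) by omega, h1,
    show m + m - i = m + m - (i - 1 + 1) by omega, h2]
  ring

theorem gap_nonneg {g : Fin m → ℝ} (hg : Antitone g) (h0 : ∀ i, 0 ≤ g i) {i : ℕ}
    (hi : i < m + m) : 0 ≤ gap g i := by
  have h1 : ∀ j : ℕ, j < m + m → extVec (∑ i, g i) g j = ∑ i, g i + hatVec g j := fun j hj => if_pos hj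
  have h2 := antitone_extVec hg h0
    (fun i => Finset.single_le_sum (fun j _ => h0 j) (Finset.mem_univ i)) (Nat.sub_le i 1)
  rw [h1 _ hi, h1 _ (by omega)] at h2
  rw [gap]
  linarith

theorem gap_pos {g : Fin m → ℝ} (hg : StrictAnti g) (h0 : ∀ i, 0 < g i) {i : ℕ}
    (hi : 0 < i) (hi' : i < m + m) : 0 < gap g i := by
  rw [gap, hatVec, hatVec]
  by_cases h : i < m
  · rw [dif_pos h, dif_pos (by omega)]
    have : g ⟨i, h⟩ < g ⟨i - 1, by omega⟩ := hg (Fin.mk_lt_mk.mpr (by omega))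
    linarith
  · rw [dif_neg h, dif_pos hi']
    split_ifs with h1
    · linarith [h0 ⟨i - 1, h1⟩, h0 ⟨m + m - 1 - i, by omega⟩]
    · have : g ⟨m + m - 1 - (i - 1), by omega⟩ < g ⟨m + m - 1 - i, by omega⟩ :=
        hg (Fin.mk_lt_mk.mpr (by omega))
      linarith
    · omega

theorem sum_extVec_sub_mul (K : ℝ) (g : Fin m → ℝ) {d : ℕ → ℝ} (hd : d 0 = 0) :
    ∑ i : Fin (m + m + 1), (extVec K g i - extVec K g (i - 1)) * d i =
      -(∑ i ∈ Finset.range (m + m), gap g i * d i) -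
        (K + hatVec g (m + m - 1)) * d (m + m) := by
  rw [Fin.sum_univ_eq_sum_range fun i => (extVec K g i - extVec K g (i - 1)) * d i,
    Finset.sum_range_succ, extVec_length, ← Finset.sum_neg_distrib, sub_eq_add_neg]
  congr 1
  · refine Finset.sum_congr rfl fun i hi => ?_
    have hi := Finset.mem_range.mp hi
    rw [extVec, extVec, if_pos hi, if_pos (by omega), gap]
    ring
  · rcases m with - | m
    · rw [hd]; ring
    · rw [extVec, if_pos (by omega)]
      ring

/-- The pairing of a symmetric weight with dimensions of intersections with a flag. -/
noncomputable def defect (g : Fin m → ℝ) (a b : ℕ → ℝ) : ℝ :=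
  ∑ i ∈ Finset.range (m + m), gap g i * (a i + b i - i)

theorem two_mul_sum_extVec_sub_mul (K : ℝ) (g : Fin m → ℝ) {a b : ℕ → ℝ} (ha : a 0 = 0)
    (h : ∀ i ≤ m + m, a (m + m - i) + i = a (m + m) + b i) :
    2 * ∑ i : Fin (m + m + 1), (extVec K g i - extVec K g (i - 1)) * a i =
      -(2 * K * a (m + m)) - defect g a b := by
  rw [sum_extVec_sub_mul K g ha, defect]
  rcases Nat.eq_zero_or_pos m with rfl | hm
  · simp [ha]
  obtain ⟨r, hr⟩ : ∃ r, m + m = r + 1 := ⟨m + m - 1, by omega⟩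
  have h1 : gap g 0 = 0 := sub_self _
  have h2 : ∀ e : ℕ → ℝ, ∑ i ∈ Finset.range (m + m), gap g i * e i =
      ∑ i ∈ Finset.range r, gap g (i + 1) * e (i + 1) := fun e => by
    rw [hr, Finset.sum_range_succ', h1, zero_mul, add_zero]
  have h3 : ∑ i ∈ Finset.range r, gap g (i + 1) * a (i + 1) =
      ∑ i ∈ Finset.range r, gap g (i + 1) * a (m + m - (i + 1)) := by
    rw [← Finset.sum_range_reflect]
    refine Finset.sum_congr rfl fun i hi => ?_
    have hi := Finset.mem_range.mp hi
    have h4 : r - 1 - i + 1 = m + m - (i + 1) := by omega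
    rw [h4, gap_sub g (by omega) (by omega)]
  have h4 : ∑ i ∈ Finset.range r, gap g (i + 1) = -2 * hatVec g r := by
    have h5 := Finset.sum_range_sub' (hatVec g) r
    have h6 := hatVec_rev g ⟨0, by omega⟩
    rw [Fin.val_rev] at h6
    simp only [zero_add, hr, Nat.add_sub_cancel] at h6
    simp only [gap, Nat.add_sub_cancel]
    rw [h5, h6]
    ring
  have h5 : ∑ i ∈ Finset.range r, gap g (i + 1) * a (i + 1) +
      ∑ i ∈ Finset.range r, gap g (i + 1) * a (m + m - (i + 1)) =
      ∑ i ∈ Finset.range r, gap g (i + 1) * (a (i + 1) + b (i + 1) - (i + 1 : ℕ)) +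
        (∑ i ∈ Finset.range r, gap g (i + 1)) * a (m + m) := by
    rw [Finset.sum_mul, ← Finset.sum_add_distrib, ← Finset.sum_add_distrib]
    refine Finset.sum_congr rfl fun i hi => ?_
    have hi := Finset.mem_range.mp hi
    rw [eq_sub_of_add_eq (h (i + 1) (by omega))]
    ring
  rw [h2, h2, show m + m - 1 = r by omega]
  rw [h4, ← h3] at h5
  linarith

end Defect

section TriFrame

variable {c : Type} [Fintype c] [DecidableEq c] {p q : ℕ}

/-- A self-dual flag, and two self-dual flags of the eigenspaces of an involution `ζ`. -/
structure IsTriFrame (η ζ : Matrix c c ℂ)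
    (f : ∀ k, Fin (triLen (p + q + (p + q)) (p + p) (q + q) k) → c → ℂ) : Prop where
  herm : η.IsHermitian
  sq : η * η = 1
  herm' : ζ.IsHermitian
  sq' : ζ * ζ = 1
  comm : η * ζ = ζ * η
  card : Fintype.card c = p + q + (p + q)
  selfDual : ∀ k, SelfDual η (f k)
  mem_flag : ∀ v, v ∈ flag (f (some false)) (p + p) ↔ ζ *ᵥ v = v
  mem_flag' : ∀ v, v ∈ flag (f (some true)) (q + q) ↔ ζ *ᵥ v = -v

/-- A subspace stable under `ζ`. -/
def Graded (ζ : Matrix c c ℂ) (S : Submodule ℂ (c → ℂ)) : Prop := ∀ v ∈ S, ζ *ᵥ v ∈ S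

omit [DecidableEq c] in
theorem Graded.inf {ζ : Matrix c c ℂ} {S T : Submodule ℂ (c → ℂ)} (hS : Graded ζ S)
    (hT : Graded ζ T) : Graded ζ (S ⊓ T) := fun v hv => ⟨hS v hv.1, hT v hv.2⟩

namespace IsTriFrame

variable {η ζ : Matrix c c ℂ}
  {f : ∀ k, Fin (triLen (p + q + (p + q)) (p + p) (q + q) k) → c → ℂ} (h : IsTriFrame η ζ f)

include h

theorem dotProduct_comm (u v : c → ℂ) :
    star u ⬝ᵥ (η *ᵥ (ζ *ᵥ v)) = star (ζ *ᵥ u) ⬝ᵥ (η *ᵥ v) := by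
  rw [star_mulVec, h.herm'.eq, ← dotProduct_mulVec, mulVec_mulVec, mulVec_mulVec, h.comm]

theorem graded_perp {S : Submodule ℂ (c → ℂ)} (hS : Graded ζ S) : Graded ζ (perp η S) :=
  fun v hv u hu => by rw [h.dotProduct_comm]; exact hv _ (hS u hu)

theorem half_add (v : c → ℂ) : ζ *ᵥ ((1 / 2 : ℂ) • (v + ζ *ᵥ v)) = (1 / 2 : ℂ) • (v + ζ *ᵥ v) := by
  rw [mulVec_smul, mulVec_add, mulVec_mulVec, h.sq', one_mulVec, add_comm]

theorem half_sub (v : c → ℂ) :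
    ζ *ᵥ ((1 / 2 : ℂ) • (v - ζ *ᵥ v)) = -((1 / 2 : ℂ) • (v - ζ *ᵥ v)) := by
  rw [mulVec_smul, mulVec_sub, mulVec_mulVec, h.sq', one_mulVec, ← smul_neg, neg_sub]

theorem dotProduct_eq_zero {u v : c → ℂ} (hu : ζ *ᵥ u = u) (hv : ζ *ᵥ v = -v) :
    star u ⬝ᵥ (η *ᵥ v) = 0 ∧ star v ⬝ᵥ (η *ᵥ u) = 0 := by
  have h1 := h.dotProduct_comm u v
  have h2 := h.dotProduct_comm v u
  rw [hu, hv, mulVec_neg, dotProduct_neg] at h1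
  rw [hu, hv, star_neg, neg_dotProduct] at h2
  exact ⟨self_eq_neg.mp h1.symm, self_eq_neg.mp h2⟩

omit h [Fintype c] [DecidableEq c] in
theorem half_add_half (v w : c → ℂ) : (1 / 2 : ℂ) • (v + w) + (1 / 2 : ℂ) • (v - w) = v := by
  rw [← smul_add, add_add_sub_cancel, ← two_smul ℂ v, smul_smul]
  norm_num

theorem flag_top : flag (f none) (p + q + (p + q)) = ⊤ := by
  refine Submodule.eq_top_of_finrank_eq ?_
  rw [finrank_flag (h.selfDual none).linearIndependent le_rfl, Module.finrank_fintype_fun_eq_card,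
    h.card]

theorem splits {S : Submodule ℂ (c → ℂ)} (hS : Graded ζ S) (k : Option Bool) :
    Splits η (flag (f k) (triLen (p + q + (p + q)) (p + p) (q + q) k)) S := by
  have h1 : ∀ v ∈ S, (1 / 2 : ℂ) • (v + ζ *ᵥ v) ∈ S ∧ (1 / 2 : ℂ) • (v - ζ *ᵥ v) ∈ S :=
    fun v hv => ⟨S.smul_mem _ (S.add_mem hv (hS v hv)), S.smul_mem _ (S.sub_mem hv (hS v hv))⟩
  rcases k with - | - | -
  · rw [h.flag_top]
    exact le_sup_of_le_left (le_inf le_rfl le_top)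
  · intro v hv
    refine Submodule.mem_sup.mpr ⟨_, ⟨(h1 v hv).1, (h.mem_flag _).mpr (h.half_add v)⟩, _,
      ⟨(h1 v hv).2, fun u hu => ?_⟩, half_add_half _ _⟩
    exact (h.dotProduct_eq_zero ((h.mem_flag u).mp hu) (h.half_sub v)).1
  · intro v hv
    refine Submodule.mem_sup.mpr ⟨_, ⟨(h1 v hv).2, (h.mem_flag' _).mpr (h.half_sub v)⟩, _,
      ⟨(h1 v hv).1, fun u hu => ?_⟩, ?_⟩
    · exact (h.dotProduct_eq_zero (h.half_add v) ((h.mem_flag' u).mp hu)).2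
    · rw [add_comm]
      exact half_add_half _ _

theorem flag_inf_flag :
    flag (f (some false)) (p + p) ⊓ flag (f (some true)) (q + q) = ⊥ := by
  rw [eq_bot_iff]
  rintro v ⟨hv, hv'⟩
  have h1 := (h.mem_flag v).mp hv
  rw [(h.mem_flag' v).mp hv'] at h1
  exact self_eq_neg.mp h1.symm

theorem finrank_inf_add_le (S : Submodule ℂ (c → ℂ)) :
    Module.finrank ℂ ↥(flag (f (some false)) (p + p) ⊓ S) +
      Module.finrank ℂ ↥(flag (f (some true)) (q + q) ⊓ S) ≤ Module.finrank ℂ S ∧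
    (Module.finrank ℂ ↥(flag (f (some false)) (p + p) ⊓ S) +
      Module.finrank ℂ ↥(flag (f (some true)) (q + q) ⊓ S) = Module.finrank ℂ S ↔
        Graded ζ S) := by
  have h1 := Submodule.finrank_sup_add_finrank_inf_eq (flag (f (some false)) (p + p) ⊓ S)
    (flag (f (some true)) (q + q) ⊓ S)
  have h2 : (flag (f (some false)) (p + p) ⊓ S) ⊓ (flag (f (some true)) (q + q) ⊓ S) = ⊥ := by
    rw [eq_bot_iff, ← h.flag_inf_flag]
    exact inf_le_inf inf_le_left inf_le_left
  have h3 : flag (f (some false)) (p + p) ⊓ S ⊔ flag (f (some true)) (q + q) ⊓ S ≤ S :=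
    sup_le inf_le_right inf_le_right
  rw [h2, finrank_bot, add_zero] at h1
  rw [← h1]
  refine ⟨Submodule.finrank_mono h3, fun h4 v hv => ?_, fun h4 => ?_⟩
  · rw [← Submodule.eq_of_le_of_finrank_eq h3 h4] at hv
    obtain ⟨a, ha, b, hb, rfl⟩ := Submodule.mem_sup.mp hv
    rw [mulVec_add, (h.mem_flag a).mp ha.1, (h.mem_flag' b).mp hb.1]
    exact S.add_mem ha.2 (S.neg_mem hb.2)
  · refine congrArg (fun T : Submodule ℂ (c → ℂ) => Module.finrank ℂ T) (le_antisymm h3 ?_)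
    intro v hv
    refine Submodule.mem_sup.mpr ⟨_, ⟨(h.mem_flag _).mpr (h.half_add v),
      S.smul_mem _ (S.add_mem hv (h4 v hv))⟩, _, ⟨(h.mem_flag' _).mpr (h.half_sub v),
      S.smul_mem _ (S.sub_mem hv (h4 v hv))⟩, half_add_half _ _⟩

end IsTriFrame

end TriFrame

section Minimizer

variable {c : Type}

/-- The dimensions of the intersections with a flag. -/
noncomputable def flagDim {l : ℕ} (f : Fin l → c → ℂ) (S : Submodule ℂ (c → ℂ)) (i : ℕ) : ℝ :=
  Module.finrank ℂ ↥(flag f i ⊓ S)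

theorem flagDim_zero {l : ℕ} (f : Fin l → c → ℂ) (S : Submodule ℂ (c → ℂ)) : flagDim f S 0 = 0 := by
  have h1 : flag f 0 = ⊥ := by simp [flag]
  rw [flagDim, h1, bot_inf_eq, finrank_bot, Nat.cast_zero]

theorem extVec_lt {m : ℕ} {g : Fin m → ℝ} (hg : StrictAnti g) (h0 : ∀ i, 0 < g i) {K : ℝ}
    (hK : ∀ i, g i < K) {i : ℕ} (hi : 0 < i) (hi' : i ≤ m + m) :
    extVec K g i < extVec K g (i - 1) := by
  rcases hi'.eq_or_lt with rfl | hi'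
  · rw [extVec_length, extVec, if_pos (by omega)]
    have h1 := hatVec_rev g ⟨0, hi⟩
    rw [Fin.val_rev] at h1
    simp only [zero_add] at h1
    rw [h1, hatVec, dif_pos (by omega)]
    linarith [hK ⟨0, by omega⟩]
  · have h1 := gap_pos hg h0 hi hi'
    rw [extVec, extVec, if_pos hi', if_pos (by omega)]
    rw [gap] at h1
    linarith

theorem defect_mono {m : ℕ} {g : Fin m → ℝ} (hg : Antitone g) (h0 : ∀ i, 0 ≤ g i)
    {a b a' b' : ℕ → ℝ} (h : ∀ i, a i + b i ≤ a' i + b' i) : defect g a b ≤ defect g a' b' := by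
  refine Finset.sum_le_sum fun i hi => mul_le_mul_of_nonneg_left ?_
    (gap_nonneg hg h0 (Finset.mem_range.mp hi))
  linarith [h i]

theorem sum_extVec_sub_mul_ge {m : ℕ} {g : Fin m → ℝ} (hg : Antitone g) (h0 : ∀ i, 0 ≤ g i) (K : ℝ)
    {d : ℕ → ℝ} (hd : d 0 = 0) {N : ℝ} (hd' : ∀ i, 0 ≤ d i ∧ d i ≤ N) :
    -(K * d (m + m)) - (∑ i ∈ Finset.range (m + m), gap g i) * N ≤
      ∑ i : Fin (m + m + 1), (extVec K g i - extVec K g (i - 1)) * d i := by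
  rw [sum_extVec_sub_mul K g hd, Finset.sum_mul]
  have h1 : ∑ i ∈ Finset.range (m + m), gap g i * d i ≤ ∑ i ∈ Finset.range (m + m), gap g i * N :=
    Finset.sum_le_sum fun i hi => mul_le_mul_of_nonneg_left (hd' i).2
      (gap_nonneg hg h0 (Finset.mem_range.mp hi))
  have h2 : hatVec g (m + m - 1) * d (m + m) ≤ 0 := by
    rcases Nat.eq_zero_or_pos m with rfl | hm
    · simp [hd]
    refine mul_nonpos_of_nonpos_of_nonneg ?_ (hd' _).1
    have h1 := hatVec_rev g ⟨0, by omega⟩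
    rw [Fin.val_rev] at h1
    simp only [zero_add] at h1
    rw [h1, hatVec, dif_pos hm]
    linarith [h0 ⟨0, hm⟩]
  linarith

variable [Fintype c] [DecidableEq c] {p q : ℕ}

omit [DecidableEq c] in
theorem fullSub_mono [DecidableEq c] {K : Type} {L : K → ℕ} (f : ∀ k, Fin (L k) → c → ℂ)
    {S T : Submodule ℂ (c → ℂ)} (h : S ≤ T) (v : StarV L) : fullSub f S v ≤ fullSub f T v :=
  Submodule.comap_mono h

variable (η : Matrix c c ℂ) (f : ∀ k, Fin (triLen (p + q + (p + q)) (p + p) (q + q) k) → c → ℂ)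
  (g : Fin (p + q) → ℝ) (s : Fin p → ℝ) (t : Fin q → ℝ)

/-- The sum of the defects for three flags. -/
noncomputable def triDefect (S : Submodule ℂ (c → ℂ)) : ℝ :=
  defect g (flagDim (f none) S) (flagDim (f none) (perp η S)) +
    (defect s (flagDim (f (some false)) S) (flagDim (f (some false)) (perp η S)) +
      defect t (flagDim (f (some true)) S) (flagDim (f (some true)) (perp η S)))

/-- The value of the weight `triWeight` on the largest subrepresentation. -/
noncomputable def fullWeight (K : ℝ) (S : Submodule ℂ (c → ℂ)) : ℝ :=
  ∑ v, triWeight K g s t v * Module.finrank ℂ (fullSub f S v)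

variable {η f}

theorem fullWeight_eq (hf : ∀ k, LinearIndependent ℂ (f k)) (K : ℝ) (S : Submodule ℂ (c → ℂ)) :
    fullWeight f g s t K S = 2 * K * Module.finrank ℂ S +
      (∑ i : Fin (p + q + (p + q) + 1), (extVec K g i - extVec K g (i - 1)) * flagDim (f none) S i +
        (∑ i : Fin (q + q + 1), (extVec K t i - extVec K t (i - 1)) * flagDim (f (some true)) S i +
        ∑ i : Fin (p + p + 1),
          (extVec K s i - extVec K s (i - 1)) * flagDim (f (some false)) S i)) := by
  rw [fullWeight, Fintype.sum_option, Fintype.sum_sigma, Fintype.sum_option, Fintype.sum_bool]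
  simp only [finrank_fullSub_some hf]
  have h1 : Module.finrank ℂ (fullSub f S none) = Module.finrank ℂ S :=
    congrArg (fun T : Submodule ℂ (c → ℂ) => Module.finrank ℂ T) (fullSub_none f S)
  rw [h1]
  rfl

variable {ζ : Matrix c c ℂ} (h : IsTriFrame η ζ f)

include h

theorem two_mul_fullWeight (K : ℝ) {S : Submodule ℂ (c → ℂ)} (hS : Graded ζ S) :
    2 * fullWeight f g s t K S = -triDefect η f g s t S := by
  have h1 : ∀ k, ∀ i ≤ triLen (p + q + (p + q)) (p + p) (q + q) k,
      flagDim (f k) S (triLen (p + q + (p + q)) (p + p) (q + q) k - i) + i =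
        flagDim (f k) S (triLen (p + q + (p + q)) (p + p) (q + q) k) +
          flagDim (f k) (perp η S) i := fun k i hi => by
    have := (h.selfDual k).finrank_flag_sub_inf h.herm h.sq (h.splits hS k) hi
    simp only [flagDim]
    exact_mod_cast this
  have h2 := two_mul_sum_extVec_sub_mul K g (flagDim_zero (f none) S) (h1 none)
  have h3 := two_mul_sum_extVec_sub_mul K s (flagDim_zero (f (some false)) S) (h1 (some false))
  have h4 := two_mul_sum_extVec_sub_mul K t (flagDim_zero (f (some true)) S) (h1 (some true))
  have h5 := (h.finrank_inf_add_le S).2.mpr hS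
  have h6 : flagDim (f none) S (p + q + (p + q)) = Module.finrank ℂ S := by
    rw [flagDim, h.flag_top, top_inf_eq]
  have h7 : flagDim (f (some false)) S (p + p) + flagDim (f (some true)) S (q + q) =
      Module.finrank ℂ S := by
    simp only [flagDim]
    exact_mod_cast h5
  rw [fullWeight_eq g s t (fun k => (h.selfDual k).linearIndependent), triDefect, mul_add, mul_add,
    mul_add, h2, h3, h4, h6, ← h7]
  ring

theorem graded_of_fullWeight_nonpos (hg : Antitone g) (hg0 : ∀ i, 0 ≤ g i)
    (hs : Antitone s) (hs0 : ∀ i, 0 ≤ s i) (ht : Antitone t) (ht0 : ∀ i, 0 ≤ t i) {K : ℝ}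
    (hK : (∑ i ∈ Finset.range (p + q + (p + q)), gap g i + ∑ i ∈ Finset.range (p + p), gap s i +
      ∑ i ∈ Finset.range (q + q), gap t i) * Fintype.card c < K) {S : Submodule ℂ (c → ℂ)}
    (hS : fullWeight f g s t K S ≤ 0) : Graded ζ S := by
  have h1 : ∀ k i, 0 ≤ flagDim (f k) S i ∧ flagDim (f k) S i ≤ Fintype.card c := fun k i => by
    refine ⟨Nat.cast_nonneg _, ?_⟩
    have := Submodule.finrank_le (flag (f k) i ⊓ S)
    rw [Module.finrank_fintype_fun_eq_card] at this
    exact Nat.cast_le.mpr this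
  have h2 := sum_extVec_sub_mul_ge hg hg0 K (flagDim_zero (f none) S) (h1 none)
  have h3 := sum_extVec_sub_mul_ge hs hs0 K (flagDim_zero (f (some false)) S) (h1 (some false))
  have h4 := sum_extVec_sub_mul_ge ht ht0 K (flagDim_zero (f (some true)) S) (h1 (some true))
  have h6 : flagDim (f none) S (p + q + (p + q)) = Module.finrank ℂ S := by
    rw [flagDim, h.flag_top, top_inf_eq]
  rw [h6] at h2
  rw [fullWeight_eq g s t (fun k => (h.selfDual k).linearIndependent)] at hS
  obtain ⟨h7, h8⟩ := h.finrank_inf_add_le S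
  rw [← h8]
  by_contra hne
  have h9 : flagDim (f (some false)) S (p + p) + flagDim (f (some true)) S (q + q) + 1 ≤
      Module.finrank ℂ S := by
    simp only [flagDim]
    exact_mod_cast lt_of_le_of_ne h7 hne
  have hK0 : 0 ≤ K := by
    refine le_trans (mul_nonneg (add_nonneg (add_nonneg ?_ ?_) ?_) (Nat.cast_nonneg _)) hK.le
    · exact Finset.sum_nonneg fun i hi => gap_nonneg hg hg0 (Finset.mem_range.mp hi)
    · exact Finset.sum_nonneg fun i hi => gap_nonneg hs hs0 (Finset.mem_range.mp hi)
    · exact Finset.sum_nonneg fun i hi => gap_nonneg ht ht0 (Finset.mem_range.mp hi)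
  have h10 := mul_le_mul_of_nonneg_left h9 hK0
  linarith

end Minimizer

section Triples

variable {c : Type} [Fintype c] [DecidableEq c] {p q : ℕ}
  {η ζ : Matrix c c ℂ} {f : ∀ k, Fin (triLen (p + q + (p + q)) (p + p) (q + q) k) → c → ℂ}
  (g : Fin (p + q) → ℝ) (s : Fin p → ℝ) (t : Fin q → ℝ)

omit [DecidableEq c] in
theorem exists_lex_min [DecidableEq c] {K : Type} [Fintype K] {L : K → ℕ}
    (f : ∀ k, Fin (L k) → c → ℂ) (φ : (StarV L → ℕ) → ℝ ×ₗ ℕ) :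
    ∃ S, ∀ T, φ (fun v => Module.finrank ℂ (fullSub f S v)) ≤
      φ (fun v => Module.finrank ℂ (fullSub f T v)) := by
  have h1 : (Set.range fun S => fun v => Module.finrank ℂ (fullSub f S v)).Finite := by
    refine (Set.Finite.pi' fun v => Set.finite_Iic (Fintype.card (stdIdx c L v))).subset ?_
    rintro - ⟨S, rfl⟩ v
    have := Submodule.finrank_le (fullSub f S v)
    rwa [Module.finrank_fintype_fun_eq_card] at this
  obtain ⟨-, ⟨S, rfl⟩, hS⟩ := Set.exists_min_image _ φ h1 (Set.range_nonempty _)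
  exact ⟨S, fun T => hS _ ⟨T, rfl⟩⟩

variable {g s t}

theorem triWeight_neg (hg : StrictAnti g) (hg0 : ∀ i, 0 < g i) (hs : StrictAnti s)
    (hs0 : ∀ i, 0 < s i) (ht : StrictAnti t) (ht0 : ∀ i, 0 < t i) {K : ℝ} (hgK : ∀ i, g i < K)
    (hsK : ∀ i, s i < K) (htK : ∀ i, t i < K) {k : Option Bool}
    {i : Fin (triLen (p + q + (p + q)) (p + p) (q + q) k + 1)} (hi : 0 < i.val) :
    triWeight K g s t (some ⟨k, i⟩) < 0 := by
  have hi' := Nat.lt_succ_iff.mp i.2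
  refine sub_neg.mpr ?_
  rcases k with - | - | -
  · exact extVec_lt hg hg0 hgK hi hi'
  · exact extVec_lt hs hs0 hsK hi hi'
  · exact extVec_lt ht ht0 htK hi hi'

theorem opp_opp {l : ℕ} (A : Finset (Fin l)) : opp (opp A) = A := by
  ext i
  rw [mem_opp, mem_opp, Fin.rev_rev]

/-- The generic representations have no subrepresentations whose dimension violates the inequality
of the Euler form. -/
def EulerGeneric {V Q : Type} [Fintype V] [Fintype Q] {src tgt : Q → V} {ι : V → Type}
    [∀ v, Fintype (ι v)] (x : QRep src tgt ι) : Prop :=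
  ∀ δ γ : V → ℕ, (∀ v, Fintype.card (ι v) = δ v + γ v) → HasSub x δ → 0 ≤ euler src tgt δ γ

theorem exists_triple (h : IsTriFrame η ζ f) (hp : 0 < p) (hq : 0 < q)
    (hgen : EulerGeneric (inclRep f)) (hg : StrictAnti g) (hg0 : ∀ i, 0 < g i) (hs : StrictAnti s)
    (hs0 : ∀ i, 0 < s i) (ht : StrictAnti t) (ht0 : ∀ i, 0 < t i)
    {S : Submodule ℂ (c → ℂ)} (hS : Graded ζ S) :
    ∃ (A : Finset (Fin (p + q + (p + q)))) (B : Finset (Fin (p + p))) (C : Finset (Fin (q + q))),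
      B ≠ Finset.univ ∧ C ≠ Finset.univ ∧ B.card + C.card ≤ p + q ∧
      ∃ hA : A.card = B.card + C.card,
        (muVec A hA, muVec B rfl, muVec C rfl) ∈ LRcone B.card C.card ∧
        2 * (∑ i ∈ A, hatVec g i - ∑ i ∈ B, hatVec s i - ∑ i ∈ C, hatVec t i) ≤
          -triDefect η f g s t S := by
  have hli : ∀ k, LinearIndependent ℂ (f k) := fun k => (h.selfDual k).linearIndependent
  have hg' := fun i => (hg0 i).le
  have hs' := fun i => (hs0 i).le
  have ht' := fun i => (ht0 i).le
  obtain ⟨T, hT⟩ : ∃ T, T = (∑ i ∈ Finset.range (p + q + (p + q)), gap g i +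
    ∑ i ∈ Finset.range (p + p), gap s i + ∑ i ∈ Finset.range (q + q), gap t i) *
      Fintype.card c := ⟨_, rfl⟩
  have hT0 : 0 ≤ T := by
    rw [hT]
    refine mul_nonneg (add_nonneg (add_nonneg ?_ ?_) ?_) (Nat.cast_nonneg _)
    · exact Finset.sum_nonneg fun i hi => gap_nonneg hg.antitone hg' (Finset.mem_range.mp hi)
    · exact Finset.sum_nonneg fun i hi => gap_nonneg hs.antitone hs' (Finset.mem_range.mp hi)
    · exact Finset.sum_nonneg fun i hi => gap_nonneg ht.antitone ht' (Finset.mem_range.mp hi)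
  obtain ⟨K, hK⟩ : ∃ K, K = 1 + T + (∑ i, g i + ∑ i, s i + ∑ i, t i) := ⟨_, rfl⟩
  have h1 : ∀ i, g i ≤ ∑ i, g i := fun i =>
    Finset.single_le_sum (fun j _ => hg' j) (Finset.mem_univ i)
  have h2 : ∀ i, s i ≤ ∑ i, s i := fun i =>
    Finset.single_le_sum (fun j _ => hs' j) (Finset.mem_univ i)
  have h3 : ∀ i, t i ≤ ∑ i, t i := fun i =>
    Finset.single_le_sum (fun j _ => ht' j) (Finset.mem_univ i)
  have hgs := Finset.sum_nonneg fun i (_ : i ∈ Finset.univ) => hg' i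
  have hss := Finset.sum_nonneg fun i (_ : i ∈ Finset.univ) => hs' i
  have hts := Finset.sum_nonneg fun i (_ : i ∈ Finset.univ) => ht' i
  have hneg : ∀ k (i : Fin (triLen (p + q + (p + q)) (p + p) (q + q) k + 1)), 0 < i.val →
      triWeight K g s t (some ⟨k, i⟩) < 0 := fun k i hi =>
    triWeight_neg hg hg0 hs hs0 ht ht0 (fun i => by linarith [h1 i]) (fun i => by linarith [h2 i])
      (fun i => by linarith [h3 i]) hi
  have hgr : ∀ S, fullWeight f g s t K S ≤ 0 → Graded ζ S := fun S =>
    graded_of_fullWeight_nonpos g s t h hg.antitone hg' hs.antitone hs' ht.antitone ht'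
      (by rw [← hT]; linarith)
  clear h1 h2 h3 hgs hss hts hK hT hT0
  obtain ⟨S₀, hS₀⟩ := exists_lex_min f
    fun δ => toLex (∑ v, triWeight K g s t v * δ v, ∑ v, δ v)
  simp only [Prod.Lex.toLex_le_toLex] at hS₀
  have hmin : ∀ S, fullWeight f g s t K S₀ ≤ fullWeight f g s t K S := fun S => by
    rcases hS₀ S with h1 | h1
    · exact h1.le
    · exact h1.1.le
  have hmin' : ∀ S, fullWeight f g s t K S ≤ fullWeight f g s t K S₀ →
      ∑ v, Module.finrank ℂ (fullSub f S₀ v) ≤ ∑ v, Module.finrank ℂ (fullSub f S v) := fun S h1 => by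
    rcases hS₀ S with h2 | h2
    · exact absurd h1 (not_le.mpr h2)
    · exact h2.2
  have hbot : fullWeight f g s t K ⊥ = 0 := by
    have h1 : ∀ k i, flagDim (f k) ⊥ i = 0 := fun k i => by
      rw [flagDim, inf_bot_eq, finrank_bot, Nat.cast_zero]
    rw [fullWeight_eq g s t hli]
    simp only [h1]
    simp
  have hgr₀ : Graded ζ S₀ := hgr S₀ (hbot ▸ hmin ⊥)
  have hiso : S₀ ≤ perp η S₀ := by
    have h1 := hgr₀.inf (h.graded_perp hgr₀)
    have h2 : triDefect η f g s t S₀ ≤ triDefect η f g s t (S₀ ⊓ perp η S₀) := by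
      have h3 : ∀ k i, flagDim (f k) S₀ i + flagDim (f k) (perp η S₀) i ≤
          flagDim (f k) (S₀ ⊓ perp η S₀) i + flagDim (f k) (perp η (S₀ ⊓ perp η S₀)) i :=
        fun k i => by
          have := finrank_inf_le_finrank_inf_inf_perp h.herm h.sq (flag (f k) i) S₀
          simp only [flagDim]
          exact_mod_cast this
      exact add_le_add (defect_mono hg.antitone hg' (h3 none))
        (add_le_add (defect_mono hs.antitone hs' (h3 _)) (defect_mono ht.antitone ht' (h3 _)))
    have h3 := two_mul_fullWeight g s t h K hgr₀
    have h4 := two_mul_fullWeight g s t h K h1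
    have h5 := hmin' (S₀ ⊓ perp η S₀) (by linarith)
    have h6 : ∀ v ∈ Finset.univ, Module.finrank ℂ (fullSub f (S₀ ⊓ perp η S₀) v) ≤
        Module.finrank ℂ (fullSub f S₀ v) := fun v _ =>
      Submodule.finrank_mono (fullSub_mono f inf_le_left v)
    have h7 := (Finset.sum_eq_sum_iff_of_le h6).mp (le_antisymm (Finset.sum_le_sum h6) h5) none
      (Finset.mem_univ _)
    rw [finrank_fullSub hli, finrank_fullSub hli] at h7
    have h8 : S₀ ⊓ perp η S₀ = S₀ := Submodule.eq_of_le_of_finrank_eq inf_le_left h7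
    exact inf_eq_left.mp h8
  have hcard : ∀ k, (jumps (f k) S₀).card = Module.finrank ℂ
      ↥(flag (f k) (triLen (p + q + (p + q)) (p + p) (q + q) k) ⊓ S₀) := fun k => by
    rw [← card_filter_jumps (hli k) S₀ le_rfl, Finset.filter_true_of_mem fun b _ => b.2]
  have hr : (jumps (f none) S₀).card = Module.finrank ℂ S₀ := by
    rw [hcard, h.flag_top, top_inf_eq]
  have hBC : (jumps (f (some false)) S₀).card + (jumps (f (some true)) S₀).card =
      Module.finrank ℂ S₀ := by
    rw [hcard, hcard]
    exact (h.finrank_inf_add_le S₀).2.mpr hgr₀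
  have huniv : ∀ k, 0 < triLen (p + q + (p + q)) (p + p) (q + q) k →
      jumps (f k) S₀ ≠ Finset.univ := fun k hk hu => by
    have h1 := hcard k
    rw [hu, Finset.card_univ, Fintype.card_fin] at h1
    have h2 := Submodule.eq_of_le_of_finrank_eq inf_le_left
      (h1.symm.trans (finrank_flag (hli k) le_rfl).symm)
    have h3 := inf_eq_left.mp h2
    have h4 : ∀ b, f k b ∈ S₀ := fun b => h3 (Submodule.subset_span ⟨b, b.2, rfl⟩)
    have h5 := hiso (h4 (Fin.rev ⟨0, hk⟩)) _ (h4 ⟨0, hk⟩)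
    exact (h.selfDual k _ _).mp h5 rfl
  have hB : (fun k => jumps (f k) S₀) = triSet (opp (opp (jumps (f none) S₀)))
      (jumps (f (some false)) S₀) (jumps (f (some true)) S₀) := by
    rw [opp_opp]
    funext k
    rcases k with - | - | - <;> rfl
  have hA : (opp (jumps (f none) S₀)).card =
      (jumps (f (some false)) S₀).card + (jumps (f (some true)) S₀).card := by
    rw [card_opp, hr, hBC]
  have hdim : ∀ v, Module.finrank ℂ (fullSub f S₀ v) = starDim (triSet (opp (opp (jumps (f none) S₀)))
      (jumps (f (some false)) S₀) (jumps (f (some true)) S₀))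
        (opp (jumps (f none) S₀)).card v := fun v => by
    rw [finrank_fullSub hli, hB, card_opp, hr]
  refine ⟨opp (jumps (f none) S₀), jumps (f (some false)) S₀, jumps (f (some true)) S₀,
    huniv _ (show 0 < p + p by omega), huniv _ (show 0 < q + q by omega), ?_, hA, ?_, ?_⟩
  · have h1 := finrank_perp_add h.sq S₀
    have h2 := Submodule.finrank_mono hiso
    rw [h.card] at h1
    omega
  · have hκ : ∀ v, Fintype.card (stdIdx c (triLen (p + q + (p + q)) (p + p) (q + q)) v) =
        starDim (triSet (opp (opp (jumps (f none) S₀)))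
          (jumps (f (some false)) S₀) (jumps (f (some true)) S₀))
          (opp (jumps (f none) S₀)).card v +
        starDim (fun k => (triSet (opp (opp (jumps (f none) S₀)))
          (jumps (f (some false)) S₀) (jumps (f (some true)) S₀) k)ᶜ)
          (p + q + (p + q) - (opp (jumps (f none) S₀)).card) v := fun v => by
      have h1 : (opp (jumps (f none) S₀)).card ≤ p + q + (p + q) := by
        have := Finset.card_le_univ (opp (jumps (f none) S₀))
        rwa [Fintype.card_fin] at this
      rw [starDim_add_compl, Nat.add_sub_cancel' h1, card_starIdx, h.card]
    have hsub : HasSub (inclRep f) (starDim (triSet (opp (opp (jumps (f none) S₀)))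
        (jumps (f (some false)) S₀) (jumps (f (some true)) S₀))
        (opp (jumps (f none) S₀)).card) := ⟨_, isSub_fullSub f S₀, hdim⟩
    have hle : ∀ U, IsSub (inclRep f) U → ∀ v, triWeight K g s t v *
        Module.finrank ℂ (fullSub f (U none) v) ≤ triWeight K g s t v * Module.finrank ℂ (U v) ∧
        (triWeight K g s t v * Module.finrank ℂ (fullSub f (U none) v) =
          triWeight K g s t v * Module.finrank ℂ (U v) →
          Module.finrank ℂ (fullSub f (U none) v) = Module.finrank ℂ (U v)) := fun U hU v => by
      have h1 : Module.finrank ℂ (U v) ≤ Module.finrank ℂ (fullSub f (U none) v) :=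
        Submodule.finrank_mono (hU.le_fullSub v)
      rcases v with - | ⟨k, i⟩
      · have h2 : Module.finrank ℂ (fullSub f (U none) none) = Module.finrank ℂ (U none) :=
          congrArg (fun T : Submodule ℂ (c → ℂ) => Module.finrank ℂ T) (fullSub_none f (U none))
        rw [h2]
        exact ⟨le_rfl, fun _ => rfl⟩
      · rcases Nat.eq_zero_or_pos i.val with hi | hi
        · have h2 : Module.finrank ℂ (fullSub f (U none) (some ⟨k, i⟩)) = 0 := by
            have h3 := Submodule.finrank_le (fullSub f (U none) (some ⟨k, i⟩))
            rw [Module.finrank_fintype_fun_eq_card, card_starIdx] at h3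
            simp only [starDim, hi] at h3
            simpa using h3
          have h3 : Module.finrank ℂ (U (some ⟨k, i⟩)) = 0 := by omega
          rw [h2, h3]
          exact ⟨le_rfl, fun _ => rfl⟩
        · refine ⟨mul_le_mul_of_nonpos_left (Nat.cast_le.mpr h1) (hneg k i hi).le, fun h2 => ?_⟩
          exact_mod_cast mul_left_cancel₀ (hneg k i hi).ne h2
    obtain ⟨x', hx'⟩ := exists_isMoment_of_minimal
      (fun v : StarV (triLen (p + q + (p + q)) (p + p) (q + q)) =>
        match v with
        | none => (0 : ℝ)
        | some ⟨k, i⟩ => (i.val : ℝ) - (triLen (p + q + (p + q)) (p + p) (q + q) k + 1))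
      (by
        rintro (⟨k, i⟩ | k)
        · simp only [Fin.val_succ, Fin.val_castSucc]
          push_cast
          linarith
        · simp only [Fin.val_last]
          linarith)
      (triWeight K g s t) (isSub_fullSub f S₀)
      (fun U hU => (hmin (U none)).trans (Finset.sum_le_sum fun v _ => (hle U hU v).1))
      (fun U hU hUe => by
        have h1 : fullWeight f g s t K (U none) ≤ ∑ v, triWeight K g s t v * Module.finrank ℂ (U v) :=
          Finset.sum_le_sum fun v _ => (hle U hU v).1
        rw [hUe] at h1
        have h2 := hmin' (U none) h1
        have h3 : fullWeight f g s t K (U none) =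
            ∑ v, triWeight K g s t v * Module.finrank ℂ (U v) :=
          hUe ▸ le_antisymm h1 (hmin (U none))
        have h4 := (Finset.sum_eq_sum_iff_of_le fun v _ => (hle U hU v).1).mp h3
        refine h2.trans (le_of_eq (Finset.sum_congr rfl fun v hv => ?_))
        exact (hle U hU v).2 (h4 v hv))
      hdim hκ (hgen _ _ hκ hsub)
    exact mem_LRcone_of_isMoment hA (fun v => Fintype.card_fin _) hx'
  · rw [← sum_triWeight_mul K g s t hA]
    have h1 := hmin S
    have h2 := two_mul_fullWeight g s t h K hS
    have h3 : fullWeight f g s t K S₀ = ∑ v, triWeight K g s t v *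
        starDim (triSet (opp (opp (jumps (f none) S₀)))
        (jumps (f (some false)) S₀) (jumps (f (some true)) S₀))
        (opp (jumps (f none) S₀)).card v :=
      Finset.sum_congr rfl fun v _ => by rw [hdim]
    rw [← h3]
    linarith

end Triples

section Perturbation

theorem hatVec_add_mul {n : ℕ} (g d : Fin n → ℝ) (ε : ℝ) (i : ℕ) :
    hatVec (fun j => g j + ε * d j) i = hatVec g i + ε * hatVec d i := by
  unfold hatVec
  split_ifs <;> ring

theorem defect_add_mul {m : ℕ} (g d : Fin m → ℝ) (ε : ℝ) (a b : ℕ → ℝ) :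
    defect (fun j => g j + ε * d j) a b = defect g a b + ε * defect d a b := by
  simp only [defect, gap, hatVec_add_mul, Finset.mul_sum, ← Finset.sum_add_distrib]
  exact Finset.sum_congr rfl fun i _ => by ring

theorem sum_hatVec_add_mul {n : ℕ} (g d : Fin n → ℝ) (ε : ℝ) (A : Finset (Fin (n + n))) :
    ∑ i ∈ A, hatVec (fun j => g j + ε * d j) i =
      ∑ i ∈ A, hatVec g i + ε * ∑ i ∈ A, hatVec d i := by
  simp only [hatVec_add_mul, Finset.mul_sum, Finset.sum_add_distrib]

/-- A strictly decreasing positive vector. -/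
def staircase (n : ℕ) (i : Fin n) : ℝ := n - i

theorem staircase_pos {n : ℕ} (i : Fin n) : 0 < staircase n i :=
  sub_pos.mpr (Nat.cast_lt.mpr i.2)

theorem strictAnti_add_mul_staircase {n : ℕ} {g : Fin n → ℝ} (hg : Antitone g) {ε : ℝ}
    (hε : 0 < ε) : StrictAnti fun j => g j + ε * staircase n j := fun _ _ h =>
  add_lt_add_of_le_of_lt (hg h.le) (mul_lt_mul_of_pos_left
    (sub_lt_sub_left (Nat.cast_lt.mpr (Fin.lt_def.mp h)) _) hε)

theorem add_mul_staircase_pos {n : ℕ} {g : Fin n → ℝ} (hg : ∀ i, 0 ≤ g i) {ε : ℝ}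
    (hε : 0 < ε) (i : Fin n) : 0 < g i + ε * staircase n i :=
  add_pos_of_nonneg_of_pos (hg i) (mul_pos hε (staircase_pos i))

variable {c : Type} [Fintype c] [DecidableEq c] {p q : ℕ}
  {η ζ : Matrix c c ℂ} {f : ∀ k, Fin (triLen (p + q + (p + q)) (p + p) (q + q) k) → c → ℂ}
  {g : Fin (p + q) → ℝ} {s : Fin p → ℝ} {t : Fin q → ℝ}

theorem triDefect_nonpos (h : IsTriFrame η ζ f) (hp : 0 < p) (hq : 0 < q)
    (hgen : EulerGeneric (inclRep f)) (hg : Antitone g) (hg0 : ∀ i, 0 ≤ g i) (hs : Antitone s)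
    (hs0 : ∀ i, 0 ≤ s i) (ht : Antitone t) (ht0 : ∀ i, 0 ≤ t i)
    (hineq : ∀ (A : Finset (Fin (p + q + (p + q)))) (B : Finset (Fin (p + p)))
      (C : Finset (Fin (q + q))), B ≠ Finset.univ → C ≠ Finset.univ →
      ∀ hA : A.card = B.card + C.card, B.card + C.card ≤ p + q →
        (muVec A hA, muVec B rfl, muVec C rfl) ∈ LRcone B.card C.card →
        0 ≤ ∑ i ∈ A, hatVec g i - ∑ i ∈ B, hatVec s i - ∑ i ∈ C, hatVec t i)
    {S : Submodule ℂ (c → ℂ)} (hS : Graded ζ S) : triDefect η f g s t S ≤ 0 := by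
  obtain ⟨M, hM⟩ := (Set.finite_range fun T : Finset (Fin (p + q + (p + q))) ×
    Finset (Fin (p + p)) × Finset (Fin (q + q)) => ∑ i ∈ T.1, hatVec (staircase (p + q)) i -
      ∑ i ∈ T.2.1, hatVec (staircase p) i - ∑ i ∈ T.2.2, hatVec (staircase q) i).bddBelow
  have key : ∀ ε : ℝ, 0 < ε → triDefect η f g s t S ≤
      ε * (-(2 * M) - triDefect η f (staircase (p + q)) (staircase p) (staircase q) S) :=
    fun ε hε => by
      obtain ⟨A, B, C, hB, hC, hle, hA, hLR, h1⟩ := exists_triple h hp hq hgen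
        (strictAnti_add_mul_staircase hg hε) (add_mul_staircase_pos hg0 hε)
        (strictAnti_add_mul_staircase hs hε) (add_mul_staircase_pos hs0 hε)
        (strictAnti_add_mul_staircase ht hε) (add_mul_staircase_pos ht0 hε) hS
      have h2 := hineq A B C hB hC hA hle hLR
      have h3 := mul_le_mul_of_nonneg_left (hM ⟨(A, B, C), rfl⟩) hε.le
      simp only [triDefect, defect_add_mul, sum_hatVec_add_mul] at h1 h3 ⊢
      linarith
  refine le_of_forall_pos_lt_add' fun ε hε => ?_
  set N := -(2 * M) - triDefect η f (staircase (p + q)) (staircase p) (staircase q) S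
  have h1 := key (ε / (2 * (|N| + 1))) (by positivity)
  have h2 : ε / (2 * (|N| + 1)) * N ≤ ε / (2 * (|N| + 1)) * (|N| + 1) :=
    mul_le_mul_of_nonneg_left ((le_abs_self N).trans (by linarith)) (by positivity)
  have h3 : ε / (2 * (|N| + 1)) * (|N| + 1) = ε / 2 := by
    have : |N| + 1 ≠ 0 := by positivity
    field_simp
  linarith

end Perturbation

section GenericRep

variable {V Q : Type} [Fintype V] [Fintype Q] {src tgt : Q → V}
  {ι : V → Type} [∀ v, Fintype (ι v)]

theorem eventually_eulerGeneric :
    ∀ᶠ x in zariskiFilter (QRep src tgt ι), EulerGeneric x := by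
  have hfin : {δ : V → ℕ | ∀ v, δ v ≤ Fintype.card (ι v)}.Finite :=
    Set.Finite.pi' fun v => Set.finite_Iic _
  have h1 : ∀ᶠ x in zariskiFilter (QRep src tgt ι), ∀ δ ∈ {δ : V → ℕ | ∀ v, δ v ≤
      Fintype.card (ι v)}, HasSub x δ → 0 ≤ euler src tgt δ fun v => Fintype.card (ι v) - δ v := by
    refine (Filter.eventually_all_finite hfin).mpr fun δ hδ => ?_
    rcases hasSub_dichotomy (src := src) (tgt := tgt) (κ := ι) (δ := δ)
      (γ := fun v => Fintype.card (ι v) - δ v)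
      (fun v => (Nat.add_sub_cancel' (hδ v)).symm) with h | h
    · exact h.mono fun x hx hx' => absurd hx' hx
    · exact Filter.Eventually.of_forall fun _ _ => h.2
  refine h1.mono fun x hx δ γ hγ h2 => ?_
  have h3 : γ = fun v => Fintype.card (ι v) - δ v := funext fun v => by rw [hγ v]; omega
  rw [h3]
  exact hx δ (fun v => by rw [hγ v]; omega) h2

/-- The representations outside of some hypersurface containing all the nongeneric ones. -/
def PolyGeneric (x : QRep src tgt ι) : Prop :=
  ∃ P ∈ polyFun (QRep src tgt ι), P x ≠ 0 ∧ ∀ x', P x' ≠ 0 → EulerGeneric x'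

theorem eventually_polyGeneric :
    ∀ᶠ x in zariskiFilter (QRep src tgt ι), PolyGeneric x := by
  obtain ⟨P, hP, hP0, h⟩ := eventually_zariski_iff.mp (eventually_eulerGeneric (src := src)
    (tgt := tgt) (ι := ι))
  exact ⟨P, hP, hP0, fun x hx => ⟨P, hP, hx, h⟩⟩

theorem EulerGeneric.of_isHom {x y : QRep src tgt ι} {g : ∀ v, (ι v → ℂ) →ₗ[ℂ] (ι v → ℂ)}
    (hg : IsHom x y g) (hinj : ∀ v, Function.Injective (g v)) (h : EulerGeneric y) :
    EulerGeneric x :=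
  fun δ γ hγ hδ => h δ γ hγ (hδ.of_injective hg hinj)

theorem PolyGeneric.of_isHom [∀ v, DecidableEq (ι v)] {x y : QRep src tgt ι}
    {g : ∀ v, (ι v → ℂ) ≃ₗ[ℂ] (ι v → ℂ)}
    (hg : IsHom x y fun v => (g v).toLinearMap) (h : PolyGeneric y) : PolyGeneric x := by
  obtain ⟨P, hP, hP0, hP1⟩ := h
  let C : QRep src tgt ι →ₗ[ℂ] QRep src tgt ι := LinearMap.pi fun a =>
    { toFun := fun x => LinearMap.toMatrix' (g (tgt a)).toLinearMap * x a *
        LinearMap.toMatrix' (g (src a)).symm.toLinearMap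
      map_add' := fun x y => by
        rw [Pi.add_apply, Matrix.mul_add, Matrix.add_mul]
      map_smul' := fun r x => by
        rw [Pi.smul_apply, Matrix.mul_smul, Matrix.smul_mul, RingHom.id_apply] }
  have hC : ∀ x a u, (C x a) *ᵥ (g (src a) u) = g (tgt a) (x a *ᵥ u) := fun x a u => by
    change (LinearMap.toMatrix' (g (tgt a)).toLinearMap * x a *
        LinearMap.toMatrix' (g (src a)).symm.toLinearMap) *ᵥ _ = _
    rw [← mulVec_mulVec, ← mulVec_mulVec, LinearMap.toMatrix'_mulVec, LinearMap.toMatrix'_mulVec]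
    simp
  have hCx : C x = y := by
    funext a
    refine Matrix.ext_of_mulVec_single fun j => ?_
    obtain ⟨u, hu⟩ := (g (src a)).surjective (Pi.single j 1)
    rw [← hu, hC]
    exact hg a u
  refine ⟨fun x => P (C x), polyFun_comp (fun l => linear_mem_polyFun (l ∘ₗ C)) hP,
    by simpa only [hCx] using hP0, fun x' hx' => ?_⟩
  exact (hP1 _ hx').of_isHom (g := fun v => (g v).toLinearMap) (fun a u => (hC x' a u).symm)
    fun v => (g v).injective

end GenericRep

section Injective

variable {E : Type} [AddCommGroup E] [Module ℂ E] {m n : Type} [Fintype m] [Fintype n]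
  [DecidableEq n]

open ComplexOrder in
theorem det_conjTranspose_mul_ne_zero_iff {A : Matrix m n ℂ} :
    (Aᴴ * A).det ≠ 0 ↔ Function.Injective A.mulVec := by
  constructor
  · intro h
    have h1 : Function.Injective (Aᴴ * A).mulVec :=
      Matrix.mulVec_injective_iff_isUnit.mpr ((Matrix.isUnit_iff_isUnit_det _).mpr h.isUnit)
    intro u w huw
    exact h1 (by rw [← mulVec_mulVec, ← mulVec_mulVec]; exact congrArg _ huw)
  · intro h
    exact (Matrix.PosDef.conjTranspose_mul_self A h).det_pos.ne'

theorem eventually_injective {D : E →ₗ[ℂ] Matrix m n ℂ} {x₀ : E}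
    (h : Function.Injective (D x₀).mulVec) :
    ∀ᶠ x in zariskiFilter E, Function.Injective (D x).mulVec := by
  have h1 : (fun x => ((D x₀)ᴴ * D x).det) ∈ polyFun E := polyFun_det fun i j =>
    linear_mem_polyFun ((LinearMap.proj j ∘ₗ LinearMap.proj i : Matrix n n ℂ →ₗ[ℂ] ℂ) ∘ₗ
      (mulLeftLinearMap n ℂ (D x₀)ᴴ) ∘ₗ D)
  refine (eventually_zariski_of_polyFun h1 (det_conjTranspose_mul_ne_zero_iff.mpr h)).mono
    fun x hx u w huw => ?_
  have h2 : Function.Injective ((D x₀)ᴴ * D x).mulVec :=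
      Matrix.mulVec_injective_iff_isUnit.mpr ((Matrix.isUnit_iff_isUnit_det _).mpr hx.isUnit)
  exact h2 (by rw [← mulVec_mulVec, ← mulVec_mulVec]; exact congrArg _ huw)

end Injective

theorem exists_linearEquiv_comp_eq {V W : Type} [AddCommGroup V] [Module ℂ V] [AddCommGroup W]
    [Module ℂ W] [FiniteDimensional ℂ W] {a b : V →ₗ[ℂ] W} (ha : Function.Injective a)
    (hb : Function.Injective b) : ∃ g : W ≃ₗ[ℂ] W, ∀ v, g (a v) = b v := by
  obtain ⟨A, hA⟩ := Submodule.exists_isCompl (LinearMap.range a)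
  obtain ⟨B, hB⟩ := Submodule.exists_isCompl (LinearMap.range b)
  have h1 := Submodule.finrank_add_eq_of_isCompl hA
  have h2 := Submodule.finrank_add_eq_of_isCompl hB
  rw [← (LinearEquiv.ofInjective a ha).finrank_eq] at h1
  rw [← (LinearEquiv.ofInjective b hb).finrank_eq] at h2
  let e := (LinearEquiv.ofInjective a ha).symm.trans (LinearEquiv.ofInjective b hb)
  let e' : A ≃ₗ[ℂ] B := LinearEquiv.ofFinrankEq _ _ (by omega)
  refine ⟨(Submodule.prodEquivOfIsCompl _ _ hA).symm.trans ((e.prodCongr e').trans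
    (Submodule.prodEquivOfIsCompl _ _ hB)), fun v => ?_⟩
  have h3 : (Submodule.prodEquivOfIsCompl _ _ hA).symm (a v) =
      (LinearEquiv.ofInjective a ha v, 0) := by
    rw [LinearEquiv.symm_apply_eq]
    simp
  simp [h3, e]

section StarGeneric

variable {K : Type} {L : K → ℕ} {c : Type} [Fintype c] [DecidableEq c]

omit [DecidableEq c] in
theorem inclRep_mulVec_inl (f : ∀ k, Fin (L k) → c → ℂ) (k : K) (i : Fin (L k))
    (u : stdIdx c L (some ⟨k, i.castSucc⟩) → ℂ) (b : stdIdx c L (some ⟨k, i.castSucc⟩)) :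
    (armMap (inclRep f) k i *ᵥ u) ⟨b.1, Finset.mem_univ _, b.2.2.trans (Nat.lt_succ_self _)⟩ =
      u b := by
  refine (Fintype.sum_eq_single b fun b' hb' => ?_).trans ?_
  · exact mul_eq_zero_of_left (if_neg fun h => hb' (Subtype.ext h.symm)) _
  · exact (congrArg (· * u b) (if_pos rfl)).trans (one_mul _)

theorem inclRep_mulVec_inr (f : ∀ k, Fin (L k) → c → ℂ) (k : K)
    (u : stdIdx c L (some ⟨k, Fin.last _⟩) → ℂ) :
    inclRep f (.inr k) *ᵥ u = ∑ b, u b • f k b.1 := starCol_mulVec_some f k (Fin.last _) u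

omit [Fintype c] [DecidableEq c] in
theorem map_sum_smul_eq {T : Type} [Fintype T] {φ ψ : T → c → ℂ} (g : (c → ℂ) ≃ₗ[ℂ] (c → ℂ))
    {α : ℂ} (hα : α ≠ 0) (h : ∀ b, α • g (φ b) = ψ b) (u : T → ℂ) :
    g (∑ b, u b • φ b) = α⁻¹ • ∑ b, u b • ψ b := by
  rw [map_sum, Finset.smul_sum]
  refine Finset.sum_congr rfl fun b _ => ?_
  rw [map_smul, ← h, smul_comm α⁻¹ (u b), smul_smul α⁻¹, inv_mul_cancel₀ hα, one_smul]

theorem exists_isHom_smul {f f' : ∀ k, Fin (L k) → c → ℂ} (g : (c → ℂ) ≃ₗ[ℂ] (c → ℂ))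
    (α : K → ℂ) (hα : ∀ k, α k ≠ 0) (h : ∀ k b, α k • g (f k b) = f' k b) :
    ∃ G : ∀ v, (stdIdx c L v → ℂ) ≃ₗ[ℂ] (stdIdx c L v → ℂ),
      IsHom (inclRep f) (inclRep f') fun v => (G v).toLinearMap := by
  let G : ∀ v, (stdIdx c L v → ℂ) ≃ₗ[ℂ] (stdIdx c L v → ℂ)
    | none => g
    | some ⟨k, i⟩ => LinearEquiv.smulOfNeZero ℂ _ (α k)⁻¹ (inv_ne_zero (hα k))
  refine ⟨G, ?_⟩
  rintro (⟨k, i⟩ | k) u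
  · exact (mulVec_smul (inclRep f (.inl ⟨k, i⟩)) (α k)⁻¹ u).symm
  · change g (inclRep f (.inr k) *ᵥ u) = inclRep f' (.inr k) *ᵥ ((α k)⁻¹ • u)
    refine ((congrArg g (inclRep_mulVec_inr f k u)).trans ?_).trans
      ((mulVec_smul _ _ _).trans (congrArg _ (inclRep_mulVec_inr f' k u))).symm
    exact map_sum_smul_eq g (hα k) (fun b => h k b.1) u

theorem exists_isHom_of_injective {y : QRep (starSrc L) (starTgt L) (stdIdx c L)}
    (hy : ∀ k i, Function.Injective (armMap y k i).mulVec) :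
    ∃ (f : ∀ k, Fin (L k) → c → ℂ) (G : ∀ v, (stdIdx c L v → ℂ) ≃ₗ[ℂ] (stdIdx c L v → ℂ)),
      (∀ u, G none u = u) ∧
      IsHom (inclRep f) y fun v => (G v).toLinearMap := by
  have hJ : ∀ k (i : Fin (L k)), Function.Injective (armMap (inclRep fun k (b : Fin (L k)) =>
      (0 : c → ℂ)) k i).mulVecLin := fun k i u w h => by
    funext b
    exact (inclRep_mulVec_inl _ k i u b).symm.trans
      ((congrFun h _).trans (inclRep_mulVec_inl _ k i w b))
  have step : ∀ k (i : Fin (L k)) (g : (stdIdx c L (some ⟨k, i.castSucc⟩) → ℂ) ≃ₗ[ℂ]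
      (stdIdx c L (some ⟨k, i.castSucc⟩) → ℂ)), ∃ g' : (stdIdx c L (some ⟨k, i.succ⟩) → ℂ) ≃ₗ[ℂ]
      (stdIdx c L (some ⟨k, i.succ⟩) → ℂ), ∀ u, g' (armMap (inclRep fun k (b : Fin (L k)) =>
        (0 : c → ℂ)) k i *ᵥ u) = armMap y k i *ᵥ g u := fun k i g =>
    exists_linearEquiv_comp_eq (a := (armMap (inclRep fun k (b : Fin (L k)) =>
      (0 : c → ℂ)) k i).mulVecLin) (b := (armMap y k i).mulVecLin ∘ₗ g.toLinearMap) (hJ k i)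
      ((hy k i).comp g.injective)
  choose st hst using step
  let G₁ : ∀ k (i : Fin (L k + 1)), (stdIdx c L (some ⟨k, i⟩) → ℂ) ≃ₗ[ℂ]
      (stdIdx c L (some ⟨k, i⟩) → ℂ) := fun k => Fin.induction (LinearEquiv.refl ℂ _) (st k)
  have hG₁ : ∀ k i u, G₁ k i.succ (armMap (inclRep fun k (b : Fin (L k)) =>
        (0 : c → ℂ)) k i *ᵥ u) = armMap y k i *ᵥ G₁ k i.castSucc u := fun k i => hst k i _
  let f : ∀ k, Fin (L k) → c → ℂ := fun k b =>
    armLast y k *ᵥ G₁ k (Fin.last _) (Pi.single ⟨b, Finset.mem_univ _, b.2⟩ 1)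
  let G : ∀ v, (stdIdx c L v → ℂ) ≃ₗ[ℂ] (stdIdx c L v → ℂ)
    | none => LinearEquiv.refl ℂ _
    | some ⟨k, i⟩ => G₁ k i
  refine ⟨f, G, fun _ => rfl, ?_⟩
  rintro (⟨k, i⟩ | k) u
  · exact hG₁ k i u
  · change inclRep f (.inr k) *ᵥ u = armLast y k *ᵥ G₁ k (Fin.last _) u
    rw [inclRep_mulVec_inr]
    have h1 : u = ∑ b, u b • Pi.single b (1 : ℂ) := pi_eq_sum_univ' u
    conv_rhs => rw [h1, map_sum, mulVec_sum]
    refine Finset.sum_congr rfl fun b _ => ?_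
    rw [map_smul, mulVec_smul]
    rfl

end StarGeneric

section Cayley

variable {c : Type} [Fintype c] [DecidableEq c]

theorem polyFun_matrix_comp {φ : ℂ → Matrix c c ℂ}
    (hφ : ∀ i j, (fun z => φ z i j) ∈ polyFun ℂ) (l : Matrix c c ℂ →ₗ[ℂ] ℂ) :
    (fun z => l (φ z)) ∈ polyFun ℂ := by
  have h1 : (fun z => l (φ z)) =
      ∑ i, ∑ j, (fun z => φ z i j) * fun _ => l (Matrix.single i j 1) := by
    funext z
    conv_lhs => rw [Matrix.matrix_eq_sum_single (φ z)]
    simp only [map_sum, Finset.sum_apply, Pi.mul_apply]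
    refine Finset.sum_congr rfl fun i _ => Finset.sum_congr rfl fun j _ => ?_
    rw [← smul_eq_mul, ← map_smul, Matrix.smul_single, smul_eq_mul, mul_one]
  rw [h1]
  exact sum_mem fun i _ => sum_mem fun j _ => mul_mem (hφ i j) (const_mem_polyFun _)

theorem polyFun_adjugate {φ : ℂ → Matrix c c ℂ} (hφ : ∀ i j, (fun z => φ z i j) ∈ polyFun ℂ)
    (i j : c) : (fun z => (φ z).adjugate i j) ∈ polyFun ℂ := by
  simp only [Matrix.adjugate_apply]
  refine polyFun_det fun k l => ?_
  by_cases hk : k = j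
  · subst hk
    simp only [Matrix.updateRow_self]
    exact const_mem_polyFun _
  · simp only [Matrix.updateRow_ne hk]
    exact hφ k l

theorem cayley_unitary {η X : Matrix c c ℂ} (hX : Xᴴ * η = -(η * X)) (hD : (1 - X).det ≠ 0) :
    ((1 + X) * (1 - X)⁻¹)ᴴ * η * ((1 + X) * (1 - X)⁻¹) = η := by
  have hu : IsUnit (1 - X).det := hD.isUnit
  have h1 : (1 + X)ᴴ * η = η * (1 - X) := by
    rw [conjTranspose_add, conjTranspose_one, Matrix.add_mul, hX]
    noncomm_ring
  have h2 : (1 - X)ᴴ * η = η * (1 + X) := by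
    rw [conjTranspose_sub, conjTranspose_one, Matrix.sub_mul, hX]
    noncomm_ring
  have h3 : (1 - X)ᴴ⁻¹ * (1 - X)ᴴ = 1 :=
    Matrix.nonsing_inv_mul _ (by rw [det_conjTranspose]; exact hu.star)
  calc ((1 + X) * (1 - X)⁻¹)ᴴ * η * ((1 + X) * (1 - X)⁻¹)
      = (1 - X)ᴴ⁻¹ * ((1 + X)ᴴ * η) * ((1 + X) * (1 - X)⁻¹) := by
        rw [conjTranspose_mul, conjTranspose_nonsing_inv]
        simp only [Matrix.mul_assoc]
    _ = (1 - X)ᴴ⁻¹ * (η * (1 + X)) * ((1 - X) * (1 - X)⁻¹) := by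
        rw [h1]
        simp only [Matrix.mul_assoc]
        rw [← Matrix.mul_assoc (1 - X) (1 + X), ← Matrix.mul_assoc (1 + X) (1 - X)]
        congr 3
        noncomm_ring
    _ = η := by
        rw [← h2, Matrix.mul_nonsing_inv _ hu, Matrix.mul_one, ← Matrix.mul_assoc, h3,
          Matrix.one_mul]

theorem exists_cayley_path {η : Matrix c c ℂ} (hη : η.IsHermitian) (hη' : η * η = 1)
    (m : Matrix c c ℂ) :
    ∃ φ : ℂ → Matrix c c ℂ, (∀ i j, (fun z => φ z i j) ∈ polyFun ℂ) ∧ φ Complex.I = m ∧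
      ∀ᶠ z : ℂ in zariskiFilter ℂ, ∀ r : ℝ, z = (r : ℂ) →
        ∃ α : ℂ, α ≠ 0 ∧ ∃ u : Matrix c c ℂ, uᴴ * η * u = η ∧ φ z = α • u := by
  obtain ⟨s, hs, hs0⟩ : ∃ s : ℂ, (s • m + 1).det ≠ 0 ∧ s ≠ 0 := by
    have h1 : ∀ᶠ s in zariskiFilter ℂ, (s • m + 1).det ≠ 0 :=
      eventually_zariski_of_polyFun (x := 0) (f := fun s : ℂ => (s • m + 1).det)
        (polyFun_det fun i j => (polyFun ℂ).add_mem
          (linear_mem_polyFun (LinearMap.mulRight ℂ (m i j))) (const_mem_polyFun _)) (by simp)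
    have h2 : ∀ᶠ s in zariskiFilter ℂ, s ≠ 0 :=
      eventually_zariski_of_polyFun (x := 1) (f := fun s : ℂ => s)
        (linear_mem_polyFun LinearMap.id) one_ne_zero
    exact (h1.and h2).exists
  obtain ⟨X₀, hX₀⟩ : ∃ X₀ : Matrix c c ℂ, X₀ = (s • m - 1) * (s • m + 1)⁻¹ := ⟨_, rfl⟩
  have hX₁ : X₀ * (s • m + 1) = s • m - 1 := by
    rw [hX₀, Matrix.mul_assoc, Matrix.nonsing_inv_mul _ hs.isUnit, Matrix.mul_one]
  obtain ⟨A, hA⟩ : ∃ A : Matrix c c ℂ, A = (1 / 2 : ℂ) • (X₀ - η * X₀ᴴ * η) := ⟨_, rfl⟩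
  obtain ⟨B, hB⟩ : ∃ B : Matrix c c ℂ, B = (-Complex.I / 2 : ℂ) • (X₀ + η * X₀ᴴ * η) := ⟨_, rfl⟩
  have hηX : (η * X₀ᴴ * η)ᴴ * η = η * X₀ := by
    rw [conjTranspose_mul, conjTranspose_mul, conjTranspose_conjTranspose, hη.eq,
      Matrix.mul_assoc, Matrix.mul_assoc, hη', Matrix.mul_one]
  have hηX' : η * (η * X₀ᴴ * η) = X₀ᴴ * η := by
    rw [← Matrix.mul_assoc, ← Matrix.mul_assoc, hη', Matrix.one_mul]
  have hA' : Aᴴ * η = -(η * A) := by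
    rw [hA, conjTranspose_smul, Matrix.smul_mul, Matrix.mul_smul, conjTranspose_sub,
      Matrix.sub_mul, Matrix.mul_sub, hηX, hηX', ← smul_neg, neg_sub]
    congr 1
    simp
  have hB' : Bᴴ * η = -(η * B) := by
    rw [hB, conjTranspose_smul, Matrix.smul_mul, Matrix.mul_smul, conjTranspose_add,
      Matrix.add_mul, Matrix.mul_add, hηX, hηX', ← neg_smul, add_comm]
    congr 1
    simp [neg_div]
  have hAB : A + Complex.I • B = X₀ := by
    rw [hA, hB, smul_smul]
    have h1 : Complex.I * (-Complex.I / 2) = 1 / 2 := by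
      rw [mul_div_assoc', mul_neg, Complex.I_mul_I, neg_neg]
    rw [h1, ← smul_add, sub_add_add_cancel, ← two_smul ℂ X₀, smul_smul]
    norm_num
  have hD1 : (1 - X₀) * (s • m + 1) = (2 : ℂ) • (1 : Matrix c c ℂ) := by
    rw [Matrix.sub_mul, hX₁, Matrix.one_mul, two_smul]
    abel
  have hD : (1 - X₀).det ≠ 0 := fun h0 => by
    have h1 := congrArg Matrix.det hD1
    rw [det_mul, h0, zero_mul, det_smul, det_one, mul_one] at h1
    exact pow_ne_zero _ two_ne_zero h1.symm
  have hN : 1 + X₀ = s • m * (1 - X₀) := by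
    have h1 : (1 + X₀) * (s • m + 1) = s • m * (1 - X₀) * (s • m + 1) := by
      rw [Matrix.mul_assoc, hD1, Matrix.add_mul, hX₁, Matrix.one_mul, Matrix.mul_smul,
        Matrix.mul_one, two_smul]
      abel
    have h2 := congrArg (· * (s • m + 1)⁻¹) h1
    simpa only [Matrix.mul_assoc, Matrix.mul_nonsing_inv _ hs.isUnit, Matrix.mul_one] using h2
  have hXpoly : ∀ i j, (fun z : ℂ => (A + z • B) i j) ∈ polyFun ℂ := fun i j =>
    (polyFun ℂ).add_mem (const_mem_polyFun _) (linear_mem_polyFun (LinearMap.mulRight ℂ (B i j)))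
  have hDpoly : ∀ i j, (fun z : ℂ => (1 - (A + z • B)) i j) ∈ polyFun ℂ := fun i j =>
    (polyFun ℂ).sub_mem (const_mem_polyFun _) (hXpoly i j)
  have hNpoly : ∀ i j, (fun z : ℂ => (1 + (A + z • B)) i j) ∈ polyFun ℂ := fun i j =>
    (polyFun ℂ).add_mem (const_mem_polyFun _) (hXpoly i j)
  have hev : ∀ᶠ z in zariskiFilter ℂ, (1 - (A + z • B)).det ≠ 0 :=
    eventually_zariski_of_polyFun (x := Complex.I) (f := fun z : ℂ => (1 - (A + z • B)).det)
      (polyFun_det hDpoly) (by rwa [hAB])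
  refine ⟨fun z => (s * (1 - X₀).det)⁻¹ • ((1 + (A + z • B)) * (1 - (A + z • B)).adjugate),
    fun i j => ?_, ?_, hev.mono ?_⟩
  · have h1 : (fun z : ℂ => ((s * (1 - X₀).det)⁻¹ •
        ((1 + (A + z • B)) * (1 - (A + z • B)).adjugate)) i j) =
        (fun _ => (s * (1 - X₀).det)⁻¹) * ∑ k, (fun z : ℂ => (1 + (A + z • B)) i k) *
          fun z : ℂ => (1 - (A + z • B)).adjugate k j := by
      funext z
      simp only [Matrix.smul_apply, Matrix.mul_apply, Pi.mul_apply, Finset.sum_apply, smul_eq_mul]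
    rw [h1]
    exact mul_mem (const_mem_polyFun _) (sum_mem fun k _ =>
      mul_mem (hNpoly i k) (polyFun_adjugate hDpoly k j))
  · change (s * (1 - X₀).det)⁻¹ • ((1 + (A + Complex.I • B)) * (1 - (A + Complex.I • B)).adjugate)
      = m
    rw [hAB, hN, Matrix.mul_assoc, Matrix.mul_adjugate, Matrix.mul_smul, Matrix.mul_one,
      smul_smul, smul_smul, mul_assoc, mul_comm _ s, inv_mul_cancel₀ (mul_ne_zero hs0 hD), one_smul]
  · rintro - hz r rfl
    refine ⟨(s * (1 - X₀).det)⁻¹ * (1 - (A + (r : ℂ) • B)).det,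
      mul_ne_zero (inv_ne_zero (mul_ne_zero hs0 hD)) hz,
      (1 + (A + (r : ℂ) • B)) * (1 - (A + (r : ℂ) • B))⁻¹, cayley_unitary ?_ hz, ?_⟩
    · rw [conjTranspose_add, conjTranspose_smul, Matrix.add_mul, Matrix.smul_mul, hA', hB',
        Matrix.mul_add, Matrix.mul_smul, neg_add, smul_neg]
      simp
    · rw [Matrix.inv_def, Ring.inverse_eq_inv', Matrix.mul_smul, smul_smul, mul_assoc,
        mul_inv_cancel₀ hz, mul_one]

end Cayley

theorem eventually_forall_injective {V Q : Type} [Fintype V] [Fintype Q] {src tgt : Q → V}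
    {ι : V → Type} [∀ v, Fintype (ι v)] [∀ v, DecidableEq (ι v)] {x₀ : QRep src tgt ι}
    (h : ∀ a, Function.Injective (x₀ a).mulVec) :
    ∀ᶠ x in zariskiFilter (QRep src tgt ι), ∀ a, Function.Injective (x a).mulVec :=
  Filter.eventually_all.mpr fun a => eventually_injective
    (D := (LinearMap.proj a : QRep src tgt ι →ₗ[ℂ] Matrix (ι (tgt a)) (ι (src a)) ℂ)) (h a)

section Columns

variable {K : Type} {L : K → ℕ} {c : Type} [Fintype c] [DecidableEq c]

omit [DecidableEq c] in
theorem exists_linearEquiv_of_linearIndependent {T : Type} [Fintype T] {φ ψ : T → c → ℂ}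
    (hφ : LinearIndependent ℂ φ) (hψ : LinearIndependent ℂ ψ) :
    ∃ g : (c → ℂ) ≃ₗ[ℂ] (c → ℂ), ∀ b, g (φ b) = ψ b := by
  classical
  obtain ⟨g, hg⟩ := exists_linearEquiv_comp_eq hφ.fintypeLinearCombination_injective
    hψ.fintypeLinearCombination_injective
  refine ⟨g, fun b => ?_⟩
  have h1 := hg (Pi.single b 1)
  rwa [Fintype.linearCombination_apply_single, Fintype.linearCombination_apply_single, one_smul,
    one_smul] at h1

/-- The indices at the end of an arm. -/
def stdLast (c : Type) (L : K → ℕ) (k : K) : stdIdx c L (some ⟨k, Fin.last _⟩) ≃ Fin (L k) where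
  toFun b := b.1
  invFun b := ⟨b, Finset.mem_univ _, b.2⟩
  left_inv _ := rfl
  right_inv _ := rfl

omit [DecidableEq c] in
theorem linearIndependent_iff_armLast (f : ∀ k, Fin (L k) → c → ℂ) (k : K) :
    LinearIndependent ℂ (f k) ↔ Function.Injective (armLast (inclRep f) k).mulVec :=
  (linearIndependent_equiv (stdLast c L k)).symm.trans Matrix.mulVec_injective_iff.symm

omit [DecidableEq c] in
theorem linearIndependent_iff_fromCols (f : ∀ k, Fin (L k) → c → ℂ) (k k' : K) :
    LinearIndependent ℂ (Sum.elim (f k) (f k')) ↔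
      Function.Injective (fromCols (armLast (inclRep f) k) (armLast (inclRep f) k')).mulVec := by
  have h1 : Sum.elim (f k) (f k') ∘ (stdLast c L k).sumCongr (stdLast c L k') =
      (fromCols (armLast (inclRep f) k) (armLast (inclRep f) k')).col := by
    funext b
    rcases b with b | b <;> rfl
  rw [← linearIndependent_equiv ((stdLast c L k).sumCongr (stdLast c L k')),
    Matrix.mulVec_injective_iff, h1]
  rfl

theorem inclRep_injective {f : ∀ k, Fin (L k) → c → ℂ} (hf : ∀ k, LinearIndependent ℂ (f k)) (a) :
    Function.Injective (inclRep f a).mulVec := fun u w huw => by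
  refine starCol_injective hf (starSrc _ a) ?_
  rw [← starCol_mul_inclRep, mulVecLin_apply, mulVecLin_apply, ← mulVec_mulVec, ← mulVec_mulVec]
  exact congrArg _ huw

theorem fromCols_mulVec_injective {m n n' : Type} [Fintype n] [Fintype n'] {A A' : Matrix m n ℂ}
    {B B' : Matrix m n' ℂ} (g : (n → ℂ) → n → ℂ) (g' : (n' → ℂ) → n' → ℂ)
    (hg : Function.Injective g) (hg' : Function.Injective g') (hA : ∀ u, A *ᵥ u = A' *ᵥ g u)
    (hB : ∀ u, B *ᵥ u = B' *ᵥ g' u) (h : Function.Injective (fromCols A' B').mulVec) :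
    Function.Injective (fromCols A B).mulVec := by
  intro u w huw
  rw [fromCols_mulVec, fromCols_mulVec, hA, hA, hB, hB] at huw
  have h1 : fromCols A' B' *ᵥ Sum.elim (g (u ∘ Sum.inl)) (g' (u ∘ Sum.inr)) =
      fromCols A' B' *ᵥ Sum.elim (g (w ∘ Sum.inl)) (g' (w ∘ Sum.inr)) := by
    rw [fromCols_mulVec, fromCols_mulVec]
    exact huw
  have h2 := h h1
  have h3 := hg (congrArg (· ∘ Sum.inl) h2)
  have h4 := hg' (congrArg (· ∘ Sum.inr) h2)
  funext b
  rcases b with b | b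
  · exact congrFun h3 b
  · exact congrFun h4 b

theorem exists_polyGeneric_inclRep [Fintype K] {f : ∀ k, Fin (L k) → c → ℂ}
    (hf : ∀ k, LinearIndependent ℂ (f k)) {k k' : K}
    (hk : LinearIndependent ℂ (Sum.elim (f k) (f k'))) :
    ∃ φ : ∀ k, Fin (L k) → c → ℂ, (∀ k, LinearIndependent ℂ (φ k)) ∧
      LinearIndependent ℂ (Sum.elim (φ k) (φ k')) ∧ PolyGeneric (inclRep φ) := by
  have hev₁ : ∀ᶠ x in zariskiFilter (QRep (starSrc L) (starTgt L) (stdIdx c L)),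
      ∀ a, Function.Injective (x a).mulVec :=
    eventually_forall_injective (inclRep_injective hf)
  let D : QRep (starSrc L) (starTgt L) (stdIdx c L) →ₗ[ℂ] Matrix c _ ℂ :=
    { toFun := fun x => fromCols (armLast x k) (armLast x k')
      map_add' := fun x y => by
        ext i (j | j) <;> rfl
      map_smul' := fun r x => by
        ext i (j | j) <;> rfl }
  have hev₂ := eventually_injective (D := D) (x₀ := inclRep f)
    ((linearIndependent_iff_fromCols f k k').mp hk)
  obtain ⟨y, hgen, hy, hyD⟩ := (eventually_polyGeneric.and (hev₁.and hev₂)).exists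
  obtain ⟨φ, G, hG, hφ⟩ := exists_isHom_of_injective fun k i => hy (.inl ⟨k, i⟩)
  have hlast : ∀ k u, armLast (inclRep φ) k *ᵥ u = armLast y k *ᵥ G (some ⟨k, Fin.last _⟩) u :=
    fun k u => (hG _).symm.trans (hφ (.inr k) u)
  refine ⟨φ, fun k => (linearIndependent_iff_armLast φ k).mpr fun u w huw => ?_,
    (linearIndependent_iff_fromCols φ k k').mpr (fromCols_mulVec_injective _ _
      (G (some ⟨k, Fin.last _⟩)).injective (G (some ⟨k', Fin.last _⟩)).injective (hlast k)
      (hlast k') hyD), hgen.of_isHom hφ⟩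
  exact (G _).injective (hy (.inr k) ((hlast k u).symm.trans (huw.trans (hlast k w))))

end Columns

section Generic

variable {c : Type} [Fintype c] [DecidableEq c] {p q : ℕ} {η ζ : Matrix c c ℂ}
  {f : ∀ k, Fin (triLen (p + q + (p + q)) (p + p) (q + q) k) → c → ℂ}

/-- Replace the first family by its image under a linear map. -/
def triTwist (u : Matrix c c ℂ) {L : Option Bool → ℕ} (f : ∀ k, Fin (L k) → c → ℂ) :
    ∀ k, Fin (L k) → c → ℂ
  | none => fun b => u *ᵥ f none b
  | some k => f (some k)

theorem IsTriFrame.triTwist (h : IsTriFrame η ζ f) {u : Matrix c c ℂ} (hu : uᴴ * η * u = η) :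
    IsTriFrame η ζ (triTwist u f) where
  herm := h.herm
  sq := h.sq
  herm' := h.herm'
  sq' := h.sq'
  comm := h.comm
  card := h.card
  selfDual k := by
    rcases k with - | k
    · intro a b
      rw [← h.selfDual none a b, _root_.triTwist, star_mulVec, ← dotProduct_mulVec, mulVec_mulVec,
        mulVec_mulVec, hu]
    · exact h.selfDual (some k)
  mem_flag := h.mem_flag
  mem_flag' := h.mem_flag'

theorem IsTriFrame.linearIndependent_sum (h : IsTriFrame η ζ f) :
    LinearIndependent ℂ (Sum.elim (f (some false)) (f (some true))) := by
  refine (h.selfDual _).linearIndependent.sum_type (h.selfDual _).linearIndependent ?_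
  rw [Submodule.disjoint_def]
  intro v hv hv'
  have h1 : v ∈ flag (f (some false)) (p + p) ⊓ flag (f (some true)) (q + q) :=
    ⟨(mem_flag_length _).mpr ((Submodule.mem_span_range_iff_exists_fun ℂ).mp hv),
      (mem_flag_length _).mpr ((Submodule.mem_span_range_iff_exists_fun ℂ).mp hv')⟩
  rwa [h.flag_inf_flag, Submodule.mem_bot] at h1

/-- The linear part of the dependence of the standard representation on the twist. -/
def twistLin {L : Option Bool → ℕ} (f : ∀ k, Fin (L k) → c → ℂ) :
    Matrix c c ℂ →ₗ[ℂ] QRep (starSrc L) (starTgt L) (stdIdx c L) where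
  toFun M
    | .inl _ => 0
    | .inr none => fun j b => (M *ᵥ f none b.1) j
    | .inr (some _) => 0
  map_add' M N := by
    funext a
    rcases a with a | - | k
    · exact (add_zero _).symm
    · funext j b
      exact congrFun (add_mulVec M N _) j
    · exact (add_zero _).symm
  map_smul' r M := by
    funext a
    rcases a with a | - | k
    · exact (smul_zero r).symm
    · funext j b
      exact congrFun (smul_mulVec r M _) j
    · exact (smul_zero r).symm

omit [DecidableEq c] in
theorem inclRep_triTwist {L : Option Bool → ℕ} (f : ∀ k, Fin (L k) → c → ℂ) (M : Matrix c c ℂ) :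
    inclRep (triTwist M f) = inclRep (triTwist 0 f) + twistLin f M := by
  funext a
  rcases a with a | - | k
  · exact (add_zero _).symm
  · funext j b
    refine (zero_add _).symm.trans (congrArg (· + _) ?_)
    exact (congrFun (zero_mulVec (f none b.1)) j).symm
  · exact (add_zero _).symm

theorem exists_polyGeneric_triTwist {L : Option Bool → ℕ} {f : ∀ k, Fin (L k) → c → ℂ}
    (hf : ∀ k, LinearIndependent ℂ (f k))
    (hf' : LinearIndependent ℂ (Sum.elim (f (some false)) (f (some true)))) :
    ∃ m : Matrix c c ℂ, PolyGeneric (inclRep (triTwist m f)) := by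
  obtain ⟨φ, hφ, hφ', hgen⟩ := exists_polyGeneric_inclRep hf hf'
  obtain ⟨g₁, hg₁⟩ := exists_linearEquiv_of_linearIndependent hf' hφ'
  obtain ⟨g₂, hg₂⟩ := exists_linearEquiv_of_linearIndependent (hf none)
    ((hφ none).map' g₁.symm.toLinearMap g₁.symm.ker)
  refine ⟨LinearMap.toMatrix' g₂.toLinearMap, ?_⟩
  obtain ⟨G, hG⟩ := exists_isHom_smul (f := triTwist (LinearMap.toMatrix' g₂.toLinearMap) f)
    (f' := φ) g₁ 1 (fun _ => one_ne_zero) (by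
      rintro (- | - | -) b
      · refine (one_smul ℂ _).trans ?_
        refine (congrArg g₁ (LinearMap.toMatrix'_mulVec _ _)).trans ?_
        exact (congrArg g₁ (hg₂ b)).trans (g₁.apply_symm_apply _)
      · exact (one_smul ℂ _).trans (hg₁ (.inl b))
      · exact (one_smul ℂ _).trans (hg₁ (.inr b)))
  exact hgen.of_isHom hG

theorem PolyGeneric.exists_isometry {L : Option Bool → ℕ} {f : ∀ k, Fin (L k) → c → ℂ}
    (hη : η.IsHermitian) (hη' : η * η = 1) {m : Matrix c c ℂ}
    (h : PolyGeneric (inclRep (triTwist m f))) :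
    ∃ u : Matrix c c ℂ, uᴴ * η * u = η ∧ EulerGeneric (inclRep (triTwist u f)) := by
  obtain ⟨P, hP, hP0, hP1⟩ := h
  obtain ⟨ψ, hψ, hψI, hψu⟩ := exists_cayley_path hη hη' m
  have hP2 : (fun z => P (inclRep (triTwist (ψ z) f))) ∈ polyFun ℂ := by
    simp only [inclRep_triTwist f (ψ _)]
    exact polyFun_comp (polyFun_matrix_comp hψ)
      (polyFun_affine (inclRep (triTwist 0 f)) (twistLin f) hP)
  have hev := (eventually_zariski_of_polyFun (x := Complex.I) hP2 (by
    simpa only [hψI] using hP0)).and hψu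
  obtain ⟨-, ⟨r, rfl⟩, hr⟩ := ((Set.infinite_range_of_injective Complex.ofReal_injective).sdiff
    (finite_of_eventually_zariski hev)).nonempty
  obtain ⟨hr1, hr2⟩ := not_not.mp hr
  obtain ⟨α, hα, u, hu, hψr⟩ := hr2 r rfl
  refine ⟨u, hu, ?_⟩
  obtain ⟨G, hG⟩ := exists_isHom_smul (f := triTwist u f)
    (f' := triTwist (ψ r) f) (LinearEquiv.refl ℂ _) (fun k => k.elim α fun _ => 1) (by
      rintro (- | k)
      exacts [hα, one_ne_zero]) (by
      rintro (- | k) b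
      · refine (smul_mulVec α u _).symm.trans ?_
        rw [triTwist, hψr]
      · exact one_smul ℂ _)
  exact (hP1 _ hr1).of_isHom hG fun v => (G v).injective

/-- After twisting by an isometry, the standard representation is generic. -/
theorem IsTriFrame.exists_eulerGeneric (h : IsTriFrame η ζ f) :
    ∃ u : Matrix c c ℂ, uᴴ * η * u = η ∧ EulerGeneric (inclRep (_root_.triTwist u f)) := by
  obtain ⟨m, hm⟩ := exists_polyGeneric_triTwist (fun k => (h.selfDual k).linearIndependent)
    h.linearIndependent_sum
  exact hm.exists_isometry h.herm h.sq

end Generic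

section HyperbolicFrame

variable {b : Type} [Fintype b] [DecidableEq b] {m : ℕ}

/-- The standard self-dual family of isotropic vectors attached to some of the coordinates. -/
def hypVec (θ : Fin m → b) (i : Fin (m + m)) : b ⊕ b → ℂ :=
  Fin.addCases (fun i => Sum.elim (Pi.single (θ i) 1) (Pi.single (θ i) 1))
    (fun i => Sum.elim (Pi.single (θ i.rev) 1) (Pi.single (θ i.rev) (-1))) i

omit [Fintype b] in
theorem hypVec_castAdd (θ : Fin m → b) (i : Fin m) : hypVec θ (Fin.castAdd m i) =
    Sum.elim (Pi.single (θ i) 1) (Pi.single (θ i) 1) := Fin.addCases_left i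

omit [Fintype b] in
theorem hypVec_natAdd (θ : Fin m → b) (i : Fin m) : hypVec θ (Fin.natAdd m i) =
    Sum.elim (Pi.single (θ i.rev) 1) (Pi.single (θ i.rev) (-1)) := Fin.addCases_right i

/-- The standard hermitian form of signature zero. -/
def hypForm (b : Type) [DecidableEq b] : Matrix (b ⊕ b) (b ⊕ b) ℂ :=
  diagonal (Sum.elim 1 (-1))

/-- The standard grading. -/
def hypGrading (p q : ℕ) : Matrix ((Fin p ⊕ Fin q) ⊕ (Fin p ⊕ Fin q))
    ((Fin p ⊕ Fin q) ⊕ (Fin p ⊕ Fin q)) ℂ :=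
  diagonal (Sum.elim (Sum.elim 1 (-1)) (Sum.elim 1 (-1)))

theorem selfDual_hypVec {θ : Fin m → b} (hθ : Function.Injective θ) :
    SelfDual (hypForm b) (hypVec θ) := by
  intro x y
  have hrev : ∀ i : Fin m, (Fin.castAdd m i).rev = Fin.natAdd m i.rev := fun i =>
    Fin.ext (by simp only [Fin.val_rev, Fin.val_castAdd, Fin.val_natAdd]; omega)
  have hrev' : ∀ i : Fin m, (Fin.natAdd m i).rev = Fin.castAdd m i.rev := fun i =>
    Fin.ext (by simp only [Fin.val_rev, Fin.val_castAdd, Fin.val_natAdd]; omega)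
  have hne : ∀ i j : Fin m, Fin.castAdd m i ≠ Fin.natAdd m j := fun i j h => by
    have := congrArg Fin.val h
    simp only [Fin.val_castAdd, Fin.val_natAdd] at this
    omega
  have key : ∀ u v u' v' : b → ℂ, star (Sum.elim u v) ⬝ᵥ (hypForm b *ᵥ Sum.elim u' v') =
      star u ⬝ᵥ u' - star v ⬝ᵥ v' := fun u v u' v' => by
    simp [dotProduct, hypForm, mulVec_diagonal, sub_eq_add_neg]
  induction x using Fin.addCases with
  | left i =>
    induction y using Fin.addCases with
    | left j =>
      rw [hypVec_castAdd, hypVec_castAdd, key, hrev]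
      exact iff_of_true (sub_self _) (hne _ _)
    | right j =>
      rw [hypVec_castAdd, hypVec_natAdd, key, hrev, Ne, (Fin.natAdd_injective _ _).eq_iff]
      by_cases h : j = i.rev
      · simp [h]
      · have h' : θ i ≠ θ j.rev := fun h1 => h (by rw [hθ h1, Fin.rev_rev])
        simp [h, h']
  | right i =>
    induction y using Fin.addCases with
    | left j =>
      rw [hypVec_castAdd, hypVec_natAdd, key, hrev', Ne, (Fin.castAdd_injective _ _).eq_iff]
      by_cases h : j = i.rev
      · simp [h]
      · have h' : θ i.rev ≠ θ j := fun h1 => h (hθ h1).symm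
        simp [h, h']
    | right j =>
      rw [hypVec_natAdd, hypVec_natAdd, key, hrev']
      refine iff_of_true ?_ (hne _ _).symm
      by_cases h : θ j.rev = θ i.rev <;> simp [h]

omit [Fintype b] in
theorem mem_flag_hypVec {θ : Fin m → b} (hθ : Function.Injective θ) {v : b ⊕ b → ℂ} :
    v ∈ flag (hypVec θ) (m + m) ↔
      ∀ x, x ∉ Set.range θ → v (Sum.inl x) = 0 ∧ v (Sum.inr x) = 0 := by
  rw [mem_flag_length]
  constructor
  · rintro ⟨z, rfl⟩ x hx
    have h1 : ∀ i, θ i ≠ x := fun i hi => hx ⟨i, hi⟩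
    rw [Fin.sum_univ_add]
    simp only [hypVec_castAdd, hypVec_natAdd]
    simp [(h1 _).symm]
  · intro h
    refine ⟨Fin.addCases (fun i => (v (Sum.inl (θ i)) + v (Sum.inr (θ i))) / 2)
      (fun i => (v (Sum.inl (θ i.rev)) - v (Sum.inr (θ i.rev))) / 2), ?_⟩
    rw [Fin.sum_univ_add, ← Equiv.sum_comp Fin.revPerm fun i => _ • hypVec θ (Fin.natAdd m i)]
    simp only [Fin.addCases_left, Fin.addCases_right, hypVec_castAdd, hypVec_natAdd,
      Fin.revPerm_apply, Fin.rev_rev]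
    funext x
    rcases x with x | x <;> by_cases hx : x ∈ Set.range θ
    · obtain ⟨j, rfl⟩ := hx
      simp [Pi.single_apply, hθ.eq_iff]
      ring
    · have h1 : ∀ i, x ≠ θ i := fun i hi => hx ⟨i, hi.symm⟩
      simp [h1, (h x hx).1]
    · obtain ⟨j, rfl⟩ := hx
      simp [Pi.single_apply, hθ.eq_iff]
      ring
    · have h1 : ∀ i, x ≠ θ i := fun i hi => hx ⟨i, hi.symm⟩
      simp [h1, (h x hx).2]

/-- The standard frames. -/
def hypFrame (p q : ℕ) : ∀ k, Fin (triLen (p + q + (p + q)) (p + p) (q + q) k) →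
    (Fin p ⊕ Fin q) ⊕ (Fin p ⊕ Fin q) → ℂ
  | none => hypVec finSumFinEquiv.symm
  | some false => hypVec Sum.inl
  | some true => hypVec Sum.inr

theorem isTriFrame_hypFrame (p q : ℕ) :
    IsTriFrame (hypForm (Fin p ⊕ Fin q)) (hypGrading p q) (hypFrame p q) where
  herm := by
    refine isHermitian_diagonal_iff.mpr ?_
    rintro (x | x) <;> simp [IsSelfAdjoint]
  sq := by
    rw [hypForm, diagonal_mul_diagonal, ← diagonal_one]
    congr 1
    funext x
    rcases x with x | x <;> simp
  herm' := by
    refine isHermitian_diagonal_iff.mpr ?_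
    rintro ((x | x) | (x | x)) <;> simp [IsSelfAdjoint]
  sq' := by
    rw [hypGrading, diagonal_mul_diagonal, ← diagonal_one]
    congr 1
    funext x
    rcases x with (x | x) | (x | x) <;> simp
  comm := by
    rw [hypForm, hypGrading, diagonal_mul_diagonal, diagonal_mul_diagonal]
    simp only [mul_comm]
  card := by simp
  selfDual := by
    rintro (- | - | -)
    · exact selfDual_hypVec finSumFinEquiv.symm.injective
    · exact selfDual_hypVec Sum.inl_injective
    · exact selfDual_hypVec Sum.inr_injective
  mem_flag v := by
    refine (mem_flag_hypVec Sum.inl_injective).trans ?_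
    simp only [hypGrading, funext_iff, mulVec_diagonal, Sum.forall]
    simp [CharZero.neg_eq_self_iff]
    grind
  mem_flag' v := by
    refine (mem_flag_hypVec Sum.inr_injective).trans ?_
    simp only [hypGrading, funext_iff, mulVec_diagonal, Sum.forall]
    simp [CharZero.eq_neg_self_iff]
    grind

theorem exists_isTriFrame_eulerGeneric (p q : ℕ) :
    ∃ f, IsTriFrame (p := p) (q := q) (hypForm (Fin p ⊕ Fin q)) (hypGrading p q) f ∧
      EulerGeneric (inclRep f) := by
  obtain ⟨u, hu, hgen⟩ := (isTriFrame_hypFrame p q).exists_eulerGeneric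
  exact ⟨_, (isTriFrame_hypFrame p q).triTwist hu, hgen⟩

end HyperbolicFrame

section HalfDefect

/-- The extension of a vector by zero. -/
noncomputable def zeroExt {m : ℕ} (g : Fin m → ℝ) (i : ℕ) : ℝ := if h : i < m then g ⟨i, h⟩ else 0

theorem defect_eq_two_mul {m : ℕ} (g : Fin m → ℝ) {a b : ℕ → ℝ} (ha : a 0 = 0) (hb : b 0 = 0)
    (h : ∀ i ≤ m + m, a (m + m - i) + i = a (m + m) + b i)
    (h' : ∀ i ≤ m + m, b (m + m - i) + i = b (m + m) + a i) :
    defect g a b = 2 * ∑ i ∈ Finset.range m,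
      (zeroExt g i - zeroExt g (i + 1)) * (a (i + 1) + b (i + 1) - (i + 1 : ℕ)) := by
  obtain ⟨D, hD⟩ : ∃ D : ℕ → ℝ, ∀ i, D i = a i + b i - i := ⟨_, fun _ => rfl⟩
  have h2 : a (m + m) + b (m + m) = (m + m : ℕ) := by
    have h1 := h (m + m) le_rfl
    rw [Nat.sub_self, ha] at h1
    linarith
  have hsym : ∀ i ≤ m + m, D (m + m - i) = D i := fun i hi => by
    rw [hD, hD, Nat.cast_sub hi]
    linarith [h i hi, h' i hi]
  simp only [defect, ← hD]
  rcases m with - | r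
  · simp
  have h3 : ∑ i ∈ Finset.range (r + 1 + (r + 1)), gap g i * D i =
      ∑ i ∈ Finset.range (r + 1), gap g i * D i +
        ∑ i ∈ Finset.range (r + 1), gap g (i + 1) * D (i + 1) := by
    rw [Finset.sum_range_add]
    congr 1
    rw [← Finset.sum_range_reflect]
    refine Finset.sum_congr rfl fun i hi => ?_
    rw [Finset.mem_range] at hi
    rw [show r + 1 + (r + 1 - 1 - i) = r + 1 + (r + 1) - (i + 1) by omega,
      hsym _ (by omega), gap_sub _ (by omega) (by omega)]
  have h4 : ∀ i ∈ Finset.range r, (zeroExt g i - zeroExt g (i + 1)) * D (i + 1) =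
      gap g (i + 1) * D (i + 1) := fun i hi => by
    rw [Finset.mem_range] at hi
    rw [gap, zeroExt, zeroExt, hatVec, hatVec, dif_pos (by omega), dif_pos (by omega),
      dif_pos (by omega), dif_pos (by omega)]
    rfl
  have h5 : zeroExt g r - zeroExt g (r + 1) = gap g (r + 1) / 2 := by
    rw [gap, zeroExt, zeroExt, hatVec, hatVec, dif_pos (by omega), dif_neg (by omega),
      dif_pos (by omega), dif_neg (by omega), dif_pos (by omega)]
    have h6 : (⟨r + 1 + (r + 1) - 1 - (r + 1), by omega⟩ : Fin (r + 1)) = ⟨r, by omega⟩ :=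
      Fin.ext (by simp only; omega)
    have h7 : (⟨r + 1 - 1, by omega⟩ : Fin (r + 1)) = ⟨r, by omega⟩ := rfl
    rw [h6, h7]
    ring
  have h8 : D 0 = 0 := by rw [hD, ha, hb, Nat.cast_zero, add_zero, sub_zero]
  rw [h3, Finset.sum_range_succ', h8, Finset.sum_range_succ (fun i => gap g (i + 1) * D (i + 1)),
    Finset.sum_range_succ (fun i => (zeroExt g i - zeroExt g (i + 1)) * D (i + 1)),
    Finset.sum_congr rfl h4, h5]
  ring

variable {c : Type} [Fintype c] [DecidableEq c] {p q : ℕ} {η ζ : Matrix c c ℂ}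
  {f : ∀ k, Fin (triLen (p + q + (p + q)) (p + p) (q + q) k) → c → ℂ}

theorem IsTriFrame.triDefect_eq (h : IsTriFrame η ζ f) (g : Fin (p + q) → ℝ) (s : Fin p → ℝ)
    (t : Fin q → ℝ) {S : Submodule ℂ (c → ℂ)} (hS : Graded ζ S) :
    triDefect η f g s t S = 2 *
      (∑ i ∈ Finset.range (p + q), (zeroExt g i - zeroExt g (i + 1)) *
          (flagDim (f none) S (i + 1) + flagDim (f none) (perp η S) (i + 1) - (i + 1 : ℕ)) +
        (∑ i ∈ Finset.range p, (zeroExt s i - zeroExt s (i + 1)) *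
          (flagDim (f (some false)) S (i + 1) + flagDim (f (some false)) (perp η S) (i + 1) -
            (i + 1 : ℕ)) +
        ∑ i ∈ Finset.range q, (zeroExt t i - zeroExt t (i + 1)) *
          (flagDim (f (some true)) S (i + 1) + flagDim (f (some true)) (perp η S) (i + 1) -
            (i + 1 : ℕ)))) := by
  have h1 : ∀ k, ∀ S, Graded ζ S → ∀ i ≤ triLen (p + q + (p + q)) (p + p) (q + q) k,
      flagDim (f k) S (triLen (p + q + (p + q)) (p + p) (q + q) k - i) + i =
        flagDim (f k) S (triLen (p + q + (p + q)) (p + p) (q + q) k) +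
          flagDim (f k) (perp η S) i := fun k S hS i hi => by
    have := (h.selfDual k).finrank_flag_sub_inf h.herm h.sq (h.splits hS k) hi
    simp only [flagDim]
    exact_mod_cast this
  have h2 : ∀ k, ∀ i ≤ triLen (p + q + (p + q)) (p + p) (q + q) k,
      flagDim (f k) (perp η S) (triLen (p + q + (p + q)) (p + p) (q + q) k - i) + i =
        flagDim (f k) (perp η S) (triLen (p + q + (p + q)) (p + p) (q + q) k) +
          flagDim (f k) S i := fun k i hi => by
    have := h1 k _ (h.graded_perp hS) i hi
    rwa [perp_perp h.herm h.sq] at this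
  rw [triDefect, defect_eq_two_mul g (flagDim_zero _ _) (flagDim_zero _ _) (h1 none S hS) (h2 none),
    defect_eq_two_mul s (flagDim_zero _ _) (flagDim_zero _ _) (h1 (some false) S hS)
      (h2 (some false)),
    defect_eq_two_mul t (flagDim_zero _ _) (flagDim_zero _ _) (h1 (some true) S hS)
      (h2 (some true)), ← mul_add, ← mul_add]

end HalfDefect

section Semistable

/-- Abel summation for a function together with its negative. -/
theorem sum_mul_sum_nonpos_of_symm {V : Type} [Fintype V] {ι : V → Type} [∀ v, Fintype (ι v)]
    (σ : V → ℝ) (z : ∀ v, ι v → ℝ) (h : ∀ r : ℝ, 0 ≤ ∑ v, σ v *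
      ((Finset.univ.filter fun i => z v i ≤ r).card +
        (Finset.univ.filter fun i => z v i < -r).card - Fintype.card (ι v))) :
    ∑ v, σ v * ∑ i, z v i ≤ 0 := by
  have h1 := sum_mul_nonpos_of_partial_sums (I := (Σ v, ι v) ⊕ Σ v, ι v)
    (Sum.elim (fun i => z i.1 i.2) fun i => -z i.1 i.2)
    (Sum.elim (fun i => σ i.1) fun i => -σ i.1)
    (by simp [Fintype.sum_sum_type]) fun r => by
      refine (h r).trans_eq ?_
      rw [Finset.sum_filter, Fintype.sum_sum_type, Fintype.sum_sigma, Fintype.sum_sigma,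
        ← Finset.sum_add_distrib]
      refine Finset.sum_congr rfl fun v _ => ?_
      change _ = (∑ i, if z v i ≤ r then σ v else 0) + ∑ i, if -z v i ≤ r then -σ v else 0
      rw [← Finset.sum_filter, ← Finset.sum_filter, Finset.sum_const, Finset.sum_const,
        nsmul_eq_mul, nsmul_eq_mul]
      have h2 := Finset.card_filter_add_card_filter_not (s := Finset.univ) fun i : ι v => z v i < -r
      have h3 : (Finset.univ.filter fun i => ¬ z v i < -r) =
          Finset.univ.filter fun i => -z v i ≤ r :=
        Finset.filter_congr fun i _ => by rw [not_lt, neg_le]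
      rw [h3, Finset.card_univ] at h2
      rw [← h2]
      push_cast
      ring
  rw [Fintype.sum_sum_type, Fintype.sum_sigma, Fintype.sum_sigma] at h1
  simp only [Sum.elim_inl, Sum.elim_inr, neg_mul_neg, ← Finset.mul_sum] at h1
  linarith

variable {K : Type} [Fintype K] {L : K → ℕ} {c : Type} [Fintype c] [DecidableEq c]

theorem sum_starWeight_zero_mul (e : K → ℕ → ℝ) (d : StarV L → ℝ) :
    ∑ v, starWeight e 0 v * d v =
      ∑ k, ∑ i : Fin (L k), (e k (i + 1) - e k i) * d (some ⟨k, i.succ⟩) := by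
  rw [Fintype.sum_option, Fintype.sum_sigma]
  change 0 * _ + _ = _
  rw [zero_mul, zero_add]
  refine Finset.sum_congr rfl fun k _ => ?_
  rw [Fin.sum_univ_succ]
  change (e k 0 - e k (0 - 1)) * _ + _ = _
  rw [Nat.zero_sub, sub_self, zero_mul, zero_add]
  rfl

theorem sum_starWeight_mul_nonneg {f : ∀ k, Fin (L k) → c → ℂ}
    (hf : ∀ k, LinearIndependent ℂ (f k)) {e : K → ℕ → ℝ} (he : ∀ k, Antitone (e k))
    {S S' : ∀ v, Submodule ℂ (stdIdx c L v → ℂ)} (hS : IsSub (inclRep f) S)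
    (hS' : IsSub (inclRep f) S') {T : Submodule ℂ (c → ℂ)} (hT : S' none ≤ T)
    (h : ∑ k, ∑ i ∈ Finset.range (L k), (e k i - e k (i + 1)) *
      (flagDim (f k) (S none) (i + 1) + flagDim (f k) T (i + 1) - (i + 1 : ℕ)) ≤ 0) :
    0 ≤ ∑ v, starWeight e 0 v * ((Module.finrank ℂ (S v) : ℝ) + Module.finrank ℂ (S' v) -
      Fintype.card (stdIdx c L v)) := by
  rw [sum_starWeight_zero_mul e fun v => (Module.finrank ℂ (S v) : ℝ) + Module.finrank ℂ (S' v) -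
      Fintype.card (stdIdx c L v)]
  refine (neg_nonneg.mpr h).trans ?_
  rw [← Finset.sum_neg_distrib]
  refine Finset.sum_le_sum fun k _ => ?_
  rw [← Fin.sum_univ_eq_sum_range fun i => (e k i - e k (i + 1)) *
      (flagDim (f k) (S none) (i + 1) + flagDim (f k) T (i + 1) - (i + 1 : ℕ)),
    ← Finset.sum_neg_distrib]
  refine Finset.sum_le_sum fun i _ => ?_
  have h1 : ∀ {S : ∀ v, Submodule ℂ (stdIdx c L v → ℂ)} {T : Submodule ℂ (c → ℂ)},
      IsSub (inclRep f) S → S none ≤ T →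
      (Module.finrank ℂ (S (some ⟨k, i.succ⟩)) : ℝ) ≤ flagDim (f k) T (i + 1) := fun hS hT => by
    have h2 := (Submodule.finrank_mono (hS.le_fullSub (some ⟨k, i.succ⟩))).trans_eq
      (finrank_fullSub_some hf _ k i.succ)
    simp only [flagDim]
    exact_mod_cast h2.trans (Submodule.finrank_mono (inf_le_inf_left _ hT))
  have h3 : (Fintype.card (stdIdx c L (some ⟨k, i.succ⟩)) : ℝ) = (i.val + 1 : ℕ) := by
    rw [card_starIdx]
    congr 1
    change (Finset.univ.filter fun b : Fin (L k) => b.val < i.val + 1).card = _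
    rw [Fin.card_filter_val_lt, min_eq_right (by omega)]
  rw [h3, ← neg_mul, neg_sub]
  exact mul_le_mul_of_nonpos_left (by linarith [h1 hS le_rfl, h1 hS' hT])
    (sub_nonpos.mpr (he k (Nat.le_succ _)))

end Semistable

section HalfFrame

variable {c : Type} {p q : ℕ}

/-- The first halves of three families. -/
def halfFrame (f : ∀ k, Fin (triLen (p + q + (p + q)) (p + p) (q + q) k) → c → ℂ) :
    ∀ k, Fin (triLen (p + q) p q k) → c → ℂ
  | none => fun i => f none (Fin.castAdd (p + q) i)
  | some false => fun i => f (some false) (Fin.castAdd p i)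
  | some true => fun i => f (some true) (Fin.castAdd q i)

theorem flag_comp_castAdd {m m' : ℕ} (f : Fin (m + m') → c → ℂ) {i : ℕ} (hi : i ≤ m) :
    flag (fun b => f (Fin.castAdd m' b)) i = flag f i := by
  rw [flag, flag]
  congr 1
  ext v
  constructor
  · rintro ⟨b, hb, rfl⟩
    exact ⟨Fin.castAdd m' b, hb, rfl⟩
  · rintro ⟨b, hb, rfl⟩
    have hb' : b.val < i := hb
    exact ⟨⟨b, by omega⟩, hb, rfl⟩

theorem antitone_zeroExt {m : ℕ} {g : Fin m → ℝ} (hg : Antitone g) (h0 : ∀ i, 0 ≤ g i) :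
    Antitone (zeroExt g) := by
  intro i j hij
  rw [zeroExt, zeroExt]
  split_ifs with h1 h2
  · exact hg (Fin.mk_le_mk.mpr hij)
  · omega
  · exact h0 _
  · exact le_rfl

variable [Fintype c] [DecidableEq c] {η ζ : Matrix c c ℂ}
  {f : ∀ k, Fin (triLen (p + q + (p + q)) (p + p) (q + q) k) → c → ℂ}

theorem IsTriFrame.linearIndependent_halfFrame (h : IsTriFrame η ζ f) :
    ∀ k, LinearIndependent ℂ (halfFrame f k)
  | none => (h.selfDual none).linearIndependent.comp _ (Fin.castAdd_injective _ _)
  | some false => (h.selfDual (some false)).linearIndependent.comp _ (Fin.castAdd_injective _ _)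
  | some true => (h.selfDual (some true)).linearIndependent.comp _ (Fin.castAdd_injective _ _)

theorem IsTriFrame.sum_halfFrame_nonpos (h : IsTriFrame η ζ f) {g : Fin (p + q) → ℝ}
    {s : Fin p → ℝ} {t : Fin q → ℝ} {S : Submodule ℂ (c → ℂ)} (hS : Graded ζ S)
    (hd : triDefect η f g s t S ≤ 0) :
    ∑ k, ∑ i ∈ Finset.range (triLen (p + q) p q k),
      (triFun (zeroExt g) (zeroExt s) (zeroExt t) k i -
        triFun (zeroExt g) (zeroExt s) (zeroExt t) k (i + 1)) *
      (flagDim (halfFrame f k) S (i + 1) + flagDim (halfFrame f k) (perp η S) (i + 1) -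
        (i + 1 : ℕ)) ≤ 0 := by
  rw [h.triDefect_eq g s t hS] at hd
  have h1 : ∀ {m : ℕ} (f : Fin (m + m) → c → ℂ) (e : ℕ → ℝ),
      ∑ i ∈ Finset.range m, (e i - e (i + 1)) *
        (flagDim (fun b => f (Fin.castAdd m b)) S (i + 1) +
          flagDim (fun b => f (Fin.castAdd m b)) (perp η S) (i + 1) - (i + 1 : ℕ)) =
      ∑ i ∈ Finset.range m, (e i - e (i + 1)) *
        (flagDim f S (i + 1) + flagDim f (perp η S) (i + 1) - (i + 1 : ℕ)) := fun f e =>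
    Finset.sum_congr rfl fun i hi => by
      simp only [flagDim]
      rw [flag_comp_castAdd f (Finset.mem_range.mp hi)]
  rw [Fintype.sum_option, Fintype.sum_bool]
  have h2 := h1 (f none) (zeroExt g)
  have h3 := h1 (f (some false)) (zeroExt s)
  have h4 := h1 (f (some true)) (zeroExt t)
  simp only [halfFrame]
  linarith

end HalfFrame

section SymmetricPair

section Intertwine

variable {b : Type} [Fintype b] [DecidableEq b] {A W : Matrix b b ℂ} {z z' : b → ℝ}

/-- A matrix intertwining two diagonalized matrices matches eigenvalues. -/
theorem eigenvalue_eq_of_intertwine (hW : W * Wᴴ = 1)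
    (h : A * (W * diagonal (fun i => (z i : ℂ)) * Wᴴ) =
      W * diagonal (fun i => (z' i : ℂ)) * Wᴴ * A) {i j : b} (hij : (Wᴴ * A * W) i j ≠ 0) :
    z' i = z j := by
  have hW' : Wᴴ * W = 1 := mul_eq_one_comm.mp hW
  have h1 : (Wᴴ * A * W) * (diagonal (fun i => (z i : ℂ)) : Matrix b b ℂ) =
      (diagonal (fun i => (z' i : ℂ)) : Matrix b b ℂ) * (Wᴴ * A * W) := by
    have h2 := congrArg (fun M => Wᴴ * M * W) h
    simp only [Matrix.mul_assoc] at h2 ⊢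
    rw [hW', Matrix.mul_one, ← Matrix.mul_assoc Wᴴ W, hW', Matrix.one_mul] at h2
    exact h2
  have h2 := congrFun (congrFun h1 i) j
  rw [mul_diagonal, diagonal_mul, mul_comm] at h2
  exact_mod_cast (mul_right_cancel₀ hij h2).symm

theorem graded_specSub (hW : W * Wᴴ = 1)
    (h : A * (W * diagonal (fun i => (z i : ℂ)) * Wᴴ) =
      W * diagonal (fun i => (z i : ℂ)) * Wᴴ * A) (P : ℝ → Prop) :
    Graded A (specSub W fun i => P (z i)) := by
  intro u hu i hi
  have h1 : Wᴴ *ᵥ (A *ᵥ u) = (Wᴴ * A * W) *ᵥ (Wᴴ *ᵥ u) := by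
    rw [mulVec_mulVec, mulVec_mulVec, Matrix.mul_assoc (_ * _), hW, Matrix.mul_one]
  rw [h1, mulVec, dotProduct]
  refine Finset.sum_eq_zero fun j _ => ?_
  by_cases hj : (Wᴴ * A * W) i j = 0
  · rw [hj, zero_mul]
  · rw [hu j fun hP => hi ?_, mul_zero]
    change P (z i)
    rwa [eigenvalue_eq_of_intertwine hW h hj]

theorem specSub_le_perp (hW : W * Wᴴ = 1)
    (h : A * (W * diagonal (fun i => (z i : ℂ)) * Wᴴ) =
      -(W * diagonal (fun i => (z i : ℂ)) * Wᴴ) * A) (r : ℝ) :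
    (specSub W fun i => z i < -r) ≤ perp A (specSub W fun i => z i ≤ r) := by
  intro v hv u hu
  have h0 : A * (W * diagonal (fun i => (z i : ℂ)) * Wᴴ) =
      W * diagonal (fun i => ((-z i : ℝ) : ℂ)) * Wᴴ * A := by
    rw [h, ← Matrix.neg_mul, ← Matrix.mul_neg, diagonal_neg]
    simp
  have h1 : star u ⬝ᵥ (A *ᵥ v) = star (Wᴴ *ᵥ u) ⬝ᵥ ((Wᴴ * A * W) *ᵥ (Wᴴ *ᵥ v)) := by
    rw [mulVec_mulVec, Matrix.mul_assoc (_ * _), hW, Matrix.mul_one, star_mulVec,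
      conjTranspose_conjTranspose, ← dotProduct_mulVec, mulVec_mulVec, ← Matrix.mul_assoc, hW,
      Matrix.one_mul]
  rw [h1, dotProduct]
  refine Finset.sum_eq_zero fun i _ => ?_
  rw [mulVec, dotProduct, Finset.mul_sum]
  refine Finset.sum_eq_zero fun j _ => ?_
  by_cases hi : z i ≤ r
  · by_cases hj : z j < -r
    · by_cases hij : (Wᴴ * A * W) i j = 0
      · rw [hij, zero_mul, mul_zero]
      · have := eigenvalue_eq_of_intertwine hW h0 hij
        linarith
    · rw [hv j hj, mul_zero, mul_zero]
  · rw [Pi.star_apply, hu i hi, star_zero, zero_mul]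

end Intertwine

section Exponential

open NormedSpace
open scoped Matrix.Norms.L2Operator

variable {b : Type} [Fintype b] [DecidableEq b] {η : Matrix b b ℂ}

theorem exp_conj_of_mul_self_eq_one (hη : η * η = 1) (X : Matrix b b ℂ) :
    exp (η * X * η) = η * exp X * η :=
  Matrix.exp_units_conj ⟨η, η, hη, hη⟩ X

theorem conj_mul_conj (hη : η * η = 1) (X Y : Matrix b b ℂ) :
    (η * X * η) * (η * Y * η) = η * (X * Y) * η := by
  simp only [Matrix.mul_assoc]
  rw [← Matrix.mul_assoc η η, hη, Matrix.one_mul]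

omit [DecidableEq b] in
theorem isHermitian_conj (hη : η.IsHermitian) {X : Matrix b b ℂ} (hX : X.IsHermitian) :
    (η * X * η).IsHermitian := by
  have := Matrix.isHermitian_mul_mul_conjTranspose η hX
  rwa [hη.eq] at this

/-- The Hermitian matrices fixed by an involution are closed under geodesic reflection. -/
theorem conj_eq_of_exp (h : η.IsHermitian) (hη : η * η = 1) {X Y Z : Matrix b b ℂ}
    (hZ : Z.IsHermitian) (hX : η * X * η = X) (hY : η * Y * η = Y)
    (hexp : exp ((2 : ℝ) • Z) = exp X * exp ((2 : ℝ) • Y) * exp X) : η * Z * η = Z := by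
  have h2 : ∀ {Z : Matrix b b ℂ}, Z.IsHermitian → ((2 : ℝ) • Z).IsHermitian := fun hZ => by
    rw [IsHermitian, conjTranspose_smul, hZ.eq, star_trivial]
  refine smul_right_injective _ (two_ne_zero (α := ℝ))
    (exp_hermitian_injective (h2 (isHermitian_conj h hZ)) (h2 hZ) ?_)
  change exp ((2 : ℝ) • (η * Z * η)) = exp ((2 : ℝ) • Z)
  have h3 : ∀ Z : Matrix b b ℂ, (2 : ℝ) • (η * Z * η) = η * ((2 : ℝ) • Z) * η := fun Z => by
    rw [Matrix.mul_smul, Matrix.smul_mul]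
  rw [h3, exp_conj_of_mul_self_eq_one hη, hexp, ← conj_mul_conj hη, ← conj_mul_conj hη,
    ← exp_conj_of_mul_self_eq_one hη, ← exp_conj_of_mul_self_eq_one hη, hX, ← h3, hY]

/-- The Hermitian matrices negated by an involution are closed under geodesic reflection. -/
theorem conj_eq_neg_of_exp (h : η.IsHermitian) (hη : η * η = 1) {X Y Z : Matrix b b ℂ}
    (hZ : Z.IsHermitian) (hX : η * X * η = -X) (hY : η * Y * η = -Y)
    (hexp : exp ((2 : ℝ) • Z) = exp X * exp ((2 : ℝ) • Y) * exp X) : η * Z * η = -Z := by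
  have h2 : ∀ {Z : Matrix b b ℂ}, Z.IsHermitian → ((2 : ℝ) • Z).IsHermitian := fun hZ => by
    rw [IsHermitian, conjTranspose_smul, hZ.eq, star_trivial]
  refine smul_right_injective _ (two_ne_zero (α := ℝ))
    (exp_hermitian_injective (h2 (isHermitian_conj h hZ)) (h2 hZ.neg) ?_)
  change exp ((2 : ℝ) • (η * Z * η)) = exp ((2 : ℝ) • (-Z))
  have h3 : ∀ Z : Matrix b b ℂ, (2 : ℝ) • (η * Z * η) = η * ((2 : ℝ) • Z) * η := fun Z => by
    rw [Matrix.mul_smul, Matrix.smul_mul]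
  rw [h3, exp_conj_of_mul_self_eq_one hη, hexp, ← conj_mul_conj hη, ← conj_mul_conj hη,
    ← exp_conj_of_mul_self_eq_one hη, ← exp_conj_of_mul_self_eq_one hη, hX, ← h3, hY, smul_neg,
    smul_neg, Matrix.exp_neg, Matrix.exp_neg, Matrix.exp_neg, hexp, Matrix.mul_inv_rev,
    Matrix.mul_inv_rev, Matrix.mul_assoc]

theorem exp_mul_mul_exp_of_conj_eq_neg (hη : η * η = 1) {X : Matrix b b ℂ} (hX : η * X * η = -X) :
    exp X * η * exp X = η := by
  have h1 := exp_conj_of_mul_self_eq_one hη X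
  have h2 : exp (-X) * exp X = 1 := by
    rw [Matrix.exp_neg]
    exact Matrix.nonsing_inv_mul _ ((Matrix.isUnit_iff_isUnit_det _).mp (Matrix.isUnit_exp X))
  rw [hX] at h1
  rw [h1] at h2
  calc exp X * η * exp X = η * (η * exp X * η * exp X) := by
        simp only [← Matrix.mul_assoc]; rw [hη, Matrix.one_mul]
    _ = η := by rw [h2, Matrix.mul_one]

theorem mul_exp_of_conj_eq (hη : η * η = 1) {X : Matrix b b ℂ} (hX : η * X * η = X) :
    η * exp X = exp X * η := by
  have h1 := exp_conj_of_mul_self_eq_one hη X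
  rw [hX] at h1
  calc η * exp X = η * exp X * (η * η) := by rw [hη, Matrix.mul_one]
    _ = exp X * η := by rw [← Matrix.mul_assoc, ← h1]

variable {V Q : Type} [Fintype V] [Fintype Q] {src tgt : Q → V}
variable {ι : V → Type} [∀ v, Fintype (ι v)] [∀ v, DecidableEq (ι v)]

/-- Solutions of the moment map equation for the symmetric pair defined by a form `η` and a
grading `ζ` at the vertex `o`. -/
theorem exists_mem_forall_momentPairing_eq_of_graded {o : V} {η ζ : Matrix (ι o) (ι o) ℂ}
    (hη : η.IsHermitian) (hη' : η * η = 1) (hζ : ζ.IsHermitian) (hζ' : ζ * ζ = 1)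
    (ℓ : V → ℝ) (hℓ : ℓ o = 0) (hℓ' : ∀ a : Q, 1 ≤ ℓ (tgt a) - ℓ (src a))
    (x : QRep src tgt ι) (σ : V → ℝ)
    (hss : ∀ S S', IsSub x S → IsSub x S' → Graded ζ (S o) → S' o ≤ perp η (S o) →
      0 ≤ ∑ v, σ v * ((Module.finrank ℂ (S v) : ℝ) + Module.finrank ℂ (S' v) -
        Fintype.card (ι v)))
    {C : Set (QRep src tgt ι)} (hCl : IsClosed C)
    (hCx : ∀ X, (∀ v, (X v).IsHermitian) → η * X o * η = -X o → ζ * X o * ζ = X o →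
      expAct X x ∈ C) :
    ∃ x' ∈ C, ∀ Y : ∀ v, Matrix (ι v) (ι v) ℂ, (∀ v, (Y v).IsHermitian) → η * Y o * η = -Y o →
      ζ * Y o * ζ = Y o → momentPairing x' Y = ∑ v, σ v * (Y v).trace.re := by
  let 𝔰 : Submodule ℝ (∀ v, Matrix (ι v) (ι v) ℂ) :=
    { carrier := {X | (∀ v, (X v).IsHermitian) ∧ η * X o * η = -X o ∧ ζ * X o * ζ = X o}
      add_mem' := fun {X Y} hX hY => ⟨fun v => (hX.1 v).add (hY.1 v), by
        rw [Pi.add_apply, Matrix.mul_add, Matrix.add_mul, hX.2.1, hY.2.1, neg_add], by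
        rw [Pi.add_apply, Matrix.mul_add, Matrix.add_mul, hX.2.2, hY.2.2]⟩
      zero_mem' := ⟨fun v => Matrix.isHermitian_zero, by simp, by simp⟩
      smul_mem' := fun c X hX => ⟨fun v => by
        change (c • X v)ᴴ = c • X v
        rw [Matrix.conjTranspose_smul, (hX.1 v).eq, star_trivial], by
        rw [Pi.smul_apply, Matrix.mul_smul, Matrix.smul_mul, hX.2.1, smul_neg], by
        rw [Pi.smul_apply, Matrix.mul_smul, Matrix.smul_mul, hX.2.2]⟩ }
  obtain ⟨x', hx', h⟩ := exists_mem_forall_momentPairing_eq 𝔰 (fun X hX => hX.1)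
    (fun X hX Y hY Z hZ hexp => ⟨hZ, conj_eq_neg_of_exp hη hη' (hZ o) hX.2.1 hY.2.1 (hexp o),
      conj_eq_of_exp hζ hζ' (hZ o) hX.2.2 hY.2.2 (hexp o)⟩) ℓ ⟨fun v => by
        change ((ℓ v : ℂ) • (1 : Matrix (ι v) (ι v) ℂ))ᴴ = _
        rw [Matrix.conjTranspose_smul, Matrix.conjTranspose_one]
        simp, by simp [hℓ], by simp [hℓ]⟩ hℓ' x σ (fun W z hW h𝔰 hj => by
      have hco : ∀ {A X : Matrix (ι o) (ι o) ℂ}, A * A = 1 → A * (A * X * A) = X * A :=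
        fun {A X} hA => by rw [← Matrix.mul_assoc, ← Matrix.mul_assoc, hA, Matrix.one_mul]
      refine sum_mul_sum_nonpos_of_symm σ z fun r => ?_
      have h1 := hss _ _ (isSub_specSub hW hj (P := fun y => y ≤ r) fun a b => le_trans)
        (isSub_specSub hW hj (P := fun y => y < -r) fun a b => lt_of_le_of_lt)
        (graded_specSub (hW o) (by
          have h2 := hco (X := W o * diagonal (fun i => (z o i : ℂ)) * (W o)ᴴ) hζ'
          rwa [h𝔰.2.2] at h2) fun y => y ≤ r)
        (specSub_le_perp (hW o) (by
          have h2 := hco (X := W o * diagonal (fun i => (z o i : ℂ)) * (W o)ᴴ) hη'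
          rw [h𝔰.2.1, Matrix.mul_neg] at h2
          rw [Matrix.neg_mul, ← h2, neg_neg]) r)
      refine h1.trans_eq (Finset.sum_congr rfl fun v _ => ?_)
      rw [finrank_specSub (hW v), finrank_specSub (hW v)]) hCl
    (fun X hX => hCx X hX.1 hX.2.1 hX.2.2)
  exact ⟨x', hx', fun Y h1 h2 h3 => h Y ⟨h1, h2, h3⟩⟩

end Exponential

end SymmetricPair

section StarSolution

open NormedSpace
open scoped Matrix.Norms.L2Operator

variable {K : Type} [Fintype K] [DecidableEq K] {L : K → ℕ} {ι : StarV L → Type}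
variable [∀ v, Fintype (ι v)] [∀ v, DecidableEq (ι v)]

theorem momentPairing_single (x : QRep (starSrc L) (starTgt L) ι) {v : StarV L}
    (Y : Matrix (ι v) (ι v) ℂ) :
    momentPairing x (Pi.single v Y) = ((Y * starMoment x v).trace).re := by
  rw [momentPairing_star, Finset.sum_eq_single v, Pi.single_eq_same]
  · intro w _ hw
    rw [Pi.single_eq_of_ne hw]
    simp
  · simp

omit [∀ v, DecidableEq (ι v)] in
theorem sum_mul_trace_single (σ : StarV L → ℝ) {v : StarV L} (Y : Matrix (ι v) (ι v) ℂ) :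
    ∑ w, σ w * ((Pi.single v Y : ∀ w, Matrix (ι w) (ι w) ℂ) w).trace.re = σ v * Y.trace.re := by
  rw [Finset.sum_eq_single v, Pi.single_eq_same]
  · intro w _ hw
    rw [Pi.single_eq_of_ne hw]
    simp
  · simp

omit [Fintype K] [∀ v, Fintype (ι v)] [∀ v, DecidableEq (ι v)] in
theorem isHermitian_single {v : StarV L} {Y : Matrix (ι v) (ι v) ℂ} (hY : Y.IsHermitian) (w) :
    ((Pi.single v Y : ∀ w, Matrix (ι w) (ι w) ℂ) w).IsHermitian := by
  rcases eq_or_ne w v with rfl | hw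
  · rwa [Pi.single_eq_same]
  · rw [Pi.single_eq_of_ne hw]
    exact isHermitian_zero

/-- Semistable representations of a star quiver degenerate to solutions of the moment map equation
of a symmetric pair at the center, in the same closed conditions on the last arrows. -/
theorem exists_star_solution {η ζ : Matrix (ι none) (ι none) ℂ} (hη : η.IsHermitian)
    (hη' : η * η = 1) (hζ : ζ.IsHermitian) (hζ' : ζ * ζ = 1)
    (x : QRep (starSrc L) (starTgt L) ι) {e : K → ℕ → ℝ} (he : ∀ k, e k (L k) = 0)
    (hd : ∀ k i, Fintype.card (ι (some ⟨k, i⟩)) =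
      ((Finset.univ : Finset (Fin (L k))).filter fun b => b.val < i.val).card)
    (hss : ∀ S S', IsSub x S → IsSub x S' → Graded ζ (S none) → S' none ≤ perp η (S none) →
      0 ≤ ∑ v, starWeight e 0 v * ((Module.finrank ℂ (S v) : ℝ) + Module.finrank ℂ (S' v) -
        Fintype.card (ι v))) :
    ∃ y : QRep (starSrc L) (starTgt L) ι,
      (∀ k, HasSpec ((armLast y k)ᴴ * armLast y k) fun b : Fin (L k) => e k b) ∧
      (∀ k, (armLast x k)ᴴ * η * armLast x k = 0 → (armLast y k)ᴴ * η * armLast y k = 0) ∧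
      (∀ k (w : ℂ), ζ * armLast x k = w • armLast x k → ζ * armLast y k = w • armLast y k) ∧
      ∀ Y : Matrix (ι none) (ι none) ℂ, Y.IsHermitian → η * Y * η = -Y → ζ * Y * ζ = Y →
        ((Y * ∑ k, armLast y k * (armLast y k)ᴴ).trace).re = 0 := by
  obtain ⟨ℓ, hℓ, hℓ'⟩ : ∃ ℓ : StarV L → ℝ, ℓ none = 0 ∧
      ∀ a, 1 ≤ ℓ (starTgt L a) - ℓ (starSrc L a) := by
    refine ⟨fun | none => 0 | some ⟨k, i⟩ => (i : ℝ) - (L k + 1), rfl, ?_⟩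
    rintro (⟨k, i⟩ | k)
    · change (1 : ℝ) ≤ ((i.val + 1 : ℕ) : ℝ) - (L k + 1) - ((i : ℝ) - (L k + 1))
      push_cast
      linarith
    · change (1 : ℝ) ≤ 0 - ((L k : ℝ) - (L k + 1))
      linarith
  have hcont : ∀ k, Continuous fun y : QRep (starSrc L) (starTgt L) ι => armLast y k :=
    fun k => continuous_apply _
  obtain ⟨y, hy, hm⟩ := exists_mem_forall_momentPairing_eq_of_graded hη hη' hζ hζ' ℓ hℓ hℓ' x
    (starWeight e 0) hss
    (C := {y | ∀ k, ((armLast x k)ᴴ * η * armLast x k = 0 →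
      (armLast y k)ᴴ * η * armLast y k = 0) ∧
      ∀ w : ℂ, ζ * armLast x k = w • armLast x k → ζ * armLast y k = w • armLast y k}) (by
        simp only [Set.ofPred_forall, Set.ofPred_and]
        refine isClosed_iInter fun k => (isClosed_iInter fun _ => ?_).inter
          (isClosed_iInter fun w => isClosed_iInter fun _ => ?_)
        · exact isClosed_eq ((((hcont k).matrix_conjTranspose).matrix_mul
            continuous_const).matrix_mul (hcont k)) continuous_const
        · exact isClosed_eq (continuous_const.matrix_mul (hcont k)) ((hcont k).const_smul w))
    (fun X hX hXη hXζ k => by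
      have h1 : armLast (expAct X x) k =
        exp (X none) * armLast x k * exp (-X (some ⟨k, Fin.last _⟩)) := rfl
      constructor
      · intro h
        rw [h1, conjTranspose_mul, conjTranspose_mul, ← Matrix.exp_conjTranspose (X none),
          (hX none).eq]
        have h2 := exp_mul_mul_exp_of_conj_eq_neg hη' hXη
        calc _ = (exp (-X (some ⟨k, Fin.last _⟩)))ᴴ * ((armLast x k)ᴴ *
              (exp (X none) * η * exp (X none)) * armLast x k) *
              exp (-X (some ⟨k, Fin.last _⟩)) := by simp only [Matrix.mul_assoc]
          _ = 0 := by rw [h2, h, Matrix.mul_zero, Matrix.zero_mul]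
      · intro w h
        rw [h1, ← Matrix.mul_assoc, ← Matrix.mul_assoc, mul_exp_of_conj_eq hζ' hXζ,
          Matrix.mul_assoc (exp _), h, Matrix.mul_smul, Matrix.smul_mul])
  refine ⟨y, fun k => ?_, fun k => (hy k).1, fun k => (hy k).2, fun Y hY hYη hYζ => ?_⟩
  · have h1 := hasSpec_armLast y (hd k) (e := e k) (fun i => by
      refine eq_smul_one_of_trace (isHermitian_starMoment y _) _ fun Y hY => ?_
      have hn : (Pi.single (some ⟨k, i.succ⟩) Y : ∀ w, Matrix (ι w) (ι w) ℂ) none = 0 :=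
        Pi.single_eq_of_ne (by simp) _
      have h2 := hm _ (isHermitian_single hY) (by rw [hn]; simp) (by rw [hn]; simp)
      rw [momentPairing_single, sum_mul_trace_single] at h2
      exact h2) (he k)
    exact h1.comp_equiv (Equiv.subtypeUnivEquiv Finset.mem_univ).symm
  · have h2 := hm _ (isHermitian_single hY) (by rwa [Pi.single_eq_same])
      (by rwa [Pi.single_eq_same])
    rw [momentPairing_single, sum_mul_trace_single] at h2
    exact h2.trans (zero_mul _)

end StarSolution

section TriSolution

variable {c : Type} [Fintype c] [DecidableEq c] {p q : ℕ} {η ζ : Matrix c c ℂ}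
  {f : ∀ k, Fin (triLen (p + q + (p + q)) (p + p) (q + q) k) → c → ℂ}

omit [DecidableEq c] in
theorem conjTranspose_mul_mul_eq_zero {b : Type} {A : Matrix c b ℂ} {w : b → c → ℂ}
    (hA : ∀ i j, A i j = w j i) (h : ∀ i j, star (w i) ⬝ᵥ (η *ᵥ w j) = 0) : Aᴴ * η * A = 0 := by
  obtain rfl : A = (Matrix.of w)ᵀ := Matrix.ext hA
  rw [Matrix.mul_assoc]
  exact Matrix.ext fun i j => h i j

omit [DecidableEq c] in
theorem SelfDual.dotProduct_castAdd {m : ℕ} {f : Fin (m + m) → c → ℂ} (hf : SelfDual η f)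
    (i j : Fin m) : star (f (Fin.castAdd m i)) ⬝ᵥ (η *ᵥ f (Fin.castAdd m j)) = 0 := by
  rw [hf, Ne, Fin.ext_iff, Fin.val_rev, Fin.val_castAdd, Fin.val_castAdd]
  omega

namespace IsTriFrame

theorem dotProduct_halfFrame (h : IsTriFrame η ζ f) : ∀ k i j,
    star (halfFrame f k i) ⬝ᵥ (η *ᵥ halfFrame f k j) = 0
  | none => (h.selfDual none).dotProduct_castAdd
  | some false => (h.selfDual (some false)).dotProduct_castAdd
  | some true => (h.selfDual (some true)).dotProduct_castAdd

theorem mul_halfFrame (h : IsTriFrame η ζ f) {b : Type} {A : Matrix c b ℂ} {θ : b → Fin p}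
    (hA : ∀ i j, A i j = halfFrame f (some false) (θ j) i) : ζ * A = (1 : ℂ) • A := by
  obtain rfl : A = Matrix.of fun i j => halfFrame f (some false) (θ j) i := Matrix.ext hA
  rw [one_smul]
  ext i j
  exact congrFun ((h.mem_flag _).mp (Submodule.subset_span ⟨_, Fin.is_lt _, rfl⟩)) i

theorem mul_halfFrame' (h : IsTriFrame η ζ f) {b : Type} {A : Matrix c b ℂ} {θ : b → Fin q}
    (hA : ∀ i j, A i j = halfFrame f (some true) (θ j) i) : ζ * A = (-1 : ℂ) • A := by
  obtain rfl : A = Matrix.of fun i j => halfFrame f (some true) (θ j) i := Matrix.ext hA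
  rw [neg_one_smul]
  ext i j
  exact congrFun ((h.mem_flag' _).mp (Submodule.subset_span ⟨_, Fin.is_lt _, rfl⟩)) i

/-- The inequalities imply the existence of isotropic frames with prescribed spectra solving the
moment map equation. -/
theorem exists_solution (h : IsTriFrame η ζ f) {g : Fin (p + q) → ℝ} {s : Fin p → ℝ} {t : Fin q → ℝ}
    (hg : Antitone g) (hg0 : ∀ i, 0 ≤ g i) (hs : Antitone s) (hs0 : ∀ i, 0 ≤ s i)
    (ht : Antitone t) (ht0 : ∀ i, 0 ≤ t i)
    (hd : ∀ S, Graded ζ S → triDefect η f g s t S ≤ 0) :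
    ∃ F : ∀ k, Matrix c (Fin (triLen (p + q) p q k)) ℂ,
      (∀ k, HasSpec ((F k)ᴴ * F k) fun b : Fin (triLen (p + q) p q k) =>
        triFun (zeroExt g) (zeroExt s) (zeroExt t) k b) ∧
      (∀ k, (F k)ᴴ * η * F k = 0) ∧ ζ * F (some false) = F (some false) ∧
      ζ * F (some true) = -F (some true) ∧
      ∀ Y : Matrix c c ℂ, Y.IsHermitian → η * Y * η = -Y → ζ * Y * ζ = Y →
        ((Y * ∑ k, F k * (F k)ᴴ).trace).re = 0 := by
  have he : ∀ k, Antitone (triFun (zeroExt g) (zeroExt s) (zeroExt t) k)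
    | none => antitone_zeroExt hg hg0
    | some false => antitone_zeroExt hs hs0
    | some true => antitone_zeroExt ht ht0
  have he0 : ∀ k, triFun (zeroExt g) (zeroExt s) (zeroExt t) k (triLen (p + q) p q k) = 0
    | none => dif_neg (lt_irrefl _)
    | some false => dif_neg (lt_irrefl _)
    | some true => dif_neg (lt_irrefl _)
  obtain ⟨y, h1, h2, h3, h4⟩ := exists_star_solution h.herm h.sq h.herm' h.sq'
    (inclRep (halfFrame f)) he0 (fun k i => (card_starIdx _ _ _).trans rfl)
    fun S S' hS hS' hgr hle => sum_starWeight_mul_nonneg h.linearIndependent_halfFrame he hS hS'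
      hle (h.sum_halfFrame_nonpos hgr (hd _ hgr))
  obtain ⟨A, hA1, hA2, hA3, hA4, hA5⟩ : ∃ A : ∀ k, Matrix c {b : Fin (triLen (p + q) p q k) //
      b ∈ Finset.univ ∧ b.val < triLen (p + q) p q k} ℂ,
      (∀ k, HasSpec ((A k)ᴴ * A k) fun b : Fin (triLen (p + q) p q k) =>
        triFun (zeroExt g) (zeroExt s) (zeroExt t) k b) ∧
      (∀ k, (A k)ᴴ * η * A k = 0) ∧ ζ * A (some false) = (1 : ℂ) • A (some false) ∧
      ζ * A (some true) = (-1 : ℂ) • A (some true) ∧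
      ∀ Y : Matrix c c ℂ, Y.IsHermitian → η * Y * η = -Y → ζ * Y * ζ = Y →
        ((Y * ∑ k, A k * (A k)ᴴ).trace).re = 0 :=
    ⟨fun k => armLast y k, h1,
      fun k => h2 k (conjTranspose_mul_mul_eq_zero (w := fun b => halfFrame f k b.1) (fun _ _ => rfl)
        fun i j => h.dotProduct_halfFrame k i.1 j.1),
      h3 _ _ (h.mul_halfFrame (θ := fun b => b.1) fun _ _ => rfl),
      h3 _ _ (h.mul_halfFrame' (θ := fun b => b.1) fun _ _ => rfl), h4⟩
  rw [one_smul] at hA3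
  rw [neg_one_smul] at hA4
  have e : ∀ k, Fin (triLen (p + q) p q k) ≃ {b : Fin (triLen (p + q) p q k) //
      b ∈ Finset.univ ∧ b.val < triLen (p + q) p q k} := fun k =>
    (Equiv.subtypeUnivEquiv fun b => ⟨Finset.mem_univ b, b.2⟩).symm
  refine ⟨fun k => (A k).submatrix id (e k), fun k => (hA1 k).submatrix (e k),
    fun k => congrArg (fun M => M.submatrix (e k) (e k)) (hA2 k),
    congrArg (fun M => M.submatrix id (e _)) hA3,
    congrArg (fun M => M.submatrix id (e _)) hA4, fun Y hY hY1 hY2 => ?_⟩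
  simpa only [conjTranspose_submatrix, submatrix_mul_equiv, submatrix_id_id] using hA5 Y hY hY1 hY2

end IsTriFrame

end TriSolution

section ConeOfFrames

theorem HasSpec.two_smul_sq {m n : Type} [Fintype m] [DecidableEq m] [Fintype n] [DecidableEq n]
    {J : Type} [Fintype J] [DecidableEq J] {A B : Matrix m n ℂ} {e : J → ℝ}
    (hc : Fintype.card n = Fintype.card m) (hAB : Aᴴ * A = Bᴴ * B)
    (h : HasSpec (Aᴴ * A + Bᴴ * B) e) {X : Matrix m m ℂ}
    (hX : X * Xᴴ = (4 : ℂ) • (A * Bᴴ * (A * Bᴴ)ᴴ)) : HasSpec (X * Xᴴ) fun j => e j ^ 2 := by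
  have h1 : HasSpec (A * ((2 : ℂ) • Aᴴ)) e := by
    refine HasSpec.mul_comm (A := (2 : ℂ) • Aᴴ) (B := A) ?_ hc
    rwa [Matrix.smul_mul, two_smul, ← hAB] at *
  have h2 : (A * ((2 : ℂ) • Aᴴ)).IsHermitian := by
    rw [Matrix.mul_smul, IsHermitian, conjTranspose_smul, (isHermitian_mul_conjTranspose_self A).eq]
    simp
  have h3 : X * Xᴴ = A * ((2 : ℂ) • Aᴴ) * (A * ((2 : ℂ) • Aᴴ)) := by
    have h4 : A * Bᴴ * (A * Bᴴ)ᴴ = A * Aᴴ * (A * Aᴴ) := by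
      rw [conjTranspose_mul, conjTranspose_conjTranspose]
      calc A * Bᴴ * (B * Aᴴ) = A * (Bᴴ * B) * Aᴴ := by simp only [Matrix.mul_assoc]
        _ = _ := by rw [← hAB]; simp only [Matrix.mul_assoc]
    rw [hX, h4, Matrix.mul_smul, Matrix.mul_smul, Matrix.smul_mul, smul_smul]
    norm_num
  obtain ⟨V, hV, hV', hM⟩ := h1.exists_conj h2
  have h5 : X * Xᴴ = V * diagonal (fun j => ((e j ^ 2 : ℝ) : ℂ)) * Vᴴ := by
    rw [h3, hM]
    calc _ = V * diagonal (fun j => (e j : ℂ)) * (Vᴴ * V) * diagonal (fun j => (e j : ℂ)) * Vᴴ := by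
          simp only [Matrix.mul_assoc]
      _ = _ := by
          rw [hV, Matrix.mul_one, Matrix.mul_assoc V, diagonal_mul_diagonal]
          simp [sq]
  rw [h5]
  exact hasSpec_conj hV hV' _

variable {p q : ℕ} {g : Fin (p + q) → ℝ} {s : Fin p → ℝ} {t : Fin q → ℝ}

theorem mem_coneT_of_frames (hg : Antitone g) (hg0 : ∀ i, 0 ≤ g i) (hs : Antitone s)
    (hs0 : ∀ i, 0 ≤ s i) (ht : Antitone t) (ht0 : ∀ i, 0 ≤ t i)
    {G H : Matrix (Fin p ⊕ Fin q) (Fin (p + q)) ℂ} {A B : Matrix (Fin p) (Fin p) ℂ}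
    {A' B' : Matrix (Fin q) (Fin q) ℂ} (hG : HasSpec (Gᴴ * G + Hᴴ * H) g) (hG' : Gᴴ * G = Hᴴ * H)
    (hA : HasSpec (Aᴴ * A + Bᴴ * B) s) (hAB : Aᴴ * A = Bᴴ * B)
    (hA' : HasSpec (A'ᴴ * A' + B'ᴴ * B') t) (hAB' : A'ᴴ * A' = B'ᴴ * B')
    (h₁ : (G * Hᴴ).toBlocks₁₁ + A * Bᴴ = 0) (h₂ : (G * Hᴴ).toBlocks₂₂ + A' * B'ᴴ = 0) :
    (g, s, t) ∈ coneT p q := by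
  have h4 : ∀ {m : Type} [Fintype m] (Y : Matrix m m ℂ),
      (2 : ℂ) • Y * ((2 : ℂ) • Y)ᴴ = (4 : ℂ) • (Y * Yᴴ) := fun Y => by
    rw [conjTranspose_smul, Matrix.mul_smul, Matrix.smul_mul, smul_smul]
    norm_num
  refine ⟨((2 : ℂ) • (G * Hᴴ)).submatrix finSumFinEquiv.symm finSumFinEquiv.symm,
    (forall_eq_sval_iff hg hg0).mpr ?_, (forall_eq_sval_iff hs hs0).mpr ?_,
    (forall_eq_sval_iff ht ht0).mpr ?_⟩
  · rw [conjTranspose_submatrix, submatrix_mul_equiv]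
    exact (hG.two_smul_sq (by simp) hG' (h4 _)).submatrix _
  · have h5 : blockTL p q (((2 : ℂ) • (G * Hᴴ)).submatrix finSumFinEquiv.symm
        finSumFinEquiv.symm) = -((2 : ℂ) • (A * Bᴴ)) := by
      rw [← smul_neg, ← eq_neg_of_add_eq_zero_left h₁]
      ext i j
      simp [blockTL, toBlocks₁₁]
    rw [h5, conjTranspose_neg, neg_mul_neg]
    exact hA.two_smul_sq rfl hAB (h4 _)
  · have h5 : blockBR p q (((2 : ℂ) • (G * Hᴴ)).submatrix finSumFinEquiv.symm
        finSumFinEquiv.symm) = -((2 : ℂ) • (A' * B'ᴴ)) := by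
      rw [← smul_neg, ← eq_neg_of_add_eq_zero_left h₂]
      ext i j
      simp only [blockBR, toBlocks₂₂, submatrix_apply, finSumFinEquiv_symm_apply_natAdd, Matrix.smul_apply,
        of_apply]
    rw [h5, conjTranspose_neg, neg_mul_neg]
    exact hA'.two_smul_sq rfl hAB' (h4 _)

end ConeOfFrames

section ConeOfHyperbolic

variable {p q : ℕ}

theorem conjTranspose_mul_hypForm_mul {b m : Type} [Fintype b] [DecidableEq b] [Fintype m]
    (F : Matrix (b ⊕ b) m ℂ) :
    Fᴴ * hypForm b * F = F.toRows₁ᴴ * F.toRows₁ - F.toRows₂ᴴ * F.toRows₂ := by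
  conv_lhs => rw [← fromRows_toRows F]
  have h : (1 : b → ℂ) = fun _ => 1 := rfl
  rw [hypForm, ← fromBlocks_diagonal, conjTranspose_fromRows_eq_fromCols_conjTranspose,
    Matrix.mul_assoc, fromBlocks_mul_fromRows, fromCols_mul_fromRows,
    show (diagonal (-1) : Matrix b b ℂ) = -1 by
      ext i j
      simp [diagonal_apply, one_apply]
      split_ifs <;> simp]
  simp [sub_eq_add_neg, h]

theorem conjTranspose_mul_self_eq_toRows {b m : Type} [Fintype b] [Fintype m]
    (F : Matrix (b ⊕ b) m ℂ) :
    Fᴴ * F = F.toRows₁ᴴ * F.toRows₁ + F.toRows₂ᴴ * F.toRows₂ := by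
  conv_lhs => rw [← fromRows_toRows F]
  rw [conjTranspose_fromRows_eq_fromCols_conjTranspose, fromCols_mul_fromRows]

theorem mul_conjTranspose_toBlocks₁₂ {b m : Type} [Fintype b] [Fintype m]
    (F : Matrix (b ⊕ b) m ℂ) : (F * Fᴴ).toBlocks₁₂ = F.toRows₁ * F.toRows₂ᴴ := by
  conv_lhs => rw [← fromRows_toRows F]
  rw [conjTranspose_fromRows_eq_fromCols_conjTranspose, fromRows_mul_fromCols, toBlocks_fromBlocks₁₂]

theorem trace_fromBlocks_eq {m n : Type} [Fintype m] [Fintype n] (A : Matrix m m ℂ)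
    (B : Matrix m n ℂ) (C : Matrix n m ℂ) (D : Matrix n n ℂ) :
    (fromBlocks A B C D).trace = A.trace + D.trace := by
  simp [trace]

/-- If the Hermitian matrix `Φ` is orthogonal to every `[[0, N], [Nᴴ, 0]]` with `N` block diagonal,
then the diagonal blocks of its upper right corner vanish. -/
theorem toBlocks_eq_zero_of_trace {m n : Type} [Fintype m] [DecidableEq m] [Fintype n]
    [DecidableEq n] {Φ : Matrix ((m ⊕ n) ⊕ (m ⊕ n)) ((m ⊕ n) ⊕ (m ⊕ n)) ℂ} (hΦ : Φ.IsHermitian)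
    (h : ∀ (P : Matrix m m ℂ) (R : Matrix n n ℂ), ((fromBlocks 0 (fromBlocks P 0 0 R)
      (fromBlocks P 0 0 R)ᴴ 0 * Φ).trace).re = 0) :
    Φ.toBlocks₁₂.toBlocks₁₁ = 0 ∧ Φ.toBlocks₁₂.toBlocks₂₂ = 0 := by
  set Q := Φ.toBlocks₁₂ with hQ
  have h1 : Φ = fromBlocks Φ.toBlocks₁₁ Q Qᴴ Φ.toBlocks₂₂ := by
    conv_lhs => rw [← fromBlocks_toBlocks Φ]
    congr 1
    ext i j
    simpa [hQ, toBlocks₁₂, toBlocks₂₁] using (hΦ.apply (Sum.inr i) (Sum.inl j)).symm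
  have h2 := h Q.toBlocks₁₁ Q.toBlocks₂₂
  set N := fromBlocks Q.toBlocks₁₁ 0 0 Q.toBlocks₂₂ with hN
  have h3 : (Nᴴ * Q).trace = (Nᴴ * N).trace := by
    have h4 : Q = fromBlocks Q.toBlocks₁₁ Q.toBlocks₁₂ Q.toBlocks₂₁ Q.toBlocks₂₂ :=
      (fromBlocks_toBlocks Q).symm
    conv_lhs => rw [h4]
    rw [hN, fromBlocks_conjTranspose, fromBlocks_multiply, fromBlocks_multiply, trace_fromBlocks_eq,
      trace_fromBlocks_eq]
    simp
  have h4 : (N * Qᴴ).trace = star (Nᴴ * N).trace := by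
    rw [← h3, ← trace_conjTranspose, conjTranspose_mul, conjTranspose_conjTranspose,
      trace_mul_comm]
  rw [h1, fromBlocks_multiply, trace_fromBlocks_eq] at h2
  simp only [Matrix.zero_mul, zero_add, add_zero, h3, h4] at h2
  have h5 : (N * Nᴴ).trace.re = 0 := by
    rw [trace_mul_comm]
    simp at h2
    linarith
  rw [trace_mul_conjTranspose_re] at h5
  have h6 : N = 0 := by
    ext i j
    have h7 := (Finset.sum_eq_zero_iff_of_nonneg fun i _ => Finset.sum_nonneg fun j _ =>
      sq_nonneg ‖N i j‖).mp h5 i (Finset.mem_univ i)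
    simpa using (Finset.sum_eq_zero_iff_of_nonneg fun j _ => sq_nonneg ‖N i j‖).mp h7 j
      (Finset.mem_univ j)
  rw [hN, ← fromBlocks_zero, fromBlocks_inj] at h6
  exact ⟨h6.1, h6.2.2.2⟩

variable {g : Fin (p + q) → ℝ} {s : Fin p → ℝ} {t : Fin q → ℝ}

theorem mem_coneT_of_hyperbolic (hg : Antitone g) (hg0 : ∀ i, 0 ≤ g i) (hs : Antitone s)
    (hs0 : ∀ i, 0 ≤ s i) (ht : Antitone t) (ht0 : ∀ i, 0 ≤ t i)
    {F : Matrix ((Fin p ⊕ Fin q) ⊕ (Fin p ⊕ Fin q)) (Fin (p + q)) ℂ}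
    {F₁ : Matrix ((Fin p ⊕ Fin q) ⊕ (Fin p ⊕ Fin q)) (Fin p) ℂ}
    {F₂ : Matrix ((Fin p ⊕ Fin q) ⊕ (Fin p ⊕ Fin q)) (Fin q) ℂ}
    (hF : HasSpec (Fᴴ * F) g) (hF₁ : HasSpec (F₁ᴴ * F₁) s) (hF₂ : HasSpec (F₂ᴴ * F₂) t)
    (hη : Fᴴ * hypForm (Fin p ⊕ Fin q) * F = 0) (hη₁ : F₁ᴴ * hypForm (Fin p ⊕ Fin q) * F₁ = 0)
    (hη₂ : F₂ᴴ * hypForm (Fin p ⊕ Fin q) * F₂ = 0) (hζ₁ : hypGrading p q * F₁ = F₁)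
    (hζ₂ : hypGrading p q * F₂ = -F₂)
    (h : ∀ Y : Matrix ((Fin p ⊕ Fin q) ⊕ (Fin p ⊕ Fin q)) ((Fin p ⊕ Fin q) ⊕ (Fin p ⊕ Fin q)) ℂ,
      Y.IsHermitian → hypForm (Fin p ⊕ Fin q) * Y * hypForm (Fin p ⊕ Fin q) = -Y →
      hypGrading p q * Y * hypGrading p q = Y →
      ((Y * (F * Fᴴ + F₁ * F₁ᴴ + F₂ * F₂ᴴ)).trace).re = 0) : (g, s, t) ∈ coneT p q := by
  rw [conjTranspose_mul_hypForm_mul, sub_eq_zero] at hη hη₁ hη₂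
  rw [conjTranspose_mul_self_eq_toRows] at hF hF₁ hF₂
  have key := toBlocks_eq_zero_of_trace (Φ := F * Fᴴ + F₁ * F₁ᴴ + F₂ * F₂ᴴ)
    (((isHermitian_mul_conjTranspose_self F).add (isHermitian_mul_conjTranspose_self F₁)).add
      (isHermitian_mul_conjTranspose_self F₂)) fun P R => h _ ?_ ?_ ?_
  · have z (b : (Fin p ⊕ Fin q) ⊕ (Fin p ⊕ Fin q)) (j) := congrFun₂ hζ₁ b j
    have z' (b : (Fin p ⊕ Fin q) ⊕ (Fin p ⊕ Fin q)) (j) := congrFun₂ hζ₂ b j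
    simp only [hypGrading, diagonal_mul] at z z'
    have z₁ : F₁.toRows₁.toRows₂ = 0 := by
      ext i j; simpa [neg_eq_self] using z (Sum.inl (Sum.inr i)) j
    have z₂ : F₁.toRows₂.toRows₂ = 0 := by
      ext i j; simpa [neg_eq_self] using z (Sum.inr (Sum.inr i)) j
    have z₃ : F₂.toRows₁.toRows₁ = 0 := by
      ext i j; simpa [self_eq_neg] using z' (Sum.inl (Sum.inl i)) j
    have z₄ : F₂.toRows₂.toRows₁ = 0 := by
      ext i j; simpa [self_eq_neg] using z' (Sum.inr (Sum.inl i)) j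
    have e₁ : F₁.toRows₁ = fromRows F₁.toRows₁.toRows₁ 0 := by rw [← z₁, fromRows_toRows]
    have e₂ : F₁.toRows₂ = fromRows F₁.toRows₂.toRows₁ 0 := by rw [← z₂, fromRows_toRows]
    have e₃ : F₂.toRows₁ = fromRows 0 F₂.toRows₁.toRows₂ := by rw [← z₃, fromRows_toRows]
    have e₄ : F₂.toRows₂ = fromRows 0 F₂.toRows₂.toRows₂ := by rw [← z₄, fromRows_toRows]
    have key' : (F * Fᴴ + F₁ * F₁ᴴ + F₂ * F₂ᴴ).toBlocks₁₂ = F.toRows₁ * F.toRows₂ᴴ +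
        fromBlocks (F₁.toRows₁.toRows₁ * F₁.toRows₂.toRows₁ᴴ) 0 0
          (F₂.toRows₁.toRows₂ * F₂.toRows₂.toRows₂ᴴ) := by
      have := congrArg₂ (· + ·) (mul_conjTranspose_toBlocks₁₂ F₁) (mul_conjTranspose_toBlocks₁₂ F₂)
      rw [e₁, e₂, e₃, e₄] at this
      simp only [conjTranspose_fromRows_eq_fromCols_conjTranspose, fromRows_mul_fromCols,
        fromBlocks_add, conjTranspose_zero, Matrix.mul_zero, Matrix.zero_mul, add_zero,
        zero_add] at this
      rw [← this, ← mul_conjTranspose_toBlocks₁₂, ← add_assoc]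
      rfl
    rw [key'] at key
    rw [e₁, e₂] at hη₁ hF₁
    rw [e₃, e₄] at hη₂ hF₂
    simp only [conjTranspose_fromRows_eq_fromCols_conjTranspose, fromCols_mul_fromRows,
      Matrix.mul_zero, add_zero, zero_add] at hη₁ hF₁ hη₂ hF₂
    exact mem_coneT_of_frames hg hg0 hs hs0 ht ht0 hF hη hF₁ hη₁ hF₂ hη₂ key.1 key.2
  · simp [IsHermitian, fromBlocks_conjTranspose]
  · ext (i | i) (j | j) <;> simp [hypForm, diagonal_mul, mul_diagonal]
  · ext ((i | i) | (i | i)) ((j | j) | (j | j)) <;>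
      simp [hypGrading, diagonal_mul, mul_diagonal]

end ConeOfHyperbolic

section SingletonInequalities

theorem eigVec_diagonal_const {k : ℕ} (x : ℝ) {M : Matrix (Fin k) (Fin k) ℂ} (hM : M.IsHermitian)
    (h : M = diagonal fun _ => (x : ℂ)) : eigVec M hM = fun _ => x := by
  refine eigVec_eq_of_hasSpec hM antitone_const ?_
  rw [h, HasSpec, charpoly_diagonal]

theorem mem_LRcone_const {m n : ℕ} (x : ℝ) :
    ((fun _ => x, fun _ => x, fun _ => x) :
      (Fin (m + n) → ℝ) × (Fin m → ℝ) × (Fin n → ℝ)) ∈ LRcone m n := by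
  refine ⟨diagonal fun _ => (x : ℂ), isHermitian_diagonal_of_self_adjoint _ (by ext; simp),
    (eigVec_diagonal_const x _ rfl).symm, (eigVec_diagonal_const x _ ?_).symm,
    (eigVec_diagonal_const x _ ?_).symm⟩
  · rw [submatrix_diagonal _ _ (Fin.castAdd_injective _ _)]; rfl
  · rw [submatrix_diagonal _ _ (Fin.natAdd_injective _ _)]; rfl

theorem muVec_of_subset_singleton {n r : ℕ} {B : Finset (Fin n)} (h : B.card = r) {b : Fin n}
    (hB : B ⊆ {b}) : muVec B h = fun _ => (b : ℝ) := by
  funext j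
  have h1 := (B.orderIsoOfFin h j.rev).2
  have h2 := Finset.card_le_card hB
  rw [Finset.card_singleton, h] at h2
  rw [muVec, Finset.mem_singleton.mp (hB h1), show (j.rev : ℕ) = 0 by omega]
  simp

variable {p q : ℕ} {g : Fin (p + q) → ℝ} {s : Fin p → ℝ} {t : Fin q → ℝ}

theorem hatVec_le_of_mem_coneT (hg : Antitone g) (hg0 : ∀ i, 0 ≤ g i) (hs : Antitone s)
    (hs0 : ∀ i, 0 ≤ s i) (ht : Antitone t) (ht0 : ∀ i, 0 ≤ t i) (h : (g, s, t) ∈ coneT p q)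
    {i : ℕ} (hi : i < p + p) : hatVec s i ≤ hatVec g i := by
  have hA : ({(⟨i, by omega⟩ : Fin (p + q + (p + q)))} : Finset _).card =
    ({(⟨i, hi⟩ : Fin (p + p))} : Finset _).card + (∅ : Finset (Fin (q + q))).card := rfl
  have h1 := sum_hatVec_le hg hg0 hs hs0 ht ht0 h hA (by
    rw [muVec_of_subset_singleton hA subset_rfl, muVec_of_subset_singleton rfl subset_rfl,
      show muVec (∅ : Finset (Fin (q + q))) rfl = fun _ => (i : ℝ) from funext fun j => j.elim0]
    exact mem_LRcone_const _)
  simpa using h1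

theorem hatVec_le_of_mem_coneT' (hg : Antitone g) (hg0 : ∀ i, 0 ≤ g i) (hs : Antitone s)
    (hs0 : ∀ i, 0 ≤ s i) (ht : Antitone t) (ht0 : ∀ i, 0 ≤ t i) (h : (g, s, t) ∈ coneT p q)
    {i : ℕ} (hi : i < q + q) : hatVec t i ≤ hatVec g i := by
  have hA : ({(⟨i, by omega⟩ : Fin (p + q + (p + q)))} : Finset _).card =
    (∅ : Finset (Fin (p + p))).card + ({(⟨i, hi⟩ : Fin (q + q))} : Finset _).card := rfl
  have h1 := sum_hatVec_le hg hg0 hs hs0 ht ht0 h hA (by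
    rw [muVec_of_subset_singleton hA subset_rfl, muVec_of_subset_singleton rfl subset_rfl,
      show muVec (∅ : Finset (Fin (p + p))) rfl = fun _ => (i : ℝ) from funext fun j => j.elim0]
    exact mem_LRcone_const _)
  simpa using h1

end SingletonInequalities

theorem stmt_13 (p q : ℕ) (hq : 1 ≤ q) (hpq : q ≤ p)
    (g : Fin (p + q) → ℝ) (hg : Antitone g) (hg0 : ∀ i, 0 ≤ g i)
    (s : Fin p → ℝ) (hs : Antitone s) (hs0 : ∀ i, 0 ≤ s i)
    (t : Fin q → ℝ) (ht : Antitone t) (ht0 : ∀ i, 0 ≤ t i) :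
    (g, s, t) ∈ coneT p q ↔
      ((∀ k : Fin p, g (Fin.castLE (Nat.le_add_right p q) k) ≥ s k) ∧
       (∀ j : Fin q, g (Fin.castLE (Nat.le_add_left q p) j) ≥ t j) ∧
       (∀ (l : ℕ) (hl : l < p - q), g ⟨2 * q + l, by omega⟩ ≤ s ⟨l, by omega⟩) ∧
       ∀ (A : Finset (Fin (p + q + (p + q)))) (B : Finset (Fin (p + p)))
         (C : Finset (Fin (q + q))),
         B ≠ Finset.univ → C ≠ Finset.univ →
         ∀ hA : A.card = B.card + C.card, B.card + C.card ≤ p + q →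
           (muVec A hA, muVec B rfl, muVec C rfl) ∈ LRcone B.card C.card →
           sumRestr g A - sumRestr g (opp A) ≥
             sumRestr s B - sumRestr s (opp B) + (sumRestr t C - sumRestr t (opp C))) := by
  constructor
  · intro h
    refine ⟨fun k => ?_, fun j => ?_, fun l hl => ?_, fun A B C _ _ hA _ hLR => ?_⟩
    · have h1 := hatVec_le_of_mem_coneT hg hg0 hs hs0 ht ht0 h (i := k) (by omega)
      rw [hatVec_castAdd, hatVec, dif_pos (by omega)] at h1
      exact h1
    · have h1 := hatVec_le_of_mem_coneT' hg hg0 hs hs0 ht ht0 h (i := j) (by omega)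
      rw [hatVec_castAdd, hatVec, dif_pos (by omega)] at h1
      exact h1
    · have h1 := hatVec_le_of_mem_coneT hg hg0 hs hs0 ht ht0 h (i := p + p - 1 - l) (by omega)
      rw [hatVec, hatVec, dif_neg (by omega), dif_pos (by omega), dif_neg (by omega),
        dif_pos (by omega), neg_le_neg_iff] at h1
      convert h1 using 3 <;> omega
    · have h1 := sum_hatVec_le hg hg0 hs hs0 ht ht0 h hA hLR
      simp only [sum_hatVec] at h1
      linarith
  · rintro ⟨-, -, -, h⟩
    obtain ⟨f, hf, hgen⟩ := exists_isTriFrame_eulerGeneric p q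
    obtain ⟨F, hF, hη, hζ₁, hζ₂, hY⟩ := hf.exists_solution hg hg0 hs hs0 ht ht0 fun S hS =>
      triDefect_nonpos hf (hq.trans hpq) hq hgen hg hg0 hs hs0 ht ht0
        (fun A B C hB hC hA hle hLR => by
          have h1 := h A B C hB hC hA hle hLR
          simp only [sum_hatVec]
          linarith) hS
    have hz {m : ℕ} (x : Fin m → ℝ) : (fun b : Fin m => zeroExt x b) = x :=
      funext fun b => dif_pos b.2
    have h0 := hF none
    have h1 := hF (some false)
    have h2 := hF (some true)
    simp only [triFun, hz] at h0 h1 h2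
    refine mem_coneT_of_hyperbolic hg hg0 hs hs0 ht ht0 h0 h1 h2 (hη none) (hη (some false))
      (hη (some true)) hζ₁ hζ₂ fun Y hYh hYη hYζ => ?_
    have h3 := hY Y hYh hYη hYζ
    rw [Fintype.sum_option, Fintype.sum_bool] at h3
    rw [← h3, add_assoc, add_comm (F (some false) * _)]
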